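/- For every integer d ≥ 1 and every exponent p with 1 < p < ∞ there exists a constant C = C(p,d) > 0 (depending only on p and d, not on the polynomial) such that for every real polynomial P of degree at most d and every f in the Schwartz class on ℝ, the maximal operator C_P f(x) = sup_{N ∈ ℝ} | p.v. ∫_ℝ f(x−t) e^{i(Nt + P(t))} dt/t | satisfies ‖C_P f‖_{L^p(ℝ)} ≤ C ‖f‖_{L^p(ℝ)}. -/

import Mathlib

namespace PC
open MeasureTheory Set Filter
open scoped ENNReal NNReal Topology ComplexConjugate
/-! ### Layer cake and Marcinkiewicz type lemma -/
lemma lay_pos (a : ℝ≥0∞) (q : ℝ) (hq : 0 < q) :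
    ∫⁻ t in Ioi (0:ℝ), (if ENNReal.ofReal t < a then ENNReal.ofReal (t ^ (q-1)) else 0)
      = ENNReal.ofReal q⁻¹ * a ^ q := by
  have key : ∀ b : ℝ, 0 ≤ b → ∫⁻ t in Ioc (0:ℝ) b, ENNReal.ofReal (t ^ (q-1)) = ENNReal.ofReal (q⁻¹ * b ^ q) := by
    intro b hb
    rw [← ofReal_integral_eq_lintegral_ofReal]
    · rw [← intervalIntegral.integral_of_le hb, integral_rpow (Or.inl (by linarith))]
      rw [sub_add_cancel, Real.zero_rpow hq.ne']
      congr 1; field_simp; ring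
    · have := intervalIntegral.intervalIntegrable_rpow' (a := 0) (b := b) (r := q - 1) (by linarith)
      rwa [intervalIntegrable_iff_integrableOn_Ioc_of_le hb] at this
    · filter_upwards [ae_restrict_mem measurableSet_Ioc] with t ht
      exact Real.rpow_nonneg ht.1.le _
  rcases eq_or_ne a ∞ with rfl | ha
  · rw [ENNReal.top_rpow_of_pos hq, ENNReal.mul_top (by simp [hq])]
    rw [eq_top_iff]
    refine ENNReal.le_of_forall_nnreal_lt ?_ |>.trans (le_refl _)
    intro r _
    have h1 : ∫⁻ t in Ioc (0:ℝ) ((q * r) ^ q⁻¹), ENNReal.ofReal (t ^ (q-1)) ≤ ∫⁻ t in Ioi (0:ℝ), (if ENNReal.ofReal t < ∞ then ENNReal.ofReal (t ^ (q-1)) else 0) := by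
      simp only [ENNReal.ofReal_lt_top, if_true]
      exact lintegral_mono_set Ioc_subset_Ioi_self
    rw [key _ (by positivity), ← Real.rpow_mul (by positivity), inv_mul_cancel₀ hq.ne', Real.rpow_one,
      inv_mul_cancel_left₀ hq.ne'] at h1
    simpa using h1
  · lift a to ℝ≥0 using ha
    have : ∫⁻ t in Ioi (0:ℝ), (if ENNReal.ofReal t < a then ENNReal.ofReal (t ^ (q-1)) else 0)
        = ∫⁻ t in Ioo (0:ℝ) a, ENNReal.ofReal (t ^ (q-1)) := by
      rw [← lintegral_indicator measurableSet_Ioi, ← lintegral_indicator measurableSet_Ioo]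
      congr 1; ext t
      simp only [indicator, mem_Ioi, mem_Ioo]
      by_cases ht : 0 < t
      · simp only [ht, true_and, if_true]
        congr 1
        rw [← ENNReal.ofReal_coe_nnreal, ENNReal.ofReal_lt_ofReal_iff']
        simp only [eq_iff_iff]
        constructor
        · exact fun h => h.1
        · exact fun h => ⟨h, ht.trans h⟩
      · simp [ht]
    rw [this, Measure.restrict_congr_set (Ioo_ae_eq_Ioc), key (a:ℝ) a.2, ENNReal.ofReal_mul (by positivity)]
    congr 1
    rw [← ENNReal.ofReal_rpow_of_nonneg (NNReal.coe_nonneg a) hq.le, ENNReal.ofReal_coe_nnreal]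
lemma lay_neg (a : ℝ≥0∞) (ha : a ≠ 0) (q : ℝ) (hq : 0 < q) :
    ∫⁻ t in Ioi (0:ℝ), (if a ≤ ENNReal.ofReal t then ENNReal.ofReal (t ^ (-q-1)) else 0)
      = ENNReal.ofReal q⁻¹ * a ^ (-q) := by
  rcases eq_or_ne a ∞ with rfl | ha'
  · simp [hq]
  · lift a to ℝ≥0 using ha'
    have ha0 : (0:ℝ) < a := by
      have : a ≠ 0 := by exact_mod_cast ha
      exact_mod_cast pos_iff_ne_zero.mpr this
    have : ∫⁻ t in Ioi (0:ℝ), (if a ≤ ENNReal.ofReal t then ENNReal.ofReal (t ^ (-q-1)) else 0)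
        = ∫⁻ t in Ici (a:ℝ), ENNReal.ofReal (t ^ (-q-1)) := by
      rw [← lintegral_indicator measurableSet_Ioi, ← lintegral_indicator measurableSet_Ici]
      congr 1; ext t
      simp only [indicator, mem_Ioi, mem_Ici]
      by_cases ht : 0 < t
      · simp only [ht, if_true]
        congr 1
        rw [← ENNReal.ofReal_coe_nnreal, ENNReal.ofReal_le_ofReal_iff ht.le]
      · have : ¬ (a:ℝ) ≤ t := by intro h; exact ht (ha0.trans_le h)
        simp [ht, this]
    rw [this, ← Measure.restrict_congr_set (Ioi_ae_eq_Ici), ← ofReal_integral_eq_lintegral_ofReal]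
    · rw [integral_Ioi_rpow_of_lt (by linarith) ha0]
      rw [show (-q - 1 + 1) = -q by ring, neg_div_neg_eq, div_eq_inv_mul, ENNReal.ofReal_mul (by positivity)]
      congr 1
      rw [← ENNReal.ofReal_rpow_of_pos ha0, ENNReal.ofReal_coe_nnreal]
    · exact integrableOn_Ioi_rpow_of_lt (by linarith) ha0
    · filter_upwards [ae_restrict_mem measurableSet_Ioi] with t ht
      exact Real.rpow_nonneg (ha0.trans ht).le _
/-- layer cake -/
lemma lay_cake (F : ℝ → ℝ≥0∞) (hF : Measurable F) (p : ℝ) (hp : 0 < p) :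
    ∫⁻ x, F x ^ p = ENNReal.ofReal p * ∫⁻ t in Ioi (0:ℝ), volume {x | ENNReal.ofReal t < F x} * ENNReal.ofReal (t ^ (p-1)) := by
  have h1 : ∀ x, F x ^ p = ENNReal.ofReal p * ∫⁻ t in Ioi (0:ℝ), (if ENNReal.ofReal t < F x then ENNReal.ofReal (t ^ (p-1)) else 0) := by
    intro x
    rw [lay_pos _ _ hp, ← mul_assoc, ← ENNReal.ofReal_mul hp.le, mul_inv_cancel₀ hp.ne']
    simp
  have hm : Measurable (fun z : ℝ × ℝ => (if ENNReal.ofReal z.2 < F z.1 then ENNReal.ofReal (z.2 ^ (p-1)) else 0)) := by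
    refine Measurable.ite (measurableSet_lt (by fun_prop) (by fun_prop)) (by fun_prop) measurable_const
  simp_rw [h1]
  rw [lintegral_const_mul _ (Measurable.lintegral_prod_right' hm)]
  congr 1
  rw [lintegral_lintegral_swap hm.aemeasurable]
  refine lintegral_congr fun t => ?_
  rw [mul_comm, ← lintegral_indicator_const (measurableSet_lt measurable_const hF)]
  refine lintegral_congr fun x => ?_
  simp only [indicator, mem_ofPred_eq]
lemma marc (F g : ℝ → ℝ≥0∞) (hF : Measurable F) (hg : Measurable g) (p0 p p1 : ℝ) (h0 : 0 < p0)
    (h01 : p0 < p) (h1 : p < p1) (c : ℝ) (hc : 0 < c) (A B : ℝ≥0∞)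
    (H : ∀ t : ℝ, 0 < t → volume {x | ENNReal.ofReal t < F x} ≤
      A * ENNReal.ofReal (t ^ (-p0)) * (∫⁻ x in {x | ENNReal.ofReal (c * t) < g x}, g x ^ p0)
      + B * ENNReal.ofReal (t ^ (-p1)) * ∫⁻ x in {x | g x ≤ ENNReal.ofReal (c * t)}, g x ^ p1) :
    ∫⁻ x, F x ^ p ≤ ENNReal.ofReal p * (A * ENNReal.ofReal ((p - p0)⁻¹ * c ^ (p0 - p))
      + B * ENNReal.ofReal ((p1 - p)⁻¹ * c ^ (p1 - p))) * ∫⁻ x, g x ^ p := by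
  have hp : 0 < p := h0.trans h01
  rw [lay_cake F hF p hp, mul_assoc]
  gcongr
  have e1 : ∀ t : ℝ, 0 < t → volume {x | ENNReal.ofReal t < F x} * ENNReal.ofReal (t ^ (p-1)) ≤
      A * (∫⁻ x, (if ENNReal.ofReal t < g x / ENNReal.ofReal c then ENNReal.ofReal (t^(p-p0-1)) else 0) * g x ^ p0)
      + B * (∫⁻ x, (if g x / ENNReal.ofReal c ≤ ENNReal.ofReal t then ENNReal.ofReal (t^(-(p1-p)-1)) else 0) * g x ^ p1) := by
    intro t ht
    have hc0 : ENNReal.ofReal c ≠ 0 := by simpa using hc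
    refine (mul_le_mul_left (H t ht) _).trans (le_of_eq ?_)
    rw [add_mul]
    congr 1
    · rw [mul_right_comm, mul_assoc A, mul_assoc A]
      congr 1
      rw [← ENNReal.ofReal_mul (by positivity), ← Real.rpow_add ht, show -p0 + (p-1) = p-p0-1 by ring,
        ← lintegral_indicator (measurableSet_lt measurable_const hg), ← lintegral_const_mul _ (Measurable.indicator (by fun_prop) (measurableSet_lt measurable_const hg))]
      refine lintegral_congr fun x => ?_
      simp only [indicator, mem_ofPred_eq, ENNReal.ofReal_mul hc.le, ENNReal.lt_div_iff_mul_lt (Or.inl hc0) (Or.inl ENNReal.ofReal_ne_top)]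
      simp only [mul_comm (ENNReal.ofReal c)]
      split_ifs <;> simp
    · rw [mul_right_comm, mul_assoc B, mul_assoc B]
      congr 1
      rw [← ENNReal.ofReal_mul (by positivity), ← Real.rpow_add ht, show -p1 + (p-1) = -(p1-p)-1 by ring,
        ← lintegral_indicator (measurableSet_le hg measurable_const), ← lintegral_const_mul _ (Measurable.indicator (by fun_prop) (measurableSet_le hg measurable_const))]
      refine lintegral_congr fun x => ?_
      simp only [indicator, mem_ofPred_eq, ENNReal.ofReal_mul hc.le, ENNReal.div_le_iff_le_mul (Or.inl hc0) (Or.inl ENNReal.ofReal_ne_top)]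
      simp only [mul_comm (ENNReal.ofReal c)]
      split_ifs <;> simp
  have m1 : Measurable (fun z : ℝ × ℝ => (if ENNReal.ofReal z.1 < g z.2 / ENNReal.ofReal c then ENNReal.ofReal (z.1^(p-p0-1)) else 0) * g z.2 ^ p0) := by
    refine Measurable.mul (Measurable.ite (measurableSet_lt (by fun_prop) (by fun_prop)) (by fun_prop) measurable_const) (by fun_prop)
  have m2 : Measurable (fun z : ℝ × ℝ => (if g z.2 / ENNReal.ofReal c ≤ ENNReal.ofReal z.1 then ENNReal.ofReal (z.1^(-(p1-p)-1)) else 0) * g z.2 ^ p1) := by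
    refine Measurable.mul (Measurable.ite (measurableSet_le (by fun_prop) (by fun_prop)) (by fun_prop) measurable_const) (by fun_prop)
  refine (setLIntegral_mono' measurableSet_Ioi (fun t ht => e1 t ht)).trans ?_
  rw [lintegral_add_left ((Measurable.lintegral_prod_right' m1).const_mul A),
    lintegral_const_mul _ (Measurable.lintegral_prod_right' m1), lintegral_const_mul _ (Measurable.lintegral_prod_right' m2),
    lintegral_lintegral_swap (f := fun t x => (if ENNReal.ofReal t < g x / ENNReal.ofReal c then ENNReal.ofReal (t^(p-p0-1)) else 0) * g x ^ p0) m1.aemeasurable,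
    lintegral_lintegral_swap (f := fun t x => (if g x / ENNReal.ofReal c ≤ ENNReal.ofReal t then ENNReal.ofReal (t^(-(p1-p)-1)) else 0) * g x ^ p1) m2.aemeasurable, add_mul, mul_assoc, mul_assoc,
    ← lintegral_const_mul (ENNReal.ofReal ((p - p0)⁻¹ * c ^ (p0 - p))) (show Measurable (fun x => g x ^ p) by fun_prop),
    ← lintegral_const_mul (ENNReal.ofReal ((p1 - p)⁻¹ * c ^ (p1 - p))) (show Measurable (fun x => g x ^ p) by fun_prop)]
  gcongr with x x
  · rw [lintegral_mul_const _ (Measurable.ite (measurableSet_lt (by fun_prop) (by fun_prop)) (by fun_prop) measurable_const), lay_pos _ _ (by linarith)]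
    rw [ENNReal.div_rpow_of_nonneg _ _ (by linarith), ENNReal.ofReal_mul (by rw [inv_nonneg]; linarith), mul_assoc, mul_assoc, ENNReal.div_eq_inv_mul,
      ENNReal.ofReal_rpow_of_pos hc, ← ENNReal.ofReal_inv_of_pos (by positivity), ← Real.rpow_neg hc.le, neg_sub, mul_assoc,
      ← ENNReal.rpow_add_of_nonneg _ _ (by linarith) h0.le, sub_add_cancel]
  · rcases eq_or_ne (g x) 0 with h | h
    · simp [h, ENNReal.zero_rpow_of_pos (show 0 < p1 by linarith)]
    rw [lintegral_mul_const _ (Measurable.ite (measurableSet_le (by fun_prop) (by fun_prop)) (by fun_prop) measurable_const), lay_neg _ (by simpa [ENNReal.div_eq_zero_iff] using h) _ (by linarith)]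
    rcases eq_or_ne (g x) ∞ with h' | h'
    · rw [h', ENNReal.top_rpow_of_pos hp, ENNReal.mul_top]
      · exact le_top
      · have : 0 < p1 - p := by linarith
        simp only [ne_eq, ENNReal.ofReal_eq_zero, not_le]; positivity
    rw [ENNReal.ofReal_mul (by rw [inv_nonneg]; linarith), mul_assoc, mul_assoc]
    refine mul_le_mul' le_rfl (le_of_eq ?_)
    rw [ENNReal.rpow_neg, ENNReal.div_rpow_of_nonneg _ _ (by linarith), ENNReal.inv_div (Or.inl (by simp [ENNReal.rpow_eq_top_iff, hc.not_ge])) (Or.inl (by simp [ENNReal.rpow_eq_zero_iff, hc, h1.le]))]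
    rw [ENNReal.div_eq_inv_mul, ENNReal.ofReal_rpow_of_pos hc, mul_right_comm, ← ENNReal.rpow_neg, ← ENNReal.rpow_add _ _ h h', mul_comm]
    rw [show -(p1-p)+p1 = p by ring]
/-! ### The maximal function -/
noncomputable def MM (g : ℝ → ℝ≥0∞) (x : ℝ) : ℝ≥0∞ :=
  ⨆ k : ℤ, ENNReal.ofReal ((2:ℝ)^(-k)) * ∫⁻ y in Icc (x - (2:ℝ)^k) (x + (2:ℝ)^k), g y
lemma MM_mono {g h : ℝ → ℝ≥0∞} (H : ∀ x, g x ≤ h x) (x : ℝ) : MM g x ≤ MM h x := by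
  unfold MM
  gcongr with k y
  exact H y
lemma measurable_avg (g : ℝ → ℝ≥0∞) (hg : Measurable g) (r : ℝ) :
    Measurable (fun x => ∫⁻ y in Icc (x - r) (x + r), g y) := by
  have : (fun x => ∫⁻ y in Icc (x - r) (x + r), g y) = fun x => ∫⁻ y, if |x - y| ≤ r then g y else 0 := by
    ext x
    rw [← lintegral_indicator measurableSet_Icc]
    refine lintegral_congr fun y => ?_
    simp only [indicator, mem_Icc]
    congr 1
    rw [abs_le, eq_iff_iff]
    constructor <;> rintro ⟨h1, h2⟩ <;> constructor <;> linarith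
  rw [this]
  refine Measurable.lintegral_prod_right (f := fun x y => if |x - y| ≤ r then g y else 0) ?_
  refine Measurable.ite (measurableSet_le (by fun_prop) (by fun_prop)) (by fun_prop) measurable_const
lemma measurable_MM {g : ℝ → ℝ≥0∞} (hg : Measurable g) : Measurable (MM g) :=
  Measurable.iSup fun k => (measurable_avg g hg _).const_mul _
lemma lintegral_le_MM (g : ℝ → ℝ≥0∞) (x r : ℝ) (hr : 0 < r) (S : Set ℝ) (hS : S ⊆ Icc (x - r) (x + r)) :
    ∫⁻ y in S, g y ≤ ENNReal.ofReal (2 * r) * MM g x := by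
  obtain ⟨k, hk1, hk2⟩ := exists_mem_Ioc_zpow (y := (2:ℝ)) hr (by norm_num)
  have h2 : (2:ℝ)^(k+1) ≤ 2 * r := by
    rw [zpow_add_one₀ (by norm_num)]; linarith
  calc ∫⁻ y in S, g y ≤ ∫⁻ y in Icc (x - (2:ℝ)^(k+1)) (x + (2:ℝ)^(k+1)), g y := by
        refine lintegral_mono_set (hS.trans (Icc_subset_Icc ?_ ?_)) <;> linarith
    _ = ENNReal.ofReal ((2:ℝ)^(k+1)) * (ENNReal.ofReal ((2:ℝ)^(-(k+1))) * ∫⁻ y in Icc (x - (2:ℝ)^(k+1)) (x + (2:ℝ)^(k+1)), g y) := by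
        rw [← mul_assoc, ← ENNReal.ofReal_mul (by positivity), ← zpow_add₀ (by norm_num)]
        simp
    _ ≤ ENNReal.ofReal (2 * r) * MM g x := by
        gcongr
        exact le_iSup (fun k : ℤ => ENNReal.ofReal ((2:ℝ)^(-k)) * ∫⁻ y in Icc (x - (2:ℝ)^k) (x + (2:ℝ)^k), g y) (k+1)
lemma MM_le_of_le {g : ℝ → ℝ≥0∞} (a : ℝ≥0∞) (H : ∀ x, g x ≤ a) (x : ℝ) : MM g x ≤ 2 * a := by
  refine iSup_le fun k => ?_
  calc _ ≤ ENNReal.ofReal ((2:ℝ)^(-k)) * ∫⁻ y in Icc (x - (2:ℝ)^k) (x + (2:ℝ)^k), a := by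
        gcongr with y; exact H y
    _ = 2 * a := by
        rw [setLIntegral_const, Real.volume_Icc, mul_comm a, ← mul_assoc, ← ENNReal.ofReal_mul (by positivity)]
        congr 1
        rw [show (2:ℝ)^(-k) * (x + (2:ℝ)^k - (x - (2:ℝ)^k)) = 2 * ((2:ℝ)^(-k) * 2^k) by ring, ← zpow_add₀ (by norm_num)]
        simp
lemma MM_add_le {g h : ℝ → ℝ≥0∞} (hg : Measurable g) (x : ℝ) : MM (fun y => g y + h y) x ≤ MM g x + MM h x := by
  refine iSup_le fun k => ?_
  rw [lintegral_add_left hg, mul_add]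
  exact add_le_add (le_iSup (fun k : ℤ => ENNReal.ofReal ((2:ℝ)^(-k)) * ∫⁻ y in Icc (x - (2:ℝ)^k) (x + (2:ℝ)^k), g y) k)
    (le_iSup (fun k : ℤ => ENNReal.ofReal ((2:ℝ)^(-k)) * ∫⁻ y in Icc (x - (2:ℝ)^k) (x + (2:ℝ)^k), h y) k)
lemma MM_weak (g : ℝ → ℝ≥0∞) (t : ℝ) (ht : 0 < t) :
    volume {x | ENNReal.ofReal t < MM g x} ≤ 8 * ENNReal.ofReal t⁻¹ * ∫⁻ y, g y := by
  rcases eq_or_ne (∫⁻ y, g y) ∞ with hi | hi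
  · rw [hi, ENNReal.mul_top]
    · exact le_top
    · simp [ht]
  set S := {a : ℝ × ℤ | ENNReal.ofReal (t * 2 ^ a.2) < ∫⁻ y in Icc (a.1 - (2:ℝ)^a.2) (a.1 + (2:ℝ)^a.2), g y} with hS
  set G := (∫⁻ y, g y).toReal
  have hb : ∀ a ∈ S, (2:ℝ)^a.2 ≤ G / t := by
    intro a ha
    have : ENNReal.ofReal (t * 2 ^ a.2) ≤ ∫⁻ y, g y := (le_of_lt ha).trans (setLIntegral_le_lintegral _ _)
    rw [ENNReal.ofReal_le_iff_le_toReal hi] at this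
    rw [le_div_iff₀ ht]; linarith
  obtain ⟨u, huS, hd, hcov⟩ := Vitali.exists_disjoint_subfamily_covering_enlargement_closedBall S (fun a => a.1) (fun a => (2:ℝ)^a.2) _ hb 4 (by norm_num)
  have hcount : u.Countable := by
    refine hd.countable_of_nonempty_interior fun a _ => ?_
    rw [interior_closedBall _ (by positivity)]
    exact Metric.nonempty_ball.mpr (by positivity)
  have hsub : {x | ENNReal.ofReal t < MM g x} ⊆ ⋃ b ∈ u, Metric.closedBall b.1 (4 * (2:ℝ)^b.2) := by
    intro x hx
    simp only [mem_ofPred_eq, MM, lt_iSup_iff] at hx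
    obtain ⟨k, hk⟩ := hx
    have hm : (x, k) ∈ S := by
      simp only [hS, mem_ofPred_eq]
      rw [ENNReal.ofReal_mul ht.le]
      have := ENNReal.mul_lt_mul_left (a := ENNReal.ofReal ((2:ℝ)^k)) (by simp; positivity) (by simp) hk
      rw [mul_right_comm, ← ENNReal.ofReal_mul (show (0:ℝ) ≤ (2:ℝ)^(-k) by positivity), ← zpow_add₀ (two_ne_zero)] at this
      simpa using this
    obtain ⟨b, hb, hsb⟩ := hcov _ hm
    exact mem_biUnion hb (hsb (Metric.mem_closedBall_self (by positivity)))
  calc volume {x | ENNReal.ofReal t < MM g x} ≤ volume (⋃ b ∈ u, Metric.closedBall b.1 (4 * (2:ℝ)^b.2)) := measure_mono hsub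
    _ ≤ ∑' b : u, volume (Metric.closedBall b.1.1 (4 * (2:ℝ)^b.1.2)) := measure_biUnion_le _ hcount _
    _ ≤ ∑' b : u, 8 * ENNReal.ofReal t⁻¹ * ∫⁻ y in Metric.closedBall b.1.1 ((2:ℝ)^b.1.2), g y := by
        refine ENNReal.tsum_le_tsum fun b => ?_
        rw [Real.volume_closedBall, Real.closedBall_eq_Icc]
        calc ENNReal.ofReal (2 * (4 * 2 ^ b.1.2)) = 8 * ENNReal.ofReal t⁻¹ * ENNReal.ofReal (t * 2 ^ b.1.2) := by
              rw [mul_assoc, ← ENNReal.ofReal_mul (by positivity), inv_mul_cancel_left₀ ht.ne', ← mul_assoc, ENNReal.ofReal_mul (by norm_num)]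
              norm_num
          _ ≤ _ := by
              gcongr
              exact le_of_lt (huS b.2)
    _ = 8 * ENNReal.ofReal t⁻¹ * ∫⁻ y in ⋃ b ∈ u, Metric.closedBall b.1 ((2:ℝ)^b.2), g y := by
        rw [ENNReal.tsum_mul_left, lintegral_biUnion hcount (fun b _ => measurableSet_closedBall) hd]
    _ ≤ _ := by
        exact mul_le_mul' le_rfl (setLIntegral_le_lintegral _ _)
lemma MM_strong (p : ℝ) (hp : 1 < p) : ∃ C : ℝ≥0, ∀ g : ℝ → ℝ≥0∞, Measurable g →
    ∫⁻ x, MM g x ^ p ≤ C * ∫⁻ x, g x ^ p := by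
  refine ⟨(ENNReal.ofReal p * (16 * ENNReal.ofReal ((p - 1)⁻¹ * (1/4) ^ (1 - p))
      + 0 * ENNReal.ofReal ((p + 1 - p)⁻¹ * (1/4) ^ (p + 1 - p)))).toNNReal, fun g hg => ?_⟩
  rw [ENNReal.coe_toNNReal]
  swap
  · simp [ENNReal.mul_eq_top]
  refine marc (MM g) g (measurable_MM hg) hg 1 p (p+1) (by norm_num) hp (by linarith) (1/4) (by norm_num) 16 0 ?_
  intro t ht
  have hm : MeasurableSet {x | ENNReal.ofReal (1/4 * t) < g x} := measurableSet_lt measurable_const hg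
  have : {x | ENNReal.ofReal t < MM g x} ⊆ {x | ENNReal.ofReal (t/2) < MM ({x | ENNReal.ofReal (1/4 * t) < g x}.indicator g) x} := by
    intro x hx
    simp only [mem_ofPred_eq] at hx ⊢
    by_contra hcon
    push Not at hcon
    have h1 : MM g x ≤ MM ({x | ENNReal.ofReal (1/4 * t) < g x}.indicator g) x + 2 * ENNReal.ofReal (1/4 * t) := by
      refine le_trans (MM_mono (h := fun y => ({x | ENNReal.ofReal (1/4 * t) < g x}.indicator g) y + ENNReal.ofReal (1/4*t)) ?_ x) ((MM_add_le (hg.indicator hm) x).trans ?_)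
      · intro y
        by_cases hy : ENNReal.ofReal (1/4 * t) < g y
        · simp only [indicator, mem_ofPred_eq, hy, if_true]
          exact le_self_add
        · simp only [indicator, mem_ofPred_eq, hy, if_false, zero_add]
          exact not_lt.mp hy
      · gcongr
        exact MM_le_of_le _ (fun _ => le_rfl) x
    have h2 : MM g x ≤ ENNReal.ofReal t := by
      refine h1.trans ((add_le_add hcon le_rfl).trans (le_of_eq ?_))
      rw [show (2:ℝ≥0∞) = ENNReal.ofReal 2 by simp, ← ENNReal.ofReal_mul (by norm_num), ← ENNReal.ofReal_add (by positivity) (by positivity)]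
      congr 1; ring
    exact absurd hx (not_lt.mpr h2)
  refine (measure_mono this).trans ((MM_weak _ (t/2) (by positivity)).trans ?_)
  rw [lintegral_indicator hm, zero_mul, zero_mul, add_zero]
  simp only [ENNReal.rpow_one]
  refine mul_le_mul' (le_of_eq ?_) le_rfl
  rw [Real.rpow_neg_one, inv_div, div_eq_mul_inv, ENNReal.ofReal_mul (by norm_num), ← mul_assoc]
  norm_num
/-! ### The kernel pieces -/
noncomputable def th (u : ℝ) : ℝ := max 0 (min 1 (2 - 2 * u))
lemma th_nonneg (u : ℝ) : 0 ≤ th u := le_max_left _ _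
lemma th_le_one (u : ℝ) : th u ≤ 1 := max_le zero_le_one (min_le_left _ _)
lemma th_one {u : ℝ} (h : u ≤ 1/2) : th u = 1 := by
  unfold th; rw [min_eq_left (by linarith), max_eq_right zero_le_one]
lemma th_zero {u : ℝ} (h : 1 ≤ u) : th u = 0 := by
  unfold th; rw [max_eq_left]; exact (min_le_right _ _).trans (by linarith)
lemma th_lip (u v : ℝ) : |th u - th v| ≤ 2 * |u - v| := by
  unfold th
  refine (abs_max_sub_max_le_max _ _ _ _).trans (max_le (by simp) ?_)
  refine (abs_min_sub_min_le_max _ _ _ _).trans (max_le (by simp) ?_)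
  rw [show 2 - 2*u - (2-2*v) = -(2 * (u-v)) by ring, abs_neg, abs_mul]; simp
lemma th_anti {u v : ℝ} (h : u ≤ v) : th v ≤ th u := by
  unfold th; gcongr
@[fun_prop] lemma th_meas : Measurable th := by unfold th; fun_prop
noncomputable def ps (s : ℤ) (t : ℝ) : ℝ := (th ((2:ℝ)^(-s) * |t|) - th ((2:ℝ)^(1-s) * |t|)) / t
@[fun_prop] lemma ps_meas (s : ℤ) : Measurable (ps s) := by
  unfold ps
  have := th_meas
  refine Measurable.div (Measurable.sub (this.comp (by fun_prop)) (this.comp (by fun_prop))) (by fun_prop)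
lemma ps_scale (s : ℤ) (t : ℝ) : ps s t = (2:ℝ)^(-s) * ps 0 ((2:ℝ)^(-s) * t) := by
  unfold ps
  have h : (0:ℝ) < (2:ℝ)^(-s) := by positivity
  rw [abs_mul, abs_of_pos h, neg_zero, zpow_zero, one_mul, sub_zero, zpow_one,
    show (1 - s : ℤ) = 1 + -s by ring, zpow_add₀ two_ne_zero, zpow_one, mul_assoc]
  rw [mul_div_assoc', mul_div_mul_left _ _ h.ne']
lemma ps_zero_lo (s : ℤ) {t : ℝ} (h : |t| ≤ (2:ℝ)^s / 4) : ps s t = 0 := by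
  unfold ps
  have h1 : (2:ℝ)^(-s) * |t| ≤ 1/4 := by
    calc (2:ℝ)^(-s) * |t| ≤ (2:ℝ)^(-s) * ((2:ℝ)^s/4) := by gcongr
      _ = 1/4 := by rw [zpow_neg]; field_simp
  rw [th_one (by linarith), th_one, sub_self, zero_div]
  rw [show (1 - s : ℤ) = 1 + -s by ring, zpow_add₀ two_ne_zero, zpow_one]; linarith
lemma ps_zero_hi (s : ℤ) {t : ℝ} (h : (2:ℝ)^s ≤ |t|) : ps s t = 0 := by
  unfold ps
  have h1 : 1 ≤ (2:ℝ)^(-s) * |t| := by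
    calc 1 = (2:ℝ)^(-s) * ((2:ℝ)^s) := by rw [zpow_neg]; field_simp
      _ ≤ _ := by gcongr
  rw [th_zero h1, th_zero, sub_self, zero_div]
  rw [show (1 - s : ℤ) = 1 + -s by ring, zpow_add₀ two_ne_zero, zpow_one]; linarith
lemma ps_neg (s : ℤ) (t : ℝ) : ps s (-t) = - ps s t := by
  unfold ps; rw [abs_neg, div_neg]
lemma ps_bound (s : ℤ) (t : ℝ) : |ps s t| ≤ 4 * (2:ℝ)^(-s) := by
  by_cases h : |t| ≤ (2:ℝ)^s / 4
  · rw [ps_zero_lo s h, abs_zero]; positivity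
  push Not at h
  have h0 : (0:ℝ) < (2:ℝ)^s / 4 := by positivity
  unfold ps
  rw [abs_div, div_le_iff₀ (h0.trans h)]
  have h2 : |th ((2:ℝ)^(-s) * |t|) - th ((2:ℝ)^(1-s) * |t|)| ≤ 1 := by
    rw [abs_le]
    constructor <;> linarith [th_nonneg ((2:ℝ)^(-s) * |t|), th_nonneg ((2:ℝ)^(1-s) * |t|), th_le_one ((2:ℝ)^(-s) * |t|), th_le_one ((2:ℝ)^(1-s) * |t|)]
  calc _ ≤ (1:ℝ) := h2
    _ = 4 * (2:ℝ)^(-s) * ((2:ℝ)^s/4) := by rw [zpow_neg]; field_simp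
    _ ≤ _ := by gcongr
lemma ps0_lip (t u : ℝ) : |ps 0 t - ps 0 u| ≤ 40 * |t - u| := by
  set e : ℝ → ℝ := fun t => th |t| - th (2 * |t|) with he
  have hps : ∀ t, ps 0 t = e t / t := by intro t; simp [ps, he]
  have hel : ∀ t u, |e t - e u| ≤ 6 * |t - u| := by
    intro t u
    have h1 := th_lip |t| |u|
    have h2 := th_lip (2*|t|) (2*|u|)
    have h3 := abs_abs_sub_abs_le_abs_sub t u
    rw [show 2 * |t| - 2*|u| = 2 * (|t| - |u|) by ring, abs_mul, abs_two] at h2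
    calc |e t - e u| = |(th |t| - th |u|) - (th (2*|t|) - th (2*|u|))| := by simp only [he]; congr 1; ring
      _ ≤ |(th |t| - th |u|)| + |(th (2*|t|) - th (2*|u|))| := abs_sub _ _
      _ ≤ _ := by linarith
  have hz : ∀ t, |t| ≤ 1/4 → e t = 0 := by
    intro t ht; simp only [he]; rw [th_one (by linarith), th_one (by linarith), sub_self]
  have heb : ∀ t, |e t| ≤ 1 := by
    intro t; simp only [he, abs_le]
    constructor <;> linarith [th_nonneg |t|, th_le_one |t|, th_nonneg (2*|t|), th_le_one (2*|t|)]
  have key : ∀ t u, |t| ≤ 1/4 → |e t / t - e u / u| ≤ 40 * |t - u| := by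
    intro t u ht
    rw [hz t ht, zero_div, zero_sub, abs_neg]
    by_cases hu : |u| ≤ 1/4
    · rw [hz u hu]; simp
    push Not at hu
    have := hel t u
    rw [hz t ht, zero_sub, abs_neg] at this
    rw [abs_div, div_le_iff₀ (by linarith)]
    nlinarith [abs_nonneg (t-u)]
  rw [hps, hps]
  by_cases ht : |t| ≤ 1/4
  · exact key t u ht
  by_cases hu : |u| ≤ 1/4
  · rw [abs_sub_comm, abs_sub_comm t]; exact key u t hu
  push Not at ht hu
  have ht0 : t ≠ 0 := by rintro rfl; simp at ht; linarith
  have hu0 : u ≠ 0 := by rintro rfl; simp at hu; linarith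
  have : e t / t - e u / u = (e t - e u)/t + e u * (u - t) / (t * u) := by field_simp; ring
  rw [this]
  refine (abs_add_le _ _).trans ?_
  have a1 : |(e t - e u)/t| ≤ 24 * |t - u| := by
    rw [abs_div, div_le_iff₀ (by linarith)]
    nlinarith [hel t u, abs_nonneg (t-u)]
  have a2 : |e u * (u - t) / (t * u)| ≤ 16 * |t - u| := by
    rw [abs_div, abs_mul, abs_mul, div_le_iff₀ (by positivity), abs_sub_comm u t]
    have h16 : 1/16 ≤ |t| * |u| := by nlinarith
    nlinarith [heb u, abs_nonneg (t-u), mul_le_mul_of_nonneg_left h16 (abs_nonneg (t-u)), mul_le_mul_of_nonneg_right (heb u) (abs_nonneg (t-u))]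
  linarith
lemma ps_lip (s : ℤ) (t u : ℝ) : |ps s t - ps s u| ≤ 40 * (2:ℝ)^(-s) * (2:ℝ)^(-s) * |t - u| := by
  rw [ps_scale s t, ps_scale s u, ← mul_sub, abs_mul, abs_of_pos (show (0:ℝ) < (2:ℝ)^(-s) by positivity)]
  have := ps0_lip ((2:ℝ)^(-s) * t) ((2:ℝ)^(-s) * u)
  rw [← mul_sub, abs_mul, abs_of_pos (show (0:ℝ) < (2:ℝ)^(-s) by positivity)] at this
  calc _ ≤ (2:ℝ)^(-s) * (40 * ((2:ℝ)^(-s) * |t - u|)) := by gcongr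
    _ = _ := by ring
lemma ps_tele (a b : ℤ) (hab : a ≤ b + 1) (t : ℝ) :
    ∑ s ∈ Finset.Icc a b, ps s t = (th ((2:ℝ)^(-b) * |t|) - th ((2:ℝ)^(1-a) * |t|)) / t := by
  obtain ⟨n, hn⟩ : ∃ n : ℕ, b = a - 1 + n := ⟨(b + 1 - a).toNat, by omega⟩
  subst hn
  induction n with
  | zero =>
    have : Finset.Icc a (a - 1 + ((0:ℕ):ℤ)) = ∅ := by rw [Finset.Icc_eq_empty]; push_cast; omega
    rw [this]
    simp
  | succ n ih =>
    have : Finset.Icc a (a - 1 + ((n+1:ℕ):ℤ)) = insert (a + n) (Finset.Icc a (a - 1 + (n:ℤ))) := by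
      ext z; simp only [Finset.mem_Icc, Finset.mem_insert]; push_cast; omega
    rw [this, Finset.sum_insert (by simp), ih (by omega)]
    simp only [ps]
    rw [show (1 - (a + n) : ℤ) = -(a - 1 + n) by ring, show (-(a - 1 + ((n+1:ℕ):ℤ))) = -(a+n) by push_cast; ring]
    ring
/-! ### Bounded, compactly supported functions and kernels -/
noncomputable def ex (t : ℝ) : ℂ := Complex.exp (t * Complex.I)
lemma ex_add (a b : ℝ) : ex (a + b) = ex a * ex b := by
  unfold ex; rw [← Complex.exp_add]; push_cast; ring_nf
lemma ex_zero : ex 0 = 1 := by simp [ex]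
@[simp] lemma norm_ex (a : ℝ) : ‖ex a‖ = 1 := Complex.norm_exp_ofReal_mul_I a
@[simp] lemma enorm_ex (a : ℝ) : ‖ex a‖ₑ = 1 := by
  rw [← ofReal_norm, norm_ex]; simp
lemma ex_sub_one (a : ℝ) : ‖ex a - 1‖ ≤ |a| := by
  have := Real.norm_exp_I_mul_ofReal_sub_one_le (x := a)
  rwa [mul_comm] at this
lemma ex_conj (a : ℝ) : conj (ex a) = ex (-a) := by
  unfold ex; rw [← Complex.exp_conj]; simp
lemma ex_pi : ex Real.pi = -1 := by simp [ex]
@[fun_prop] lemma ex_cont : Continuous ex := by unfold ex; fun_prop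
@[fun_prop] lemma ex_meas : Measurable ex := ex_cont.measurable
lemma ex_sub_ex (a b : ℝ) : ‖ex a - ex b‖ ≤ |a - b| := by
  have h : ex a - ex b = ex b * (ex (a - b) - 1) := by
    rw [mul_sub, ← ex_add, mul_one]; ring_nf
  rw [h, norm_mul, norm_ex, one_mul]; exact ex_sub_one _
structure Bd (f : ℝ → ℂ) : Prop where
  meas : Measurable f
  bdd : ∃ B : ℝ, ∀ x, ‖f x‖ ≤ B
  supp : ∃ R : ℝ, ∀ x, R < |x| → f x = 0
lemma Bd.mul_left {f g : ℝ → ℂ} (hf : Bd f) (hg : Measurable g) (B : ℝ) (hB : ∀ x, ‖g x‖ ≤ B) : Bd (fun x => g x * f x) := by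
  obtain ⟨hm, ⟨C, hC⟩, ⟨R, hR⟩⟩ := hf
  refine ⟨hg.mul hm, ⟨B * C, fun x => ?_⟩, ⟨R, fun x hx => by rw [hR x hx, mul_zero]⟩⟩
  rw [norm_mul]
  exact mul_le_mul (hB x) (hC x) (norm_nonneg _) ((norm_nonneg _).trans (hB x))
lemma Bd.ex_mul {f : ℝ → ℂ} (hf : Bd f) {φ : ℝ → ℝ} (hφ : Measurable φ) : Bd (fun x => ex (φ x) * f x) :=
  hf.mul_left (by fun_prop) 1 (by simp)
lemma Bd.mul {f g : ℝ → ℂ} (hf : Bd f) (hg : Bd g) : Bd (fun x => f x * g x) := by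
  obtain ⟨B, hB⟩ := hf.bdd
  exact hg.mul_left hf.meas B hB
lemma Bd.zero : Bd (fun _ => 0) := ⟨measurable_const, ⟨0, by simp⟩, ⟨0, by simp⟩⟩
lemma Bd.add {f g : ℝ → ℂ} (hf : Bd f) (hg : Bd g) : Bd (fun x => f x + g x) := by
  obtain ⟨hm, ⟨C, hC⟩, ⟨R, hR⟩⟩ := hf
  obtain ⟨hm', ⟨C', hC'⟩, ⟨R', hR'⟩⟩ := hg
  refine ⟨hm.add hm', ⟨C + C', fun x => (norm_add_le _ _).trans (add_le_add (hC x) (hC' x))⟩, ⟨max R R', fun x hx => ?_⟩⟩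
  rw [hR x ((le_max_left _ _).trans_lt hx), hR' x ((le_max_right _ _).trans_lt hx), add_zero]
lemma Bd.neg {f : ℝ → ℂ} (hf : Bd f) : Bd (fun x => - f x) := by
  have := hf.mul_left (g := fun _ => -1) measurable_const 1 (by simp)
  simpa using this
lemma Bd.sub {f g : ℝ → ℂ} (hf : Bd f) (hg : Bd g) : Bd (fun x => f x - g x) := by
  simpa [sub_eq_add_neg] using hf.add hg.neg
lemma Bd.sum {ι : Type*} (s : Finset ι) (f : ι → ℝ → ℂ) (hf : ∀ i ∈ s, Bd (f i)) : Bd (fun x => ∑ i ∈ s, f i x) := by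
  classical
  induction s using Finset.induction_on with
  | empty => simpa using Bd.zero
  | insert a s ha ih =>
    simp only [Finset.sum_insert ha]
    exact (hf a (by simp)).add (ih fun i hi => hf i (by simp [hi]))
lemma Bd.indicator {f : ℝ → ℂ} (hf : Bd f) {S : Set ℝ} (hS : MeasurableSet S) : Bd (S.indicator f) := by
  obtain ⟨hm, ⟨C, hC⟩, ⟨R, hR⟩⟩ := hf
  refine ⟨hm.indicator hS, ⟨C, fun x => (norm_indicator_le_norm_self _ _).trans (hC x)⟩, ⟨R, fun x hx => ?_⟩⟩
  simp [Set.indicator, hR x hx]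
lemma Bd.conj {f : ℝ → ℂ} (hf : Bd f) : Bd (fun x => conj (f x)) := by
  obtain ⟨hm, ⟨C, hC⟩, ⟨R, hR⟩⟩ := hf
  exact ⟨by fun_prop, ⟨C, fun x => by simpa using hC x⟩, ⟨R, fun x hx => by simp [hR x hx]⟩⟩
lemma Bd.shift {f : ℝ → ℂ} (hf : Bd f) (h : ℝ) : Bd (fun x => f (x - h)) := by
  obtain ⟨hm, ⟨C, hC⟩, ⟨R, hR⟩⟩ := hf
  refine ⟨by fun_prop, ⟨C, fun x => hC _⟩, ⟨R + |h|, fun x hx => hR _ ?_⟩⟩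
  have := abs_sub_abs_le_abs_sub x h
  linarith
lemma Bd.lintegral_lt_top {f : ℝ → ℂ} (hf : Bd f) (q : ℝ) (hq : 0 < q) : ∫⁻ x, ‖f x‖ₑ ^ q < ∞ := by
  obtain ⟨hm, ⟨C, hC⟩, ⟨R, hR⟩⟩ := hf
  calc ∫⁻ x, ‖f x‖ₑ ^ q ≤ ∫⁻ x, (Icc (-R) R).indicator (fun _ => ENNReal.ofReal C ^ q) x := by
        refine lintegral_mono fun x => ?_
        by_cases hx : x ∈ Icc (-R) R
        · simp only [hx, indicator_of_mem]
          gcongr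
          rw [← ofReal_norm]; exact ENNReal.ofReal_le_ofReal (hC x)
        · rw [hR x (by rw [mem_Icc, ← abs_le] at hx; linarith)]
          simp [ENNReal.zero_rpow_of_pos hq]
    _ < ∞ := by
        rw [lintegral_indicator_const measurableSet_Icc, Real.volume_Icc]
        exact ENNReal.mul_lt_top (ENNReal.rpow_lt_top_of_nonneg hq.le ENNReal.ofReal_ne_top) ENNReal.ofReal_lt_top
lemma Bd.integrable {f : ℝ → ℂ} (hf : Bd f) : Integrable f := by
  refine ⟨hf.meas.aestronglyMeasurable, ?_⟩
  have := hf.lintegral_lt_top 1 one_pos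
  simpa [HasFiniteIntegral] using this
lemma Bd.lintegral_sq_lt_top {f : ℝ → ℂ} (hf : Bd f) : ∫⁻ x, ‖f x‖ₑ ^ 2 < ∞ := by
  have := hf.lintegral_lt_top 2 two_pos
  simpa using this
lemma Bd.sq_eq {f : ℝ → ℂ} (hf : Bd f) : ∫⁻ x, ‖f x‖ₑ ^ 2 = ‖∫ x, f x * conj (f x)‖ₑ := by
  have h1 : ∀ x, f x * conj (f x) = ((‖f x‖^2 : ℝ) : ℂ) := by
    intro x; rw [Complex.mul_conj, Complex.normSq_eq_norm_sq]
  have hi := (hf.mul hf.conj).integrable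
  simp_rw [h1] at hi ⊢
  rw [integral_complex_ofReal, ← ofReal_norm, Complex.norm_real, Real.norm_of_nonneg (integral_nonneg fun x => by positivity),
    ofReal_integral_eq_lintegral_ofReal]
  · refine lintegral_congr fun x => ?_
    rw [ENNReal.ofReal_pow (norm_nonneg _), ofReal_norm]
  · exact_mod_cast hi.re
  · exact ae_of_all _ fun x => by positivity
lemma cs_sq (f g : ℝ → ℝ≥0∞) (hf : Measurable f) (hg : Measurable g) :
    (∫⁻ x, f x * g x) ^ 2 ≤ (∫⁻ x, f x ^ 2) * ∫⁻ x, g x ^ 2 := by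
  have := ENNReal.lintegral_mul_le_Lp_mul_Lq volume Real.HolderConjugate.two_two hf.aemeasurable hg.aemeasurable
  simp only [Pi.mul_apply, ENNReal.rpow_two] at this
  calc _ ≤ _ := pow_le_pow_left' this 2
    _ = _ := by
      rw [mul_pow, ← ENNReal.rpow_natCast, ← ENNReal.rpow_natCast, ← ENNReal.rpow_mul, ← ENNReal.rpow_mul]
      norm_num
structure BK (K : ℝ → ℝ → ℂ) : Prop where
  meas : Measurable (Function.uncurry K)
  bdd : ∃ B : ℝ, ∀ x y, ‖K x y‖ ≤ B
  supp : ∃ R : ℝ, ∀ x y, R < |x - y| → K x y = 0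
noncomputable def op (K : ℝ → ℝ → ℂ) (f : ℝ → ℂ) (x : ℝ) : ℂ := ∫ y, K x y * f y
noncomputable def adj (K : ℝ → ℝ → ℂ) : ℝ → ℝ → ℂ := fun y x => conj (K x y)
lemma BK.adj {K : ℝ → ℝ → ℂ} (hK : BK K) : BK (adj K) := by
  obtain ⟨hm, ⟨C, hC⟩, ⟨R, hR⟩⟩ := hK
  refine ⟨?_, ⟨C, fun x y => by simpa [PC.adj] using hC y x⟩, ⟨R, fun x y h => ?_⟩⟩
  · have : Measurable (fun z : ℝ × ℝ => conj (Function.uncurry K z.swap)) := by fun_prop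
    exact this
  · simp only [PC.adj, hR y x (by rwa [abs_sub_comm]), map_zero]
lemma BK.slice {K : ℝ → ℝ → ℂ} (hK : BK K) (x : ℝ) : Bd (K x) := by
  obtain ⟨hm, ⟨C, hC⟩, ⟨R, hR⟩⟩ := hK
  refine ⟨hm.comp (by fun_prop : Measurable (fun y => (x, y))), ⟨C, hC x⟩, ⟨R + |x|, fun y hy => hR x y ?_⟩⟩
  have := abs_sub_abs_le_abs_sub y x
  rw [abs_sub_comm] at this; linarith
lemma Bd.op {f : ℝ → ℂ} (hf : Bd f) {K : ℝ → ℝ → ℂ} (hK : BK K) : Bd (op K f) := by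
  obtain ⟨hm, ⟨C, hC⟩, ⟨R, hR⟩⟩ := hK
  obtain ⟨B, hB⟩ := hf.bdd
  obtain ⟨R', hR'⟩ := hf.supp
  refine ⟨?_, ⟨∫ y, C * ‖f y‖, fun x => ?_⟩, ⟨R + R', fun x hx => ?_⟩⟩
  · have : Measurable (fun z : ℝ × ℝ => K z.1 z.2 * f z.2) := hm.mul (hf.meas.comp measurable_snd)
    exact (this.stronglyMeasurable.integral_prod_right' (ν := volume)).measurable
  · refine norm_integral_le_of_norm_le (hf.integrable.norm.const_mul C) (ae_of_all _ fun y => ?_)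
    rw [norm_mul]
    gcongr
    exact hC x y
  · refine integral_eq_zero_of_ae (ae_of_all _ fun y => ?_)
    by_cases hy : R' < |y|
    · simp [hR' y hy]
    · show K x y * f y = 0
      rw [hR x y, zero_mul]
      · have := abs_sub_abs_le_abs_sub x y
        linarith
lemma op_dual {f g : ℝ → ℂ} (hf : Bd f) (hg : Bd g) {K : ℝ → ℝ → ℂ} (hK : BK K) :
    ∫ x, op K f x * conj (g x) = ∫ y, f y * conj (op (adj K) g y) := by
  have h1 : ∀ x, op K f x * conj (g x) = ∫ y, K x y * f y * conj (g x) := fun x => by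
    rw [op, integral_mul_const]
  have h2 : ∀ y, f y * conj (op (adj K) g y) = ∫ x, K x y * f y * conj (g x) := fun y => by
    rw [op, ← integral_conj, ← integral_const_mul]
    congr 1; ext x
    simp only [adj, map_mul, Complex.conj_conj]; ring
  simp_rw [h1, h2]
  refine integral_integral_swap ?_
  obtain ⟨hm, ⟨C, hC⟩, -⟩ := hK
  have hi : Integrable (fun z : ℝ × ℝ => conj (g z.1) * f z.2) (volume.prod volume) :=
    hg.conj.integrable.mul_prod hf.integrable
  have := hi.bdd_mul (c := C) hm.aestronglyMeasurable (ae_of_all _ fun z => hC z.1 z.2)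
  refine this.congr (ae_of_all _ fun z => ?_)
  simp only [Function.uncurry]; ring
lemma l2_dual {K : ℝ → ℝ → ℂ} (hK : BK K) (A : ℝ≥0∞)
    (H : ∀ g, Bd g → ∫⁻ x, ‖op (adj K) g x‖ₑ ^ 2 ≤ A * ∫⁻ x, ‖g x‖ₑ ^ 2) (f : ℝ → ℂ) (hf : Bd f) :
    ∫⁻ x, ‖op K f x‖ₑ ^ 2 ≤ A * ∫⁻ x, ‖f x‖ₑ ^ 2 := by
  set X := ∫⁻ x, ‖op K f x‖ₑ ^ 2 with hX
  have hT := hf.op hK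
  have hTT := hT.op hK.adj
  have h1 : X ≤ ∫⁻ y, ‖f y‖ₑ * ‖op (adj K) (op K f) y‖ₑ := by
    rw [hX, hT.sq_eq, op_dual hf hT hK]
    refine (enorm_integral_le_lintegral_enorm _).trans (le_of_eq ?_)
    refine lintegral_congr fun y => ?_
    rw [enorm_mul, RCLike.enorm_conj]
  have h2 : X ^ 2 ≤ (∫⁻ y, ‖f y‖ₑ ^ 2) * (A * X) :=
    (pow_le_pow_left' h1 2).trans ((cs_sq _ _ hf.meas.enorm hTT.meas.enorm).trans (by gcongr; exact H _ hT))
  have hfin : X ≠ ∞ := hT.lintegral_sq_lt_top.ne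
  rcases eq_or_ne X 0 with h0 | h0
  · rw [h0]; exact zero_le
  rw [sq, ← mul_assoc] at h2
  have := (ENNReal.mul_le_mul_iff_left h0 hfin).mp h2
  rwa [mul_comm] at this
lemma sum_Icc_ind {M : Type*} [AddCommMonoid M] (f : ℤ → M) (a : ℤ) (n : ℕ) :
    ∑ s ∈ Finset.Icc a (a - 1 + n), f s = ∑ i ∈ Finset.range n, f (a + i) := by
  refine (Finset.sum_bij (fun (i:ℕ) _ => a + (i:ℤ)) ?_ ?_ ?_ ?_).symm
  · intro i hi; simp only [Finset.mem_range] at hi; simp only [Finset.mem_Icc]; omega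
  · intro i _ j _ h; simpa using h
  · intro b hb; simp only [Finset.mem_Icc] at hb
    exact ⟨(b - a).toNat, by simp only [Finset.mem_range]; omega, by omega⟩
  · intros; rfl
lemma geo_dn (a b : ℤ) : ∑ s ∈ Finset.Icc a b, (2:ℝ)^(-s) ≤ 2 * (2:ℝ)^(-a) := by
  by_cases h : a ≤ b + 1
  · obtain ⟨n, hn⟩ : ∃ n : ℕ, b = a - 1 + n := ⟨(b + 1 - a).toNat, by omega⟩
    subst hn
    rw [sum_Icc_ind]
    have : ∑ i ∈ Finset.range n, (2:ℝ)^(-(a + (i:ℤ))) = 2 * (2:ℝ)^(-a) - 2 * (2:ℝ)^(-(a+(n:ℤ))) := by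
      induction n with
      | zero => simp
      | succ n ih =>
        rw [Finset.sum_range_succ, ih (by omega)]
        push_cast
        rw [show -(a + ((n:ℤ)+1)) = -(a+(n:ℤ)) - 1 by ring, zpow_sub_one₀ two_ne_zero]; ring
    rw [this]; have : (0:ℝ) < (2:ℝ)^(-(a+(n:ℤ))) := by positivity
    linarith
  · rw [Finset.Icc_eq_empty (by omega), Finset.sum_empty]; positivity
lemma geo_up (a b : ℤ) : ∑ s ∈ Finset.Icc a b, (2:ℝ)^s ≤ 2 * (2:ℝ)^b := by
  have := geo_dn (-b) (-a)
  rw [neg_neg] at this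
  refine le_of_eq_of_le ?_ this
  refine Finset.sum_bij (fun i _ => -i) ?_ ?_ ?_ ?_
  · intro i hi; simp only [Finset.mem_Icc] at hi ⊢; omega
  · intro i _ j _ h; simpa using h
  · intro b hb; simp only [Finset.mem_Icc] at hb
    exact ⟨-b, by simp only [Finset.mem_Icc]; omega, by simp⟩
  · intro i _; simp
/-- maximal function of the norm -/
noncomputable def MN (f : ℝ → ℂ) : ℝ → ℝ≥0∞ := MM (fun y => ‖f y‖ₑ)
lemma MN_congr {f g : ℝ → ℂ} (h : ∀ y, ‖f y‖ = ‖g y‖) : MN f = MN g := by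
  unfold MN; congr 1; ext y; rw [← ofReal_norm, ← ofReal_norm, h]
lemma enorm_le_of_norm {z : ℂ} {B : ℝ} (h : ‖z‖ ≤ B) : ‖z‖ₑ ≤ ENNReal.ofReal B := by
  rw [← ofReal_norm]; exact ENNReal.ofReal_le_ofReal h
lemma ker_bound (k f : ℝ → ℂ) (z r B : ℝ) (hr : 0 < r) (hB : ∀ y, ‖k y‖ ≤ B)
    (hs : ∀ y, r < |z - y| → k y = 0) :
    ‖∫ y, k y * f y‖ₑ ≤ ENNReal.ofReal (2 * B * r) * MN f z := by
  have hB0 : 0 ≤ B := (norm_nonneg _).trans (hB 0)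
  calc ‖∫ y, k y * f y‖ₑ ≤ ∫⁻ y, ‖k y * f y‖ₑ := enorm_integral_le_lintegral_enorm _
    _ ≤ ∫⁻ y, ENNReal.ofReal B * (Icc (z - r) (z + r)).indicator (fun y => ‖f y‖ₑ) y := by
        refine lintegral_mono fun y => ?_
        by_cases hy : y ∈ Icc (z - r) (z + r)
        · rw [indicator_of_mem hy, enorm_mul]; exact mul_le_mul' (enorm_le_of_norm (hB y)) le_rfl
        · rw [hs y, zero_mul, enorm_zero]; · exact bot_le
          by_contra hc; push Not at hc; rw [abs_le] at hc
          exact hy ⟨by linarith, by linarith⟩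
    _ = ENNReal.ofReal B * ∫⁻ y in Icc (z - r) (z + r), ‖f y‖ₑ := by
        rw [lintegral_const_mul' _ _ ENNReal.ofReal_ne_top, lintegral_indicator measurableSet_Icc]
    _ ≤ ENNReal.ofReal B * (ENNReal.ofReal (2 * r) * MN f z) :=
        mul_le_mul' le_rfl (lintegral_le_MM _ z r hr _ subset_rfl)
    _ = _ := by rw [← mul_assoc, ← ENNReal.ofReal_mul hB0]; congr 2; ring
noncomputable def kp (s : ℤ) (x y : ℝ) : ℂ := (ps s (x - y) : ℂ)
lemma kp_norm_le (s : ℤ) (x y : ℝ) : ‖kp s x y‖ ≤ 4 * (2:ℝ)^(-s) := by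
  rw [kp, Complex.norm_real]; exact ps_bound _ _
lemma kp_zero (s : ℤ) {x y : ℝ} (h : (2:ℝ)^s ≤ |x - y|) : kp s x y = 0 := by
  rw [kp, ps_zero_hi s h, Complex.ofReal_zero]
lemma kp_lip (s : ℤ) (x z y : ℝ) : ‖kp s x y - kp s z y‖ ≤ 40 * (2:ℝ)^(-s) * (2:ℝ)^(-s) * |x - z| := by
  rw [kp, kp, ← Complex.ofReal_sub, Complex.norm_real]
  have := ps_lip s (x - y) (z - y)
  rwa [sub_sub_sub_cancel_right] at this
lemma kp_meas (s : ℤ) : Measurable (Function.uncurry (kp s)) := by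
  unfold kp Function.uncurry
  have := ps_meas s
  fun_prop
lemma BK_kp (s : ℤ) : BK (kp s) :=
  ⟨kp_meas s, ⟨_, kp_norm_le s⟩, ⟨(2:ℝ)^s, fun _ _ h => kp_zero s h.le⟩⟩
lemma kp_adj (s : ℤ) (x y : ℝ) : adj (kp s) x y = - kp s x y := by
  simp only [adj, kp, Complex.conj_ofReal]
  rw [show y - x = -(x - y) by ring, ps_neg]; simp
lemma op_kp_le (s : ℤ) (f : ℝ → ℂ) (x : ℝ) : ‖op (kp s) f x‖ₑ ≤ 8 * MN f x := by
  have := ker_bound (kp s x) f x ((2:ℝ)^s) _ (by positivity) (kp_norm_le s x) (fun y h => kp_zero s h.le)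
  refine this.trans_eq ?_
  rw [show 2 * (4 * (2:ℝ)^(-s)) * (2:ℝ)^s = 8 by rw [zpow_neg]; field_simp; norm_num]
  norm_num
lemma Bd.kint {f k : ℝ → ℂ} (hf : Bd f) (hk : Bd k) : Integrable (fun y => k y * f y) := (hk.mul hf).integrable
lemma op_kp_diff (s : ℤ) {f : ℝ → ℂ} (hf : Bd f) (x z : ℝ) (h : |x - z| ≤ (2:ℝ)^s) :
    ‖op (kp s) f x - op (kp s) f z‖ₑ ≤ ENNReal.ofReal (160 * (2:ℝ)^(-s) * |x - z|) * MN f z := by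
  have e : op (kp s) f x - op (kp s) f z = ∫ y, (kp s x y - kp s z y) * f y := by
    rw [op, op, ← integral_sub (hf.kint ((BK_kp s).slice x)) (hf.kint ((BK_kp s).slice z))]
    congr 1; ext y; ring
  rw [e]
  have := ker_bound (fun y => kp s x y - kp s z y) f z (2 * (2:ℝ)^s) _ (by positivity) (fun y => kp_lip s x z y) (fun y h' => ?_)
  · refine this.trans_eq ?_
    rw [show 2 * (40 * (2:ℝ)^(-s) * (2:ℝ)^(-s) * |x-z|) * (2 * (2:ℝ)^s) = 160 * (2:ℝ)^(-s) * |x-z| by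
      rw [zpow_neg]; field_simp; norm_num [mul_comm]]
  · have h1 := abs_sub_le z x y
    rw [abs_sub_comm z x] at h1
    have h0 : (0:ℝ) < (2:ℝ)^s := by positivity
    rw [kp_zero s (by linarith), kp_zero s (by linarith), sub_zero]
noncomputable def tr (a b : ℤ) (f : ℝ → ℂ) (x : ℝ) : ℂ := ∑ s ∈ Finset.Icc a b, op (kp s) f x
lemma Bd.tr {f : ℝ → ℂ} (hf : Bd f) (a b : ℤ) : Bd (tr a b f) :=
  Bd.sum _ _ fun s _ => hf.op (BK_kp s)
lemma tr_diff (a b : ℤ) {f : ℝ → ℂ} (hf : Bd f) (x z : ℝ) (h : |x - z| ≤ (2:ℝ)^a) :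
    ‖tr a b f x - tr a b f z‖ₑ ≤ ENNReal.ofReal (320 * (2:ℝ)^(-a) * |x - z|) * MN f z := by
  unfold tr
  rw [← Finset.sum_sub_distrib]
  calc ‖∑ s ∈ Finset.Icc a b, (op (kp s) f x - op (kp s) f z)‖ₑ
      ≤ ∑ s ∈ Finset.Icc a b, ‖op (kp s) f x - op (kp s) f z‖ₑ := enorm_sum_le _ _
    _ ≤ ∑ s ∈ Finset.Icc a b, ENNReal.ofReal (160 * (2:ℝ)^(-s) * |x - z|) * MN f z := by
        refine Finset.sum_le_sum fun s hs => op_kp_diff s hf x z (h.trans ?_)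
        exact zpow_le_zpow_right₀ one_le_two (Finset.mem_Icc.1 hs).1
    _ = ENNReal.ofReal (∑ s ∈ Finset.Icc a b, 160 * (2:ℝ)^(-s) * |x - z|) * MN f z := by
        rw [ENNReal.ofReal_sum_of_nonneg (fun _ _ => by positivity), Finset.sum_mul]
    _ ≤ _ := by
        refine mul_le_mul' (ENNReal.ofReal_le_ofReal ?_) le_rfl
        rw [← Finset.sum_mul, ← Finset.mul_sum]
        refine mul_le_mul_of_nonneg_right ?_ (abs_nonneg _)
        linarith [geo_dn a b]
lemma tr_split {a b : ℤ} (c : ℤ) (f : ℝ → ℂ) (x : ℝ) (h1 : a ≤ c + 1) (h2 : c ≤ b) :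
    tr a b f x = tr a c f x + tr (c+1) b f x := by
  unfold tr
  rw [← Finset.sum_union]
  · congr 1; ext s; simp only [Finset.mem_union, Finset.mem_Icc]; omega
  · rw [Finset.disjoint_left]; intro s; simp only [Finset.mem_Icc]; omega
lemma tr_empty {a b : ℤ} (f : ℝ → ℂ) (x : ℝ) (h : b < a) : tr a b f x = 0 := by
  unfold tr; rw [Finset.Icc_eq_empty (by omega), Finset.sum_empty]
lemma op_kp_cont (s : ℤ) {f : ℝ → ℂ} (hf : Bd f) : Continuous (op (kp s) f) := by
  set B := ∫ y, ‖f y‖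
  have : LipschitzWith (Real.toNNReal (40 * (2:ℝ)^(-s) * (2:ℝ)^(-s) * B)) (op (kp s) f) := by
    have hB : 0 ≤ B := integral_nonneg fun _ => norm_nonneg _
    refine LipschitzWith.of_dist_le_mul fun x z => ?_
    rw [Real.coe_toNNReal _ (by positivity), dist_eq_norm, Real.dist_eq]
    have e : op (kp s) f x - op (kp s) f z = ∫ y, (kp s x y - kp s z y) * f y := by
      rw [op, op, ← integral_sub (hf.kint ((BK_kp s).slice x)) (hf.kint ((BK_kp s).slice z))]
      congr 1; ext y; ring
    rw [e]
    calc _ ≤ ∫ y, (40 * (2:ℝ)^(-s) * (2:ℝ)^(-s) * |x - z|) * ‖f y‖ := by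
          refine norm_integral_le_of_norm_le (hf.integrable.norm.const_mul _) (Eventually.of_forall fun y => ?_)
          rw [norm_mul]; exact mul_le_mul_of_nonneg_right (kp_lip s x z y) (norm_nonneg _)
      _ = _ := by rw [integral_const_mul]; ring
  exact this.continuous
lemma tr_cont (a b : ℤ) {f : ℝ → ℂ} (hf : Bd f) : Continuous (tr a b f) := by
  unfold tr; exact continuous_finsetSum _ fun s _ => op_kp_cont s hf
/-- modulation -/
noncomputable def md (N : ℝ) (f : ℝ → ℂ) (y : ℝ) : ℂ := ex (-(N * y)) * f y
lemma Bd.md {f : ℝ → ℂ} (hf : Bd f) (N : ℝ) : Bd (md N f) := hf.ex_mul (φ := fun y => -(N*y)) (by fun_prop)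
lemma norm_md (N : ℝ) (f : ℝ → ℂ) (y : ℝ) : ‖md N f y‖ = ‖f y‖ := by rw [md, norm_mul, norm_ex, one_mul]
lemma enorm_md (N : ℝ) (f : ℝ → ℂ) (y : ℝ) : ‖md N f y‖ₑ = ‖f y‖ₑ := by rw [md, enorm_mul, enorm_ex, one_mul]
lemma MN_md (N : ℝ) (f : ℝ → ℂ) : MN (md N f) = MN f := MN_congr (norm_md N f)
lemma md_zero (f : ℝ → ℂ) : md 0 f = f := by ext y; simp [md, ex_zero]
noncomputable def CC (S : Finset ℝ) (k0 k1 : ℤ) (f : ℝ → ℂ) (x : ℝ) : ℝ≥0∞ :=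
  ⨆ N ∈ S, ⨆ a ∈ Finset.Icc k0 k1, ⨆ b ∈ Finset.Icc k0 k1, ‖tr a b (md N f) x‖ₑ
lemma le_CC {S : Finset ℝ} {k0 k1 : ℤ} {f : ℝ → ℂ} {x N : ℝ} {a b : ℤ} (hN : N ∈ S)
    (ha : k0 ≤ a) (hb : b ≤ k1) : ‖tr a b (md N f) x‖ₑ ≤ CC S k0 k1 f x := by
  by_cases h : a ≤ b
  · refine le_iSup₂_of_le N hN (le_iSup₂_of_le a (Finset.mem_Icc.2 ⟨ha, by omega⟩) (le_iSup₂_of_le b (Finset.mem_Icc.2 ⟨by omega, hb⟩) le_rfl))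
  · rw [tr_empty _ _ (by omega)]; simp
lemma CC_le {S : Finset ℝ} {k0 k1 : ℤ} {f : ℝ → ℂ} {x : ℝ} {B : ℝ≥0∞}
    (h : ∀ N ∈ S, ∀ a b, k0 ≤ a → a ≤ b → b ≤ k1 → ‖tr a b (md N f) x‖ₑ ≤ B) : CC S k0 k1 f x ≤ B := by
  refine iSup₂_le fun N hN => iSup₂_le fun a ha => iSup₂_le fun b hb => ?_
  rw [Finset.mem_Icc] at ha hb
  by_cases hab : a ≤ b
  · exact h N hN a b ha.1 hab hb.2
  · rw [tr_empty _ _ (by omega)]; simp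
lemma CC_lsc (S : Finset ℝ) (k0 k1 : ℤ) {f : ℝ → ℂ} (hf : Bd f) : LowerSemicontinuous (CC S k0 k1 f) := by
  unfold CC
  refine lowerSemicontinuous_iSup fun N => lowerSemicontinuous_iSup fun _ => lowerSemicontinuous_iSup fun a =>
    lowerSemicontinuous_iSup fun _ => lowerSemicontinuous_iSup fun b => lowerSemicontinuous_iSup fun _ => ?_
  exact (tr_cont a b (hf.md N)).enorm.lowerSemicontinuous
lemma CC_meas (S : Finset ℝ) (k0 k1 : ℤ) {f : ℝ → ℂ} (hf : Bd f) : Measurable (CC S k0 k1 f) :=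
  (CC_lsc S k0 k1 hf).measurable
lemma op_norm_le {f : ℝ → ℂ} (s : ℤ) (x : ℝ) : ‖op (kp s) f x‖ₑ ≤ ENNReal.ofReal (4 * (2:ℝ)^(-s)) * ∫⁻ y, ‖f y‖ₑ := by
  calc ‖∫ y, kp s x y * f y‖ₑ ≤ ∫⁻ y, ‖kp s x y * f y‖ₑ := enorm_integral_le_lintegral_enorm _
    _ ≤ ∫⁻ y, ENNReal.ofReal (4 * (2:ℝ)^(-s)) * ‖f y‖ₑ := by
        refine lintegral_mono fun y => ?_
        rw [enorm_mul]; exact mul_le_mul' (enorm_le_of_norm (kp_norm_le s x y)) le_rfl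
    _ = _ := lintegral_const_mul' _ _ ENNReal.ofReal_ne_top
/-- CC f is bounded -/
lemma CC_bdd (S : Finset ℝ) (k0 k1 : ℤ) {f : ℝ → ℂ} (hf : Bd f) : ∃ B : ℝ≥0, ∀ x, CC S k0 k1 f x ≤ B := by
  have hI : ∫⁻ y, ‖f y‖ₑ < ∞ := by simpa using hf.lintegral_lt_top 1 one_pos
  refine ⟨(∑ s ∈ Finset.Icc k0 k1, ENNReal.ofReal (4 * (2:ℝ)^(-s)) * ∫⁻ y, ‖f y‖ₑ).toNNReal, fun x => ?_⟩
  rw [ENNReal.coe_toNNReal (ENNReal.sum_ne_top.2 fun s _ => ENNReal.mul_ne_top ENNReal.ofReal_ne_top hI.ne)]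
  refine CC_le fun N _ a b ha _ hb => ?_
  calc _ ≤ ∑ s ∈ Finset.Icc a b, ‖op (kp s) (md N f) x‖ₑ := enorm_sum_le _ _
    _ ≤ ∑ s ∈ Finset.Icc a b, ENNReal.ofReal (4 * (2:ℝ)^(-s)) * ∫⁻ y, ‖f y‖ₑ := by
        refine Finset.sum_le_sum fun s _ => ?_
        have := op_norm_le (f := md N f) s x
        simpa only [enorm_md] using this
    _ ≤ _ := Finset.sum_le_sum_of_subset (Finset.Icc_subset_Icc ha hb)
lemma op_supp {f : ℝ → ℂ} (s : ℤ) (x : ℝ) (h : ∀ y, |x - y| < (2:ℝ)^s → f y = 0) : op (kp s) f x = 0 := by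
  unfold op
  rw [← integral_zero ℝ ℂ]
  congr 1; ext y
  by_cases hy : |x - y| < (2:ℝ)^s
  · rw [h y hy, mul_zero]
  · rw [kp_zero s (not_lt.1 hy), zero_mul]
lemma CC_supp (S : Finset ℝ) (k0 k1 : ℤ) {f : ℝ → ℂ} (hf : Bd f) : ∃ R : ℝ, ∀ x, R < |x| → CC S k0 k1 f x = 0 := by
  obtain ⟨R, hR⟩ := hf.supp
  refine ⟨R + (2:ℝ)^k1, fun x hx => ?_⟩
  refine le_antisymm (CC_le fun N _ a b ha _ hb => ?_) bot_le
  unfold tr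
  rw [Finset.sum_eq_zero, enorm_zero]
  intro s hs
  refine op_supp s x fun y hy => ?_
  rw [md, hR y, mul_zero]
  have h1 : (2:ℝ)^s ≤ (2:ℝ)^k1 := zpow_le_zpow_right₀ one_le_two (by rw [Finset.mem_Icc] at hs; omega)
  have := abs_sub_abs_le_abs_sub x y
  linarith
lemma CC_lintegral (S : Finset ℝ) (k0 k1 : ℤ) {f : ℝ → ℂ} (hf : Bd f) (q : ℝ) (hq : 0 < q) :
    ∫⁻ x, CC S k0 k1 f x ^ q < ∞ := by
  obtain ⟨B, hB⟩ := CC_bdd S k0 k1 hf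
  obtain ⟨R, hR⟩ := CC_supp S k0 k1 hf
  calc ∫⁻ x, CC S k0 k1 f x ^ q ≤ ∫⁻ x, (Icc (-R) R).indicator (fun _ => (B:ℝ≥0∞) ^ q) x := by
        refine lintegral_mono fun x => ?_
        by_cases hx : x ∈ Icc (-R) R
        · rw [indicator_of_mem hx]; exact ENNReal.rpow_le_rpow (hB x) hq.le
        · rw [hR x, ENNReal.zero_rpow_of_pos hq]; · exact bot_le
          by_contra hc; push Not at hc; rw [abs_le] at hc; exact hx hc
    _ < ∞ := by
        rw [lintegral_indicator measurableSet_Icc, setLIntegral_const]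
        exact ENNReal.mul_lt_top (ENNReal.rpow_lt_top_of_nonneg hq.le ENNReal.coe_ne_top) (by simp)
def Dy (s m : ℤ) : Set ℝ := Ico ((m:ℝ) * (2:ℝ)^s) (((m:ℝ) + 1) * (2:ℝ)^s)
noncomputable def ix (s : ℤ) (x : ℝ) : ℤ := ⌊x * (2:ℝ)^(-s)⌋
lemma mem_Dy {s m : ℤ} {x : ℝ} : x ∈ Dy s m ↔ ix s x = m := by
  have h : (0:ℝ) < (2:ℝ)^s := by positivity
  rw [Dy, ix, Int.floor_eq_iff, mem_Ico, zpow_neg, ← div_eq_mul_inv, le_div_iff₀ h, div_lt_iff₀ h]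
lemma mem_Dy_ix (s : ℤ) (x : ℝ) : x ∈ Dy s (ix s x) := mem_Dy.2 rfl
lemma Dy_meas (s m : ℤ) : MeasurableSet (Dy s m) := measurableSet_Ico
lemma Dy_vol (s m : ℤ) : volume (Dy s m) = ENNReal.ofReal ((2:ℝ)^s) := by
  rw [Dy, Real.volume_Ico]; congr 1; ring
lemma Dy_left_mem (s m : ℤ) : (m:ℝ) * (2:ℝ)^s ∈ Dy s m := by
  refine ⟨le_rfl, ?_⟩
  have h : (0:ℝ) < (2:ℝ)^s := by positivity
  nlinarith
lemma ix_step (s : ℤ) (x : ℝ) : ix (s+1) x = ix s x / 2 := by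
  unfold ix
  rw [show x * (2:ℝ)^(-(s+1)) = (x * (2:ℝ)^(-s)) / (2:ℕ) by
    rw [show -(s+1) = -s - 1 by ring, zpow_sub_one₀ two_ne_zero]; push_cast; ring, Int.floor_div_natCast]
  rfl
lemma ix_ix {s t : ℤ} (h : s ≤ t) (x y : ℝ) (hxy : ix s x = ix s y) : ix t x = ix t y := by
  induction t, h using Int.leInduction with
  | base => exact hxy
  | succ t h ih => rw [ix_step, ix_step, ih]
lemma Dy_nest {s t m n : ℤ} (h : s ≤ t) {x : ℝ} (h1 : x ∈ Dy s m) (h2 : x ∈ Dy t n) : Dy s m ⊆ Dy t n := by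
  intro y hy
  rw [mem_Dy] at *
  rw [← h2]; exact ix_ix h _ _ (by rw [hy, h1])
lemma Dy_parent (s m : ℤ) : Dy s m ⊆ Dy (s+1) (m/2) := by
  intro y hy
  rw [mem_Dy] at *; rw [ix_step, hy]
lemma Dy_dist {s m : ℤ} {x y : ℝ} (hx : x ∈ Dy s m) (hy : y ∈ Dy s m) : |x - y| < (2:ℝ)^s := by
  obtain ⟨a, b⟩ := hx; obtain ⟨c, d⟩ := hy
  rw [abs_lt]; constructor <;> nlinarith
lemma Dy_scale_le {s t m n : ℤ} (h : Dy s m ⊆ Dy t n) : s ≤ t := by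
  have := measure_mono (μ := volume) h
  rw [Dy_vol, Dy_vol, ENNReal.ofReal_le_ofReal_iff (by positivity)] at this
  exact (zpow_le_zpow_iff_right₀ one_lt_two).1 this
/-- maximal dyadic intervals with a hereditary property -/
def Wh (G : ℤ → ℤ → Prop) : Set (ℤ × ℤ) := {q | G q.1 q.2 ∧ ¬ G (q.1+1) (q.2/2)}
lemma Wh_disj {G : ℤ → ℤ → Prop} (hG : ∀ s m t n, Dy s m ⊆ Dy t n → G t n → G s m) :
    (Wh G).PairwiseDisjoint (fun q => Dy q.1 q.2) := by
  have key : ∀ q ∈ Wh G, ∀ q' ∈ Wh G, ∀ x, x ∈ Dy q.1 q.2 → x ∈ Dy q'.1 q'.2 → q'.1 ≤ q.1 := by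
    intro q hq q' hq' x h1 h2
    by_contra hc; push Not at hc
    exact hq.2 (hG _ _ _ _ (Dy_nest (by omega) (Dy_parent _ _ h1) h2) hq'.1)
  intro q hq q' hq' hne
  rw [Function.onFun, Set.disjoint_left]
  intro x h1 h2
  apply hne
  have e : q.1 = q'.1 := le_antisymm (key q' hq' q hq x h2 h1) (key q hq q' hq' x h1 h2)
  ext
  · exact e
  · rw [e] at h1; exact (mem_Dy.1 h1).symm.trans (mem_Dy.1 h2)
lemma Wh_cover {G : ℤ → ℤ → Prop} (x : ℝ) (h1 : ∃ s, G s (ix s x)) (h2 : ∃ b, ∀ s, G s (ix s x) → s ≤ b) :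
    ∃ q ∈ Wh G, x ∈ Dy q.1 q.2 := by
  obtain ⟨b, hb⟩ := h2
  obtain ⟨s, hs, hs'⟩ := Int.exists_greatest_of_bdd (P := fun s => G s (ix s x)) ⟨b, hb⟩ h1
  refine ⟨(s, ix s x), ⟨hs, fun hc => ?_⟩, mem_Dy_ix s x⟩
  simp only at hc
  rw [← ix_step] at hc
  have := hs' _ hc
  omega
lemma Wh_union_vol (W : Set (ℤ × ℤ)) (hW : W.PairwiseDisjoint (fun q => Dy q.1 q.2)) (E : Set ℝ) (hE : MeasurableSet E) (A : ℝ≥0∞)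
    (h : ∀ q ∈ W, volume (E ∩ Dy q.1 q.2) ≤ A * volume (Dy q.1 q.2)) :
    volume (E ∩ ⋃ q ∈ W, Dy q.1 q.2) ≤ A * volume (⋃ q ∈ W, Dy q.1 q.2) := by
  rw [measure_biUnion W.to_countable hW (fun q _ => Dy_meas _ _), inter_iUnion₂,
    measure_biUnion W.to_countable (fun q hq q' hq' hne => (hW hq hq' hne).mono inter_subset_right inter_subset_right)
      (fun q _ => hE.inter (Dy_meas _ _)), ← ENNReal.tsum_mul_left]
  exact ENNReal.tsum_le_tsum fun q => h q q.2
lemma whitney (U : Set ℝ) (hU : IsOpen U) (hv : volume U < ∞) : ∃ W : Set (ℤ × ℤ),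
    W.PairwiseDisjoint (fun q => Dy q.1 q.2) ∧ (⋃ q ∈ W, Dy q.1 q.2) = U ∧
    ∀ q ∈ W, ∃ z ∉ U, ∀ x ∈ Dy q.1 q.2, |x - z| ≤ (2:ℝ)^(q.1+1) := by
  refine ⟨Wh (fun s m => Dy s m ⊆ U), Wh_disj fun s m t n h1 h2 => h1.trans h2, ?_, ?_⟩
  · apply Subset.antisymm
    · exact iUnion₂_subset fun q hq => hq.1
    · intro x hx
      have c1 : ∃ s, Dy s (ix s x) ⊆ U := by
        obtain ⟨ε, he, hb⟩ := Metric.isOpen_iff.1 hU x hx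
        obtain ⟨n, hn, -⟩ := exists_mem_Ioc_zpow (y := (2:ℝ)) he (by norm_num)
        refine ⟨n, fun y hy => hb ?_⟩
        rw [Metric.mem_ball, Real.dist_eq]
        exact (Dy_dist hy (mem_Dy_ix n x)).trans hn
      have c2 : ∃ b, ∀ s, Dy s (ix s x) ⊆ U → s ≤ b := by
        obtain ⟨n, hn⟩ := exists_nat_gt (volume U).toReal
        refine ⟨n, fun s hs => ?_⟩
        have h1 := measure_mono (μ := volume) hs
        rw [Dy_vol, ENNReal.ofReal_le_iff_le_toReal hv.ne] at h1
        by_contra hc; push Not at hc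
        have h2 : (2:ℝ)^(n:ℤ) ≤ (2:ℝ)^s := zpow_le_zpow_right₀ one_le_two hc.le
        rw [zpow_natCast] at h2
        have h3 : (n:ℝ) < (2:ℝ)^n := by exact_mod_cast Nat.lt_two_pow_self
        linarith
      obtain ⟨q, hq, hq'⟩ := Wh_cover (G := fun s m => Dy s m ⊆ U) x c1 c2
      exact mem_iUnion₂.2 ⟨q, hq, hq'⟩
  · intro q hq
    obtain ⟨z, hz, hzU⟩ := not_subset.1 hq.2
    exact ⟨z, hzU, fun x hx => (Dy_dist (Dy_parent _ _ hx) hz).le⟩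
/-- enlarged interval -/
def D3 (s m : ℤ) : Set ℝ := Ico (((m:ℝ) - 1) * (2:ℝ)^s) (((m:ℝ) + 2) * (2:ℝ)^s)
lemma D3_meas (s m : ℤ) : MeasurableSet (D3 s m) := measurableSet_Ico
lemma mem_D3 {s m : ℤ} {x y : ℝ} (hx : x ∈ Dy s m) (h : |x - y| < (2:ℝ)^s) : y ∈ D3 s m := by
  obtain ⟨a, b⟩ := hx; rw [abs_lt] at h
  constructor <;> nlinarith
lemma D3_sub {s m : ℤ} {x : ℝ} (hx : x ∈ Dy s m) : D3 s m ⊆ Icc (x - 2 * (2:ℝ)^s) (x + 2 * (2:ℝ)^s) := by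
  intro y hy
  obtain ⟨a, b⟩ := hx; obtain ⟨c, d⟩ := hy
  constructor <;> nlinarith
/-- local weak type property for a class of modulation sets -/
def Loc (𝒮 : Set (Finset ℝ)) (r : ℝ) : Prop :=
  ∀ ε : ℝ, 0 < ε → ∃ A : ℝ, 0 < A ∧ ∀ S ∈ 𝒮, ∀ (k0 k1 j m : ℤ) (f : ℝ → ℂ) (h : ℝ), k1 ≤ j → Bd f → 0 < h →
    (∀ y, y ∉ D3 j m → f y = 0) →
    ∫⁻ y, ‖f y‖ₑ ^ r ≤ ENNReal.ofReal ((2:ℝ)^j * h ^ r) →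
    volume {x ∈ Dy j m | ENNReal.ofReal (A * h) < CC S k0 k1 f x} ≤ ENNReal.ofReal (ε * (2:ℝ)^j)
lemma CC_local (S : Finset ℝ) (k0 k1 j m : ℤ) (f : ℝ → ℂ) (h : k1 ≤ j) (x : ℝ) (hx : x ∈ Dy j m) :
    CC S k0 k1 f x = CC S k0 k1 ((D3 j m).indicator f) x := by
  have key : ∀ N, ∀ s ≤ k1, op (kp s) (md N f) x = op (kp s) (md N ((D3 j m).indicator f)) x := by
    intro N s hs
    unfold op; congr 1; ext y
    by_cases hy : |x - y| < (2:ℝ)^s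
    · rw [md, md, indicator_of_mem (mem_D3 hx (hy.trans_le (zpow_le_zpow_right₀ one_le_two (by omega))))]
    · rw [kp_zero s (not_lt.1 hy), zero_mul, zero_mul]
  have key2 : ∀ N a b, b ≤ k1 → tr a b (md N f) x = tr a b (md N ((D3 j m).indicator f)) x := by
    intro N a b hb
    refine Finset.sum_congr rfl fun s hs => key N s ?_
    rw [Finset.mem_Icc] at hs; omega
  refine le_antisymm (CC_le fun N hN a b ha hab hb => ?_) (CC_le fun N hN a b ha hab hb => ?_)
  · rw [key2 N a b hb]; exact le_CC hN ha hb
  · rw [← key2 N a b hb]; exact le_CC hN ha hb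
lemma good_lambda {𝒮 : Set (Finset ℝ)} {r : ℝ} (hr : 1 < r) (hL : Loc 𝒮 r) (ε : ℝ) (hε : 0 < ε) :
    ∃ γ : ℝ, 0 < γ ∧ ∀ S ∈ 𝒮, ∀ (k0 k1 : ℤ) (f : ℝ → ℂ) (l : ℝ), Bd f → 0 < l →
      volume {x | ENNReal.ofReal (3 * l) < CC S k0 k1 f x} ≤
        ENNReal.ofReal ε * volume {x | ENNReal.ofReal l < CC S k0 k1 f x}
        + volume {x | ENNReal.ofReal (γ * l) < MN f x}
        + volume {x | ENNReal.ofReal ((γ * l) ^ r) < MM (fun y => ‖f y‖ₑ ^ r) x} := by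
  obtain ⟨A, hA, HA⟩ := hL ε hε
  -- γ so that 640 γ ≤ 1 and A * 4^(1/r)... γ ≤ 1
  set γ : ℝ := min (1/640) ((4 * A)⁻¹) with hγd
  have hγ : 0 < γ := by positivity
  have hγ1 : γ ≤ 1/640 := min_le_left _ _
  have hγ2 : γ ≤ (4*A)⁻¹ := min_le_right _ _
  refine ⟨γ, hγ, fun S hS k0 k1 f l hf hl => ?_⟩
  set F := CC S k0 k1 f with hF
  have hFm : Measurable F := CC_meas S k0 k1 hf
  set U := {x | ENNReal.ofReal l < F x} with hU
  have hUo : IsOpen U := (CC_lsc S k0 k1 hf).isOpen_preimage _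
  have hUv : volume U < ∞ := by
    obtain ⟨R, hR⟩ := CC_supp S k0 k1 hf
    have : U ⊆ Icc (-R) R := by
      intro x hx
      by_contra hc
      have hx' : ENNReal.ofReal l < F x := hx
      rw [hF, hR x (by by_contra hc'; push Not at hc'; exact hc (abs_le.1 hc'))] at hx'
      exact not_lt_bot hx'
    exact (measure_mono this).trans_lt (by simp)
  obtain ⟨W, hW1, hW2, hW3⟩ := whitney U hUo hUv
  set G1 := {x | ENNReal.ofReal (γ * l) < MN f x} with hG1
  set G2 := {x | ENNReal.ofReal ((γ * l) ^ r) < MM (fun y => ‖f y‖ₑ ^ r) x} with hG2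
  have hG1m : MeasurableSet G1 := by
    have : Measurable (MN f) := measurable_MM hf.meas.enorm
    exact measurableSet_lt measurable_const this
  have hG2m : MeasurableSet G2 := by
    have : Measurable (MM (fun y => ‖f y‖ₑ ^ r)) := measurable_MM (hf.meas.enorm.pow_const _)
    exact measurableSet_lt measurable_const this
  set E := {x | ENNReal.ofReal (3 * l) < F x} \ (G1 ∪ G2) with hE
  have hEm : MeasurableSet E := (measurableSet_lt measurable_const hFm).diff (hG1m.union hG2m)
  have hEU : E ⊆ U := by
    rintro x ⟨hx, -⟩
    exact lt_of_le_of_lt (ENNReal.ofReal_le_ofReal (by linarith)) hx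
  have main : volume E ≤ ENNReal.ofReal ε * volume U := by
    have := Wh_union_vol W hW1 E hEm (ENNReal.ofReal ε) ?_
    · rwa [hW2, inter_eq_self_of_subset_left hEU] at this
    rintro ⟨j, m⟩ hq
    obtain ⟨z, hz, hzd⟩ := hW3 _ hq
    simp only at hz hzd ⊢
    by_cases hne : (E ∩ Dy j m).Nonempty
    swap
    · rw [not_nonempty_iff_eq_empty] at hne; rw [hne]; simp
    obtain ⟨x0, hx0E, hx0⟩ := hne
    rw [Dy_vol, ← ENNReal.ofReal_mul hε.le]
    set f' := (D3 j m).indicator f with hf'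
    have hzF : F z ≤ ENNReal.ofReal l := not_lt.1 hz
    refine le_trans (measure_mono ?_) (HA S hS k0 (min j k1) j m f' (4 * γ * l) (min_le_left _ _) (hf.indicator (D3_meas j m)) (by positivity)
      (fun y hy => indicator_of_notMem hy _) ?_)
    · rintro x ⟨⟨hxF, hxG⟩, hxD⟩
      refine ⟨hxD, ?_⟩
      rw [← CC_local S k0 (min j k1) j m f (min_le_left _ _) x hxD]
      have hxM : MN f x ≤ ENNReal.ofReal (γ * l) := by
        by_contra hc; push Not at hc; exact hxG (Or.inl hc)
      have hxz := hzd x hxD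
      -- F x ≤ local + l + l
      have hmain : F x ≤ CC S k0 (min j k1) f x + ENNReal.ofReal (2 * l) := by
        refine CC_le fun N hN a b ha hab hb => ?_
        have large : ∀ a' b', j + 1 ≤ a' → k0 ≤ a' → b' ≤ k1 → ‖tr a' b' (md N f) x‖ₑ ≤ ENNReal.ofReal (2 * l) := by
          intro a' b' h1 h2 h3
          have hp : (2:ℝ)^(j+1) ≤ (2:ℝ)^a' := zpow_le_zpow_right₀ one_le_two h1
          have d := tr_diff a' b' (hf.md N) z x (by rw [abs_sub_comm]; linarith)
          rw [MN_md] at d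
          have d2 : ‖tr a' b' (md N f) z - tr a' b' (md N f) x‖ₑ ≤ ENNReal.ofReal l := by
            refine d.trans ((mul_le_mul' (ENNReal.ofReal_le_ofReal (q := 320) ?_) hxM).trans ?_)
            · have : (2:ℝ)^(-a') * |z - x| ≤ 1 := by
                rw [abs_sub_comm, zpow_neg]
                rw [inv_mul_le_iff₀ (by positivity)]; linarith
              nlinarith
            · rw [← ENNReal.ofReal_mul (by norm_num)]
              refine ENNReal.ofReal_le_ofReal ?_
              nlinarith
          have e1 : ‖tr a' b' (md N f) z‖ₑ ≤ ENNReal.ofReal l := (le_CC hN h2 h3).trans hzF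
          calc ‖tr a' b' (md N f) x‖ₑ = ‖tr a' b' (md N f) z - (tr a' b' (md N f) z - tr a' b' (md N f) x)‖ₑ := by congr 1; ring
            _ ≤ ‖tr a' b' (md N f) z‖ₑ + ‖tr a' b' (md N f) z - tr a' b' (md N f) x‖ₑ := enorm_sub_le
            _ ≤ ENNReal.ofReal l + ENNReal.ofReal l := add_le_add e1 d2
            _ = ENNReal.ofReal (2 * l) := by rw [← ENNReal.ofReal_add hl.le hl.le]; congr 1; ring
        by_cases c1 : b ≤ j
        · exact (le_CC hN ha (le_min c1 hb)).trans le_self_add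
        push Not at c1
        by_cases c2 : j + 1 ≤ a
        · exact (large a b c2 ha hb).trans le_add_self
        push Not at c2
        rw [tr_split j _ _ (by omega) (by omega)]
        refine (enorm_add_le _ _).trans (add_le_add (le_CC hN ha (le_min le_rfl (by omega))) (large _ _ le_rfl (by omega) hb))
      by_contra hc; push Not at hc
      have hxF' : ENNReal.ofReal (3 * l) < F x := hxF
      have := hxF'.trans_le (hmain.trans (add_le_add hc le_rfl))
      rw [← ENNReal.ofReal_add (by positivity) (by positivity)] at this
      refine absurd this (not_lt.2 (ENNReal.ofReal_le_ofReal ?_))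
      have h4 : 4 * A * γ ≤ 1 := by
        calc 4 * A * γ ≤ 4 * A * (4*A)⁻¹ := by gcongr
          _ = 1 := by field_simp
      nlinarith
    · have hxM : MM (fun y => ‖f y‖ₑ ^ r) x0 ≤ ENNReal.ofReal ((γ * l) ^ r) := by
        by_contra hc; push Not at hc; exact hx0E.2 (Or.inr hc)
      calc ∫⁻ y, ‖f' y‖ₑ ^ r = ∫⁻ y in D3 j m, ‖f y‖ₑ ^ r := by
            rw [← lintegral_indicator (D3_meas j m)]; congr 1; ext y
            by_cases hy : y ∈ D3 j m
            · simp [hf', hy]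
            · simp [hf', hy, ENNReal.zero_rpow_of_pos (show 0 < r by linarith)]
        _ ≤ ENNReal.ofReal (2 * (2 * (2:ℝ)^j)) * MM (fun y => ‖f y‖ₑ ^ r) x0 :=
            lintegral_le_MM _ x0 _ (by positivity) _ (D3_sub hx0)
        _ ≤ ENNReal.ofReal (2 * (2 * (2:ℝ)^j)) * ENNReal.ofReal ((γ * l) ^ r) := mul_le_mul' le_rfl hxM
        _ ≤ _ := by
            rw [← ENNReal.ofReal_mul (by positivity)]
            refine ENNReal.ofReal_le_ofReal ?_
            rw [show 4 * γ * l = 4 * (γ * l) by ring, Real.mul_rpow (by norm_num) (mul_nonneg hγ.le hl.le)]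
            have : (4:ℝ) ≤ 4 ^ r := by
              simpa using Real.rpow_le_rpow_of_exponent_le (show (1:ℝ) ≤ 4 by norm_num) hr.le
            have h0 : 0 ≤ (2:ℝ)^j * (γ * l)^r := by
              have := Real.rpow_nonneg (mul_nonneg hγ.le hl.le) r
              positivity
            calc _ = 4 * ((2:ℝ)^j * (γ * l)^r) := by ring
              _ ≤ 4 ^ r * ((2:ℝ)^j * (γ * l)^r) := mul_le_mul_of_nonneg_right this h0
              _ = _ := by ring
  calc volume {x | ENNReal.ofReal (3 * l) < F x} ≤ volume (E ∪ (G1 ∪ G2)) := by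
        refine measure_mono fun x hx => ?_
        by_cases h : x ∈ G1 ∪ G2
        · exact Or.inr h
        · exact Or.inl ⟨hx, h⟩
    _ ≤ volume E + (volume G1 + volume G2) := (measure_union_le _ _).trans (add_le_add le_rfl (measure_union_le _ _))
    _ ≤ _ := by rw [add_assoc]; exact add_le_add main le_rfl
lemma lay_comb (F0 F1 F2 F3 : ℝ → ℝ≥0∞) (h0 : Measurable F0) (h1 : Measurable F1) (h2 : Measurable F2) (h3 : Measurable F3)
    (e : ℝ≥0∞) (he : e ≠ ∞) (q : ℝ) (hq : 0 < q)
    (H : ∀ t : ℝ, 0 < t → volume {x | ENNReal.ofReal t < F0 x} ≤ e * volume {x | ENNReal.ofReal t < F1 x}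
      + volume {x | ENNReal.ofReal t < F2 x} + volume {x | ENNReal.ofReal t < F3 x}) :
    ∫⁻ x, F0 x ^ q ≤ e * (∫⁻ x, F1 x ^ q) + (∫⁻ x, F2 x ^ q) + ∫⁻ x, F3 x ^ q := by
  have mono : ∀ F : ℝ → ℝ≥0∞, Measurable (fun t : ℝ => volume {x | ENNReal.ofReal t < F x}) := by
    intro F
    refine Antitone.measurable fun s t hst => measure_mono fun x hx => ?_
    exact lt_of_le_of_lt (ENNReal.ofReal_le_ofReal hst) hx
  have hw : Measurable (fun t : ℝ => ENNReal.ofReal (t ^ (q-1))) := by fun_prop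
  rw [lay_cake F0 h0 q hq, lay_cake F1 h1 q hq, lay_cake F2 h2 q hq, lay_cake F3 h3 q hq]
  rw [mul_left_comm, ← mul_add, ← mul_add]
  refine mul_le_mul' le_rfl ?_
  rw [← lintegral_const_mul' _ _ he, ← lintegral_add_left, ← lintegral_add_left]
  · refine setLIntegral_mono' measurableSet_Ioi fun t ht => ?_
    refine (mul_le_mul' (H t ht) le_rfl).trans_eq ?_
    ring
  · exact (((mono F1).mul hw).const_mul e).add ((mono F2).mul hw)
  · exact (((mono F1).mul hw).const_mul e)
lemma Loc_strong {𝒮 : Set (Finset ℝ)} {r : ℝ} (hr : 1 < r) (hL : Loc 𝒮 r) (q : ℝ) (hq : r < q) :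
    ∃ C : ℝ≥0, ∀ S ∈ 𝒮, ∀ (k0 k1 : ℤ) (f : ℝ → ℂ), Bd f →
      ∫⁻ x, CC S k0 k1 f x ^ q ≤ C * ∫⁻ x, ‖f x‖ₑ ^ q := by
  have hq0 : 0 < q := by linarith
  set ε : ℝ := (3:ℝ) ^ (-q) / 2 with hε
  obtain ⟨γ, hγ, H⟩ := good_lambda hr hL ε (by positivity)
  obtain ⟨C1, hC1⟩ := MM_strong q (by linarith)
  obtain ⟨C2, hC2⟩ := MM_strong (q / r) (by rw [lt_div_iff₀ (by linarith)]; linarith)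
  set c : ℝ≥0 := Real.toNNReal (γ⁻¹) with hc
  set t3 : ℝ≥0 := Real.toNNReal ((3:ℝ) ^ q) with ht3
  refine ⟨2 * t3 * (c^q * C1 + c^q * C2), fun S hS k0 k1 f hf => ?_⟩
  set F := CC S k0 k1 f with hF
  have hFm : Measurable F := CC_meas S k0 k1 hf
  have hMN : Measurable (MN f) := measurable_MM hf.meas.enorm
  have hMr : Measurable (MM (fun y => ‖f y‖ₑ ^ r)) := measurable_MM (hf.meas.enorm.pow_const _)
  have hcγ : (c:ℝ≥0∞) = ENNReal.ofReal γ⁻¹ := rfl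
  have key := lay_comb (fun x => ENNReal.ofReal (1/3) * F x) F (fun x => c * MN f x)
    (fun x => c * (MM (fun y => ‖f y‖ₑ ^ r) x) ^ r⁻¹) (hFm.const_mul _) hFm (hMN.const_mul _) ((hMr.pow_const _).const_mul _)
    (ENNReal.ofReal ε) ENNReal.ofReal_ne_top q hq0 ?_
  · have e0 : ∫⁻ x, (ENNReal.ofReal (1/3) * F x) ^ q = ENNReal.ofReal ((3:ℝ)^(-q)) * ∫⁻ x, F x ^ q := by
      rw [← lintegral_const_mul' _ _ ENNReal.ofReal_ne_top]
      congr 1; ext x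
      rw [ENNReal.mul_rpow_of_nonneg _ _ hq0.le, ENNReal.ofReal_rpow_of_nonneg (by norm_num) hq0.le]
      rw [one_div, Real.inv_rpow (by norm_num), Real.rpow_neg (by norm_num)]
    have e1 : ∫⁻ x, (c * MN f x) ^ q ≤ (c:ℝ≥0∞)^q * (C1 * ∫⁻ x, ‖f x‖ₑ ^ q) := by
      calc ∫⁻ x, (c * MN f x) ^ q = ∫⁻ x, (c:ℝ≥0∞)^q * MN f x ^ q := by
            congr 1; ext x; rw [ENNReal.mul_rpow_of_nonneg _ _ hq0.le]
        _ = (c:ℝ≥0∞)^q * ∫⁻ x, MN f x ^ q := lintegral_const_mul _ (hMN.pow_const _)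
        _ ≤ _ := mul_le_mul' le_rfl (hC1 _ hf.meas.enorm)
    have e2 : ∫⁻ x, (c * (MM (fun y => ‖f y‖ₑ ^ r) x) ^ r⁻¹) ^ q ≤ (c:ℝ≥0∞)^q * (C2 * ∫⁻ x, ‖f x‖ₑ ^ q) := by
      calc ∫⁻ x, (c * (MM (fun y => ‖f y‖ₑ ^ r) x) ^ r⁻¹) ^ q = ∫⁻ x, (c:ℝ≥0∞)^q * (MM (fun y => ‖f y‖ₑ ^ r) x) ^ (q/r) := by
            congr 1; ext x; rw [ENNReal.mul_rpow_of_nonneg _ _ hq0.le, ← ENNReal.rpow_mul]; congr 2; field_simp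
        _ = (c:ℝ≥0∞)^q * ∫⁻ x, (MM (fun y => ‖f y‖ₑ ^ r) x) ^ (q/r) := lintegral_const_mul _ (hMr.pow_const _)
        _ ≤ (c:ℝ≥0∞)^q * (C2 * ∫⁻ x, (‖f x‖ₑ ^ r) ^ (q / r)) := mul_le_mul' le_rfl (hC2 _ (hf.meas.enorm.pow_const _))
        _ = _ := by
            congr 3; ext x; rw [← ENNReal.rpow_mul]; congr 1; field_simp
    rw [e0] at key
    set X := ∫⁻ x, F x ^ q with hX
    have hXf : X < ∞ := CC_lintegral S k0 k1 hf q hq0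
    set Y := ∫⁻ x, ‖f x‖ₑ ^ q
    have k2 : ENNReal.ofReal ((3:ℝ)^(-q)) * X ≤ ENNReal.ofReal ε * X + ((c:ℝ≥0∞)^q * (C1 * Y) + (c:ℝ≥0∞)^q * (C2 * Y)) := by
      rw [← add_assoc]
      exact key.trans (add_le_add (add_le_add le_rfl e1) e2)
    have e3 : ENNReal.ofReal ((3:ℝ)^(-q)) = ENNReal.ofReal ε + ENNReal.ofReal ε := by
      rw [← ENNReal.ofReal_add (by positivity) (by positivity)]; congr 1; rw [hε]; ring
    rw [e3, add_mul] at k2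
    have k3 := (ENNReal.add_le_add_iff_left (ENNReal.mul_lt_top ENNReal.ofReal_lt_top hXf).ne).1 k2
    have e4 : (2 * (t3:ℝ≥0∞)) * ENNReal.ofReal ε = 1 := by
      rw [show (t3:ℝ≥0∞) = ENNReal.ofReal ((3:ℝ)^q) from rfl, show (2:ℝ≥0∞) = ENNReal.ofReal 2 by norm_num,
        ← ENNReal.ofReal_mul (by norm_num), ← ENNReal.ofReal_mul (by positivity), hε, ← ENNReal.ofReal_one]
      congr 1
      rw [Real.rpow_neg (by norm_num)]; field_simp
    calc X = (2 * (t3:ℝ≥0∞)) * (ENNReal.ofReal ε * X) := by rw [← mul_assoc, e4, one_mul]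
      _ ≤ (2 * (t3:ℝ≥0∞)) * ((c:ℝ≥0∞)^q * (C1 * Y) + (c:ℝ≥0∞)^q * (C2 * Y)) := mul_le_mul' le_rfl k3
      _ = _ := by
        push_cast
        rw [ENNReal.coe_rpow_of_nonneg _ hq0.le]; ring
  · intro t ht
    refine le_trans (le_of_eq ?_) ((H S hS k0 k1 f t hf ht).trans (add_le_add (add_le_add le_rfl (le_of_eq ?_)) (le_of_eq ?_)))
    · congr 1; ext x
      simp only [mem_ofPred_eq]
      rw [show (ENNReal.ofReal (3 * t) : ℝ≥0∞) = ENNReal.ofReal 3 * ENNReal.ofReal t from ENNReal.ofReal_mul (by norm_num)]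
      have : ENNReal.ofReal (1/3) = (ENNReal.ofReal 3)⁻¹ := by
        rw [one_div, ENNReal.ofReal_inv_of_pos (by norm_num)]
      rw [this, mul_comm _ (F x), ← div_eq_mul_inv, ENNReal.lt_div_iff_mul_lt (by simp) (by simp), mul_comm]
    · congr 1; ext x
      simp only [mem_ofPred_eq]
      rw [hcγ, ENNReal.ofReal_inv_of_pos hγ, mul_comm _ (MN f x), ← div_eq_mul_inv, ENNReal.lt_div_iff_mul_lt (by simp [hγ]) (by simp),
        ← ENNReal.ofReal_mul ht.le, mul_comm t]
    · congr 1; ext x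
      simp only [mem_ofPred_eq]
      rw [hcγ, ENNReal.ofReal_inv_of_pos hγ, mul_comm _ ((MM (fun y => ‖f y‖ₑ ^ r) x) ^ r⁻¹), ← div_eq_mul_inv, ENNReal.lt_div_iff_mul_lt (by simp [hγ]) (by simp),
        ← ENNReal.ofReal_mul ht.le, mul_comm t, ← ENNReal.ofReal_rpow_of_nonneg (by positivity) (by linarith), ENNReal.lt_rpow_inv_iff (by linarith)]
noncomputable def FT (f : ℝ → ℂ) (ξ : ℝ) : ℂ := ∫ y, ex (-(ξ * y)) * f y
lemma sum_split_le (a b n : ℤ) (F U V : ℤ → ℝ) (hU : ∀ s, 0 ≤ U s) (hV : ∀ s, 0 ≤ V s)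
    (h1 : ∀ s, s ≤ n → F s ≤ U s) (h2 : ∀ s, n < s → F s ≤ V s) :
    ∑ s ∈ Finset.Icc a b, F s ≤ ∑ s ∈ Finset.Icc a n, U s + ∑ s ∈ Finset.Icc (n+1) b, V s := by
  rw [← Finset.sum_filter_add_sum_filter_not _ (fun s => s ≤ n)]
  refine add_le_add ?_ ?_
  · calc _ ≤ ∑ s ∈ (Finset.Icc a b).filter (fun s => s ≤ n), U s :=
        Finset.sum_le_sum fun s hs => h1 s (Finset.mem_filter.1 hs).2
      _ ≤ _ := Finset.sum_le_sum_of_subset_of_nonneg (fun s hs => by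
          simp only [Finset.mem_filter, Finset.mem_Icc] at hs ⊢; omega) (fun s _ _ => hU s)
  · calc _ ≤ ∑ s ∈ (Finset.Icc a b).filter (fun s => ¬ s ≤ n), V s :=
        Finset.sum_le_sum fun s hs => h2 s (not_le.1 (Finset.mem_filter.1 hs).2)
      _ ≤ _ := Finset.sum_le_sum_of_subset_of_nonneg (fun s hs => by
          simp only [Finset.mem_filter, Finset.mem_Icc] at hs ⊢; omega) (fun s _ _ => hV s)
lemma parseval {f : ℝ → ℂ} (hf : Bd f) (T : ℝ) (hT : 0 < T) (hs : ∀ x, T ≤ |x| → f x = 0) :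
    HasSum (fun n : ℤ => ‖FT f (Real.pi * n / T)‖ ^ 2) ((2 * T) * ∫ x, ‖f x‖ ^ 2) := by
  have hab : -T < T := by linarith
  have hbd : MemLp f 2 (volume.restrict (Ioc (-T) T)) := by
    obtain ⟨B, hB⟩ := hf.bdd
    exact MemLp.of_bound hf.meas.aestronglyMeasurable B (Eventually.of_forall hB)
  have key := hasSum_sq_fourierCoeffOn hab hbd
  have e1 : ∫ x in (-T)..T, ‖f x‖ ^ 2 = ∫ x, ‖f x‖ ^ 2 := by
    rw [intervalIntegral.integral_of_le hab.le]
    refine setIntegral_eq_integral_of_forall_compl_eq_zero fun x hx => ?_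
    rw [hs x, norm_zero]; · norm_num
    by_contra hc; push Not at hc; rw [abs_lt] at hc
    exact hx ⟨hc.1, hc.2.le⟩
  have e2 : ∀ n : ℤ, fourierCoeffOn hab f n = ((2 * T)⁻¹ : ℝ) • FT f (Real.pi * n / T) := by
    intro n
    rw [fourierCoeffOn_eq_integral, show T - -T = 2 * T by ring, one_div]
    congr 1
    rw [intervalIntegral.integral_of_le hab.le, FT,
      setIntegral_eq_integral_of_forall_compl_eq_zero]
    · congr 1; ext x
      rw [smul_eq_mul, fourier_coe_apply, ex]
      congr 2
      push_cast; field_simp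
    · intro x hx
      rw [hs x, smul_zero]
      by_contra hc; push Not at hc; rw [abs_lt] at hc
      exact hx ⟨hc.1, hc.2.le⟩
  rw [e1] at key
  simp_rw [e2] at key
  have k2 := key.mul_left ((2 * T)^2)
  have c1 : (fun n : ℤ => (2 * T)^2 * ‖((2 * T)⁻¹ : ℝ) • FT f (Real.pi * n / T)‖ ^ 2) = fun n : ℤ => ‖FT f (Real.pi * n / T)‖ ^ 2 := by
    ext n
    rw [norm_smul, mul_pow, Real.norm_of_nonneg (by positivity)]; field_simp
  have c2 : (2 * T) ^ 2 * ((T - -T)⁻¹ • ∫ x, ‖f x‖ ^ 2) = (2 * T) * ∫ x, ‖f x‖ ^ 2 := by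
    rw [smul_eq_mul, show T - -T = 2 * T by ring]; field_simp
  rwa [c1, c2] at k2
noncomputable def cv (k : ℝ → ℂ) (x y : ℝ) : ℂ := k (x - y)
lemma BK_cv {k : ℝ → ℂ} (hk : Bd k) : BK (cv k) := by
  obtain ⟨hm, ⟨C, hC⟩, ⟨R, hR⟩⟩ := hk
  refine ⟨?_, ⟨C, fun x y => hC _⟩, ⟨R, fun x y h => hR _ h⟩⟩
  unfold cv Function.uncurry; fun_prop
lemma FT_cv {k f : ℝ → ℂ} (hk : Bd k) (hf : Bd f) (ξ : ℝ) : FT (op (cv k) f) ξ = FT k ξ * FT f ξ := by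
  unfold FT op cv
  have h1 : ∀ x, ex (-(ξ * x)) * ∫ y, k (x - y) * f y = ∫ y, (ex (-(ξ * y)) * f y) * (ex (-(ξ * (x - y))) * k (x - y)) := by
    intro x
    rw [← integral_const_mul]
    congr 1; ext y
    rw [show -(ξ * x) = -(ξ * y) + -(ξ * (x - y)) by ring, ex_add]; ring
  simp_rw [h1]
  have hk' : Bd (fun y => ex (-(ξ * y)) * k y) := hk.ex_mul (φ := fun y => -(ξ * y)) (by fun_prop)
  have hf' : Bd (fun y => ex (-(ξ * y)) * f y) := hf.ex_mul (φ := fun y => -(ξ * y)) (by fun_prop)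
  rw [integral_integral_swap]
  · have h2 : ∀ y, ∫ x, (ex (-(ξ * y)) * f y) * (ex (-(ξ * (x - y))) * k (x - y))
        = (ex (-(ξ * y)) * f y) * ∫ x, ex (-(ξ * x)) * k x := by
      intro y
      rw [integral_const_mul]; congr 1
      exact integral_sub_right_eq_self (fun x => ex (-(ξ * x)) * k x) y
    simp_rw [h2]
    rw [integral_mul_const, mul_comm]
  · exact hf'.integrable.convolution_integrand (ContinuousLinearMap.mul ℝ ℂ) hk'.integrable
lemma cv_L2 {k : ℝ → ℂ} (hk : Bd k) (C : ℝ) (hC : ∀ ξ, ‖FT k ξ‖ ≤ C) {f : ℝ → ℂ} (hf : Bd f) :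
    ∫⁻ x, ‖op (cv k) f x‖ₑ ^ 2 ≤ ENNReal.ofReal (C^2) * ∫⁻ x, ‖f x‖ₑ ^ 2 := by
  have hg := hf.op (BK_cv hk)
  obtain ⟨R1, hR1⟩ := hf.supp
  obtain ⟨R2, hR2⟩ := hg.supp
  set T := |R1| + |R2| + 1 with hT
  have hT0 : 0 < T := by positivity
  have p1 := parseval hf T hT0 (fun x hx => hR1 x (by linarith [le_abs_self R1, abs_nonneg R2]))
  have p2 := parseval hg T hT0 (fun x hx => hR2 x (by linarith [le_abs_self R2, abs_nonneg R1]))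
  have hle := hasSum_le (fun n => ?_) p2 (p1.mul_left (C^2))
  · have hle2 : ∫ x, ‖op (cv k) f x‖ ^ 2 ≤ C^2 * ∫ x, ‖f x‖ ^ 2 := by
      have : 2 * T * ∫ x, ‖op (cv k) f x‖ ^ 2 ≤ 2 * T * (C^2 * ∫ x, ‖f x‖ ^ 2) := by linarith
      exact le_of_mul_le_mul_left this (by positivity)
    have conv : ∀ u : ℝ → ℂ, Bd u → ∫⁻ x, ‖u x‖ₑ ^ 2 = ENNReal.ofReal (∫ x, ‖u x‖ ^ 2) := by
      intro u hu
      rw [ofReal_integral_eq_lintegral_ofReal]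
      · congr 1; ext x; rw [← ofReal_norm, ENNReal.ofReal_pow (norm_nonneg _)]
      · have := (hu.mul hu.conj).integrable.norm
        refine this.congr (Eventually.of_forall fun x => ?_)
        simp [sq]
      · exact Eventually.of_forall fun x => by positivity
    rw [conv _ hg, conv _ hf, ← ENNReal.ofReal_mul (by positivity)]
    exact ENNReal.ofReal_le_ofReal hle2
  · rw [FT_cv hk hf, norm_mul, mul_pow]
    exact mul_le_mul_of_nonneg_right (pow_le_pow_left₀ (norm_nonneg _) (hC _) 2) (by positivity)
lemma norm_int_le (u : ℝ → ℂ) (B r : ℝ) (hr : 0 ≤ r) (hB : ∀ y, ‖u y‖ ≤ B) (hs : ∀ y, r < |y| → u y = 0) :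
    ‖∫ y, u y‖ ≤ 2 * r * B := by
  have e : ∫ y, u y = ∫ y in Icc (-r) r, u y := by
    refine (setIntegral_eq_integral_of_forall_compl_eq_zero fun y hy => hs y ?_).symm
    by_contra hc; push Not at hc; exact hy (abs_le.1 hc)
  rw [e]
  refine (norm_setIntegral_le_of_norm_le_const (by simp) (fun y _ => hB y)).trans (le_of_eq ?_)
  simp only [measureReal_def, Real.volume_Icc]
  rw [ENNReal.toReal_ofReal (by linarith)]; ring
noncomputable def pc (s : ℤ) (t : ℝ) : ℂ := (ps s t : ℂ)
lemma Bd_pc (s : ℤ) : Bd (pc s) := ⟨by unfold pc; have := ps_meas s; fun_prop,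
  ⟨_, fun x => by rw [pc, Complex.norm_real]; exact ps_bound s x⟩,
  ⟨(2:ℝ)^s, fun x hx => by rw [pc, ps_zero_hi s hx.le, Complex.ofReal_zero]⟩⟩
lemma int_pc (s : ℤ) : ∫ t, pc s t = 0 := by
  have h := integral_neg_eq_self (pc s) volume
  have h2 : (fun x => pc s (-x)) = fun x => - pc s x := by ext x; simp [pc, ps_neg]
  rw [h2, integral_neg] at h
  exact self_eq_neg.1 h.symm
lemma FT_pc_lo (s : ℤ) (ξ : ℝ) : ‖FT (pc s) ξ‖ ≤ 8 * (2:ℝ)^s * |ξ| := by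
  have hi : Integrable (fun y => ex (-(ξ * y)) * pc s y) := ((Bd_pc s).ex_mul (φ := fun y => -(ξ*y)) (by fun_prop)).integrable
  have e : FT (pc s) ξ = ∫ y, (ex (-(ξ * y)) - 1) * pc s y := by
    have : (fun y => (ex (-(ξ * y)) - 1) * pc s y) = fun y => ex (-(ξ * y)) * pc s y - pc s y := by ext y; ring
    rw [this, integral_sub hi (Bd_pc s).integrable, int_pc, sub_zero, FT]
  rw [e]
  refine (norm_int_le _ (|ξ| * (2:ℝ)^s * (4 * (2:ℝ)^(-s))) ((2:ℝ)^s) (by positivity) (fun y => ?_) (fun y hy => ?_)).trans (le_of_eq ?_)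
  · by_cases hy : (2:ℝ)^s < |y|
    · rw [pc, ps_zero_hi s hy.le, Complex.ofReal_zero, mul_zero, norm_zero]; positivity
    · push Not at hy
      rw [norm_mul, pc, Complex.norm_real]
      refine mul_le_mul ?_ (ps_bound s y) (norm_nonneg _) (by positivity)
      refine (ex_sub_one _).trans ?_
      rw [abs_neg, abs_mul]; gcongr
  · rw [pc, ps_zero_hi s hy.le, Complex.ofReal_zero, mul_zero]
  · rw [zpow_neg]; field_simp; ring
lemma FT_pc_triv (s : ℤ) (ξ : ℝ) : ‖FT (pc s) ξ‖ ≤ 8 := by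
  unfold FT
  refine (norm_int_le _ (4 * (2:ℝ)^(-s)) ((2:ℝ)^s) (by positivity) (fun y => ?_) (fun y hy => ?_)).trans (le_of_eq ?_)
  · rw [norm_mul, norm_ex, one_mul, pc, Complex.norm_real]; exact ps_bound s y
  · rw [pc, ps_zero_hi s hy.le, Complex.ofReal_zero, mul_zero]
  · rw [zpow_neg]; field_simp; norm_num
lemma FT_pc_hi (s : ℤ) (ξ : ℝ) (hξ : ξ ≠ 0) : ‖FT (pc s) ξ‖ ≤ 320 * (2:ℝ)^(-s) * |ξ|⁻¹ := by
  have h0 : (0:ℝ) < (2:ℝ)^s := by positivity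
  have hx : 0 < |ξ| := abs_pos.2 hξ
  set h := Real.pi / ξ with hh
  have habs : |h| = Real.pi * |ξ|⁻¹ := by rw [hh, abs_div, abs_of_pos Real.pi_pos, div_eq_mul_inv]
  have hpi := Real.pi_le_four
  by_cases c : |h| ≤ (2:ℝ)^s
  · have e1 : FT (fun y => pc s (y - h)) ξ = - FT (pc s) ξ := by
      unfold FT
      rw [← integral_sub_right_eq_self (fun y => ex (-(ξ * y)) * pc s y) h, ← integral_neg]
      congr 1; ext y
      rw [show -(ξ * (y - h)) = -(ξ * y) + Real.pi by rw [hh]; field_simp; ring, ex_add, ex_pi]; ring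
    have e2 : FT (fun y => pc s y - pc s (y - h)) ξ = 2 * FT (pc s) ξ := by
      have hi1 : Integrable (fun y => ex (-(ξ * y)) * pc s y) := ((Bd_pc s).ex_mul (φ := fun y => -(ξ*y)) (by fun_prop)).integrable
      have hi2 : Integrable (fun y => ex (-(ξ * y)) * pc s (y - h)) := (((Bd_pc s).shift h).ex_mul (φ := fun y => -(ξ*y)) (by fun_prop)).integrable
      calc _ = FT (pc s) ξ - FT (fun y => pc s (y - h)) ξ := by
            unfold FT; rw [← integral_sub hi1 hi2]; congr 1; ext y; ring
        _ = _ := by rw [e1]; ring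
    have e3 : ‖FT (fun y => pc s y - pc s (y - h)) ξ‖ ≤ 2 * (2 * (2:ℝ)^s) * (40 * (2:ℝ)^(-s) * (2:ℝ)^(-s) * |h|) := by
      unfold FT
      refine norm_int_le _ _ _ (by positivity) (fun y => ?_) (fun y hy => ?_)
      · rw [norm_mul, norm_ex, one_mul]; unfold pc; beta_reduce; rw [← Complex.ofReal_sub, Complex.norm_real]
        have := ps_lip s y (y - h)
        rwa [sub_sub_cancel] at this
      · have := abs_sub_abs_le_abs_sub y h
        unfold pc; beta_reduce; rw [ps_zero_hi s (by linarith), ps_zero_hi s (by linarith)]; simp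
    rw [e2, norm_mul, habs] at e3
    have e4 : 2 * (2 * (2:ℝ)^s) * (40 * (2:ℝ)^(-s) * (2:ℝ)^(-s) * (Real.pi * |ξ|⁻¹)) = 160 * Real.pi * ((2:ℝ)^(-s) * |ξ|⁻¹) := by
      rw [zpow_neg]; field_simp; norm_num
    rw [e4] at e3
    have hp : 0 ≤ (2:ℝ)^(-s) * |ξ|⁻¹ := by positivity
    rw [Complex.norm_two] at e3
    have e5 : 160 * Real.pi * ((2:ℝ)^(-s) * |ξ|⁻¹) ≤ 160 * 4 * ((2:ℝ)^(-s) * |ξ|⁻¹) := by gcongr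
    linarith
  · push Not at c
    refine (FT_pc_triv s ξ).trans ?_
    rw [habs] at c
    have : 1 ≤ Real.pi * ((2:ℝ)^(-s) * |ξ|⁻¹) := by
      have h1 : (2:ℝ)^(-s) * (2:ℝ)^s = 1 := by rw [zpow_neg]; field_simp
      have h2 : (2:ℝ)^(-s) * (2:ℝ)^s ≤ (2:ℝ)^(-s) * (Real.pi * |ξ|⁻¹) := by gcongr
      linarith
    have hp : 0 ≤ (2:ℝ)^(-s) * |ξ|⁻¹ := by positivity
    nlinarith
noncomputable def wk (a b : ℤ) (t : ℝ) : ℂ := ∑ s ∈ Finset.Icc a b, pc s t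
lemma Bd_wk (a b : ℤ) : Bd (wk a b) := Bd.sum _ _ fun s _ => Bd_pc s
lemma FT_wk (a b : ℤ) (ξ : ℝ) : ‖FT (wk a b) ξ‖ ≤ 656 := by
  have e : FT (wk a b) ξ = ∑ s ∈ Finset.Icc a b, FT (pc s) ξ := by
    unfold FT wk
    simp_rw [Finset.mul_sum]
    exact integral_finsetSum _ fun s _ => ((Bd_pc s).ex_mul (φ := fun y => -(ξ*y)) (by fun_prop)).integrable
  rw [e]
  by_cases h0 : ξ = 0
  · rw [Finset.sum_eq_zero]; · simp
    intro s _
    have := FT_pc_lo s ξ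
    rw [h0, abs_zero, mul_zero] at this
    rw [h0]; exact norm_le_zero_iff.1 this
  have hx : 0 < |ξ| := abs_pos.2 h0
  obtain ⟨n, hn1, hn2⟩ := exists_mem_Ioc_zpow (y := (2:ℝ)) (inv_pos.2 hx) (by norm_num)
  refine (norm_sum_le _ _).trans ((sum_split_le a b n _ (fun s => 8 * (2:ℝ)^s * |ξ|) (fun s => 320 * (2:ℝ)^(-s) * |ξ|⁻¹)
    (fun s => by positivity) (fun s => by positivity) (fun s _ => FT_pc_lo s ξ) (fun s _ => FT_pc_hi s ξ h0)).trans ?_)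
  rw [← Finset.sum_mul, ← Finset.sum_mul, ← Finset.mul_sum, ← Finset.mul_sum]
  have g1 := geo_up a n
  have g2 := geo_dn (n+1) b
  have b1 : (2:ℝ)^n * |ξ| ≤ 1 := by
    calc (2:ℝ)^n * |ξ| ≤ |ξ|⁻¹ * |ξ| := by gcongr
      _ = 1 := by field_simp
  have b2 : (2:ℝ)^(-(n+1)) * |ξ|⁻¹ ≤ 1 := by
    calc (2:ℝ)^(-(n+1)) * |ξ|⁻¹ ≤ (2:ℝ)^(-(n+1)) * (2:ℝ)^(n+1) := by gcongr
      _ = 1 := by rw [zpow_neg]; field_simp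
  have c1 : 8 * (∑ s ∈ Finset.Icc a n, (2:ℝ)^s) * |ξ| ≤ 16 := by
    calc _ ≤ 8 * (2 * (2:ℝ)^n) * |ξ| := by gcongr
      _ ≤ 16 := by linarith
  have c2 : 320 * (∑ s ∈ Finset.Icc (n+1) b, (2:ℝ)^(-s)) * |ξ|⁻¹ ≤ 640 := by
    calc _ ≤ 320 * (2 * (2:ℝ)^(-(n+1))) * |ξ|⁻¹ := by gcongr
      _ ≤ 640 := by linarith
  linarith
lemma tr_eq_cv (a b : ℤ) {f : ℝ → ℂ} (hf : Bd f) (x : ℝ) : tr a b f x = op (cv (wk a b)) f x := by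
  unfold tr op cv wk
  simp_rw [Finset.sum_mul]
  rw [integral_finsetSum]
  · rfl
  · exact fun s _ => hf.kint ((BK_kp s).slice x)
lemma tr_L2 (a b : ℤ) {f : ℝ → ℂ} (hf : Bd f) :
    ∫⁻ x, ‖tr a b f x‖ₑ ^ 2 ≤ ENNReal.ofReal (656^2) * ∫⁻ x, ‖f x‖ₑ ^ 2 := by
  simp_rw [tr_eq_cv a b hf]
  exact cv_L2 (Bd_wk a b) 656 (FT_wk a b) hf
noncomputable def bp (a : ℤ) (x z : ℝ) : ℂ := (th ((2:ℝ)^(-a) * |x - z|) : ℂ)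
lemma norm_bp (a : ℤ) (x z : ℝ) : ‖bp a x z‖ ≤ 1 := by
  rw [bp, Complex.norm_real, Real.norm_of_nonneg (th_nonneg _)]; exact th_le_one _
lemma bp_zero (a : ℤ) {x z : ℝ} (h : (2:ℝ)^a ≤ |x - z|) : bp a x z = 0 := by
  rw [bp, th_zero, Complex.ofReal_zero]
  rw [zpow_neg, inv_mul_eq_div, le_div_iff₀ (by positivity)]; linarith
lemma bp_lip (a : ℤ) (x y z : ℝ) : ‖bp a x y - bp a x z‖ ≤ 2 * (2:ℝ)^(-a) * |y - z| := by
  rw [bp, bp, ← Complex.ofReal_sub, Complex.norm_real]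
  refine (th_lip _ _).trans ?_
  rw [← mul_sub, abs_mul, abs_of_pos (show (0:ℝ) < (2:ℝ)^(-a) by positivity), mul_assoc]
  have : |(|x - y| - |x - z|)| ≤ |y - z| := by
    refine (abs_abs_sub_abs_le_abs_sub _ _).trans (le_of_eq ?_)
    rw [sub_sub_sub_cancel_left, abs_sub_comm]
  gcongr
lemma Bd_bp (a : ℤ) (x : ℝ) : Bd (bp a x) := by
  refine ⟨by unfold bp; have := th_meas; fun_prop, ⟨1, norm_bp a x⟩, ⟨(2:ℝ)^a + |x|, fun z hz => bp_zero a ?_⟩⟩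
  have := abs_sub_abs_le_abs_sub z x
  rw [abs_sub_comm] at this; linarith
lemma int_bp (a : ℤ) (x : ℝ) : ENNReal.ofReal ((2:ℝ)^a) ≤ ‖∫ z, bp a x z‖ₑ := by
  have h0 : (0:ℝ) < (2:ℝ)^a := by positivity
  unfold bp
  rw [integral_complex_ofReal, ← ofReal_norm, Complex.norm_real]
  refine ENNReal.ofReal_le_ofReal ((le_abs_self _).trans' ?_)
  have hi : Integrable (fun z => th ((2:ℝ)^(-a) * |x - z|)) := by
    have := (Bd_bp a x).integrable.re
    exact this
  calc (2:ℝ)^a = ∫ z in Icc (x - (2:ℝ)^a/2) (x + (2:ℝ)^a/2), (1:ℝ) := by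
        rw [setIntegral_const, smul_eq_mul, mul_one, measureReal_def, Real.volume_Icc, ENNReal.toReal_ofReal (by linarith)]; ring
    _ ≤ ∫ z in Icc (x - (2:ℝ)^a/2) (x + (2:ℝ)^a/2), th ((2:ℝ)^(-a) * |x - z|) := by
        refine setIntegral_mono_on (by simp) hi.integrableOn measurableSet_Icc fun z hz => ?_
        rw [th_one]
        have : |x - z| ≤ (2:ℝ)^a/2 := by rw [abs_le]; constructor <;> linarith [hz.1, hz.2]
        rw [zpow_neg, inv_mul_eq_div, div_le_iff₀ h0]; linarith
    _ ≤ _ := setIntegral_le_integral hi (Eventually.of_forall fun z => th_nonneg _)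
lemma int_kp (s : ℤ) (y : ℝ) : ∫ z, kp s y z = 0 := by
  have := integral_sub_left_eq_self (pc s) volume y
  rw [int_pc] at this
  exact this
lemma op_kp_bp (s a : ℤ) (x y : ℝ) : ‖op (kp s) (bp a x) y‖ ≤ 16 * (2:ℝ)^s * (2:ℝ)^(-a) := by
  have e : op (kp s) (bp a x) y = ∫ t, kp s y (y - t) * (bp a x (y - t) - bp a x y) := by
    rw [integral_sub_left_eq_self (fun z => kp s y z * (bp a x z - bp a x y)) volume y]
    simp_rw [mul_sub]
    rw [integral_sub ((Bd_bp a x).kint ((BK_kp s).slice y)) (((BK_kp s).slice y).integrable.mul_const _), integral_mul_const, int_kp,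
      zero_mul, sub_zero, op]
  rw [e]
  refine (norm_int_le _ (4 * (2:ℝ)^(-s) * (2 * (2:ℝ)^(-a) * (2:ℝ)^s)) ((2:ℝ)^s) (by positivity) (fun t => ?_) (fun t ht => ?_)).trans (le_of_eq ?_)
  · by_cases ht : (2:ℝ)^s < |t|
    · rw [kp_zero s (by rw [sub_sub_cancel]; exact ht.le), zero_mul, norm_zero]; positivity
    · push Not at ht
      rw [norm_mul]
      refine mul_le_mul (kp_norm_le _ _ _) ((bp_lip _ _ _ _).trans ?_) (norm_nonneg _) (by positivity)
      rw [show |y - t - y| = |t| by rw [sub_sub_cancel_left, abs_neg]]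
      gcongr
  · rw [kp_zero s (by rw [sub_sub_cancel]; exact ht.le), zero_mul]
  · rw [zpow_neg 2 s]; field_simp; norm_num
lemma bp_small (s a : ℤ) (hs : s ≤ a) (x : ℝ) {f : ℝ → ℂ} (hf : Bd f) :
    ‖∫ z, bp a x z * op (kp s) f z‖ₑ ≤ ENNReal.ofReal (64 * (2:ℝ)^s) * MN f x := by
  have e0 : ∫ z, bp a x z * op (kp s) f z = ∫ z, op (kp s) f z * conj (bp a x z) := by
    congr 1; ext z; simp only [bp, Complex.conj_ofReal]; ring
  rw [e0, op_dual hf (Bd_bp a x) (BK_kp s)]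
  have e1 : ∀ y, f y * conj (op (adj (kp s)) (bp a x) y) = conj (op (adj (kp s)) (bp a x) y) * f y := fun y => mul_comm _ _
  simp_rw [e1]
  have e2 : ∀ y, op (adj (kp s)) (bp a x) y = - op (kp s) (bp a x) y := by
    intro y; unfold op; rw [← integral_neg]; congr 1; ext z; rw [kp_adj]; ring
  have hsa : (2:ℝ)^s ≤ (2:ℝ)^a := zpow_le_zpow_right₀ one_le_two hs
  refine (ker_bound _ f x (2 * (2:ℝ)^a) (16 * (2:ℝ)^s * (2:ℝ)^(-a)) (by positivity) (fun y => ?_) (fun y hy => ?_)).trans_eq ?_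
  · rw [RCLike.norm_conj, e2, norm_neg]; exact op_kp_bp s a x y
  · rw [e2, op_supp s y, neg_zero, map_zero]
    intro z hz
    refine bp_zero a ?_
    have := abs_sub_le x z y
    rw [abs_sub_comm z y] at this; linarith
  · congr 2; rw [zpow_neg]; field_simp; norm_num
lemma cotlar1 (k0 k1 a : ℤ) (ha0 : k0 ≤ a) (ha1 : a ≤ k1) {f : ℝ → ℂ} (hf : Bd f) (x : ℝ) :
    ‖tr a k1 f x‖ₑ ≤ 2 * MN (tr k0 k1 f) x + 704 * MN f x := by
  have h0 : (0:ℝ) < (2:ℝ)^a := by positivity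
  set G := tr a k1 f with hG
  have hGB : Bd G := hf.tr a k1
  have i1 : Integrable (fun z => bp a x z * G z) := hGB.kint (Bd_bp a x)
  have i2 : Integrable (fun z => bp a x z * (G x - G z)) := by
    simp_rw [mul_sub]; exact ((Bd_bp a x).integrable.mul_const _).sub i1
  have split : (∫ z, bp a x z) * G x = (∫ z, bp a x z * (G x - G z)) + ((∫ z, bp a x z * tr k0 k1 f z)
      - ∑ s ∈ Finset.Icc k0 (a-1), ∫ z, bp a x z * op (kp s) f z) := by
    have e1 : ∑ s ∈ Finset.Icc k0 (a-1), ∫ z, bp a x z * op (kp s) f z = ∫ z, bp a x z * tr k0 (a-1) f z := by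
      unfold tr; simp_rw [Finset.mul_sum]
      exact (integral_finsetSum _ fun s _ => (hf.op (BK_kp s)).kint (Bd_bp a x)).symm
    rw [e1, ← integral_sub ((hf.tr k0 k1).kint (Bd_bp a x)) ((hf.tr k0 (a-1)).kint (Bd_bp a x))]
    have e2 : ∀ z, bp a x z * tr k0 k1 f z - bp a x z * tr k0 (a-1) f z = bp a x z * G z := by
      intro z; rw [tr_split (a-1) f z (by omega) (by omega), sub_add_cancel]; ring
    simp_rw [e2]
    rw [← integral_add i2 i1, ← integral_mul_const]
    congr 1; ext z; ring
  have b1 : ‖∫ z, bp a x z * (G x - G z)‖ₑ ≤ ENNReal.ofReal (640 * (2:ℝ)^a) * MN f x := by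
    calc _ ≤ ∫⁻ z, ‖bp a x z * (G x - G z)‖ₑ := enorm_integral_le_lintegral_enorm _
      _ ≤ ∫⁻ z, (Icc (x - (2:ℝ)^a) (x + (2:ℝ)^a)).indicator (fun _ => ENNReal.ofReal 320 * MN f x) z := by
          refine lintegral_mono fun z => ?_
          by_cases hz : |x - z| ≤ (2:ℝ)^a
          · rw [indicator_of_mem (by rw [abs_le] at hz; constructor <;> linarith)]
            rw [enorm_mul]
            have t := tr_diff a k1 hf z x (by rwa [abs_sub_comm])
            rw [← enorm_neg, neg_sub] at t
            calc _ ≤ 1 * (ENNReal.ofReal (320 * (2:ℝ)^(-a) * |z - x|) * MN f x) := by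
                  refine mul_le_mul' ?_ t
                  simpa using enorm_le_of_norm (norm_bp a x z)
              _ ≤ _ := by
                  rw [one_mul]
                  refine mul_le_mul' (ENNReal.ofReal_le_ofReal ?_) le_rfl
                  have : (2:ℝ)^(-a) * |z - x| ≤ 1 := by
                    rw [abs_sub_comm, zpow_neg, inv_mul_le_iff₀ h0]; linarith
                  linarith
          · rw [bp_zero a (not_le.1 hz).le, zero_mul, enorm_zero]; exact bot_le
      _ = _ := by
          rw [lintegral_indicator measurableSet_Icc, setLIntegral_const, Real.volume_Icc, mul_right_comm, ← ENNReal.ofReal_mul (by norm_num)]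
          congr 2; ring
  have b2 : ‖∫ z, bp a x z * tr k0 k1 f z‖ₑ ≤ ENNReal.ofReal (2 * (2:ℝ)^a) * MN (tr k0 k1 f) x := by
    have := ker_bound (bp a x) (tr k0 k1 f) x ((2:ℝ)^a) 1 h0 (norm_bp a x) (fun y hy => bp_zero a hy.le)
    rwa [mul_one] at this
  have b3 : ‖∑ s ∈ Finset.Icc k0 (a-1), ∫ z, bp a x z * op (kp s) f z‖ₑ ≤ ENNReal.ofReal (64 * (2:ℝ)^a) * MN f x := by
    calc _ ≤ ∑ s ∈ Finset.Icc k0 (a-1), ‖∫ z, bp a x z * op (kp s) f z‖ₑ := enorm_sum_le _ _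
      _ ≤ ∑ s ∈ Finset.Icc k0 (a-1), ENNReal.ofReal (64 * (2:ℝ)^s) * MN f x :=
          Finset.sum_le_sum fun s hs => bp_small s a (by rw [Finset.mem_Icc] at hs; omega) x hf
      _ = ENNReal.ofReal (∑ s ∈ Finset.Icc k0 (a-1), 64 * (2:ℝ)^s) * MN f x := by
          rw [ENNReal.ofReal_sum_of_nonneg (fun _ _ => by positivity), Finset.sum_mul]
      _ ≤ _ := by
          refine mul_le_mul' (ENNReal.ofReal_le_ofReal ?_) le_rfl
          rw [← Finset.mul_sum]
          have := geo_up k0 (a-1)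
          rw [zpow_sub_one₀ two_ne_zero] at this
          linarith
  have hfin : ENNReal.ofReal ((2:ℝ)^a) * ‖G x‖ₑ ≤ ENNReal.ofReal ((2:ℝ)^a) * (2 * MN (tr k0 k1 f) x + 704 * MN f x) := by
    calc _ ≤ ‖(∫ z, bp a x z) * G x‖ₑ := by rw [enorm_mul]; exact mul_le_mul' (int_bp a x) le_rfl
      _ ≤ ENNReal.ofReal (640 * (2:ℝ)^a) * MN f x + (ENNReal.ofReal (2 * (2:ℝ)^a) * MN (tr k0 k1 f) x + ENNReal.ofReal (64 * (2:ℝ)^a) * MN f x) := by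
          rw [split]
          refine (enorm_add_le _ _).trans (add_le_add b1 (enorm_sub_le.trans (add_le_add b2 b3)))
      _ = _ := by
          rw [ENNReal.ofReal_mul (by norm_num), ENNReal.ofReal_mul (by norm_num), ENNReal.ofReal_mul (by norm_num)]
          norm_num; ring
  exact (ENNReal.mul_le_mul_iff_right (by simpa using h0) ENNReal.ofReal_ne_top).1 hfin
lemma cotlar (k0 k1 : ℤ) {f : ℝ → ℂ} (hf : Bd f) (x : ℝ) :
    CC {0} k0 k1 f x ≤ 4 * MN (tr k0 k1 f) x + 1408 * MN f x := by
  refine CC_le fun N hN a b ha hab hb => ?_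
  rw [Finset.mem_singleton] at hN
  rw [hN, md_zero]
  have c1 := cotlar1 k0 k1 a ha (by omega) hf x
  have c2 : ‖tr (b+1) k1 f x‖ₑ ≤ 2 * MN (tr k0 k1 f) x + 704 * MN f x := by
    by_cases h : b + 1 ≤ k1
    · exact cotlar1 k0 k1 (b+1) (by omega) h hf x
    · rw [tr_empty _ _ (by omega)]; simp
  have e : tr a b f x = tr a k1 f x - tr (b+1) k1 f x := by
    rw [tr_split b f x (by omega) hb]; ring
  rw [e]
  refine enorm_sub_le.trans ((add_le_add c1 c2).trans_eq ?_)
  ring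
/-- strong type of the maximal truncation from strong type of the linear operator -/
lemma cotlar_strong (q : ℝ) (hq : 1 < q) (C : ℝ≥0)
    (H : ∀ (k0 k1 : ℤ) (f : ℝ → ℂ), Bd f → ∫⁻ x, ‖tr k0 k1 f x‖ₑ ^ q ≤ C * ∫⁻ x, ‖f x‖ₑ ^ q) :
    ∃ C' : ℝ≥0, ∀ (k0 k1 : ℤ) (f : ℝ → ℂ), Bd f → ∫⁻ x, CC {0} k0 k1 f x ^ q ≤ C' * ∫⁻ x, ‖f x‖ₑ ^ q := by
  obtain ⟨M, hM⟩ := MM_strong q hq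
  have hq0 : 0 < q := by linarith
  refine ⟨2^(q-1) * (4^q * (M * C) + 1408^q * M), fun k0 k1 f hf => ?_⟩
  have m1 : Measurable (MN (tr k0 k1 f)) := measurable_MM (hf.tr k0 k1).meas.enorm
  have m2 : Measurable (MN f) := measurable_MM hf.meas.enorm
  calc ∫⁻ x, CC {0} k0 k1 f x ^ q ≤ ∫⁻ x, 2^(q-1) * ((4 : ℝ≥0∞)^q * MN (tr k0 k1 f) x ^ q + 1408^q * MN f x ^ q) := by
        refine lintegral_mono fun x => (ENNReal.rpow_le_rpow (cotlar k0 k1 hf x) hq0.le).trans ?_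
        refine (ENNReal.rpow_add_le_mul_rpow_add_rpow _ _ hq.le).trans_eq ?_
        rw [ENNReal.mul_rpow_of_nonneg _ _ hq0.le, ENNReal.mul_rpow_of_nonneg _ _ hq0.le]
    _ = 2^(q-1) * ((4 : ℝ≥0∞)^q * (∫⁻ x, MN (tr k0 k1 f) x ^ q) + 1408^q * ∫⁻ x, MN f x ^ q) := by
        rw [lintegral_const_mul, lintegral_add_left, lintegral_const_mul, lintegral_const_mul]
        all_goals fun_prop
    _ ≤ 2^(q-1) * ((4 : ℝ≥0∞)^q * (M * (C * ∫⁻ x, ‖f x‖ₑ ^ q)) + 1408^q * (M * ∫⁻ x, ‖f x‖ₑ ^ q)) := by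
        refine mul_le_mul' le_rfl (add_le_add (mul_le_mul' le_rfl ((hM _ (hf.tr k0 k1).meas.enorm).trans (mul_le_mul' le_rfl (H k0 k1 f hf))))
          (mul_le_mul' le_rfl (hM _ hf.meas.enorm)))
    _ = _ := by
        push_cast
        rw [ENNReal.coe_rpow_of_nonneg _ hq0.le, ENNReal.coe_rpow_of_nonneg _ hq0.le, ENNReal.coe_rpow_of_nonneg _ (by linarith)]
        push_cast; ring
lemma lq_dual {K : ℝ → ℝ → ℂ} (hK : BK K) (q q' : ℝ) (hq : q.HolderConjugate q') (A : ℝ≥0)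
    (H : ∀ g, Bd g → ∫⁻ x, ‖op (adj K) g x‖ₑ ^ q' ≤ A * ∫⁻ x, ‖g x‖ₑ ^ q') (f : ℝ → ℂ) (hf : Bd f) :
    ∫⁻ x, ‖op K f x‖ₑ ^ q ≤ (A ^ (q/q') : ℝ≥0) * ∫⁻ x, ‖f x‖ₑ ^ q := by
  have hq1 := hq.lt
  have hq0 : 0 < q := by linarith
  have hq0' : 0 < q' := hq.symm.pos
  have hqq : (q-1) * q' = q := by have := hq.sub_one_mul_conj; exact this
  set F := op K f with hF
  have hFB : Bd F := hf.op hK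
  have hFm := hFB.meas
  set X := ∫⁻ x, ‖F x‖ₑ ^ q with hX
  have hXt : X < ∞ := hFB.lintegral_lt_top q hq0
  set g : ℝ → ℂ := fun x => ((‖F x‖ ^ (q-2) : ℝ) : ℂ) * F x with hg
  have hgn : ∀ x, ‖g x‖ = ‖F x‖ ^ (q-1) := by
    intro x
    rw [hg]; simp only
    rw [norm_mul, Complex.norm_real, Real.norm_of_nonneg (Real.rpow_nonneg (norm_nonneg _) _)]
    rcases eq_or_ne (‖F x‖) 0 with h0 | h0
    · rw [h0, mul_zero, Real.zero_rpow (by linarith)]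
    · rw [← Real.rpow_add_one h0]; congr 1; ring
  have hgB : Bd g := by
    obtain ⟨B, hB⟩ := hFB.bdd
    obtain ⟨R, hR⟩ := hFB.supp
    refine ⟨by rw [hg]; fun_prop, ⟨B ^ (q-1), fun x => ?_⟩, ⟨R, fun x hx => by rw [hg]; simp [hR x hx]⟩⟩
    rw [hgn]; exact Real.rpow_le_rpow (norm_nonneg _) (hB x) (by linarith)
  have hge : ∀ x, ‖g x‖ₑ ^ q' = ‖F x‖ₑ ^ q := by
    intro x
    rw [← ofReal_norm, hgn, ← ofReal_norm, ENNReal.ofReal_rpow_of_nonneg (Real.rpow_nonneg (norm_nonneg _) _) hq0'.le,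
      ENNReal.ofReal_rpow_of_nonneg (norm_nonneg _) hq0.le, ← Real.rpow_mul (norm_nonneg _), hqq]
  have h1 : X = ‖∫ x, F x * conj (g x)‖ₑ := by
    have h2 : ∀ x, F x * conj (g x) = ((‖F x‖ ^ q : ℝ) : ℂ) := by
      intro x
      rw [hg]; simp only [map_mul, Complex.conj_ofReal]
      rw [mul_left_comm, Complex.mul_conj, Complex.normSq_eq_norm_sq]
      norm_cast
      rcases eq_or_ne (‖F x‖) 0 with h0 | h0
      · rw [h0, Real.zero_rpow hq0.ne']; simp
      · rw [← Real.rpow_natCast, ← Real.rpow_add (lt_of_le_of_ne (norm_nonneg _) h0.symm)]; congr 1; push_cast; ring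
    have hi := (hFB.mul hgB.conj).integrable
    simp_rw [h2] at hi ⊢
    have hio : ∫ x, ((‖F x‖ ^ q : ℝ) : ℂ) = ((∫ x, ‖F x‖ ^ q : ℝ) : ℂ) := integral_ofReal
    rw [hio, ← ofReal_norm, Complex.norm_real]
    have hi' : Integrable (fun x => ‖F x‖ ^ q) := by
      have := hi.norm
      refine this.congr (ae_of_all _ fun x => ?_)
      simp only [Complex.norm_real]
      rw [Real.norm_of_nonneg (Real.rpow_nonneg (norm_nonneg _) _)]
    rw [Real.norm_of_nonneg (integral_nonneg fun x => Real.rpow_nonneg (norm_nonneg _) _),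
      ofReal_integral_eq_lintegral_ofReal hi' (ae_of_all _ fun x => Real.rpow_nonneg (norm_nonneg _) _)]
    rw [hX]; refine lintegral_congr fun x => ?_
    rw [← ofReal_norm, ENNReal.ofReal_rpow_of_nonneg (norm_nonneg _) hq0.le]
  have hO := hgB.op hK.adj
  have h3 : X ≤ (∫⁻ x, ‖f x‖ₑ ^ q) ^ (1/q) * (A * X) ^ (1/q') := by
    calc X = ‖∫ y, f y * conj (op (adj K) g y)‖ₑ := by rw [h1, hF, op_dual hf hgB hK]
      _ ≤ ∫⁻ y, ‖f y * conj (op (adj K) g y)‖ₑ := enorm_integral_le_lintegral_enorm _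
      _ = ∫⁻ y, ‖f y‖ₑ * ‖op (adj K) g y‖ₑ := by
          refine lintegral_congr fun y => ?_
          rw [enorm_mul]; congr 1; rw [← ofReal_norm, RCLike.norm_conj, ofReal_norm]
      _ ≤ (∫⁻ x, ‖f x‖ₑ ^ q) ^ (1/q) * (∫⁻ x, ‖op (adj K) g x‖ₑ ^ q') ^ (1/q') :=
          ENNReal.lintegral_mul_le_Lp_mul_Lq volume hq hf.meas.enorm.aemeasurable hO.meas.enorm.aemeasurable
      _ ≤ _ := by
          refine mul_le_mul' le_rfl (ENNReal.rpow_le_rpow ?_ (by positivity))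
          refine (H g hgB).trans (mul_le_mul' le_rfl ?_)
          simp_rw [hge]; exact le_rfl
  rcases eq_or_ne X 0 with h0 | h0
  · rw [h0]; exact bot_le
  have h4 : X ^ (1/q) * X ^ (1/q') = X := by
    rw [← ENNReal.rpow_add _ _ h0 hXt.ne, one_div, one_div, hq.inv_add_inv_eq_one, ENNReal.rpow_one]
  have h5 : X ^ (1/q) ≤ (∫⁻ x, ‖f x‖ₑ ^ q) ^ (1/q) * (A:ℝ≥0∞) ^ (1/q') := by
    have hne : X ^ (1/q') ≠ 0 := by simp [h0, hXt.ne]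
    have hnt : X ^ (1/q') ≠ ∞ := ENNReal.rpow_ne_top_of_nonneg (by positivity) hXt.ne
    rw [← ENNReal.mul_le_mul_iff_right hne hnt]
    rw [ENNReal.mul_rpow_of_nonneg _ _ (by positivity : 0 ≤ 1/q')] at h3
    calc _ = X := by rw [mul_comm, h4]
      _ ≤ _ := h3
      _ = _ := by ring
  have h6 := ENNReal.rpow_le_rpow h5 hq0.le
  rw [ENNReal.mul_rpow_of_nonneg _ _ hq0.le, ← ENNReal.rpow_mul, ← ENNReal.rpow_mul, ← ENNReal.rpow_mul,
    one_div_mul_cancel hq0.ne', ENNReal.rpow_one, ENNReal.rpow_one] at h6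
  refine h6.trans_eq ?_
  rw [mul_comm, ← ENNReal.coe_rpow_of_nonneg _ (by positivity)]
  congr 3; ring
lemma tr_op (a b : ℤ) {f : ℝ → ℂ} (hf : Bd f) : tr a b f = op (cv (wk a b)) f := by
  ext x; exact tr_eq_cv a b hf x
lemma wk_neg (a b : ℤ) (t : ℝ) : conj (wk a b (-t)) = - wk a b t := by
  unfold wk pc
  rw [map_sum, ← Finset.sum_neg_distrib]
  refine Finset.sum_congr rfl fun s _ => ?_
  rw [Complex.conj_ofReal, ps_neg]; push_cast; rfl
lemma CC0_q2 : ∃ C : ℝ≥0, ∀ (k0 k1 : ℤ) (f : ℝ → ℂ), Bd f → ∫⁻ x, CC {0} k0 k1 f x ^ (2:ℝ) ≤ C * ∫⁻ x, ‖f x‖ₑ ^ (2:ℝ) := by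
  refine cotlar_strong 2 (by norm_num) (Real.toNNReal (656^2)) fun k0 k1 f hf => ?_
  have := tr_L2 k0 k1 hf
  simp only [ENNReal.rpow_two]; exact this
lemma cheb (F : ℝ → ℝ≥0∞) (hF : Measurable F) (q t : ℝ) (hq : 0 < q) (ht : 0 < t) (B : ℝ≥0∞)
    (hB : ∫⁻ x, F x ^ q ≤ B) : volume {x | ENNReal.ofReal t < F x} ≤ B * ENNReal.ofReal (t ^ (-q)) := by
  have h1 := mul_meas_ge_le_lintegral (μ := volume) (hF.pow_const q) (ENNReal.ofReal t ^ q)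
  have h2 : {x | ENNReal.ofReal t < F x} ⊆ {x | ENNReal.ofReal t ^ q ≤ F x ^ q} := fun x hx =>
    ENNReal.rpow_le_rpow hx.le hq.le
  rw [Real.rpow_neg ht.le, ENNReal.ofReal_inv_of_pos (Real.rpow_pos_of_pos ht _),
    ← ENNReal.ofReal_rpow_of_pos ht, ← div_eq_mul_inv]
  rw [ENNReal.le_div_iff_mul_le (Or.inl (by simp [ht, hq.le])) (Or.inl (ENNReal.rpow_ne_top_of_nonneg hq.le ENNReal.ofReal_ne_top)), mul_comm]
  exact (mul_le_mul' le_rfl (measure_mono h2)).trans (h1.trans hB)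
lemma Loc0 : Loc {{0}} 2 := by
  obtain ⟨C, hC⟩ := CC0_q2
  intro ε hε
  set A := Real.sqrt ((C + 1)/ε) with hA
  have hA0 : 0 < A := Real.sqrt_pos.2 (by positivity)
  have hA2 : A ^ (2:ℝ) = (C+1)/ε := by rw [Real.rpow_two, Real.sq_sqrt (by positivity)]
  refine ⟨A, hA0, fun S hS k0 k1 j m f h hj hf hh _ hfr => ?_⟩
  rw [mem_singleton_iff] at hS; subst hS
  have h1 := cheb _ (CC_meas {0} k0 k1 hf) 2 (A*h) (by norm_num) (by positivity) _ ((hC k0 k1 f hf).trans (mul_le_mul' le_rfl hfr))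
  refine (measure_mono (fun x hx => hx.2)).trans (h1.trans ?_)
  rw [← ENNReal.ofReal_coe_nnreal, ← ENNReal.ofReal_mul (by positivity), ← ENNReal.ofReal_mul (by positivity)]
  refine ENNReal.ofReal_le_ofReal ?_
  rw [Real.rpow_neg (by positivity), Real.mul_rpow hA0.le hh.le, hA2]
  have h2 : (0:ℝ) < 2^j := by positivity
  have h3 : (0:ℝ) < h^(2:ℝ) := by positivity
  have h4 : (0:ℝ) ≤ C := C.2
  rw [← div_eq_mul_inv, div_le_iff₀ (by positivity)]
  field_simp
  nlinarith [mul_pos h2 h3]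
lemma tr_strong (q : ℝ) (hq : 1 < q) : ∃ C : ℝ≥0, ∀ (k0 k1 : ℤ) (f : ℝ → ℂ), Bd f → ∫⁻ x, ‖tr k0 k1 f x‖ₑ ^ q ≤ C * ∫⁻ x, ‖f x‖ₑ ^ q := by
  have hbig : ∀ q : ℝ, 2 < q → ∃ C : ℝ≥0, ∀ (k0 k1 : ℤ) (f : ℝ → ℂ), Bd f → ∫⁻ x, ‖tr k0 k1 f x‖ₑ ^ q ≤ C * ∫⁻ x, ‖f x‖ₑ ^ q := by
    intro q hq
    obtain ⟨C, hC⟩ := Loc_strong (by norm_num) Loc0 q hq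
    refine ⟨C, fun k0 k1 f hf => (lintegral_mono fun x => ?_).trans (hC {0} rfl k0 k1 f hf)⟩
    refine ENNReal.rpow_le_rpow ?_ (by linarith)
    have := le_CC (f := f) (x := x) (Finset.mem_singleton_self (0:ℝ)) (le_refl k0) (le_refl k1)
    rwa [md_zero] at this
  rcases lt_trichotomy q 2 with h | h | h
  · have hc := Real.HolderConjugate.conjExponent hq
    set q' := q.conjExponent
    have hq' : 2 < q' := by
      have := hc.symm.lt
      have := hc.mul_eq_add
      nlinarith [hc.pos]
    obtain ⟨C, hC⟩ := hbig q' hq'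
    refine ⟨C ^ (q/q'), fun k0 k1 f hf => ?_⟩
    rw [tr_op k0 k1 hf]
    refine lq_dual (BK_cv (Bd_wk k0 k1)) q q' hc C (fun g hg => ?_) f hf
    have h1 : ∀ x, ‖op (adj (cv (wk k0 k1))) g x‖ₑ = ‖tr k0 k1 g x‖ₑ := by
      intro x
      rw [tr_op k0 k1 hg]
      have : op (adj (cv (wk k0 k1))) g x = - op (cv (wk k0 k1)) g x := by
        unfold op; rw [← integral_neg]
        refine integral_congr_ae (ae_of_all _ fun y => ?_)
        simp only [adj, cv]
        rw [← neg_sub, wk_neg, neg_mul]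
      rw [this, enorm_neg]
    simp_rw [h1]; exact hC k0 k1 g hg
  · subst h
    refine ⟨(Real.toNNReal (656^2)), fun k0 k1 f hf => ?_⟩
    have := tr_L2 k0 k1 hf
    simp only [ENNReal.rpow_two]; exact this
  · exact hbig q h
lemma CC0_strong (q : ℝ) (hq : 1 < q) : ∃ C : ℝ≥0, ∀ (k0 k1 : ℤ) (f : ℝ → ℂ), Bd f → ∫⁻ x, CC {0} k0 k1 f x ^ q ≤ C * ∫⁻ x, ‖f x‖ₑ ^ q := by
  obtain ⟨C, hC⟩ := tr_strong q hq
  exact cotlar_strong q hq C hC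
@[ext] structure Tile where
  s : ℤ
  m : ℤ
  n : ℤ
namespace Tile
def I (p : Tile) : Set ℝ := Dy p.s p.m
def Om (p : Tile) : Set ℝ := Dy (-p.s) p.n
noncomputable def L (p : Tile) : ℝ := (2:ℝ)^p.s
noncomputable def c (p : Tile) : ℝ := ((p.n:ℝ) + 1/2) * (2:ℝ)^(-p.s)
def Le (p q : Tile) : Prop := p.I ⊆ q.I ∧ q.Om ⊆ p.Om
lemma L_pos (p : Tile) : 0 < p.L := by unfold L; positivity
lemma inv_L (p : Tile) : p.L⁻¹ = (2:ℝ)^(-p.s) := by rw [L, zpow_neg]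
lemma L_le {p q : Tile} (h : p.s ≤ q.s) : p.L ≤ q.L := zpow_le_zpow_right₀ (by norm_num) h
lemma iL_le {p q : Tile} (h : p.s ≤ q.s) : q.L⁻¹ ≤ p.L⁻¹ := inv_anti₀ p.L_pos (L_le h)
lemma iL_le_pow {p q : Tile} (D : ℕ) (h : p.s + D ≤ q.s) : (2:ℝ)^D * q.L⁻¹ ≤ p.L⁻¹ := by
  rw [inv_L, inv_L, ← zpow_natCast, ← zpow_add₀ (by norm_num)]
  exact zpow_le_zpow_right₀ (by norm_num) (by omega)
lemma I_meas (p : Tile) : MeasurableSet p.I := Dy_meas _ _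
lemma Om_meas (p : Tile) : MeasurableSet p.Om := Dy_meas _ _
lemma I_vol (p : Tile) : volume p.I = ENNReal.ofReal p.L := Dy_vol _ _
lemma I_scale {p q : Tile} (h : p.I ⊆ q.I) : p.s ≤ q.s := Dy_scale_le h
lemma I_nonempty (p : Tile) : p.I.Nonempty := ⟨_, Dy_left_mem _ _⟩
/-- frequency within the tile is close to its center -/
lemma Om_close {p : Tile} {v : ℝ} (h : v ∈ p.Om) : |v - p.c| ≤ 1/2 * p.L⁻¹ := by
  obtain ⟨h1, h2⟩ := h
  rw [inv_L, c, abs_le]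
  constructor <;> nlinarith
lemma c_mem (p : Tile) : p.c ∈ p.Om := by
  have h : (0:ℝ) < (2:ℝ)^(-p.s) := by positivity
  unfold c Om Dy
  constructor <;> nlinarith
/-- nested frequency intervals -/
lemma c_close {p q : Tile} (h : p.Le q) : |q.c - p.c| ≤ 1/2 * p.L⁻¹ - 1/2 * q.L⁻¹ := by
  obtain ⟨-, h⟩ := h
  have h1 := h q.c_mem
  have hq : (0:ℝ) < (2:ℝ)^(-q.s) := by positivity
  have hs : -q.s ≤ -p.s := by
    unfold Om at h; exact Dy_scale_le h
  have hl : (q.n:ℝ) * (2:ℝ)^(-q.s) ∈ p.Om := h (Dy_left_mem _ _)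
  have hr : ((q.n:ℝ)+1) * (2:ℝ)^(-q.s) ≤ ((p.n:ℝ)+1) * (2:ℝ)^(-p.s) := by
    by_contra hc
    push Not at hc
    have : ((p.n:ℝ)+1) * (2:ℝ)^(-p.s) ∈ q.Om := ⟨hl.2.le, hc⟩
    exact absurd (h this).2 (lt_irrefl _)
  rw [inv_L, inv_L, c, c, abs_le]
  constructor <;> nlinarith [hl.1]
lemma eq_of_s {p q : Tile} (h : p.Le q) (hs : p.s = q.s) : p = q := by
  obtain ⟨h1, h2⟩ := h
  have e1 : p.m = q.m := by
    have := h1 (Dy_left_mem p.s p.m)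
    have h3 := mem_Dy.1 (Dy_left_mem p.s p.m)
    have h4 := mem_Dy.1 this
    rw [← hs] at h4; rw [← h3, h4]
  have e2 : q.n = p.n := by
    have := h2 (Dy_left_mem (-q.s) q.n)
    have h3 := mem_Dy.1 (Dy_left_mem (-q.s) q.n)
    have h4 := mem_Dy.1 this
    rw [hs] at h4; rw [← h3, h4]
  exact Tile.ext hs e1 e2.symm
lemma Le.refl (p : Tile) : p.Le p := ⟨subset_rfl, subset_rfl⟩
lemma Le.trans {p q r : Tile} (h : p.Le q) (h' : q.Le r) : p.Le r := ⟨h.1.trans h'.1, h'.2.trans h.2⟩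
lemma Le.s {p q : Tile} (h : p.Le q) : p.s ≤ q.s := I_scale h.1
/-- tiles sharing a point are comparable -/
lemma le_of_mem {p q : Tile} (hs : p.s ≤ q.s) {x v : ℝ} (h1 : x ∈ p.I) (h2 : x ∈ q.I) (h3 : v ∈ p.Om) (h4 : v ∈ q.Om) :
    p.Le q := ⟨Dy_nest hs h1 h2, Dy_nest (by omega) h4 h3⟩
lemma I_nest {p q : Tile} (hs : p.s ≤ q.s) {x : ℝ} (h1 : x ∈ p.I) (h2 : x ∈ q.I) : p.I ⊆ q.I := Dy_nest hs h1 h2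
end Tile
structure Cx where
  N : ℝ → ℝ
  a : ℝ → ℤ
  b : ℝ → ℤ
  S : Finset ℝ
  j : ℤ
  M : ℤ
  k0 : ℤ
  hN : Measurable N
  ha : Measurable a
  hb : Measurable b
  hS : ∀ x, N x ∈ S
namespace Cx
def Q (X : Cx) : Set ℝ := Dy X.j X.M
def A (X : Cx) (p : Tile) : Set ℝ := {x | x ∈ p.I ∧ X.N x ∈ p.Om}
def E (X : Cx) (p : Tile) : Set ℝ := {x | x ∈ p.I ∧ X.N x ∈ p.Om ∧ X.a x ≤ p.s ∧ p.s ≤ X.b x}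
lemma A_meas (X : Cx) (p : Tile) : MeasurableSet (X.A p) := p.I_meas.inter (X.hN p.Om_meas)
lemma E_meas (X : Cx) (p : Tile) : MeasurableSet (X.E p) :=
  p.I_meas.inter ((X.hN p.Om_meas).inter ((measurableSet_le X.ha measurable_const).inter (measurableSet_le measurable_const X.hb)))
lemma E_sub_A (X : Cx) (p : Tile) : X.E p ⊆ X.A p := fun _ hx => ⟨hx.1, hx.2.1⟩
lemma E_sub_I (X : Cx) (p : Tile) : X.E p ⊆ p.I := fun _ hx => hx.1
lemma E_eq (X : Cx) {p q : Tile} {x : ℝ} (hs : p.s = q.s) (hp : x ∈ X.A p) (hq : x ∈ X.A q) : p = q :=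
  Tile.eq_of_s (Tile.le_of_mem hs.le hp.1 hq.1 hp.2 hq.2) hs
def tset (X : Cx) : Set Tile := {p | X.k0 ≤ p.s ∧ p.s ≤ X.j ∧ p.I ⊆ X.Q ∧ ∃ v ∈ X.S, p.n = ix (-p.s) v}
lemma tset_fin (X : Cx) : X.tset.Finite := by
  classical
  let U : Finset Tile := (Finset.Icc X.k0 X.j).biUnion fun s =>
    ((Finset.Icc (ix s ((X.M:ℝ)*(2:ℝ)^X.j)) (ix s (((X.M:ℝ)+1)*(2:ℝ)^X.j))) ×ˢ (X.S.image (ix (-s)))).image fun z => ⟨s, z.1, z.2⟩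
  refine (U.finite_toSet).subset ?_
  rintro p ⟨h1, h2, h3, v, hv, hn⟩
  simp only [U, Finset.coe_biUnion, mem_iUnion, Finset.mem_coe, Finset.mem_Icc, Finset.mem_image, Finset.mem_product, exists_prop]
  refine ⟨p.s, ⟨h1, h2⟩, (p.m, p.n), ⟨?_, v, hv, hn.symm⟩, rfl⟩
  have h4 := h3 (Dy_left_mem p.s p.m)
  have h5 := mem_Dy.1 (Dy_left_mem p.s p.m)
  have hm : ∀ u w : ℝ, u ≤ w → ix p.s u ≤ ix p.s w := fun u w h =>
    Int.floor_le_floor (mul_le_mul_of_nonneg_right h (by positivity))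
  simp only
  constructor
  · rw [← h5]; exact hm _ _ h4.1
  · rw [← h5]; exact hm _ _ h4.2.le
noncomputable def tiles (X : Cx) : Finset Tile := X.tset_fin.toFinset
lemma mem_tiles (X : Cx) {p : Tile} : p ∈ X.tiles ↔ X.k0 ≤ p.s ∧ p.s ≤ X.j ∧ p.I ⊆ X.Q ∧ ∃ v ∈ X.S, p.n = ix (-p.s) v := by
  rw [tiles, Set.Finite.mem_toFinset]; rfl
/-- the tile of scale `s` at `x` -/
noncomputable def tl (X : Cx) (s : ℤ) (x : ℝ) : Tile := ⟨s, ix s x, ix (-s) (X.N x)⟩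
lemma tl_A (X : Cx) (s : ℤ) (x : ℝ) : x ∈ X.A (X.tl s x) := ⟨mem_Dy_ix _ _, mem_Dy_ix _ _⟩
lemma tl_mem (X : Cx) {s : ℤ} {x : ℝ} (h0 : X.k0 ≤ s) (h1 : s ≤ X.j) (hx : x ∈ X.Q) : X.tl s x ∈ X.tiles :=
  X.mem_tiles.2 ⟨h0, h1, Dy_nest h1 (mem_Dy_ix _ _) hx, X.N x, X.hS x, rfl⟩
/-- kernel of the model operator -/
noncomputable def K (X : Cx) (P : Finset Tile) (x y : ℝ) : ℂ :=
  ∑ p ∈ P, (X.E p).indicator (fun x => kp p.s x y * ex (-(X.N x * y))) x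
lemma BK_K (X : Cx) (P : Finset Tile) : BK (X.K P) := by
  refine ⟨?_, ⟨∑ p ∈ P, 4 * (2:ℝ)^(-p.s), fun x y => ?_⟩, ⟨∑ p ∈ P, (2:ℝ)^p.s, fun x y h => ?_⟩⟩
  · unfold Function.uncurry K
    refine Finset.measurable_sum _ fun p _ => ?_
    have h1 : Measurable fun z : ℝ × ℝ => kp p.s z.1 z.2 * ex (-(X.N z.1 * z.2)) := by
      have h2 := kp_meas p.s
      have h3 := X.hN
      have h4 : Measurable fun z : ℝ × ℝ => -(X.N z.1 * z.2) := by fun_prop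
      exact h2.mul (ex_meas.comp h4)
    have h5 := h1.indicator (measurable_fst (X.E_meas p))
    convert h5 using 2
    rename_i z
    by_cases hz : z.1 ∈ X.E p
    · rw [indicator_of_mem hz, indicator_of_mem (show z ∈ Prod.fst ⁻¹' X.E p from hz)]
    · rw [indicator_of_notMem hz, indicator_of_notMem (show z ∉ Prod.fst ⁻¹' X.E p from hz)]
  · unfold K
    refine (norm_sum_le _ _).trans (Finset.sum_le_sum fun p _ => (norm_indicator_le_norm_self _ _).trans ?_)
    rw [norm_mul, norm_ex, mul_one]; exact kp_norm_le _ _ _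
  · unfold K
    refine Finset.sum_eq_zero fun p hp => ?_
    rw [Set.indicator_apply_eq_zero]; intro _
    rw [kp_zero, zero_mul]
    exact (Finset.single_le_sum (f := fun p : Tile => (2:ℝ)^p.s) (fun i _ => by positivity) hp).trans h.le
lemma op_K (X : Cx) (P : Finset Tile) {f : ℝ → ℂ} (hf : Bd f) (x : ℝ) :
    op (X.K P) f x = ∑ p ∈ P, (X.E p).indicator (fun x => op (kp p.s) (md (X.N x) f) x) x := by
  unfold op K
  simp_rw [Finset.sum_mul]
  rw [integral_finsetSum]
  · refine Finset.sum_congr rfl fun p _ => ?_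
    by_cases hx : x ∈ X.E p
    · simp only [indicator_of_mem hx]
      refine integral_congr_ae (ae_of_all _ fun y => ?_)
      simp only [md]; ring
    · simp only [indicator_of_notMem hx, zero_mul, integral_zero]
  · intro p _
    by_cases hx : x ∈ X.E p
    · simp only [indicator_of_mem hx]
      have := (hf.md (X.N x)).kint ((BK_kp p.s).slice x)
      refine this.congr (ae_of_all _ fun y => ?_)
      simp only [md]; ring
    · simp only [indicator_of_notMem hx, zero_mul]; exact integrable_zero _ _ _
end Cx
lemma sparse_int {W : Set (ℤ × ℤ)} (hW : W.PairwiseDisjoint (fun q => Dy q.1 q.2)) {E : Set ℝ} (hE : MeasurableSet E)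
    (hc : E ⊆ ⋃ q ∈ W, Dy q.1 q.2) (d : ℝ≥0∞) (hd : ∀ q ∈ W, volume (E ∩ Dy q.1 q.2) ≤ d * volume (Dy q.1 q.2))
    (F G : ℝ → ℝ≥0∞) (hF : ∀ x ∉ E, F x = 0)
    (hFG : ∀ q ∈ W, ∀ x ∈ E ∩ Dy q.1 q.2, ∀ z ∈ Dy q.1 q.2, F x ≤ G z) :
    ∫⁻ x, F x ≤ d * ∫⁻ x, G x := by
  have hWc : W.Countable := W.to_countable
  have hU : MeasurableSet (⋃ q ∈ W, Dy q.1 q.2) := MeasurableSet.biUnion hWc fun q _ => Dy_meas _ _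
  have h1 : ∫⁻ x, F x = ∫⁻ x in ⋃ q ∈ W, Dy q.1 q.2, F x := by
    rw [← lintegral_indicator hU]
    refine lintegral_congr fun x => ?_
    by_cases hx : x ∈ ⋃ q ∈ W, Dy q.1 q.2
    · rw [indicator_of_mem hx]
    · rw [indicator_of_notMem hx, hF x (fun h => hx (hc h))]
  have h2 : ∫⁻ x in ⋃ q ∈ W, Dy q.1 q.2, G x ≤ ∫⁻ x, G x := setLIntegral_le_lintegral _ _
  rw [h1]
  refine le_trans ?_ (mul_le_mul' le_rfl h2)
  rw [lintegral_biUnion hWc (fun q _ => Dy_meas _ _) hW, lintegral_biUnion hWc (fun q _ => Dy_meas _ _) hW, ← ENNReal.tsum_mul_left]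
  refine ENNReal.tsum_le_tsum fun q => ?_
  obtain ⟨q, hq⟩ := q
  simp only
  set cc := ⨅ z ∈ Dy q.1 q.2, G z with hcc
  calc ∫⁻ x in Dy q.1 q.2, F x ≤ ∫⁻ x in Dy q.1 q.2, E.indicator (fun _ => cc) x := by
        refine setLIntegral_mono' (Dy_meas _ _) fun x hx => ?_
        by_cases hxE : x ∈ E
        · rw [indicator_of_mem hxE]
          exact le_iInf₂ fun z hz => hFG q hq x ⟨hxE, hx⟩ z hz
        · rw [hF x hxE]; exact bot_le
    _ = cc * volume (E ∩ Dy q.1 q.2) := by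
        rw [lintegral_indicator hE, setLIntegral_const, Measure.restrict_apply hE]
    _ ≤ cc * (d * volume (Dy q.1 q.2)) := mul_le_mul' le_rfl (hd q hq)
    _ = d * ∫⁻ x in Dy q.1 q.2, cc := by rw [setLIntegral_const]; ring
    _ ≤ _ := mul_le_mul' le_rfl (setLIntegral_mono' (Dy_meas _ _) fun x hx => iInf₂_le x hx)
namespace Cx
def Heavy (X : Cx) (n : ℕ) (p : Tile) : Prop :=
  ∃ (l : ℕ) (t k : ℤ) (ξ : ℝ), p.I ⊆ Dy t k ∧ Dy t k ⊆ X.Q ∧ |ξ - p.c| ≤ 2^l * p.L⁻¹ ∧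
    ENNReal.ofReal (2^(2*l) / 2^n * (2:ℝ)^t) < volume {x | x ∈ Dy t k ∧ |X.N x - ξ| ≤ 2^(l+1) * (2:ℝ)^(-t)}
lemma Heavy_anti (X : Cx) {n : ℕ} {p q : Tile} (h : p.Le q) (hq : X.Heavy n q) : X.Heavy n p := by
  obtain ⟨l, t, k, ξ, h1, h2, h3, h4⟩ := hq
  refine ⟨l, t, k, ξ, h.1.trans h1, h2, ?_, h4⟩
  rcases h.s.eq_or_lt with hs | hs
  · rw [Tile.eq_of_s h hs]; exact h3
  · have h5 := Tile.c_close h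
    have h6 : 2 * q.L⁻¹ ≤ p.L⁻¹ := by
      have := Tile.iL_le_pow (p := p) (q := q) 1 (by push_cast; omega)
      simpa using this
    have h7 : (1:ℝ) ≤ 2^l := one_le_pow₀ (by norm_num)
    have h8 : 0 < p.L⁻¹ := inv_pos.2 p.L_pos
    have h10 : 0 < q.L⁻¹ := inv_pos.2 q.L_pos
    have h9 := abs_sub_le ξ q.c p.c
    nlinarith
lemma Heavy_zero (X : Cx) (p : Tile) : ¬ X.Heavy 0 p := by
  rintro ⟨l, t, k, ξ, h1, h2, h3, h4⟩
  have h5 : volume {x | x ∈ Dy t k ∧ |X.N x - ξ| ≤ 2^(l+1) * (2:ℝ)^(-t)} ≤ ENNReal.ofReal ((2:ℝ)^t) := by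
    rw [← Dy_vol t k]; exact measure_mono fun x hx => hx.1
  refine absurd (h4.trans_le h5) (not_lt.2 (ENNReal.ofReal_le_ofReal ?_))
  have h7 : (1:ℝ) ≤ 2^(2*l) := one_le_pow₀ (by norm_num)
  have h6 : (0:ℝ) < 2^t := by positivity
  simp only [pow_zero, div_one]; nlinarith
/-- union of the sets E(p) -/
def EU (X : Cx) (V : Finset Tile) : Set ℝ := ⋃ p ∈ V, X.E p
lemma EU_meas (X : Cx) (V : Finset Tile) : MeasurableSet (X.EU V) := Finset.measurableSet_biUnion _ fun p _ => X.E_meas p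
lemma mem_EU (X : Cx) {V : Finset Tile} {x : ℝ} : x ∈ X.EU V ↔ ∃ p ∈ V, x ∈ X.E p := by simp [EU]
lemma sparse (X : Cx) (n l : ℕ) (V : Finset Tile) (hV : ∀ p ∈ V, p.I ⊆ X.Q) (ξ : ℝ)
    (hξ : ∀ p ∈ V, |ξ - p.c| ≤ 2^l * p.L⁻¹) (hh : ∀ p ∈ V, ¬ X.Heavy n p) :
    ∃ W : Set (ℤ × ℤ), W.PairwiseDisjoint (fun q => Dy q.1 q.2) ∧ (∀ p ∈ V, p.I ⊆ ⋃ q ∈ W, Dy q.1 q.2) ∧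
      (∀ q ∈ W, ∃ p ∈ V, Dy q.1 q.2 ⊆ p.I) ∧
      (∀ q ∈ W, ∀ p ∈ V, ∀ x ∈ p.I, x ∈ Dy q.1 q.2 → q.1 + 1 ≤ p.s) ∧
      (∀ q ∈ W, volume (X.EU V ∩ Dy q.1 q.2) ≤ ENNReal.ofReal (2 * 2^(2*l) / 2^n) * volume (Dy q.1 q.2)) := by
  set G : ℤ → ℤ → Prop := fun s m => ∀ p ∈ V, ¬ p.I ⊆ Dy s m with hG
  have hGm : ∀ s m t n, Dy s m ⊆ Dy t n → G t n → G s m := fun s m t n h h1 p hp h2 => h1 p hp (h2.trans h)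
  have key : ∀ q ∈ Wh G, ∀ p ∈ V, ∀ x ∈ p.I, x ∈ Dy q.1 q.2 → q.1 + 1 ≤ p.s := by
    intro q hq p hp x hx hxq
    by_contra hc
    exact hq.1 p hp (Dy_nest (by omega) hx hxq)
  refine ⟨{q | q ∈ Wh G ∧ ∃ p ∈ V, Dy q.1 q.2 ⊆ p.I}, (Wh_disj hGm).subset (fun q hq => hq.1), ?_, fun q hq => hq.2, fun q hq => key q hq.1, ?_⟩
  · intro p hp x hx
    obtain ⟨q, hq, hxq⟩ := Wh_cover (G := G) x (by
      obtain ⟨p1, hp1, hmin⟩ := V.exists_min_image (fun p => p.s) ⟨p, hp⟩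
      refine ⟨p1.s - 1, fun p2 hp2 h => ?_⟩
      have := Dy_scale_le h
      have := hmin p2 hp2
      omega) (by
      refine ⟨p.s, fun s hs => ?_⟩
      by_contra hc
      exact hs p hp (Dy_nest (by omega) hx (mem_Dy_ix _ _)))
    refine mem_biUnion (x := q) ⟨hq, p, hp, ?_⟩ hxq
    have := key q hq p hp x hx hxq
    exact Dy_nest (by omega) hxq hx
  · rintro q ⟨hq, -⟩
    rcases (X.EU V ∩ Dy q.1 q.2).eq_empty_or_nonempty with he | ⟨x, hx, hxq⟩
    · rw [he]; simp
    obtain ⟨p, hp, hxp⟩ := X.mem_EU.1 hx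
    have h1 := key q hq p hp x hxp.1 hxq
    have hpar := Dy_parent q.1 q.2
    have h2 : Dy (q.1+1) (q.2/2) ⊆ p.I := Dy_nest h1 (hpar hxq) hxp.1
    have h3 := hq.2
    simp only [hG] at h3
    push Not at h3
    obtain ⟨p0, hp0, h4⟩ := h3
    have h5 := hh p0 hp0
    have h6 : volume {x | x ∈ Dy (q.1+1) (q.2/2) ∧ |X.N x - ξ| ≤ 2^(l+1) * (2:ℝ)^(-(q.1+1))} ≤ ENNReal.ofReal (2^(2*l) / 2^n * (2:ℝ)^(q.1+1)) := by
      by_contra hc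
      exact h5 ⟨l, q.1+1, q.2/2, ξ, h4, h2.trans (hV p hp), hξ p0 hp0, not_le.1 hc⟩
    have h7 : X.EU V ∩ Dy q.1 q.2 ⊆ {x | x ∈ Dy (q.1+1) (q.2/2) ∧ |X.N x - ξ| ≤ 2^(l+1) * (2:ℝ)^(-(q.1+1))} := by
      rintro y ⟨hy, hyq⟩
      obtain ⟨p', hp', hyp⟩ := X.mem_EU.1 hy
      refine ⟨hpar hyq, ?_⟩
      have h8 := key q hq p' hp' y hyp.1 hyq
      have h9 := Tile.Om_close hyp.2.1
      have h10 := hξ p' hp'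
      have h11 : p'.L⁻¹ ≤ (2:ℝ)^(-(q.1+1)) := by
        rw [Tile.inv_L]; exact zpow_le_zpow_right₀ (by norm_num) (by omega)
      have h12 : (1:ℝ) ≤ 2^l := one_le_pow₀ (by norm_num)
      have h13 := abs_sub_le (X.N y) p'.c ξ
      rw [abs_sub_comm p'.c ξ] at h13
      have h14 : 0 < p'.L⁻¹ := inv_pos.2 p'.L_pos
      calc |X.N y - ξ| ≤ 2^(l+1) * p'.L⁻¹ := by rw [pow_succ]; nlinarith
        _ ≤ _ := mul_le_mul_of_nonneg_left h11 (by positivity)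
    refine (measure_mono h7).trans (h6.trans_eq ?_)
    rw [Dy_vol, ← ENNReal.ofReal_mul (by positivity), zpow_add₀ (by norm_num)]
    congr 1; rw [zpow_one]; ring
lemma sparse_vol (X : Cx) (n l : ℕ) (V : Finset Tile) (hV : ∀ p ∈ V, p.I ⊆ X.Q) (ξ : ℝ)
    (hξ : ∀ p ∈ V, |ξ - p.c| ≤ 2^l * p.L⁻¹) (hh : ∀ p ∈ V, ¬ X.Heavy n p) :
    volume (X.EU V) ≤ ENNReal.ofReal (2 * 2^(2*l) / 2^n) * volume (⋃ p ∈ V, p.I) := by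
  obtain ⟨W, h1, h2, h3, -, h5⟩ := X.sparse n l V hV ξ hξ hh
  have h6 := Wh_union_vol W h1 (X.EU V) (X.EU_meas V) _ h5
  have h7 : X.EU V ⊆ ⋃ q ∈ W, Dy q.1 q.2 := fun x hx => by
    obtain ⟨p, hp, hxp⟩ := X.mem_EU.1 hx
    exact h2 p hp hxp.1
  rw [inter_eq_left.2 h7] at h6
  refine h6.trans (mul_le_mul' le_rfl (measure_mono ?_))
  refine iUnion₂_subset fun q hq => ?_
  obtain ⟨p, hp, h⟩ := h3 q hq
  exact h.trans (subset_biUnion_of_mem (u := fun p : Tile => p.I) hp)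
end Cx
lemma op_mod (s : ℤ) {f : ℝ → ℂ} (hf : Bd f) (N ξ x z : ℝ) (h : |x - z| ≤ (2:ℝ)^s) :
    ‖op (kp s) (md N f) x - ex (-((N-ξ)*x)) * op (kp s) (md ξ f) x‖ₑ ≤ ENNReal.ofReal (16 * |N-ξ| * (2:ℝ)^s) * MN f z := by
  have h2 : (0:ℝ) < (2:ℝ)^s := by positivity
  have e : op (kp s) (md N f) x - ex (-((N-ξ)*x)) * op (kp s) (md ξ f) x
      = ∫ y, (kp s x y * (ex (-(N*y)) - ex (-((N-ξ)*x)) * ex (-(ξ*y)))) * f y := by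
    unfold op
    rw [← integral_const_mul, ← integral_sub ((hf.md N).kint ((BK_kp s).slice x)) (((hf.md ξ).kint ((BK_kp s).slice x)).const_mul _)]
    refine integral_congr_ae (ae_of_all _ fun y => ?_)
    simp only [md]; ring
  rw [e]
  refine (ker_bound _ f z (2 * (2:ℝ)^s) (4 * |N-ξ|) (by positivity) ?_ ?_).trans_eq ?_
  · intro y
    rw [norm_mul]
    rcases lt_or_ge |x-y| ((2:ℝ)^s) with hy | hy
    · have e2 : ex (-(N*y)) - ex (-((N-ξ)*x)) * ex (-(ξ*y)) = ex (-(N*y)) - ex (-((N-ξ)*x) + -(ξ*y)) := by rw [ex_add]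
      rw [e2]
      have h3 := ex_sub_ex (-(N*y)) (-((N-ξ)*x) + -(ξ*y))
      have e3 : -(N*y) - (-((N-ξ)*x) + -(ξ*y)) = (N-ξ)*(x-y) := by ring
      rw [e3, abs_mul] at h3
      calc _ ≤ (4 * (2:ℝ)^(-s)) * (|N-ξ| * (2:ℝ)^s) := by
            refine mul_le_mul (kp_norm_le _ _ _) (h3.trans ?_) (norm_nonneg _) (by positivity)
            exact mul_le_mul_of_nonneg_left hy.le (abs_nonneg _)
        _ = 4 * |N-ξ| * ((2:ℝ)^(-s) * (2:ℝ)^s) := by ring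
        _ = _ := by rw [← zpow_add₀ (by norm_num)]; simp
    · rw [kp_zero s hy, norm_zero, zero_mul]; positivity
  · intro y hy
    rw [kp_zero, zero_mul]
    have := abs_sub_le z x y
    rw [abs_sub_comm z x] at this
    linarith
  · congr 2; ring
lemma tr_mod (a b : ℤ) {f : ℝ → ℂ} (hf : Bd f) (N ξ x z : ℝ) (h : |x - z| ≤ (2:ℝ)^a) (hη : |N - ξ| ≤ 2 * (2:ℝ)^(-b)) :
    ‖tr a b (md N f) x‖ₑ ≤ ‖tr a b (md ξ f) z‖ₑ + 384 * MN f z := by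
  have h1 : ‖tr a b (md N f) x - ex (-((N-ξ)*x)) * tr a b (md ξ f) x‖ₑ ≤ ENNReal.ofReal 64 * MN f z := by
    unfold tr
    rw [Finset.mul_sum, ← Finset.sum_sub_distrib]
    refine (enorm_sum_le _ _).trans ?_
    calc _ ≤ ∑ s ∈ Finset.Icc a b, ENNReal.ofReal (16 * |N-ξ| * (2:ℝ)^s) * MN f z := by
          refine Finset.sum_le_sum fun s hs => op_mod s hf N ξ x z (h.trans ?_)
          exact zpow_le_zpow_right₀ (by norm_num) (Finset.mem_Icc.1 hs).1
      _ ≤ _ := by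
          rw [← Finset.sum_mul, ← ENNReal.ofReal_sum_of_nonneg (fun s _ => by positivity), ← Finset.mul_sum]
          refine mul_le_mul' (ENNReal.ofReal_le_ofReal ?_) le_rfl
          have h3 := geo_up a b
          have h4 : (2:ℝ)^(-b) * (2:ℝ)^b = 1 := by rw [← zpow_add₀ (by norm_num)]; simp
          calc 16 * |N-ξ| * ∑ s ∈ Finset.Icc a b, (2:ℝ)^s ≤ 16 * (2 * (2:ℝ)^(-b)) * (2 * (2:ℝ)^b) := by gcongr
            _ = 64 * ((2:ℝ)^(-b) * (2:ℝ)^b) := by ring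
            _ = 64 := by rw [h4]; norm_num
  have h2 : ‖tr a b (md ξ f) x - tr a b (md ξ f) z‖ₑ ≤ ENNReal.ofReal 320 * MN f z := by
    have := tr_diff a b (hf.md ξ) x z h
    rw [MN_md] at this
    refine this.trans (mul_le_mul' (ENNReal.ofReal_le_ofReal ?_) le_rfl)
    have h4 : (2:ℝ)^(-a) * (2:ℝ)^a = 1 := by rw [← zpow_add₀ (by norm_num)]; simp
    have : (2:ℝ)^(-a) * |x - z| ≤ (2:ℝ)^(-a) * (2:ℝ)^a := mul_le_mul_of_nonneg_left h (by positivity)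
    linarith
  have e : tr a b (md N f) x = (tr a b (md N f) x - ex (-((N-ξ)*x)) * tr a b (md ξ f) x) + ex (-((N-ξ)*x)) * ((tr a b (md ξ f) x - tr a b (md ξ f) z) + tr a b (md ξ f) z) := by ring
  rw [e]
  refine (enorm_add_le _ _).trans ?_
  rw [enorm_mul, enorm_ex, one_mul]
  calc _ ≤ ENNReal.ofReal 64 * MN f z + (ENNReal.ofReal 320 * MN f z + ‖tr a b (md ξ f) z‖ₑ) :=
        add_le_add h1 ((enorm_add_le _ _).trans (add_le_add h2 le_rfl))
    _ = _ := by
        rw [show ENNReal.ofReal 64 = 64 by simp, show ENNReal.ofReal 320 = 320 by simp]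
        ring_nf
namespace Cx
structure IsTree (X : Cx) (n : ℕ) (u : Tile) (V : Finset Tile) : Prop where
  sub : V ⊆ X.tiles
  nh : ∀ p ∈ V, ¬ X.Heavy n p
  cl : ∀ p ∈ V, |u.c - p.c| ≤ p.L⁻¹
  in5 : ∀ p ∈ V, ∀ x ∈ p.I, ∀ y, |x - y| < 2 * p.L → y ∈ u.I
  conv : ∀ p ∈ V, ∀ r ∈ V, ∀ x, x ∈ X.E p → x ∈ X.E r → ∀ s, p.s ≤ s → s ≤ r.s → X.tl s x ∈ V
lemma op_K_zero (X : Cx) (V : Finset Tile) (f : ℝ → ℂ) {x : ℝ} (hx : x ∉ X.EU V) : op (X.K V) f x = 0 := by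
  unfold op
  have : ∀ y, X.K V x y = 0 := by
    intro y; unfold K
    refine Finset.sum_eq_zero fun p hp => indicator_of_notMem (fun h => hx (X.mem_EU.2 ⟨p, hp, h⟩)) _
  simp [this]
lemma tree_tr (X : Cx) {n : ℕ} {u : Tile} {V : Finset Tile} (hT : X.IsTree n u V) {f : ℝ → ℂ} (hf : Bd f) {x : ℝ} (hx : x ∈ X.EU V) :
    ∃ p ∈ V, ∃ r ∈ V, x ∈ X.E p ∧ x ∈ X.E r ∧ op (X.K V) f x = tr p.s r.s (md (X.N x) f) x := by
  classical
  set Vx := V.filter (fun p => x ∈ X.E p) with hVx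
  have hne : Vx.Nonempty := by
    obtain ⟨p, hp, hxp⟩ := X.mem_EU.1 hx
    exact ⟨p, Finset.mem_filter.2 ⟨hp, hxp⟩⟩
  obtain ⟨p, hp, hmin⟩ := Vx.exists_min_image (fun p => p.s) hne
  obtain ⟨r, hr, hmax⟩ := Vx.exists_max_image (fun p => p.s) hne
  obtain ⟨hpV, hpE⟩ := Finset.mem_filter.1 hp
  obtain ⟨hrV, hrE⟩ := Finset.mem_filter.1 hr
  refine ⟨p, hpV, r, hrV, hpE, hrE, ?_⟩
  rw [X.op_K V hf, tr]
  have h1 : ∑ p ∈ V, (X.E p).indicator (fun x => op (kp p.s) (md (X.N x) f) x) x = ∑ p ∈ Vx, op (kp p.s) (md (X.N x) f) x := by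
    rw [hVx, Finset.sum_filter]
    refine Finset.sum_congr rfl fun q _ => ?_
    simp only [indicator]
  rw [h1]
  refine Finset.sum_bij' (fun q _ => q.s) (fun s _ => X.tl s x) ?_ ?_ ?_ ?_ ?_
  · intro q hq; exact Finset.mem_Icc.2 ⟨hmin q hq, hmax q hq⟩
  · intro s hs
    obtain ⟨h2, h3⟩ := Finset.mem_Icc.1 hs
    refine Finset.mem_filter.2 ⟨hT.conv p hpV r hrV x hpE hrE s h2 h3, ?_⟩
    exact ⟨(X.tl_A s x).1, (X.tl_A s x).2, hpE.2.2.1.trans h2, h3.trans hrE.2.2.2⟩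
  · intro q hq
    exact X.E_eq (x := x) rfl (X.tl_A _ _) (X.E_sub_A _ (Finset.mem_filter.1 hq).2)
  · intro s _; rfl
  · intro q _; rfl
lemma tree_pt (X : Cx) {n : ℕ} {u : Tile} {V : Finset Tile} (hT : X.IsTree n u V) {f : ℝ → ℂ} (hf : Bd f) {x z : ℝ} (hx : x ∈ X.EU V)
    (hz : ∀ p ∈ V, x ∈ X.E p → |x - z| ≤ p.L) :
    ‖op (X.K V) f x‖ₑ ≤ CC {0} X.k0 X.j (md u.c f) z + 384 * MN f z := by
  obtain ⟨p, hp, r, hr, hxp, hxr, e⟩ := X.tree_tr hT hf hx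
  rw [e]
  refine (tr_mod p.s r.s hf (X.N x) u.c x z (hz p hp hxp) ?_).trans ?_
  · have h1 := Tile.Om_close hxr.2.1
    have h2 := hT.cl r hr
    have h3 := abs_sub_le (X.N x) r.c u.c
    rw [abs_sub_comm r.c u.c] at h3
    have h4 : 0 < r.L⁻¹ := inv_pos.2 r.L_pos
    rw [← Tile.inv_L]; linarith
  · refine add_le_add ?_ le_rfl
    have := le_CC (S := {0}) (f := md u.c f) (x := z) (Finset.mem_singleton_self (0:ℝ)) (X.mem_tiles.1 (hT.sub hp)).1 (X.mem_tiles.1 (hT.sub hr)).2.1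
    rwa [md_zero] at this
lemma op_K_local (X : Cx) {V : Finset Tile} {U : Set ℝ} (h : ∀ p ∈ V, ∀ x ∈ p.I, ∀ y, |x - y| < p.L → y ∈ U) (f : ℝ → ℂ) (x : ℝ) :
    op (X.K V) f x = op (X.K V) (U.indicator f) x := by
  unfold op
  refine integral_congr_ae (ae_of_all _ fun y => ?_)
  simp only
  by_cases hy : y ∈ U
  · rw [indicator_of_mem hy]
  · have : X.K V x y = 0 := by
      unfold K
      refine Finset.sum_eq_zero fun p hp => ?_
      rw [Set.indicator_apply_eq_zero]; intro hx
      rw [kp_zero, zero_mul]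
      by_contra hc
      exact hy (h p hp x hx.1 y (not_le.1 hc))
    rw [this, zero_mul, zero_mul]
end Cx
lemma tree_bound (q : ℝ) (hq : 1 < q) : ∃ C : ℝ≥0, ∀ (X : Cx) (n : ℕ) (u : Tile) (V : Finset Tile), X.IsTree n u V → ∀ f, Bd f →
    ∫⁻ x, ‖op (X.K V) f x‖ₑ ^ q ≤ ENNReal.ofReal (2 / 2^n) * (C * ∫⁻ x in u.I, ‖f x‖ₑ ^ q) := by
  obtain ⟨C1, hC1⟩ := CC0_strong q hq
  obtain ⟨C2, hC2⟩ := MM_strong q hq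
  have hq0 : 0 < q := by linarith
  refine ⟨2^(q-1) * (C1 + 384^q * C2), fun X n u V hT f hf => ?_⟩
  set f' := u.I.indicator f with hf'
  have hfB : Bd f' := hf.indicator u.I_meas
  have h0 : ∀ x, op (X.K V) f x = op (X.K V) f' x := fun x => X.op_K_local (fun p hp x hx y hy => hT.in5 p hp x hx y (by
    have := p.L_pos; linarith)) f x
  obtain ⟨W, hW1, hW2, -, hW4, hW5⟩ := X.sparse n 0 V (fun p hp => (X.mem_tiles.1 (hT.sub hp)).2.2.1) u.c (fun p hp => by
    simpa using hT.cl p hp) hT.nh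
  have hfi : ∫⁻ x in u.I, ‖f x‖ₑ ^ q = ∫⁻ x, ‖f' x‖ₑ ^ q := by
    rw [← lintegral_indicator u.I_meas]
    refine lintegral_congr fun x => ?_
    rw [hf']
    by_cases hx : x ∈ u.I
    · rw [indicator_of_mem hx, indicator_of_mem hx]
    · rw [indicator_of_notMem hx, indicator_of_notMem hx]; simp [hq0]
  have h1 := sparse_int hW1 (X.EU_meas V) (fun x hx => by
      obtain ⟨p, hp, hxp⟩ := X.mem_EU.1 hx
      exact hW2 p hp hxp.1) (ENNReal.ofReal (2/2^n)) (fun w hw => by simpa using hW5 w hw)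
    (fun x => ‖op (X.K V) f x‖ₑ ^ q) (fun z => (CC {0} X.k0 X.j (md u.c f') z + 384 * MN f' z) ^ q)
    (fun x hx => by simp [X.op_K_zero V f hx, hq0])
    (by
      rintro w hw x ⟨hx, hxw⟩ z hz
      refine ENNReal.rpow_le_rpow ?_ hq0.le
      rw [h0]
      refine X.tree_pt hT hfB hx (fun p hp hxp => ?_)
      have h2 := hW4 w hw p hp x hxp.1 hxw
      refine (Dy_dist hxw hz).le.trans ?_
      exact zpow_le_zpow_right₀ (by norm_num) (by omega))
  refine h1.trans (mul_le_mul' le_rfl ?_)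
  rw [hfi]
  calc _ ≤ ∫⁻ z, 2^(q-1) * (CC {0} X.k0 X.j (md u.c f') z ^ q + (384:ℝ≥0∞)^q * MN f' z ^ q) := by
        refine lintegral_mono fun z => ?_
        refine (ENNReal.rpow_add_le_mul_rpow_add_rpow _ _ hq.le).trans ?_
        rw [ENNReal.mul_rpow_of_nonneg _ _ hq0.le]
    _ = 2^(q-1) * ((∫⁻ z, CC {0} X.k0 X.j (md u.c f') z ^ q) + (384:ℝ≥0∞)^q * ∫⁻ z, MN f' z ^ q) := by
        have m1 : Measurable fun z => CC {0} X.k0 X.j (md u.c f') z ^ q := (CC_meas _ _ _ (hfB.md _)).pow_const q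
        have m2 : Measurable fun z => MN f' z ^ q := (measurable_MM hfB.meas.enorm).pow_const q
        have m3 : Measurable fun z => CC {0} X.k0 X.j (md u.c f') z ^ q + (384:ℝ≥0∞)^q * MN f' z ^ q := m1.add (m2.const_mul _)
        rw [lintegral_const_mul _ m3, lintegral_add_left m1, lintegral_const_mul _ m2]
    _ ≤ 2^(q-1) * (C1 * (∫⁻ x, ‖f' x‖ₑ ^ q) + (384:ℝ≥0∞)^q * (C2 * ∫⁻ x, ‖f' x‖ₑ ^ q)) := by
        refine mul_le_mul' le_rfl (add_le_add ?_ (mul_le_mul' le_rfl ?_))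
        · have := hC1 X.k0 X.j (md u.c f') (hfB.md _)
          simpa only [enorm_md] using this
        · exact hC2 _ hfB.meas.enorm
    _ = _ := by
        push_cast
        rw [ENNReal.coe_rpow_of_nonneg _ (by linarith : (0:ℝ) ≤ q - 1), ENNReal.coe_rpow_of_nonneg _ hq0.le]
        push_cast
        ring
lemma op_sum {ι : Type*} (T : Finset ι) (k : ι → ℝ → ℝ → ℂ) (hk : ∀ i ∈ T, BK (k i)) {K : ℝ → ℝ → ℂ}
    (hK : ∀ x y, K x y = ∑ i ∈ T, k i x y) {f : ℝ → ℂ} (hf : Bd f) (x : ℝ) : op K f x = ∑ i ∈ T, op (k i) f x := by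
  unfold op
  simp_rw [hK, Finset.sum_mul]
  rw [integral_finsetSum]
  intro i hi; exact hf.kint ((hk i hi).slice x)
lemma adj_sum {ι : Type*} (T : Finset ι) (k : ι → ℝ → ℝ → ℂ) (hk : ∀ i ∈ T, BK (k i)) {K : ℝ → ℝ → ℂ}
    (hK : ∀ x y, K x y = ∑ i ∈ T, k i x y) {f : ℝ → ℂ} (hf : Bd f) (x : ℝ) : op (adj K) f x = ∑ i ∈ T, op (adj (k i)) f x :=
  op_sum T (fun i => adj (k i)) (fun i hi => (hk i hi).adj) (fun x y => by simp only [adj, hK, map_sum]) hf x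
lemma sum_sq_le {ι : Type*} (T : Finset ι) (F : ι → ℝ → ℂ) (hF : ∀ i ∈ T, Bd (F i)) :
    ∫⁻ x, ‖∑ i ∈ T, F i x‖ₑ ^ 2 ≤ ∑ i ∈ T, ∑ k ∈ T, ‖∫ x, F i x * conj (F k x)‖ₑ := by
  rw [(Bd.sum T F hF).sq_eq]
  have : ∀ x, (∑ i ∈ T, F i x) * conj (∑ i ∈ T, F i x) = ∑ i ∈ T, ∑ k ∈ T, F i x * conj (F k x) := by
    intro x; rw [map_sum, Finset.sum_mul_sum]
  simp_rw [this]
  rw [integral_finsetSum _ (fun i hi => integrable_finsetSum _ fun k hk => ((hF i hi).mul (hF k hk).conj).integrable)]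
  refine (enorm_sum_le _ _).trans (Finset.sum_le_sum fun i hi => ?_)
  rw [integral_finsetSum _ (fun k hk => ((hF i hi).mul (hF k hk).conj).integrable)]
  exact enorm_sum_le _ _
lemma inner_symm (F G : ℝ → ℂ) : ‖∫ x, F x * conj (G x)‖ₑ = ‖∫ x, G x * conj (F x)‖ₑ := by
  have : ∫ x, F x * conj (G x) = conj (∫ x, G x * conj (F x)) := by
    rw [← integral_conj]; refine integral_congr_ae (ae_of_all _ fun x => ?_); simp [mul_comm]
  rw [this, ← ofReal_norm, RCLike.norm_conj, ofReal_norm]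
lemma norm_int_le' (u : ℝ → ℂ) (c B r : ℝ) (hr : 0 ≤ r) (hB : ∀ y, ‖u y‖ ≤ B) (hs : ∀ y, r < |c - y| → u y = 0) :
    ‖∫ y, u y‖ ≤ 2 * r * B := by
  rw [← integral_add_right_eq_self u c]
  refine norm_int_le _ B r hr (fun y => hB _) fun y hy => hs _ ?_
  rw [show c - (y + c) = -y by ring, abs_neg]; exact hy
/-- shift trick -/
lemma osc (G : ℝ → ℂ) (hG : Bd G) (d : ℝ) (hd : d ≠ 0) :
    ∫ y, G y * ex (d * y) = (1/2) * ∫ y, (G y - G (y - Real.pi / d)) * ex (d * y) := by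
  have h1 : ∫ y, G y * ex (d * y) = ∫ y, G (y - Real.pi/d) * ex (d * (y - Real.pi / d)) :=
    (integral_sub_right_eq_self (fun y => G y * ex (d * y)) (Real.pi / d)).symm
  have h2 : ∀ y, G (y - Real.pi/d) * ex (d * (y - Real.pi / d)) = - (G (y - Real.pi/d) * ex (d * y)) := by
    intro y
    have e : d * y = d * (y - Real.pi/d) + Real.pi := by field_simp; ring
    rw [e, ex_add, ex_pi]; ring
  have hm : Measurable fun y : ℝ => d * y := by fun_prop
  have i1 : Integrable (fun y => G y * ex (d*y)) := by
    have := (hG.ex_mul hm).integrable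
    simpa [mul_comm] using this
  have i2 : Integrable (fun y => G (y - Real.pi/d) * ex (d*y)) := by
    have := ((hG.shift (Real.pi/d)).ex_mul hm).integrable
    simpa [mul_comm] using this
  simp_rw [h2, integral_neg] at h1
  simp_rw [sub_mul]
  rw [integral_sub i1 i2]
  linear_combination (1/2 : ℂ) * h1
lemma kp_shift (s : ℤ) (x y h : ℝ) : kp s x (y - h) = kp s (x + h) y := by
  unfold kp; congr 2; ring
lemma kp_lip2 (s : ℤ) (x y h : ℝ) : ‖kp s x y - kp s x (y - h)‖ ≤ 40 * (2:ℝ)^(-s) * (2:ℝ)^(-s) * |h| := by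
  rw [kp_shift]; refine (kp_lip s x (x+h) y).trans_eq ?_
  rw [show x - (x+h) = -h by ring, abs_neg]
lemma pair_triv (s t : ℤ) (x z d : ℝ) :
    ‖∫ y, kp s x y * kp t z y * ex (d * y)‖ ≤ 32 * (2:ℝ)^(-t) := by
  have h1 : (2:ℝ)^(-s) * (2:ℝ)^s = 1 := by rw [← zpow_add₀ (by norm_num)]; simp
  refine (norm_int_le' _ x (16 * (2:ℝ)^(-s) * (2:ℝ)^(-t)) ((2:ℝ)^s) (by positivity) (fun y => ?_) (fun y hy => ?_)).trans_eq ?_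
  · rw [norm_mul, norm_mul, norm_ex, mul_one]
    calc _ ≤ (4 * (2:ℝ)^(-s)) * (4 * (2:ℝ)^(-t)) := mul_le_mul (kp_norm_le _ _ _) (kp_norm_le _ _ _) (norm_nonneg _) (by positivity)
      _ = _ := by ring
  · rw [kp_zero s hy.le]; simp
  · linear_combination 32 * (2:ℝ)^(-t) * h1
lemma pair_zero (s t : ℤ) (hst : s ≤ t) (x z d : ℝ) (h : 2 * (2:ℝ)^t ≤ |x - z|) :
    ∫ y, kp s x y * kp t z y * ex (d * y) = 0 := by
  have : ∀ y, kp s x y * kp t z y * ex (d * y) = 0 := by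
    intro y
    have h1 : (2:ℝ)^s ≤ (2:ℝ)^t := zpow_le_zpow_right₀ (by norm_num) hst
    have h2 := abs_sub_le x y z
    rw [abs_sub_comm y z] at h2
    rcases le_or_gt ((2:ℝ)^s) |x - y| with h3 | h3
    · rw [kp_zero s h3]; simp
    · rw [kp_zero t (show (2:ℝ)^t ≤ |z - y| by linarith)]; simp
  simp [this]
lemma pair_osc (s t : ℤ) (hst : s ≤ t) (x z d : ℝ) (hd : d ≠ 0) :
    ‖∫ y, kp s x y * kp t z y * ex (d * y)‖ ≤ 2100 * (2:ℝ)^(-t) * ((2:ℝ)^(-s) * |d|⁻¹) := by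
  have h1 : (2:ℝ)^(-s) * (2:ℝ)^s = 1 := by rw [← zpow_add₀ (by norm_num)]; simp
  have hs : (0:ℝ) < (2:ℝ)^s := by positivity
  have hs' : (0:ℝ) < (2:ℝ)^(-s) := by positivity
  have ht' : (0:ℝ) < (2:ℝ)^(-t) := by positivity
  have hst' : (2:ℝ)^(-t) ≤ (2:ℝ)^(-s) := zpow_le_zpow_right₀ (by norm_num) (by omega)
  have hd' : 0 < |d| := abs_pos.2 hd
  have hpi := Real.pi_lt_d2
  have hpi0 := Real.pi_pos
  rcases lt_or_ge ((2:ℝ)^s) (Real.pi * |d|⁻¹) with hc | hc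
  · refine (pair_triv s t x z d).trans ?_
    have h2 : 1 ≤ (2:ℝ)^(-s) * (Real.pi * |d|⁻¹) := by
      rw [← h1]; exact mul_le_mul_of_nonneg_left hc.le hs'.le
    have h3 : 0 ≤ (2:ℝ)^(-s) * |d|⁻¹ := by positivity
    nlinarith [mul_nonneg ht'.le h3]
  · set h := Real.pi / d with hh
    have habs : |h| = Real.pi * |d|⁻¹ := by rw [hh, abs_div, abs_of_pos hpi0]; rfl
    have hG : Bd (fun y => kp s x y * kp t z y) := ((BK_kp s).slice x).mul ((BK_kp t).slice z)
    rw [osc _ hG d hd, norm_mul]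
    have h5 : ‖∫ y, (kp s x y * kp t z y - kp s x (y - h) * kp t z (y - h)) * ex (d * y)‖ ≤ 2 * (2 * (2:ℝ)^s) * (320 * (2:ℝ)^(-s) * (2:ℝ)^(-s) * (2:ℝ)^(-t) * |h|) := by
      refine norm_int_le' _ x _ _ (by positivity) (fun y => ?_) (fun y hy => ?_)
      · rw [norm_mul, norm_ex, mul_one]
        have e : kp s x y * kp t z y - kp s x (y - h) * kp t z (y - h) = (kp s x y - kp s x (y-h)) * kp t z y + kp s x (y-h) * (kp t z y - kp t z (y-h)) := by ring
        rw [e]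
        refine (norm_add_le _ _).trans ?_
        rw [norm_mul, norm_mul]
        calc _ ≤ (40 * (2:ℝ)^(-s) * (2:ℝ)^(-s) * |h|) * (4 * (2:ℝ)^(-t)) + (4 * (2:ℝ)^(-s)) * (40 * (2:ℝ)^(-t) * (2:ℝ)^(-t) * |h|) := by
              refine add_le_add (mul_le_mul (kp_lip2 _ _ _ _) (kp_norm_le _ _ _) (norm_nonneg _) (by positivity))
                (mul_le_mul (kp_norm_le _ _ _) (kp_lip2 _ _ _ _) (norm_nonneg _) (by positivity))
          _ ≤ _ := by
              have : (2:ℝ)^(-s) * ((2:ℝ)^(-t) * |h|) * (2:ℝ)^(-t) ≤ (2:ℝ)^(-s) * ((2:ℝ)^(-t) * |h|) * (2:ℝ)^(-s) :=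
                mul_le_mul_of_nonneg_left hst' (by positivity)
              nlinarith
      · have h6 : (2:ℝ)^s ≤ |x - y| := by linarith
        have h7 : (2:ℝ)^s ≤ |x - (y-h)| := by
          have := abs_sub_abs_le_abs_sub (x - y) (-h)
          rw [abs_neg, show x - y - -h = x - (y - h) by ring] at this
          rw [habs] at this
          linarith
        rw [kp_zero s h6, kp_zero s h7]; simp
    have e2 : ‖(1/2 : ℂ)‖ = 1/2 := by norm_num
    rw [e2]
    calc _ ≤ 1/2 * (2 * (2 * (2:ℝ)^s) * (320 * (2:ℝ)^(-s) * (2:ℝ)^(-s) * (2:ℝ)^(-t) * |h|)) := by gcongr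
      _ = 640 * ((2:ℝ)^(-s) * (2:ℝ)^s) * Real.pi * ((2:ℝ)^(-t) * ((2:ℝ)^(-s) * |d|⁻¹)) := by rw [habs]; ring
      _ ≤ 2100 * ((2:ℝ)^(-t) * ((2:ℝ)^(-s) * |d|⁻¹)) := by
          rw [h1]
          refine mul_le_mul_of_nonneg_right ?_ (by positivity)
          linarith
      _ = _ := by ring
namespace Cx
lemma K_single (X : Cx) (p : Tile) (x y : ℝ) : X.K {p} x y = (X.E p).indicator (fun x => kp p.s x y * ex (-(X.N x * y))) x := by
  unfold K; rw [Finset.sum_singleton]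
lemma K_sum (X : Cx) (V : Finset Tile) (x y : ℝ) : X.K V x y = ∑ p ∈ V, X.K {p} x y := by
  simp_rw [K_single]; rfl
/-- pairing of two tiles -/
lemma pair_int (X : Cx) (p p' : Tile) {g : ℝ → ℂ} (hg : Bd g) :
    ‖∫ y, op (adj (X.K {p})) g y * conj (op (adj (X.K {p'})) g y)‖ₑ ≤
      ∫⁻ z in X.E p', ‖g z‖ₑ * ∫⁻ x in X.E p, ‖g x‖ₑ * ‖∫ y, kp p.s x y * kp p'.s z y * ex ((X.N z - X.N x) * y)‖ₑ := by
  set Fp := op (adj (X.K {p})) g with hFp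
  have hFB : Bd Fp := hg.op (X.BK_K {p}).adj
  rw [← op_dual hFB hg (X.BK_K {p'})]
  refine (enorm_integral_le_lintegral_enorm _).trans ?_
  rw [← lintegral_indicator (X.E_meas p')]
  refine lintegral_mono fun z => ?_
  by_cases hz : z ∈ X.E p'
  swap
  · rw [indicator_of_notMem hz]
    have : op (X.K {p'}) Fp z = 0 := X.op_K_zero _ _ (fun h => hz (by
      obtain ⟨q, hq, h⟩ := X.mem_EU.1 h; rw [Finset.mem_singleton] at hq; rwa [hq] at h))
    simp [this]
  rw [indicator_of_mem hz, enorm_mul, mul_comm]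
  have e0 : ‖conj (g z)‖ₑ = ‖g z‖ₑ := by rw [← ofReal_norm, RCLike.norm_conj, ofReal_norm]
  rw [e0]
  refine mul_le_mul' le_rfl ?_
  set φ : ℝ → ℂ := fun y => conj (X.K {p'} z y) with hφ
  have hφB : Bd φ := ((X.BK_K {p'}).slice z).conj
  have e1 : op (X.K {p'}) Fp z = conj (∫ x, op (X.K {p}) φ x * conj (g x)) := by
    rw [op_dual hφB hg (X.BK_K {p}), ← integral_conj]
    unfold op
    refine integral_congr_ae (ae_of_all _ fun y => ?_)
    simp only [hφ, map_mul, Complex.conj_conj]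
    rfl
  rw [e1, ← ofReal_norm, RCLike.norm_conj, ofReal_norm]
  refine (enorm_integral_le_lintegral_enorm _).trans ?_
  rw [← lintegral_indicator (X.E_meas p)]
  refine lintegral_mono fun x => ?_
  by_cases hx : x ∈ X.E p
  swap
  · rw [indicator_of_notMem hx]
    have : op (X.K {p}) φ x = 0 := X.op_K_zero _ _ (fun h => hx (by
      obtain ⟨q, hq, h⟩ := X.mem_EU.1 h; rw [Finset.mem_singleton] at hq; rwa [hq] at h))
    simp [this]
  rw [indicator_of_mem hx, enorm_mul, mul_comm]
  have e2 : ‖conj (g x)‖ₑ = ‖g x‖ₑ := by rw [← ofReal_norm, RCLike.norm_conj, ofReal_norm]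
  rw [e2]
  refine mul_le_mul' le_rfl (le_of_eq ?_)
  congr 1
  unfold op
  refine integral_congr_ae (ae_of_all _ fun y => ?_)
  simp only [hφ, K_single, indicator_of_mem hx, indicator_of_mem hz, map_mul, ex_conj]
  have e3 : conj (kp p'.s z y) = kp p'.s z y := by unfold kp; rw [Complex.conj_ofReal]
  rw [e3, show (X.N z - X.N x) * y = -(X.N x * y) + -(-(X.N z * y)) by ring, ex_add]
  ring
end Cx
lemma sum_symm {ι : Type*} (T : Finset ι) (a : ι → ι → ℝ≥0∞) (s : ι → ℤ) (ha : ∀ i k, a i k = a k i) :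
    ∑ i ∈ T, ∑ k ∈ T, a i k ≤ 2 * ∑ k ∈ T, ∑ i ∈ T.filter (fun i => s i ≤ s k), a i k := by
  have h1 : ∀ i k, a i k ≤ (if s i ≤ s k then a i k else 0) + (if s k ≤ s i then a k i else 0) := by
    intro i k
    rcases le_total (s i) (s k) with h | h
    · rw [if_pos h]; exact le_self_add
    · rw [if_pos h, ha i k]; exact le_add_self
  simp_rw [Finset.sum_filter]
  calc ∑ i ∈ T, ∑ k ∈ T, a i k ≤ ∑ i ∈ T, ∑ k ∈ T, ((if s i ≤ s k then a i k else 0) + (if s k ≤ s i then a k i else 0)) :=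
        Finset.sum_le_sum fun i _ => Finset.sum_le_sum fun k _ => h1 i k
    _ = (∑ i ∈ T, ∑ k ∈ T, (if s i ≤ s k then a i k else 0)) + ∑ i ∈ T, ∑ k ∈ T, (if s k ≤ s i then a k i else 0) := by
        simp_rw [Finset.sum_add_distrib]
    _ = _ := by rw [Finset.sum_comm, two_mul]
lemma sum_lintegral_le {ι α : Type*} [MeasurableSpace α] (μ : Measure α) (T : Finset ι) (f : ι → α → ℝ≥0∞) :
    ∑ i ∈ T, ∫⁻ x, f i x ∂μ ≤ ∫⁻ x, ∑ i ∈ T, f i x ∂μ := by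
  classical
  induction T using Finset.induction_on with
  | empty => simp
  | insert i T hi ih =>
    simp_rw [Finset.sum_insert hi]
    exact (add_le_add le_rfl ih).trans (le_lintegral_add _ _)
lemma mul_le_sq_add (a b : ℝ≥0∞) : a * b ≤ a^2 + b^2 := by
  rcases le_total a b with h | h
  · exact (mul_le_mul' h le_rfl).trans (by rw [← sq]; exact le_add_self)
  · exact (mul_le_mul' le_rfl h).trans (by rw [← sq]; exact le_self_add)
noncomputable def M3 (g : ℝ → ℂ) (z : ℝ) : ℝ≥0∞ := (MM (fun y => ‖g y‖ₑ ^ (3/2:ℝ)) z) ^ (2/3:ℝ)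
lemma M3_meas {g : ℝ → ℂ} (hg : Measurable g) : Measurable (M3 g) :=
  (measurable_MM (hg.enorm.pow_const _)).pow_const _
lemma M3_L2 : ∃ C : ℝ≥0, ∀ g, Bd g → ∫⁻ z, M3 g z ^ 2 ≤ C * ∫⁻ z, ‖g z‖ₑ ^ 2 := by
  obtain ⟨C, hC⟩ := MM_strong (4/3) (by norm_num)
  refine ⟨C, fun g hg => ?_⟩
  have := hC (fun y => ‖g y‖ₑ ^ (3/2:ℝ)) (hg.meas.enorm.pow_const _)
  calc _ = ∫⁻ z, MM (fun y => ‖g y‖ₑ ^ (3/2:ℝ)) z ^ (4/3:ℝ) := by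
        refine lintegral_congr fun z => ?_
        rw [M3, ← ENNReal.rpow_natCast, ← ENNReal.rpow_mul]; norm_num
    _ ≤ _ := this
    _ = _ := by
        congr 1; refine lintegral_congr fun z => ?_
        rw [← ENNReal.rpow_mul, ← ENNReal.rpow_natCast]; norm_num
lemma M3_holder {g : ℝ → ℂ} (hg : Measurable g) (z r v : ℝ) (hr : 0 < r) (hv : 0 ≤ v) {S : Set ℝ}
    (hS : S ⊆ Icc (z - r) (z + r)) (hvol : volume S ≤ ENNReal.ofReal (2 * r * v)) :
    ∫⁻ y in S, ‖g y‖ₑ ≤ ENNReal.ofReal (2 * r * v ^ (1/3:ℝ)) * M3 g z := by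
  have h := ENNReal.lintegral_mul_le_Lp_mul_Lq (volume.restrict S) (p := 3/2) (q := 3)
    (by rw [Real.holderConjugate_iff]; norm_num) (f := fun y => ‖g y‖ₑ) (g := fun _ => 1) hg.enorm.aemeasurable aemeasurable_const
  simp only [Pi.mul_apply, mul_one, ENNReal.one_rpow, lintegral_const, one_mul, Measure.restrict_apply_univ] at h
  refine h.trans ?_
  have h2 := lintegral_le_MM (fun y => ‖g y‖ₑ ^ (3/2:ℝ)) z r hr S hS
  calc _ ≤ (ENNReal.ofReal (2 * r) * MM (fun y => ‖g y‖ₑ ^ (3/2:ℝ)) z) ^ (2/3:ℝ) * (ENNReal.ofReal (2 * r * v)) ^ (1/3:ℝ) := by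
        refine mul_le_mul' ?_ ?_
        · rw [show (1/(3/2):ℝ) = 2/3 by norm_num]; exact ENNReal.rpow_le_rpow h2 (by norm_num)
        · exact ENNReal.rpow_le_rpow hvol (by norm_num)
    _ = ENNReal.ofReal (2*r) ^ (2/3:ℝ) * ENNReal.ofReal (2*r*v) ^ (1/3:ℝ) * M3 g z := by
        rw [ENNReal.mul_rpow_of_nonneg _ _ (by norm_num), M3]; ring
    _ = _ := by
        congr 1
        rw [ENNReal.ofReal_rpow_of_nonneg (by positivity) (by norm_num), ENNReal.ofReal_rpow_of_nonneg (by positivity) (by norm_num),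
          ← ENNReal.ofReal_mul (by positivity), Real.mul_rpow (by positivity) hv, ← mul_assoc, ← Real.rpow_add (by positivity)]
        norm_num
lemma two_quarter (n : ℕ) : (2:ℝ)^(-(n/4:ℕ):ℝ) ≤ 2 * 2^(-(n:ℝ)/6) := by
  have h : (n:ℝ) ≤ 4 * (n/4:ℕ) + 3 := by
    have : n ≤ 4 * (n/4) + 3 := by omega
    exact_mod_cast this
  rw [show (2:ℝ) * 2^(-(n:ℝ)/6) = 2^(1 + -(n:ℝ)/6) by rw [Real.rpow_add (by norm_num), Real.rpow_one]]
  refine Real.rpow_le_rpow_of_exponent_le (by norm_num) ?_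
  have : (0:ℝ) ≤ n := Nat.cast_nonneg n
  linarith
lemma two_quarter' (n : ℕ) : ((2:ℝ) * 2^(2*(n/4+1)) / 2^n) ^ (1/3:ℝ) ≤ 2 * 2^(-(n:ℝ)/6) := by
  have h : 2 * ((n/4:ℕ):ℝ) ≤ n/2 := by
    have : 4 * (n/4) ≤ n := by omega
    have : 4 * ((n/4:ℕ):ℝ) ≤ n := by exact_mod_cast this
    linarith
  have e : ((2:ℝ) * 2^(2*(n/4+1)) / 2^n) = 2^((3:ℝ) + 2*(n/4:ℕ) - n) := by
    rw [Real.rpow_sub (by norm_num), Real.rpow_natCast]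
    congr 1
    rw [show (3:ℝ) + 2*(n/4:ℕ) = ((1 + 2*(n/4+1) : ℕ):ℝ) by push_cast; ring, Real.rpow_natCast]; ring
  rw [e, ← Real.rpow_mul (by norm_num), show (2:ℝ) * 2^(-(n:ℝ)/6) = 2^(1 + -(n:ℝ)/6) by rw [Real.rpow_add (by norm_num), Real.rpow_one]]
  refine Real.rpow_le_rpow_of_exponent_le (by norm_num) ?_
  linarith
lemma pair_comb (s t : ℤ) (hst : s ≤ t) (x z d : ℝ) (l : ℕ) (h : (2:ℝ)^l * 2^(-s) < |d|) :
    ‖∫ y, kp s x y * kp t z y * ex (d * y)‖ ≤ 2100 * (2:ℝ)^(-t) * 2^(-(l:ℝ)) := by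
  have hd : d ≠ 0 := by
    rintro rfl; rw [abs_zero] at h
    have : (0:ℝ) < (2:ℝ)^l * 2^(-s) := by positivity
    linarith
  refine (pair_osc s t hst x z d hd).trans ?_
  have hd' := abs_pos.2 hd
  refine mul_le_mul_of_nonneg_left ?_ (by positivity)
  rw [Real.rpow_neg (by norm_num), Real.rpow_natCast, ← div_eq_mul_inv, div_le_iff₀ hd', ← div_eq_inv_mul, le_div_iff₀ (by positivity)]
  linarith
namespace Cx
lemma sum_E (X : Cx) {V : Finset Tile} (hd : ∀ p ∈ V, ∀ q ∈ V, ∀ x, x ∈ X.E p → x ∈ X.E q → p = q) (h : ℝ → ℝ≥0∞) :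
    ∑ p ∈ V, ∫⁻ x in X.E p, h x = ∫⁻ x in X.EU V, h x := by
  unfold EU
  rw [lintegral_biUnion_finset _ (fun p _ => X.E_meas p)]
  intro p hp q hq hpq
  refine Set.disjoint_left.2 fun x h1 h2 => hpq (hd p hp q hq x h1 h2)
lemma anti_H (X : Cx) (n : ℕ) (V : Finset Tile) (hV : V ⊆ X.tiles) (hn : ∀ p ∈ V, ¬ X.Heavy n p)
    (hd : ∀ p ∈ V, ∀ q ∈ V, ∀ x, x ∈ X.E p → x ∈ X.E q → p = q) {g : ℝ → ℂ} (hg : Bd g) (t : ℤ) (z : ℝ) :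
    ∑ p ∈ V.filter (fun p => p.s ≤ t), ∫⁻ x in X.E p, ‖g x‖ₑ * ‖∫ y, kp p.s x y * kp t z y * ex ((X.N z - X.N x) * y)‖ₑ ≤
      ENNReal.ofReal (50000 * 2^(-(n:ℝ)/6)) * M3 g z := by
  classical
  set l := n/4 with hl
  set T : ℝ := (2:ℝ)^t with hT
  have hT0 : 0 < T := by positivity
  have hTi : (2:ℝ)^(-t) = T⁻¹ := by rw [hT, zpow_neg]
  set B := Icc (z - 2*T) (z + 2*T) with hB
  set V' := V.filter (fun p => p.s ≤ t ∧ ∃ x ∈ X.E p, |x - z| < 2 * T ∧ |X.N z - X.N x| ≤ 2^l * p.L⁻¹) with hV'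
  have hsub : V' ⊆ V.filter (fun p => p.s ≤ t) := by
    intro p hp; rw [hV', Finset.mem_filter] at hp; exact Finset.mem_filter.2 ⟨hp.1, hp.2.1⟩
  set α := ENNReal.ofReal (2100 * T⁻¹ * 2^(-(l:ℝ))) with hα
  set β := ENNReal.ofReal (2100 * T⁻¹) with hβ
  have h1 : ∀ p ∈ V.filter (fun p => p.s ≤ t), ∫⁻ x in X.E p, ‖g x‖ₑ * ‖∫ y, kp p.s x y * kp t z y * ex ((X.N z - X.N x) * y)‖ₑ ≤
      (∫⁻ x in X.E p, α * B.indicator (fun x => ‖g x‖ₑ) x) + (if p ∈ V' then (∫⁻ x in X.E p, β * ‖g x‖ₑ) else 0) := by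
    intro p hp
    rw [Finset.mem_filter] at hp
    have hm : Measurable fun x => α * B.indicator (fun x => ‖g x‖ₑ) x := (hg.meas.enorm.indicator measurableSet_Icc).const_mul _
    have : (if p ∈ V' then (∫⁻ x in X.E p, β * ‖g x‖ₑ) else 0) = ∫⁻ x in X.E p, (if p ∈ V' then β * ‖g x‖ₑ else 0) := by
      split_ifs <;> simp
    rw [this, ← lintegral_add_left hm]
    refine setLIntegral_mono' (X.E_meas p) fun x hx => ?_
    by_cases h2 : 2 * T ≤ |x - z|
    · rw [pair_zero p.s t hp.2 x z _ h2]; simp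
    push Not at h2
    by_cases h3 : |X.N z - X.N x| ≤ 2^l * p.L⁻¹
    · have : p ∈ V' := Finset.mem_filter.2 ⟨hp.1, hp.2, x, hx, h2, h3⟩
      rw [if_pos this]
      refine le_trans ?_ le_add_self
      rw [mul_comm]
      refine mul_le_mul' ?_ le_rfl
      refine enorm_le_of_norm ((pair_triv p.s t x z _).trans ?_)
      rw [hTi]; have := inv_pos.2 hT0; linarith
    · push Not at h3
      refine le_trans ?_ le_self_add
      have hxB : x ∈ B := by
        rw [hB, mem_Icc]; rw [abs_lt] at h2; constructor <;> linarith
      rw [indicator_of_mem hxB, mul_comm]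
      refine mul_le_mul' ?_ le_rfl
      refine enorm_le_of_norm ?_
      rw [Tile.inv_L] at h3
      rw [← hTi]
      exact pair_comb p.s t hp.2 x z _ l h3
  refine (Finset.sum_le_sum h1).trans ?_
  rw [Finset.sum_add_distrib, ← Finset.sum_filter, Finset.filter_mem_eq_inter, Finset.inter_eq_right.2 hsub]
  rw [X.sum_E (fun p hp q hq => hd p (Finset.mem_filter.1 hp).1 q (Finset.mem_filter.1 hq).1),
    X.sum_E (fun p hp q hq => hd p (Finset.mem_filter.1 hp).1 q (Finset.mem_filter.1 hq).1),
    lintegral_const_mul _ (hg.meas.enorm.indicator measurableSet_Icc), lintegral_const_mul _ hg.meas.enorm]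
  have h4 : ∫⁻ x in X.EU (V.filter (fun p => p.s ≤ t)), B.indicator (fun x => ‖g x‖ₑ) x ≤ ENNReal.ofReal (4*T) * M3 g z := by
    refine (setLIntegral_le_lintegral _ _).trans ?_
    rw [lintegral_indicator measurableSet_Icc]
    refine (M3_holder hg.meas z (2*T) 1 (by positivity) (by norm_num) subset_rfl ?_).trans (le_of_eq ?_)
    · rw [Real.volume_Icc]; apply ENNReal.ofReal_le_ofReal; linarith
    · rw [Real.one_rpow]; congr 2; ring
  have hin : ∀ p ∈ V', p.I ⊆ Icc (z - 3*T) (z + 3*T) := by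
    intro p hp w hw
    obtain ⟨hp1, hp2, x, hx, hx2, -⟩ := Finset.mem_filter.1 hp
    have := Dy_dist hw (X.E_sub_I p hx)
    have h5 : (2:ℝ)^p.s ≤ T := zpow_le_zpow_right₀ (by norm_num) hp2
    rw [abs_lt] at hx2; have := abs_lt.1 (lt_of_lt_of_le this h5)
    rw [mem_Icc]; constructor <;> linarith
  have hsv := X.sparse_vol n (l+1) V' (fun p hp => (X.mem_tiles.1 (hV (Finset.mem_filter.1 hp).1)).2.2.1) (X.N z) (by
    intro p hp
    obtain ⟨hp1, hp2, x, hx, hx2, hx3⟩ := Finset.mem_filter.1 hp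
    have := Tile.Om_close (X.E_sub_A p hx).2
    calc |X.N z - p.c| ≤ |X.N z - X.N x| + |X.N x - p.c| := by
          have := abs_add_le (X.N z - X.N x) (X.N x - p.c); rwa [sub_add_sub_cancel] at this
      _ ≤ 2^l * p.L⁻¹ + 1 * p.L⁻¹ := by have := inv_pos.2 p.L_pos; linarith
      _ ≤ 2^l * p.L⁻¹ + 2^l * p.L⁻¹ := by
          have := inv_pos.2 p.L_pos
          have h1 : (1:ℝ) ≤ 2^l := one_le_pow₀ (by norm_num)
          gcongr
      _ = _ := by ring) (fun p hp => hn p (Finset.mem_filter.1 hp).1)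
  set v : ℝ := 2 * 2^(2*(l+1))/2^n with hv
  have hv0 : 0 ≤ v := by positivity
  have h6 : ∫⁻ x in X.EU V', ‖g x‖ₑ ≤ ENNReal.ofReal (6*T*(2 * 2^(-(n:ℝ)/6))) * M3 g z := by
    refine (M3_holder hg.meas z (3*T) v (by positivity) hv0 ?_ ?_).trans ?_
    · intro x hx; obtain ⟨p, hp, hx⟩ := X.mem_EU.1 hx; exact hin p hp (X.E_sub_I p hx)
    · refine hsv.trans ?_
      have : volume (⋃ p ∈ V', p.I) ≤ ENNReal.ofReal (6*T) := by
        refine (measure_mono (iUnion₂_subset hin)).trans ?_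
        rw [Real.volume_Icc]; apply ENNReal.ofReal_le_ofReal; linarith
      refine (mul_le_mul' le_rfl this).trans ?_
      rw [← ENNReal.ofReal_mul hv0]; apply ENNReal.ofReal_le_ofReal; linarith
    · refine mul_le_mul' (ENNReal.ofReal_le_ofReal ?_) le_rfl
      rw [show 2 * (3*T) = 6*T by ring]
      exact mul_le_mul_of_nonneg_left (two_quarter' n) (by positivity)
  refine (add_le_add (mul_le_mul' le_rfl h4) (mul_le_mul' le_rfl h6)).trans ?_
  rw [← mul_assoc, ← mul_assoc, ← add_mul, hα, hβ, ← ENNReal.ofReal_mul (by positivity), ← ENNReal.ofReal_mul (by positivity),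
    ← ENNReal.ofReal_add (by positivity) (by positivity)]
  refine mul_le_mul' (ENNReal.ofReal_le_ofReal ?_) le_rfl
  have h7 := two_quarter n
  have h8 : T⁻¹ * T = 1 := inv_mul_cancel₀ hT0.ne'
  set w := (2:ℝ)^(-(n:ℝ)/6)
  have hw : 0 < w := by positivity
  calc _ = (T⁻¹ * T) * (8400 * 2^(-(l:ℝ)) + 25200 * w) := by ring
    _ = 8400 * 2^(-(l:ℝ)) + 25200 * w := by rw [h8, one_mul]
    _ ≤ _ := by rw [hl]; linarith
lemma anti_L2 : ∃ C : ℝ≥0, ∀ (X : Cx) (n : ℕ) (V : Finset Tile), V ⊆ X.tiles → (∀ p ∈ V, ¬ X.Heavy n p) →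
    (∀ p ∈ V, ∀ q ∈ V, ∀ x, x ∈ X.E p → x ∈ X.E q → p = q) → ∀ f, Bd f →
    ∫⁻ x, ‖op (X.K V) f x‖ₑ ^ 2 ≤ ENNReal.ofReal (2^(-(n:ℝ)/6)) * (C * ∫⁻ x, ‖f x‖ₑ ^ 2) := by
  obtain ⟨C, hC⟩ := M3_L2
  refine ⟨100000 * (1 + C), fun X n V hV hn hd f hf => ?_⟩
  rw [← mul_assoc]
  refine l2_dual (X.BK_K V) _ (fun g hg => ?_) f hf
  set F : Tile → ℝ → ℂ := fun p => op (adj (X.K {p})) g with hF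
  have e : ∀ x, op (adj (X.K V)) g x = ∑ p ∈ V, F p x := fun x =>
    adj_sum V (fun p => X.K {p}) (fun p _ => X.BK_K {p}) (X.K_sum V) hg x
  simp_rw [e]
  refine (sum_sq_le V F (fun p _ => hg.op (X.BK_K {p}).adj)).trans ?_
  refine (sum_symm V (fun p p' => ‖∫ x, F p x * conj (F p' x)‖ₑ) (fun p => p.s) (fun p p' => inner_symm _ _)).trans ?_
  have h1 : ∀ p' ∈ V, ∑ p ∈ V.filter (fun p => p.s ≤ p'.s), ‖∫ x, F p x * conj (F p' x)‖ₑ ≤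
      ∫⁻ z in X.E p', ‖g z‖ₑ * (ENNReal.ofReal (50000 * 2^(-(n:ℝ)/6)) * M3 g z) := by
    intro p' hp'
    refine (Finset.sum_le_sum fun p _ => X.pair_int p p' hg).trans ?_
    refine (sum_lintegral_le _ _ _).trans ?_
    refine lintegral_mono fun z => ?_
    simp only
    rw [← Finset.mul_sum]
    exact mul_le_mul' le_rfl (X.anti_H n V hV hn hd hg p'.s z)
  refine (mul_le_mul' le_rfl (Finset.sum_le_sum h1)).trans ?_
  rw [X.sum_E hd]
  refine (mul_le_mul' le_rfl (setLIntegral_le_lintegral _ _)).trans ?_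
  have h2 : ∀ z, ‖g z‖ₑ * (ENNReal.ofReal (50000 * 2^(-(n:ℝ)/6)) * M3 g z) = ENNReal.ofReal (50000 * 2^(-(n:ℝ)/6)) * (‖g z‖ₑ * M3 g z) := by
    intro z; ring
  simp_rw [h2]
  have m3 : Measurable fun z => ‖g z‖ₑ * M3 g z := hg.meas.enorm.mul (M3_meas hg.meas)
  rw [lintegral_const_mul _ m3]
  have h3 : ∫⁻ z, ‖g z‖ₑ * M3 g z ≤ (1 + C) * ∫⁻ z, ‖g z‖ₑ^2 := by
    refine (lintegral_mono fun z => mul_le_sq_add _ _).trans ?_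
    rw [lintegral_add_left (hg.meas.enorm.pow_const _), add_mul, one_mul]
    exact add_le_add le_rfl (hC g hg)
  refine (mul_le_mul' le_rfl (mul_le_mul' le_rfl h3)).trans (le_of_eq ?_)
  rw [ENNReal.ofReal_mul (by norm_num)]
  push_cast
  rw [show ENNReal.ofReal 50000 = 50000 by norm_num]
  ring
/-- pointwise bound for antichains -/
lemma anti_pt (X : Cx) (V : Finset Tile) (hd : ∀ p ∈ V, ∀ q ∈ V, ∀ x, x ∈ X.E p → x ∈ X.E q → p = q) {f : ℝ → ℂ} (hf : Bd f) (x : ℝ) :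
    ‖op (X.K V) f x‖ₑ ≤ 8 * MN f x := by
  by_cases hx : x ∈ X.EU V
  swap
  · rw [X.op_K_zero V f hx]; simp
  obtain ⟨p, hp, hx⟩ := X.mem_EU.1 hx
  rw [X.op_K V hf, Finset.sum_eq_single_of_mem p hp]
  · rw [indicator_of_mem hx]
    refine (op_kp_le _ _ _).trans ?_
    rw [MN_md]
  · intro q hq hqp
    exact indicator_of_notMem (fun h => hqp (hd q hq p hp x h hx)) _
lemma adjK (X : Cx) (V : Finset Tile) (x y : ℝ) : conj (X.K V x y) = ∑ p ∈ V, (X.E p).indicator (fun x => kp p.s x y * ex (X.N x * y)) x := by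
  rw [X.K_sum, map_sum]
  refine Finset.sum_congr rfl fun p _ => ?_
  rw [K_single]
  by_cases hx : x ∈ X.E p
  · rw [indicator_of_mem hx, indicator_of_mem hx, map_mul, ex_conj, neg_neg]
    congr 1; unfold kp; rw [Complex.conj_ofReal]
  · rw [indicator_of_notMem hx, indicator_of_notMem hx, map_zero]
lemma op_adjK (X : Cx) (V : Finset Tile) (g : ℝ → ℂ) (y : ℝ) : op (adj (X.K V)) g y = ∫ x, conj (X.K V x y) * g x := rfl
lemma adj_zero (X : Cx) (V : Finset Tile) (g : ℝ → ℂ) (y : ℝ) (h : ∀ p ∈ V, ∀ x ∈ p.I, p.L ≤ |x - y|) : op (adj (X.K V)) g y = 0 := by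
  rw [op_adjK]
  have : ∀ x, conj (X.K V x y) * g x = 0 := by
    intro x
    rw [adjK, Finset.sum_eq_zero, zero_mul]
    intro p hp
    by_cases hx : x ∈ X.E p
    · rw [indicator_of_mem hx, kp_zero _ (h p hp x (X.E_sub_I p hx)), zero_mul]
    · rw [indicator_of_notMem hx]
  simp [this]
lemma adj_restrict (X : Cx) (V : Finset Tile) (g : ℝ → ℂ) (y : ℝ) : op (adj (X.K V)) ((X.EU V).indicator g) y = op (adj (X.K V)) g y := by
  rw [op_adjK, op_adjK]
  refine integral_congr_ae (ae_of_all _ fun x => ?_)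
  simp only
  by_cases hx : x ∈ X.EU V
  · rw [indicator_of_mem hx]
  · rw [adjK, Finset.sum_eq_zero, zero_mul, zero_mul]
    intro p hp
    exact indicator_of_notMem (fun h => hx (X.mem_EU.2 ⟨p, hp, h⟩)) _
lemma adiff (X : Cx) (V : Finset Tile) (ξ h y z : ℝ) (s0 s1 : ℤ) (h0 : ∀ p ∈ V, s0 ≤ p.s) (h1 : ∀ p ∈ V, p.s ≤ s1)
    (hh : |h| ≤ (2:ℝ)^s0) (hξ : ∀ p ∈ V, |ξ - p.c| ≤ p.L⁻¹) {g : ℝ → ℂ} (hg : Bd g) (hz1 : |z - y| ≤ |h|) (hz2 : |z - (y - h)| ≤ |h|) :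
    ‖ex (-(ξ * y)) * op (adj (X.K V)) g y - ex (-(ξ * (y-h))) * op (adj (X.K V)) g (y-h)‖ₑ ≤
      ENNReal.ofReal (400 * |h| * (2:ℝ)^(-s0)) * MN ((X.EU V).indicator g) z := by
  classical
  have i1 := (hg.kint ((X.BK_K V).adj.slice y))
  have i2 := (hg.kint ((X.BK_K V).adj.slice (y-h)))
  unfold op
  rw [← integral_const_mul, ← integral_const_mul, ← integral_sub (i1.const_mul _) (i2.const_mul _)]
  refine (enorm_integral_le_lintegral_enorm _).trans ?_
  set w : ℤ → ℝ → ℝ≥0∞ := fun s x => ENNReal.ofReal (46 * (2:ℝ)^(-s) * (2:ℝ)^(-s) * |h|) *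
    (Icc (z - 2*(2:ℝ)^s) (z + 2*(2:ℝ)^s)).indicator (fun x => ‖(X.EU V).indicator g x‖ₑ) x with hw
  have hgm : Measurable fun x => ‖(X.EU V).indicator g x‖ₑ := (hg.indicator (X.EU_meas V)).meas.enorm
  have hwm : ∀ s, Measurable (w s) := fun s => (hgm.indicator measurableSet_Icc).const_mul _
  have hpt : ∀ x, ‖ex (-(ξ * y)) * (adj (X.K V) y x * g x) - ex (-(ξ * (y-h))) * (adj (X.K V) (y-h) x * g x)‖ₑ ≤
      ∑ p ∈ V, (X.E p).indicator (w p.s) x := by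
    intro x
    have e : ex (-(ξ * y)) * (adj (X.K V) y x * g x) - ex (-(ξ * (y-h))) * (adj (X.K V) (y-h) x * g x) =
        ∑ p ∈ V, (X.E p).indicator (fun x => (kp p.s x y * ex ((X.N x - ξ) * y) - kp p.s x (y-h) * ex ((X.N x - ξ) * (y-h))) * g x) x := by
      have : ∀ y, adj (X.K V) y x = conj (X.K V x y) := fun y => rfl
      rw [this, this, adjK, adjK, Finset.sum_mul, Finset.sum_mul, Finset.mul_sum, Finset.mul_sum, ← Finset.sum_sub_distrib]
      refine Finset.sum_congr rfl fun p _ => ?_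
      by_cases hx : x ∈ X.E p
      · simp only [indicator_of_mem hx]
        rw [show (X.N x - ξ) * y = X.N x * y + -(ξ * y) by ring, show (X.N x - ξ) * (y-h) = X.N x * (y-h) + -(ξ * (y-h)) by ring, ex_add, ex_add]
        ring
      · simp only [indicator_of_notMem hx]; simp
    rw [e]
    refine (enorm_sum_le _ _).trans (Finset.sum_le_sum fun p hp => ?_)
    by_cases hx : x ∈ X.E p
    swap
    · simp only [indicator_of_notMem hx]; simp
    simp only [indicator_of_mem hx]
    have hL : (2:ℝ)^s0 ≤ (2:ℝ)^p.s := zpow_le_zpow_right₀ (by norm_num) (h0 p hp)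
    by_cases hxz : x ∈ Icc (z - 2*(2:ℝ)^p.s) (z + 2*(2:ℝ)^p.s)
    · simp only [hw, indicator_of_mem hxz, indicator_of_mem (X.mem_EU.2 ⟨p, hp, hx⟩)]
      rw [enorm_mul]
      refine mul_le_mul' (enorm_le_of_norm ?_) le_rfl
      have hNx : |X.N x - ξ| ≤ 3/2 * (2:ℝ)^(-p.s) := by
        have a1 := Tile.Om_close (X.E_sub_A p hx).2
        have a2 := hξ p hp
        rw [Tile.inv_L] at a1 a2
        have := abs_sub_le (X.N x) p.c ξ
        rw [abs_sub_comm p.c ξ] at this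
        linarith
      have e2 : kp p.s x y * ex ((X.N x - ξ) * y) - kp p.s x (y-h) * ex ((X.N x - ξ) * (y-h)) =
          (kp p.s x y - kp p.s x (y-h)) * ex ((X.N x - ξ) * y) + kp p.s x (y-h) * (ex ((X.N x - ξ) * y) - ex ((X.N x - ξ) * (y-h))) := by ring
      rw [e2]
      refine (norm_add_le _ _).trans ?_
      rw [norm_mul, norm_mul]
      have b1 := kp_lip2 p.s x y h
      have b2 := kp_norm_le p.s x (y-h)
      have b3 := ex_sub_ex ((X.N x - ξ) * y) ((X.N x - ξ) * (y-h))
      rw [show (X.N x - ξ) * y - (X.N x - ξ) * (y-h) = (X.N x - ξ) * h by ring, abs_mul] at b3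
      have b4 : ‖ex ((X.N x - ξ) * y)‖ = 1 := by unfold ex; exact Complex.norm_exp_ofReal_mul_I _
      rw [b4, mul_one]
      have hpos : (0:ℝ) < (2:ℝ)^(-p.s) := by positivity
      calc _ ≤ 40 * (2:ℝ)^(-p.s) * (2:ℝ)^(-p.s) * |h| + 4 * (2:ℝ)^(-p.s) * (3/2 * (2:ℝ)^(-p.s) * |h|) := by
            refine add_le_add b1 (mul_le_mul b2 (b3.trans ?_) (norm_nonneg _) (by positivity))
            exact mul_le_mul_of_nonneg_right hNx (abs_nonneg _)
        _ = _ := by ring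
    · have hfar : 2*(2:ℝ)^p.s < |x - z| := by
        by_contra hc; push Not at hc; rw [abs_le] at hc
        exact hxz ⟨by linarith, by linarith⟩
      have c1 : (2:ℝ)^p.s ≤ |x - y| := by
        have := abs_sub_le x y z; rw [abs_sub_comm y z] at this; linarith
      have c2 : (2:ℝ)^p.s ≤ |x - (y-h)| := by
        have := abs_sub_le x (y-h) z; rw [abs_sub_comm (y-h) z] at this; linarith
      rw [kp_zero _ c1, kp_zero _ c2]; simp
  refine (lintegral_mono hpt).trans ?_
  rw [lintegral_finsetSum _ (fun p _ => (hwm p.s).indicator (X.E_meas p))]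
  rw [Finset.sum_congr rfl fun p _ => lintegral_indicator (X.E_meas p) (w p.s)]
  rw [← Finset.sum_fiberwise_of_maps_to (s := V) (t := Finset.Icc s0 s1) (g := fun p => p.s) (fun p hp => Finset.mem_Icc.2 ⟨h0 p hp, h1 p hp⟩)]
  set m := MN ((X.EU V).indicator g) z with hm
  have hs : ∀ s ∈ Finset.Icc s0 s1, ∑ p ∈ V with p.s = s, ∫⁻ x in X.E p, w p.s x ≤ ENNReal.ofReal (200 * |h| * (2:ℝ)^(-s)) * m := by
    intro s _
    have : ∑ p ∈ V with p.s = s, ∫⁻ x in X.E p, w p.s x = ∑ p ∈ V with p.s = s, ∫⁻ x in X.E p, w s x :=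
      Finset.sum_congr rfl fun p hp => by rw [(Finset.mem_filter.1 hp).2]
    rw [this, X.sum_E (fun p hp q hq x hx hx' => X.E_eq ((Finset.mem_filter.1 hp).2.trans (Finset.mem_filter.1 hq).2.symm) (X.E_sub_A p hx) (X.E_sub_A q hx'))]
    refine (setLIntegral_le_lintegral _ _).trans ?_
    rw [hw]
    simp only
    rw [lintegral_const_mul _ (hgm.indicator measurableSet_Icc), lintegral_indicator measurableSet_Icc]
    refine (mul_le_mul' le_rfl (lintegral_le_MM _ z (2*(2:ℝ)^s) (by positivity) _ subset_rfl)).trans ?_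
    rw [← mul_assoc, ← ENNReal.ofReal_mul (by positivity)]
    refine mul_le_mul' (ENNReal.ofReal_le_ofReal ?_) le_rfl
    have hc : (2:ℝ)^(-s) * (2:ℝ)^s = 1 := by rw [zpow_neg, inv_mul_cancel₀ (by positivity)]
    calc _ = 184 * |h| * (2:ℝ)^(-s) * ((2:ℝ)^(-s) * (2:ℝ)^s) := by ring
      _ ≤ _ := by
        rw [hc, mul_one]; gcongr; norm_num
  refine (Finset.sum_le_sum hs).trans ?_
  rw [← Finset.sum_mul, ← ENNReal.ofReal_sum_of_nonneg (fun s _ => by positivity), ← Finset.mul_sum]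
  refine mul_le_mul' (ENNReal.ofReal_le_ofReal ?_) le_rfl
  have := geo_dn s0 s1
  calc _ ≤ 200 * |h| * (2 * (2:ℝ)^(-s0)) := by gcongr
    _ = _ := by ring
end Cx
lemma ex_norm (t : ℝ) : ‖ex t‖ = 1 := by unfold ex; exact Complex.norm_exp_ofReal_mul_I _
lemma ex_enorm (t : ℝ) : ‖ex t‖ₑ = 1 := by rw [← ofReal_norm, ex_norm, ENNReal.ofReal_one]
lemma conj_enorm (z : ℂ) : ‖conj z‖ₑ = ‖z‖ₑ := by rw [← ofReal_norm, RCLike.norm_conj, ofReal_norm]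
namespace Cx
lemma tree_supp (X : Cx) {n : ℕ} {u : Tile} {V : Finset Tile} (hT : X.IsTree n u V) (g : ℝ → ℂ) {y : ℝ} (hy : y ∉ u.I) :
    op (adj (X.K V)) g y = 0 := by
  refine X.adj_zero V g y fun p hp x hx => ?_
  by_contra hc
  push Not at hc
  exact hy (hT.in5 p hp x hx y (by have := p.L_pos; linarith))
/-- the two tree estimate -/
lemma two_tree (X : Cx) {n : ℕ} {u1 u2 : Tile} {V1 V2 : Finset Tile} (hT1 : X.IsTree n u1 V1) (hT2 : X.IsTree n u2 V2)
    (B : ℝ) (hB : 8 ≤ B) (hs1 : ∀ p ∈ V1, B ≤ |u1.c - u2.c| * p.L) (hs2 : ∀ p ∈ V2, p.I ⊆ u1.I → B ≤ |u1.c - u2.c| * p.L) {g : ℝ → ℂ} (hg : Bd g) :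
    ‖∫ y, op (adj (X.K V1)) g y * conj (op (adj (X.K V2)) g y)‖ₑ ≤ ENNReal.ofReal (2000 / B) *
      ((∫⁻ y in u1.I, MN ((X.EU V1).indicator g) y * ‖op (adj (X.K V2)) g y‖ₑ) +
        ∫⁻ y in u1.I, ‖op (adj (X.K V1)) g y‖ₑ * MN ((X.EU V2).indicator g) y) := by
  classical
  rcases V1.eq_empty_or_nonempty with he | hne
  · have : ∀ y, op (adj (X.K V1)) g y = 0 := fun y => X.adj_zero V1 g y (by rw [he]; simp)
    simp [this]
  obtain ⟨p1, hp1⟩ := hne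
  set d := u1.c - u2.c with hd
  have hp1L := p1.L_pos
  have hd0 : 0 < |d| := by
    have := hs1 p1 hp1
    by_contra hc
    have : |d| * p1.L ≤ 0 := mul_nonpos_of_nonpos_of_nonneg (not_lt.1 hc) hp1L.le
    linarith
  have hdne : d ≠ 0 := abs_pos.1 hd0
  set h := Real.pi / d with hh
  have habs : |h| = Real.pi / |d| := by rw [hh, abs_div, abs_of_pos Real.pi_pos]
  have hpi := Real.pi_lt_d2
  have hpi0 := Real.pi_pos
  set W := V2.filter (fun p => B ≤ |d| * p.L) with hW
  set Z := V2.filter (fun p => ¬ B ≤ |d| * p.L) with hZ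
  set F1 := op (adj (X.K V1)) g with hF1
  set F2 := op (adj (X.K V2)) g with hF2
  set FW := op (adj (X.K W)) g with hFW
  set FZ := op (adj (X.K Z)) g with hFZ
  have hF1B : Bd F1 := hg.op (X.BK_K V1).adj
  have hFWB : Bd FW := hg.op (X.BK_K W).adj
  have hsplit : ∀ y, F2 y = FW y + FZ y := by
    intro y
    have e : ∀ V : Finset Tile, op (adj (X.K V)) g y = ∑ p ∈ V, op (adj (X.K {p})) g y := fun V =>
      adj_sum V (fun p => X.K {p}) (fun p _ => X.BK_K {p}) (X.K_sum V) hg y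
    rw [hF2, hFW, hFZ, e V2, e W, e Z, hW, hZ, Finset.sum_filter_add_sum_filter_not]
  -- scale bound
  have hsc : ∀ p : Tile, B ≤ |d| * p.L → |h| ≤ Real.pi / B * p.L := by
    intro p hp
    rw [habs, div_mul_eq_mul_div, div_le_div_iff₀ hd0 (by linarith)]
    nlinarith
  have hB' : Real.pi / B ≤ 1/2 := by rw [div_le_iff₀ (by linarith)]; linarith
  -- F Z vanishes near tiles of V1
  have hZ0 : ∀ y, ∀ p ∈ V1, ∀ x ∈ p.I, |x - y| < 3/2 * p.L → FZ y = 0 := by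
    intro y p hp x hx hxy
    refine X.adj_zero Z g y fun q hq x' hx' => ?_
    by_contra hc
    push Not at hc
    obtain ⟨hq2, hqB⟩ := Finset.mem_filter.1 hq
    have hqp : q.L < p.L := by
      by_contra hc'
      push Not at hc'
      exact hqB ((hs1 p hp).trans (mul_le_mul_of_nonneg_left hc' hd0.le))
    have hqs : q.s + 1 ≤ p.s := by
      by_contra hc'; have : p.s ≤ q.s := by omega
      exact absurd (Tile.L_le this) (not_le.2 hqp)
    have hqp2 : 2 * q.L ≤ p.L := by
      have : (2:ℝ)^(q.s+1) ≤ (2:ℝ)^p.s := zpow_le_zpow_right₀ (by norm_num) hqs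
      rw [zpow_add₀ (by norm_num)] at this; unfold Tile.L; linarith
    have hx'u : x' ∈ u1.I := by
      refine hT1.in5 p hp x hx x' ?_
      have := abs_sub_le x y x'; rw [abs_sub_comm y x'] at this; linarith
    have hps : p.s ≤ u1.s := by
      refine Tile.I_scale (fun w hw => hT1.in5 p hp w hw w ?_)
      rw [sub_self, abs_zero]; have := p.L_pos; linarith
    exact hqB (hs2 q hq2 (Tile.I_nest (by omega) hx' hx'u))
  have hloc1 : ∀ y, F1 y ≠ 0 → ∃ p ∈ V1, ∃ x ∈ p.I, |x - y| < p.L := by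
    intro y hy
    by_contra hc
    push Not at hc
    exact hy (X.adj_zero V1 g y hc)
  have hin : ∀ (y : ℝ) (p : Tile), p ∈ V1 → ∀ x ∈ p.I, |x - y| < 3/2 * p.L → y ∈ u1.I := fun y p hp x hx hxy =>
    hT1.in5 p hp x hx y (by have := p.L_pos; linarith)
  -- minimal scales
  obtain ⟨q1, hq1, hq1m⟩ := V1.exists_min_image (fun p => p.s) ⟨p1, hp1⟩
  obtain ⟨r1, hr1, hr1m⟩ := V1.exists_max_image (fun p => p.s) ⟨p1, hp1⟩
  set A1 : ℝ → ℂ := fun y => ex (-(u1.c * y)) * F1 y with hA1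
  set A2 : ℝ → ℂ := fun y => ex (-(u2.c * y)) * FW y with hA2
  have hconst : ∀ p : Tile, B ≤ |d| * p.L → 400 * |h| * (2:ℝ)^(-p.s) ≤ 2000 / B := by
    intro p hp
    have h1 := hsc p hp
    have h2 : p.L * (2:ℝ)^(-p.s) = 1 := by rw [← Tile.inv_L, mul_inv_cancel₀ p.L_pos.ne']
    calc 400 * |h| * (2:ℝ)^(-p.s) ≤ 400 * (Real.pi / B * p.L) * (2:ℝ)^(-p.s) := by gcongr
      _ = 400 * Real.pi / B * (p.L * (2:ℝ)^(-p.s)) := by ring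
      _ ≤ _ := by rw [h2, mul_one]; gcongr; linarith
  have hhL : ∀ p : Tile, B ≤ |d| * p.L → |h| ≤ 1/2 * p.L := fun p hp =>
    (hsc p hp).trans (mul_le_mul_of_nonneg_right hB' p.L_pos.le)
  have hD1 : ∀ y, ‖A1 y - A1 (y-h)‖ₑ ≤ ENNReal.ofReal (2000/B) * MN ((X.EU V1).indicator g) y := by
    intro y
    refine (X.adiff V1 u1.c h y y q1.s r1.s hq1m hr1m ?_ hT1.cl hg (by simp) (by simp)).trans ?_
    · have := hhL q1 (hs1 q1 hq1); unfold Tile.L at this; have := zpow_pos (show (0:ℝ)<2 by norm_num) q1.s; linarith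
    · exact mul_le_mul' (ENNReal.ofReal_le_ofReal (hconst q1 (hs1 q1 hq1))) le_rfl
  have hD2 : ∀ y, ‖A2 y - A2 (y-h)‖ₑ ≤ ENNReal.ofReal (2000/B) * MN ((X.EU V2).indicator g) (y-h) := by
    intro y
    rcases W.eq_empty_or_nonempty with he | hne
    · have : ∀ y, FW y = 0 := fun y => X.adj_zero W g y (by rw [he]; simp)
      simp [hA2, this]
    obtain ⟨q2, hq2, hq2m⟩ := W.exists_min_image (fun p => p.s) hne
    obtain ⟨r2, hr2, hr2m⟩ := W.exists_max_image (fun p => p.s) hne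
    have hq2B := (Finset.mem_filter.1 hq2).2
    refine (X.adiff W u2.c h y (y-h) q2.s r2.s hq2m hr2m ?_ (fun p hp => hT2.cl p (Finset.mem_filter.1 hp).1) hg (by simp) (by simp)).trans ?_
    · have := hhL q2 hq2B; unfold Tile.L at this; have := zpow_pos (show (0:ℝ)<2 by norm_num) q2.s; linarith
    · refine mul_le_mul' (ENNReal.ofReal_le_ofReal (hconst q2 hq2B)) (MM_mono (fun x => ?_) _)
      by_cases hx : x ∈ X.EU W
      · have : x ∈ X.EU V2 := by
          obtain ⟨p, hp, hx⟩ := X.mem_EU.1 hx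
          exact X.mem_EU.2 ⟨p, (Finset.mem_filter.1 hp).1, hx⟩
        rw [indicator_of_mem hx, indicator_of_mem this]
      · rw [indicator_of_notMem hx]; simp
  -- the inner product
  have hip : ∫ y, F1 y * conj (F2 y) = ∫ y, (A1 y * conj (A2 y)) * ex (d * y) := by
    refine integral_congr_ae (ae_of_all _ fun y => ?_)
    simp only
    by_cases hy : F1 y = 0
    · simp [hA1, hy]
    obtain ⟨p, hp, x, hx, hxy⟩ := hloc1 y hy
    have : FZ y = 0 := hZ0 y p hp x hx (by have := p.L_pos; linarith)
    rw [hsplit, this, add_zero, hA1, hA2]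
    simp only
    rw [map_mul, ex_conj, neg_neg]
    have : ex (-(u1.c*y)) * ex (u2.c*y) * ex (d*y) = 1 := by
      rw [← ex_add, ← ex_add, hd, ← ex_zero]; congr 1; ring
    linear_combination (-(F1 y * conj (FW y))) * this
  have hA1B : Bd A1 := hF1B.ex_mul (φ := fun y => -(u1.c * y)) (by fun_prop)
  have hA2B : Bd A2 := hFWB.ex_mul (φ := fun y => -(u2.c * y)) (by fun_prop)
  have hnA1 : ∀ y, ‖A1 y‖ₑ = ‖F1 y‖ₑ := fun y => by rw [hA1]; simp only; rw [enorm_mul, ex_enorm, one_mul]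
  have hnA2 : ∀ y, ‖A2 y‖ₑ = ‖FW y‖ₑ := fun y => by rw [hA2]; simp only; rw [enorm_mul, ex_enorm, one_mul]
  rw [hip, osc _ (hA1B.mul hA2B.conj) d hdne, enorm_mul]
  have hhalf : ‖(1/2:ℂ)‖ₑ ≤ 1 := by
    rw [← ofReal_norm, ← ENNReal.ofReal_one]; apply ENNReal.ofReal_le_ofReal; norm_num
  refine (mul_le_mul' hhalf (enorm_integral_le_lintegral_enorm _)).trans ?_
  rw [one_mul]
  set T1 : ℝ → ℝ≥0∞ := fun y => u1.I.indicator (fun y => MN ((X.EU V1).indicator g) y * ‖F2 y‖ₑ) y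
  set T2 : ℝ → ℝ≥0∞ := fun y => u1.I.indicator (fun y => ‖F1 y‖ₑ * MN ((X.EU V2).indicator g) y) y with hT2'
  have mM : ∀ V, Measurable (MN ((X.EU V).indicator g)) := fun V => measurable_MM (hg.indicator (X.EU_meas V)).meas.enorm
  have hF2B : Bd F2 := hg.op (X.BK_K V2).adj
  have mT1 : Measurable T1 := ((mM V1).mul hF2B.meas.enorm).indicator u1.I_meas
  have mT2 : Measurable T2 := (hF1B.meas.enorm.mul (mM V2)).indicator u1.I_meas
  have hpt : ∀ y, ‖(A1 y * conj (A2 y) - A1 (y - Real.pi / d) * conj (A2 (y - Real.pi/d))) * ex (d * y)‖ₑ ≤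
      ENNReal.ofReal (2000/B) * (T1 y + T2 (y - h)) := by
    intro y
    rw [enorm_mul, ex_enorm, mul_one, ← hh]
    have e : A1 y * conj (A2 y) - A1 (y - h) * conj (A2 (y - h)) = (A1 y - A1 (y-h)) * conj (A2 y) + A1 (y-h) * conj (A2 y - A2 (y-h)) := by
      rw [map_sub]; ring
    rw [e, mul_add]
    refine (enorm_add_le _ _).trans (add_le_add ?_ ?_)
    · rw [enorm_mul, conj_enorm, hnA2]
      by_cases hz : A1 y - A1 (y-h) = 0
      · rw [hz]; simp
      have : ∃ p ∈ V1, ∃ x ∈ p.I, |x - y| < 3/2 * p.L := by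
        by_cases h1 : F1 y = 0
        · have h2 : F1 (y-h) ≠ 0 := by
            intro h2; exact hz (by simp [hA1, h1, h2])
          obtain ⟨p, hp, x, hx, hxy⟩ := hloc1 _ h2
          refine ⟨p, hp, x, hx, ?_⟩
          have a1 := abs_sub_le x (y-h) y
          rw [show y - h - y = -h by ring, abs_neg] at a1
          have := hhL p (hs1 p hp)
          linarith
        · obtain ⟨p, hp, x, hx, hxy⟩ := hloc1 _ h1
          exact ⟨p, hp, x, hx, by have := p.L_pos; linarith⟩
      obtain ⟨p, hp, x, hx, hxy⟩ := this
      have hyu := hin y p hp x hx hxy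
      have : T1 y = MN ((X.EU V1).indicator g) y * ‖F2 y‖ₑ := indicator_of_mem hyu _
      rw [this, hsplit, hZ0 y p hp x hx hxy, add_zero, ← mul_assoc]
      exact mul_le_mul' (hD1 y) le_rfl
    · rw [enorm_mul, conj_enorm, hnA1]
      by_cases hz : F1 (y-h) = 0
      · rw [hz]; simp
      have hyu : y - h ∈ u1.I := by
        by_contra hc; exact hz (X.tree_supp hT1 g hc)
      have : T2 (y-h) = ‖F1 (y-h)‖ₑ * MN ((X.EU V2).indicator g) (y-h) := indicator_of_mem hyu _
      rw [this]
      refine (mul_le_mul' le_rfl (hD2 y)).trans (le_of_eq ?_)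
      ring
  refine (lintegral_mono hpt).trans ?_
  have m3 : Measurable fun y => T1 y + T2 (y-h) := mT1.add (mT2.comp (measurable_id.sub_const h))
  rw [lintegral_const_mul _ m3, lintegral_add_left mT1, lintegral_sub_right_eq_self T2 h]
  refine mul_le_mul' le_rfl (add_le_add ?_ ?_)
  · rw [lintegral_indicator u1.I_meas]
  · rw [lintegral_indicator u1.I_meas]
lemma tree_adj : ∃ C : ℝ≥0, ∀ (X : Cx) (n : ℕ) (u : Tile) (V : Finset Tile), X.IsTree n u V → ∀ g, Bd g →
    ∫⁻ x, ‖op (adj (X.K V)) g x‖ₑ ^ 2 ≤ ENNReal.ofReal (2 / 2^n) * (C * ∫⁻ x in X.EU V, ‖g x‖ₑ ^ 2) := by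
  obtain ⟨C, hC⟩ := tree_bound 2 (by norm_num)
  refine ⟨C, fun X n u V hT g hg => ?_⟩
  have hadj : adj (adj (X.K V)) = X.K V := by funext x y; simp [adj]
  have h1 := l2_dual (X.BK_K V).adj (ENNReal.ofReal (2 / 2^n) * C) (fun f hf => by
    rw [hadj]
    have := hC X n u V hT f hf
    simp only [ENNReal.rpow_two] at this
    refine this.trans ?_
    rw [mul_assoc]
    exact mul_le_mul' le_rfl (mul_le_mul' le_rfl (setLIntegral_le_lintegral _ _))) _ (hg.indicator (X.EU_meas V))
  simp_rw [X.adj_restrict V g] at h1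
  refine h1.trans (le_of_eq ?_)
  rw [mul_assoc, ← lintegral_indicator (X.EU_meas V)]
  congr 3
  funext x
  by_cases hx : x ∈ X.EU V
  · rw [indicator_of_mem hx, indicator_of_mem hx]
  · rw [indicator_of_notMem hx, indicator_of_notMem hx]; simp
structure IsForest (X : Cx) (n : ℕ) (B Λ : ℝ) (U : Finset Tile) (V : Tile → Finset Tile) : Prop where
  tree : ∀ u ∈ U, X.IsTree n u (V u)
  sep : ∀ u ∈ U, ∀ u' ∈ U, u ≠ u' → ∀ p ∈ V u, p.I ⊆ u'.I → B ≤ |u.c - u'.c| * p.L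
  disj : ∀ u ∈ U, ∀ u' ∈ U, ∀ x, x ∈ X.EU (V u) → x ∈ X.EU (V u') → u = u'
  ov : ∀ x, ∑ u ∈ U, u.I.indicator (fun _ => (1:ℝ≥0∞)) x ≤ ENNReal.ofReal Λ
lemma forest_sum (X : Cx) {n : ℕ} {B Λ : ℝ} {U : Finset Tile} {V : Tile → Finset Tile} (hF : X.IsForest n B Λ U V) (h : ℝ → ℝ≥0∞) :
    ∑ u ∈ U, ∫⁻ x in X.EU (V u), h x ≤ ∫⁻ x, h x := by
  rw [← lintegral_biUnion_finset _ (fun u _ => X.EU_meas (V u))]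
  · exact setLIntegral_le_lintegral _ _
  · intro u hu u' hu' hne
    exact Set.disjoint_left.2 fun x h1 h2 => hne (hF.disj u hu u' hu' x h1 h2)
lemma forest_ov {U : Finset Tile} {Λ : ℝ} (ov : ∀ x, ∑ u ∈ U, u.I.indicator (fun _ => (1:ℝ≥0∞)) x ≤ ENNReal.ofReal Λ)
    {h : ℝ → ℝ≥0∞} (hh : Measurable h) : ∑ u ∈ U, ∫⁻ x in u.I, h x ≤ ENNReal.ofReal Λ * ∫⁻ x, h x := by
  rw [← lintegral_const_mul _ hh, Finset.sum_congr rfl fun u _ => (lintegral_indicator u.I_meas h).symm]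
  refine (sum_lintegral_le _ _ _).trans (lintegral_mono fun x => ?_)
  refine le_trans (le_of_eq ?_) (mul_le_mul' (ov x) le_rfl)
  rw [Finset.sum_mul]
  refine Finset.sum_congr rfl fun u _ => ?_
  by_cases hx : x ∈ u.I
  · simp [hx]
  · simp [hx]
lemma forest_Lq (q : ℝ) (hq : 1 < q) : ∃ C : ℝ≥0, ∀ (X : Cx) (n : ℕ) (B Λ : ℝ) (U : Finset Tile) (V : Tile → Finset Tile),
    X.IsForest n B Λ U V → ∀ f, Bd f →
    ∫⁻ x, ‖op (fun x y => ∑ u ∈ U, X.K (V u) x y) f x‖ₑ ^ q ≤ ENNReal.ofReal (2 / 2^n) * ENNReal.ofReal Λ * (C * ∫⁻ x, ‖f x‖ₑ ^ q) := by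
  obtain ⟨C, hC⟩ := tree_bound q hq
  refine ⟨C, fun X n B Λ U V hF f hf => ?_⟩
  have hq0 : 0 < q := by linarith
  have hpt : ∀ x, ‖op (fun x y => ∑ u ∈ U, X.K (V u) x y) f x‖ₑ ^ q ≤ ∑ u ∈ U, ‖op (X.K (V u)) f x‖ₑ ^ q := by
    intro x
    rw [op_sum U (fun u => X.K (V u)) (fun u _ => X.BK_K _) (fun _ _ => rfl) hf x]
    by_cases hx : ∃ u ∈ U, x ∈ X.EU (V u)
    · obtain ⟨u, hu, hx⟩ := hx
      rw [Finset.sum_eq_single_of_mem u hu]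
      · exact Finset.single_le_sum (f := fun u => ‖op (X.K (V u)) f x‖ₑ ^ q) (fun _ _ => bot_le) hu
      · intro u' hu' hne
        exact X.op_K_zero _ _ (fun h => hne (hF.disj u' hu' u hu x h hx))
    · push Not at hx
      rw [Finset.sum_eq_zero (fun u hu => X.op_K_zero _ _ (hx u hu))]
      simp [hq0]
  refine (lintegral_mono hpt).trans ?_
  rw [lintegral_finsetSum _ (fun u _ => ((hf.op (X.BK_K (V u))).meas.enorm.pow_const q))]
  refine (Finset.sum_le_sum fun u hu => hC X n u (V u) (hF.tree u hu) f hf).trans ?_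
  rw [← Finset.mul_sum, ← Finset.mul_sum, mul_assoc]
  refine mul_le_mul' le_rfl ?_
  refine (mul_le_mul' le_rfl (forest_ov hF.ov (hf.meas.enorm.pow_const q))).trans (le_of_eq ?_)
  ring
lemma forest_L2 : ∃ C : ℝ≥0, ∀ (X : Cx) (n : ℕ) (B Λ : ℝ) (U : Finset Tile) (V : Tile → Finset Tile), 8 ≤ B →
    X.IsForest n B Λ U V → ∀ f, Bd f →
    ∫⁻ x, ‖op (fun x y => ∑ u ∈ U, X.K (V u) x y) f x‖ₑ ^ 2 ≤
      (ENNReal.ofReal (2 / 2^n) + ENNReal.ofReal (1/B) * ENNReal.ofReal Λ) * (C * ∫⁻ x, ‖f x‖ₑ ^ 2) := by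
  classical
  obtain ⟨C, hC⟩ := tree_adj
  obtain ⟨C', hC'⟩ := MM_strong 2 (by norm_num)
  refine ⟨2 * C + 8000 * (2 * C + C'), fun X n B Λ U V hB hF f hf => ?_⟩
  rw [← mul_assoc]
  have hBK : BK (fun x y => ∑ u ∈ U, X.K (V u) x y) := by
    have : (fun x y => ∑ u ∈ U, X.K (V u) x y) = fun x y => ∑ u ∈ U, X.K (V u) x y := rfl
    refine ⟨?_, ?_, ?_⟩
    · have : Function.uncurry (fun x y => ∑ u ∈ U, X.K (V u) x y) = fun z => ∑ u ∈ U, Function.uncurry (X.K (V u)) z := by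
        funext z; rfl
      rw [this]; exact Finset.measurable_sum _ fun u _ => (X.BK_K (V u)).meas
    · choose b hb using fun u => (X.BK_K (V u)).bdd
      exact ⟨∑ u ∈ U, b u, fun x y => (norm_sum_le _ _).trans (Finset.sum_le_sum fun u _ => hb u x y)⟩
    · choose b hb using fun u => (X.BK_K (V u)).supp
      refine ⟨∑ u ∈ U, |b u|, fun x y h => Finset.sum_eq_zero fun u hu => hb u x y ?_⟩
      exact lt_of_le_of_lt ((le_abs_self _).trans (Finset.single_le_sum (f := fun u => |b u|) (fun _ _ => abs_nonneg _) hu)) h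
  refine l2_dual hBK _ (fun g hg => ?_) f hf
  set F : Tile → ℝ → ℂ := fun u => op (adj (X.K (V u))) g with hFd
  have hFB : ∀ u, Bd (F u) := fun u => hg.op (X.BK_K (V u)).adj
  have e : ∀ x, op (adj (fun x y => ∑ u ∈ U, X.K (V u) x y)) g x = ∑ u ∈ U, F u x := fun x =>
    adj_sum U (fun u => X.K (V u)) (fun u _ => X.BK_K (V u)) (fun _ _ => rfl) hg x
  simp_rw [e]
  refine (sum_sq_le U F (fun u _ => hFB u)).trans ?_
  refine (sum_symm U (fun p p' => ‖∫ x, F p x * conj (F p' x)‖ₑ) (fun p => p.s) (fun p p' => inner_symm _ _)).trans ?_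
  set a : Tile → ℝ → ℝ≥0∞ := fun u x => MN ((X.EU (V u)).indicator g) x ^ 2 + ‖F u x‖ₑ ^ 2 with ha
  have mM : ∀ u, Measurable (MN ((X.EU (V u)).indicator g)) := fun u => measurable_MM (hg.indicator (X.EU_meas (V u))).meas.enorm
  have ma : ∀ u, Measurable (a u) := fun u => ((mM u).pow_const 2).add ((hFB u).meas.enorm.pow_const 2)
  set b : ℝ≥0∞ := ENNReal.ofReal (2000/B) with hb
  -- pair estimate
  have hpair : ∀ u' ∈ U, ∀ u ∈ U.filter (fun u => u.s ≤ u'.s), ‖∫ x, F u x * conj (F u' x)‖ₑ ≤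
      (if u = u' then ∫⁻ x, ‖F u x‖ₑ ^ 2 else 0) + b * ((∫⁻ x in u.I, a u' x) + ∫⁻ x in u'.I, a u x) := by
    intro u' hu' u hu
    obtain ⟨hu, hus⟩ := Finset.mem_filter.1 hu
    by_cases huu : u = u'
    · subst huu
      rw [if_pos rfl, ← (hFB u).sq_eq]; exact le_self_add
    rw [if_neg huu, zero_add]
    by_cases hne : ∃ x, x ∈ u.I ∧ x ∈ u'.I
    swap
    · push Not at hne
      have : ∀ x, F u x * conj (F u' x) = 0 := by
        intro x
        by_cases hx : x ∈ u.I
        · have : F u' x = 0 := X.tree_supp (hF.tree u' hu') g (hne x hx)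
          rw [this]; simp
        · have : F u x = 0 := X.tree_supp (hF.tree u hu) g hx
          rw [this]; simp
      simp [this]
    obtain ⟨x0, h1, h2⟩ := hne
    have hsub := Tile.I_nest hus h1 h2
    refine (X.two_tree (hF.tree u hu) (hF.tree u' hu') B hB (fun p hp => hF.sep u hu u' hu' huu p hp (subset_trans ?_ hsub))
      (fun p hp hpu => by rw [abs_sub_comm]; exact hF.sep u' hu' u hu (Ne.symm huu) p hp hpu) hg).trans ?_
    · exact fun w hw => (hF.tree u hu).in5 p hp w hw w (by rw [sub_self, abs_zero]; have := p.L_pos; linarith)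
    refine mul_le_mul' le_rfl ?_
    have m4 : Measurable fun y => MN ((X.EU (V u)).indicator g) y * ‖op (adj (X.K (V u'))) g y‖ₑ := (mM u).mul (hFB u').meas.enorm
    rw [← lintegral_add_left m4]
    have h3 : ∫⁻ x in u.I, a u x ≤ ∫⁻ x in u'.I, a u x := lintegral_mono_set hsub
    refine le_trans ?_ (add_le_add le_rfl h3)
    rw [← lintegral_add_left (ma u')]
    refine lintegral_mono fun x => ?_
    simp only [ha]
    refine (add_le_add (mul_le_sq_add _ _) (mul_le_sq_add _ _)).trans (le_of_eq ?_)
    ring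
  refine (mul_le_mul' le_rfl (Finset.sum_le_sum fun u' hu' => (Finset.sum_le_sum (hpair u' hu')).trans
    (Finset.sum_le_sum_of_subset (Finset.filter_subset _ _)))).trans ?_
  set G := ∫⁻ x, ‖g x‖ₑ ^ 2 with hG
  set t := ENNReal.ofReal (2 / 2^n) with ht
  have ht2 : t ≤ 2 := by
    rw [ht, ← ENNReal.ofReal_ofNat 2]; apply ENNReal.ofReal_le_ofReal
    have : (1:ℝ) ≤ 2^n := one_le_pow₀ (by norm_num)
    exact div_le_self (by norm_num) this
  have hdiag : ∑ u ∈ U, ∫⁻ x, ‖F u x‖ₑ ^ 2 ≤ t * (C * G) := by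
    refine (Finset.sum_le_sum fun u hu => hC X n u (V u) (hF.tree u hu) g hg).trans ?_
    rw [← Finset.mul_sum, ← Finset.mul_sum]
    exact mul_le_mul' le_rfl (mul_le_mul' le_rfl (X.forest_sum hF _))
  have hMM : ∑ u ∈ U, ∫⁻ x, MN ((X.EU (V u)).indicator g) x ^ 2 ≤ C' * G := by
    have : ∀ u ∈ U, ∫⁻ x, MN ((X.EU (V u)).indicator g) x ^ 2 ≤ C' * ∫⁻ x in X.EU (V u), ‖g x‖ₑ ^ 2 := by
      intro u _
      have := hC' _ (hg.indicator (X.EU_meas (V u))).meas.enorm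
      simp only [ENNReal.rpow_two] at this
      refine this.trans (le_of_eq ?_)
      rw [← lintegral_indicator (X.EU_meas (V u))]
      congr 2
      funext x
      by_cases hx : x ∈ X.EU (V u)
      · rw [indicator_of_mem hx, indicator_of_mem hx]
      · rw [indicator_of_notMem hx, indicator_of_notMem hx]; simp
    refine (Finset.sum_le_sum this).trans ?_
    rw [← Finset.mul_sum]
    exact mul_le_mul' le_rfl (X.forest_sum hF _)
  have haS : ∑ u ∈ U, ∫⁻ x, a u x ≤ (C' + 2 * C) * G := by
    have : ∀ u ∈ U, ∫⁻ x, a u x = (∫⁻ x, MN ((X.EU (V u)).indicator g) x ^ 2) + ∫⁻ x, ‖F u x‖ₑ ^ 2 := fun u _ =>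
      lintegral_add_left ((mM u).pow_const 2) _
    rw [Finset.sum_congr rfl this, Finset.sum_add_distrib]
    refine (add_le_add hMM (hdiag.trans (mul_le_mul' ht2 le_rfl))).trans (le_of_eq ?_)
    ring
  have hoff : ∑ u' ∈ U, ∑ u ∈ U, ((∫⁻ x in u.I, a u' x) + ∫⁻ x in u'.I, a u x) ≤ 2 * (ENNReal.ofReal Λ * ((C' + 2*C) * G)) := by
    have h1 : ∑ u' ∈ U, ∑ u ∈ U, ∫⁻ x in u.I, a u' x ≤ ENNReal.ofReal Λ * ((C' + 2*C) * G) := by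
      refine (Finset.sum_le_sum fun u' _ => forest_ov hF.ov (ma u')).trans ?_
      rw [← Finset.mul_sum]
      exact mul_le_mul' le_rfl haS
    simp_rw [Finset.sum_add_distrib]
    rw [two_mul]
    refine add_le_add h1 ?_
    rw [Finset.sum_comm]; exact h1
  have hfin : ∑ u' ∈ U, ∑ u ∈ U, ((if u = u' then ∫⁻ x, ‖F u x‖ₑ ^ 2 else 0) + b * ((∫⁻ x in u.I, a u' x) + ∫⁻ x in u'.I, a u x)) ≤
      t * (C * G) + b * (2 * (ENNReal.ofReal Λ * ((C' + 2*C) * G))) := by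
    have h1 : ∀ u' ∈ U, ∑ u ∈ U, ((if u = u' then ∫⁻ x, ‖F u x‖ₑ ^ 2 else 0) + b * ((∫⁻ x in u.I, a u' x) + ∫⁻ x in u'.I, a u x)) =
        (∫⁻ x, ‖F u' x‖ₑ ^ 2) + b * ∑ u ∈ U, ((∫⁻ x in u.I, a u' x) + ∫⁻ x in u'.I, a u x) := by
      intro u' hu'
      rw [Finset.sum_add_distrib, Finset.sum_ite_eq' U u', if_pos hu', Finset.mul_sum]
    rw [Finset.sum_congr rfl h1, Finset.sum_add_distrib, ← Finset.mul_sum]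
    exact add_le_add hdiag (mul_le_mul' le_rfl hoff)
  refine (mul_le_mul' le_rfl hfin).trans ?_
  have hb2 : b = 2000 * ENNReal.ofReal (1/B) := by
    rw [hb, show 2000/B = 2000 * (1/B) by ring, ENNReal.ofReal_mul (by norm_num)]; norm_num
  rw [hb2]
  push_cast
  set β := ENNReal.ofReal (1/B)
  set L := ENNReal.ofReal Λ
  calc _ = (t * (2 * C) + β * L * (8000 * (2*C + C'))) * G := by ring
    _ ≤ (t * (2 * C + 8000 * (2*C + C')) + β * L * (2 * C + 8000 * (2*C + C'))) * G := by
        refine mul_le_mul' (add_le_add (mul_le_mul' le_rfl le_self_add) (mul_le_mul' le_rfl le_add_self)) le_rfl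
    _ = _ := by ring
end Cx
open scoped Classical
namespace Cx
/-- dense tiles -/
noncomputable def DT (X : Cx) (n : ℕ) : Finset Tile := X.tiles.filter (fun m => ENNReal.ofReal (m.L / 2^(n+4)) ≤ volume (X.A m))
/-- maximal dense tiles -/
noncomputable def MT (X : Cx) (n : ℕ) : Finset Tile := (X.DT n).filter (fun m => ∀ q ∈ X.DT n, m.Le q → q = m)
lemma DT_le_MT (X : Cx) {n : ℕ} {p : Tile} (hp : p ∈ X.DT n) : ∃ m ∈ X.MT n, p.Le m := by
  obtain ⟨m, hm, hmax⟩ := ((X.DT n).filter (fun q => p.Le q)).exists_max_image (fun q => q.s) ⟨p, Finset.mem_filter.2 ⟨hp, Tile.Le.refl p⟩⟩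
  obtain ⟨hm, hpm⟩ := Finset.mem_filter.1 hm
  refine ⟨m, Finset.mem_filter.2 ⟨hm, fun q hq hmq => ?_⟩, hpm⟩
  have := hmax q (Finset.mem_filter.2 ⟨hq, hpm.trans hmq⟩)
  exact (Tile.eq_of_s hmq (le_antisymm hmq.s this)).symm
lemma A_comparable (X : Cx) {p q : Tile} (hs : p.s ≤ q.s) {x : ℝ} (hp : x ∈ X.A p) (hq : x ∈ X.A q) : p.Le q :=
  Tile.le_of_mem hs hp.1 hq.1 hp.2 hq.2
lemma tiles_I (X : Cx) {p : Tile} (hp : p ∈ X.tiles) : p.I ⊆ X.Q := (X.mem_tiles.1 hp).2.2.1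
lemma MT_sub (X : Cx) {n : ℕ} {m : Tile} (hm : m ∈ X.MT n) : m ∈ X.tiles := (Finset.mem_filter.1 (Finset.mem_filter.1 hm).1).1
lemma MT_sum (X : Cx) (n : ℕ) : ∑ m ∈ X.MT n, volume m.I ≤ ENNReal.ofReal (2^(n+4)) * volume X.Q := by
  have h1 : ∀ m ∈ X.MT n, volume m.I ≤ ENNReal.ofReal (2^(n+4)) * volume (X.A m) := by
    intro m hm
    have := (Finset.mem_filter.1 (Finset.mem_filter.1 hm).1).2
    rw [m.I_vol]
    refine le_trans (le_of_eq ?_) (mul_le_mul' le_rfl this)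
    rw [← ENNReal.ofReal_mul (by positivity), mul_div_cancel₀]
    positivity
  refine (Finset.sum_le_sum h1).trans ?_
  rw [← Finset.mul_sum]
  refine mul_le_mul' le_rfl ?_
  rw [← measure_biUnion_finset _ (fun m _ => X.A_meas m)]
  · exact measure_mono (iUnion₂_subset fun m hm x hx => X.tiles_I (X.MT_sub hm) hx.1)
  · intro m hm m' hm' hne
    refine Set.disjoint_left.2 fun x h1 h2 => hne ?_
    rcases le_total m.s m'.s with h | h
    · exact ((Finset.mem_filter.1 hm).2 m' (Finset.mem_filter.1 hm').1 (X.A_comparable h h1 h2)).symm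
    · exact (Finset.mem_filter.1 hm').2 m (Finset.mem_filter.1 hm).1 (X.A_comparable h h2 h1)
lemma heavy_MT (X : Cx) {n : ℕ} {p : Tile} (hp : p ∈ X.tiles) (hh : X.Heavy (n+1) p) :
    ∃ m ∈ X.MT n, p.I ⊆ m.I ∧ |m.c - p.c| ≤ 2^(n+2) * p.L⁻¹ := by
  obtain ⟨l, t, k, ξ, h1, h2, h3, h4⟩ := hh
  have ht0 : (0:ℝ) < (2:ℝ)^t := by positivity
  have htt : (2:ℝ)^(-t) * (2:ℝ)^t = 1 := by rw [zpow_neg, inv_mul_cancel₀ ht0.ne']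
  -- l ≤ n
  have hl : 2 * l ≤ n := by
    have h5 : volume {x | x ∈ Dy t k ∧ |X.N x - ξ| ≤ 2^(l+1) * (2:ℝ)^(-t)} ≤ ENNReal.ofReal ((2:ℝ)^t) := by
      rw [← Dy_vol t k]; exact measure_mono fun x hx => hx.1
    have h6 := h4.trans_le h5
    rw [ENNReal.ofReal_lt_ofReal_iff ht0] at h6
    by_contra hc
    have : (2:ℝ)^(n+1) ≤ 2^(2*l) := pow_le_pow_right₀ (by norm_num) (by omega)
    have h7 : 1 ≤ (2:ℝ)^(2*l) / 2^(n+1) := by rw [le_div_iff₀ (by positivity)]; linarith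
    nlinarith
  set i0 := ix (-t) (ξ - 2^(l+1) * (2:ℝ)^(-t)) with hi0
  set J := Finset.Icc i0 (i0 + 2^(l+2)) with hJ
  have e0 : ∀ v : ℝ, ix (-t) v = ⌊v * (2:ℝ)^t⌋ := by intro v; unfold ix; rw [neg_neg]
  have hi1 : (i0:ℝ) ≤ ξ * (2:ℝ)^t - 2^(l+1) := by
    have := Int.floor_le ((ξ - 2^(l+1) * (2:ℝ)^(-t)) * (2:ℝ)^t)
    rw [← e0, ← hi0, sub_mul, mul_assoc, htt, mul_one] at this; exact this
  have hi2 : ξ * (2:ℝ)^t - 2^(l+1) < i0 + 1 := by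
    have := Int.lt_floor_add_one ((ξ - 2^(l+1) * (2:ℝ)^(-t)) * (2:ℝ)^t)
    rw [← e0, ← hi0, sub_mul, mul_assoc, htt, mul_one] at this; exact this
  have hcov : {x | x ∈ Dy t k ∧ |X.N x - ξ| ≤ 2^(l+1) * (2:ℝ)^(-t)} ⊆ ⋃ i ∈ J, X.A ⟨t, k, i⟩ := by
    rintro x ⟨hx, hN⟩
    refine mem_iUnion₂.2 ⟨ix (-t) (X.N x), ?_, hx, mem_Dy_ix _ _⟩
    rw [abs_le] at hN
    have a1 : (ξ - 2^(l+1) * (2:ℝ)^(-t)) * (2:ℝ)^t ≤ X.N x * (2:ℝ)^t := mul_le_mul_of_nonneg_right (by linarith) ht0.le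
    have a2 : X.N x * (2:ℝ)^t ≤ ξ * (2:ℝ)^t + 2^(l+1) := by
      calc X.N x * (2:ℝ)^t ≤ (ξ + 2^(l+1) * (2:ℝ)^(-t)) * (2:ℝ)^t := mul_le_mul_of_nonneg_right (by linarith) ht0.le
        _ = _ := by rw [add_mul, mul_assoc, htt, mul_one]
    rw [hJ, Finset.mem_Icc]
    constructor
    · rw [hi0, e0, e0]; exact Int.floor_le_floor a1
    · rw [e0]
      have : X.N x * (2:ℝ)^t < ((i0 + 2^(l+2) + 1 : ℤ):ℝ) := by
        push_cast
        have : (2:ℝ)^(l+2) = 2^(l+1) + 2^(l+1) := by ring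
        linarith
      have := Int.floor_lt.2 this
      omega
  obtain ⟨i, hiJ, hi⟩ : ∃ i ∈ J, ENNReal.ofReal ((2:ℝ)^t / 2^(n+4)) ≤ volume (X.A ⟨t, k, i⟩) := by
    by_contra hc
    push Not at hc
    have h5 : volume {x | x ∈ Dy t k ∧ |X.N x - ξ| ≤ 2^(l+1) * (2:ℝ)^(-t)} ≤ ∑ i ∈ J, ENNReal.ofReal ((2:ℝ)^t / 2^(n+4)) :=
      (measure_mono hcov).trans ((measure_biUnion_finset_le _ _).trans (Finset.sum_le_sum fun i hi => (hc i hi).le))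
    rw [Finset.sum_const, nsmul_eq_mul] at h5
    have hcard : J.card = 2^(l+2) + 1 := by
      rw [hJ, Int.card_Icc]
      have : i0 + 2^(l+2) + 1 - i0 = ((2^(l+2) + 1 : ℕ) : ℤ) := by push_cast; ring
      rw [this, Int.toNat_natCast]
    have h6 := h4.trans_le h5
    rw [hcard, ← ENNReal.ofReal_natCast, ← ENNReal.ofReal_mul (by positivity), ENNReal.ofReal_lt_ofReal_iff (by positivity)] at h6
    push_cast at h6
    have h7 : (2:ℝ)^(2*l) / 2^(n+1) * (2:ℝ)^t = 2^(2*l) * 8 * ((2:ℝ)^t / 2^(n+4)) := by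
      rw [pow_add _ n 4, pow_add _ n 1]; field_simp; norm_num
    rw [h7] at h6
    have h8 := lt_of_mul_lt_mul_right h6 (by positivity)
    have h9 : (1:ℝ) ≤ 2^l := one_le_pow₀ (by norm_num)
    rw [pow_mul', sq, pow_add] at h8
    nlinarith
  set m0 : Tile := ⟨t, k, i⟩ with hm0
  have hm0s : p.s ≤ m0.s := Dy_scale_le h1
  have hne : (X.A m0).Nonempty := by
    by_contra hc
    rw [Set.not_nonempty_iff_eq_empty] at hc
    rw [hc, measure_empty] at hi
    have : (0:ℝ) < (2:ℝ)^t / 2^(n+4) := by positivity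
    exact absurd hi (not_le.2 (ENNReal.ofReal_pos.2 this))
  obtain ⟨x, hx⟩ := hne
  have hpt := X.mem_tiles.1 hp
  have hm0t : m0 ∈ X.tiles := by
    refine X.mem_tiles.2 ⟨hpt.1.trans hm0s, Dy_scale_le h2, h2, X.N x, X.hS x, ?_⟩
    exact (mem_Dy.1 hx.2).symm
  have hm0D : m0 ∈ X.DT n := Finset.mem_filter.2 ⟨hm0t, hi⟩
  obtain ⟨m, hm, hle⟩ := X.DT_le_MT hm0D
  refine ⟨m, hm, subset_trans (b := m0.I) h1 hle.1, ?_⟩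
  have c1 := Tile.c_close hle
  have c2 : m0.L⁻¹ ≤ p.L⁻¹ := Tile.iL_le hm0s
  have c3 : |m0.c - ξ| ≤ (2^(l+1) + 1/2) * m0.L⁻¹ := by
    rw [Finset.mem_Icc] at hiJ
    have j1 : (i0:ℝ) ≤ i := by exact_mod_cast hiJ.1
    have j2 : (i:ℝ) ≤ i0 + 2^(l+2) := by exact_mod_cast hiJ.2
    have hc : m0.c - ξ = (i + 1/2 - ξ * (2:ℝ)^t) * m0.L⁻¹ := by
      rw [Tile.inv_L]; unfold Tile.c; simp only [hm0]
      rw [sub_mul, mul_assoc, mul_comm ((2:ℝ)^t), htt, mul_one]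
    have : (2:ℝ)^(l+2) = 2^(l+1) + 2^(l+1) := by ring
    rw [hc, abs_mul, abs_of_pos (inv_pos.2 m0.L_pos)]
    refine mul_le_mul_of_nonneg_right ?_ (inv_pos.2 m0.L_pos).le
    rw [abs_le]; constructor <;> linarith
  have q0 := inv_pos.2 m0.L_pos
  have q1 := inv_pos.2 m.L_pos
  have q2 := inv_pos.2 p.L_pos
  have c4 := abs_sub_le m.c m0.c p.c
  have c5 := abs_sub_le m0.c ξ p.c
  have c6 : (1:ℝ) ≤ 2^l := one_le_pow₀ (by norm_num)
  have c7 : (2:ℝ)^l ≤ 2^n := pow_le_pow_right₀ (by norm_num) (by omega)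
  have c8 : (2^(l+1) + 1/2) * m0.L⁻¹ ≤ (2^(l+1) + 1/2) * p.L⁻¹ := mul_le_mul_of_nonneg_left c2 (by positivity)
  calc |m.c - p.c| ≤ (2^l + 2^(l+1) + 1) * p.L⁻¹ := by nlinarith
    _ ≤ _ := by
      refine mul_le_mul_of_nonneg_right ?_ q2.le
      rw [pow_succ, pow_add]; nlinarith
/-- number of maximal tiles above p -/
noncomputable def cnt (X : Cx) (n : ℕ) (p : Tile) : ℕ := ((X.MT n).filter (fun m => p.I ⊆ m.I)).card
noncomputable def BB (X : Cx) (n : ℕ) (p : Tile) : Finset Tile := (X.MT n).filter (fun m => p.I ⊆ m.I ∧ |m.c - p.c| ≤ 2^(n+3) * p.L⁻¹)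
lemma BB_mono (X : Cx) {n : ℕ} {p q : Tile} (hI : p.I ⊆ q.I) (hc : |q.c - p.c| + 2^(n+3) * q.L⁻¹ ≤ 2^(n+3) * p.L⁻¹) : X.BB n q ⊆ X.BB n p := by
  intro m hm
  obtain ⟨h1, h2, h3⟩ := Finset.mem_filter.1 hm
  refine Finset.mem_filter.2 ⟨h1, hI.trans h2, ?_⟩
  have := abs_sub_le m.c q.c p.c
  linarith
lemma BB_le (X : Cx) {n : ℕ} {p q : Tile} (h : p.Le q) : X.BB n q ⊆ X.BB n p := by
  refine X.BB_mono h.1 ?_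
  have h1 := Tile.c_close h
  have h2 := Tile.iL_le h.s
  have h3 : (1:ℝ) ≤ 2^(n+3) := one_le_pow₀ (by norm_num)
  nlinarith
lemma cnt_anti (X : Cx) {n : ℕ} {p q : Tile} (h : p.I ⊆ q.I) : X.cnt n q ≤ X.cnt n p :=
  Finset.card_le_card fun m hm => by
    obtain ⟨h1, h2⟩ := Finset.mem_filter.1 hm
    exact Finset.mem_filter.2 ⟨h1, h.trans h2⟩
/-- the layer -/
noncomputable def PN (X : Cx) (n Λ : ℕ) : Finset Tile := X.tiles.filter (fun p => X.Heavy (n+1) p ∧ ¬ X.Heavy n p ∧ X.cnt n p ≤ Λ)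
noncomputable def PP (X : Cx) (n Λ i : ℕ) : Finset Tile := (X.PN n Λ).filter (fun p => Nat.log 2 (X.BB n p).card = i)
lemma PN_card (X : Cx) {n Λ : ℕ} {p : Tile} (hp : p ∈ X.PN n Λ) : (X.BB n p).card ≠ 0 ∧ (X.BB n p).card ≤ Λ := by
  obtain ⟨hp, h1, h2, h3⟩ := Finset.mem_filter.1 hp
  constructor
  · obtain ⟨m, hm, h4, h5⟩ := X.heavy_MT hp h1
    refine Finset.card_ne_zero_of_mem (a := m) (Finset.mem_filter.2 ⟨hm, h4, h5.trans ?_⟩)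
    have := inv_pos.2 p.L_pos
    have : (2:ℝ)^(n+2) ≤ 2^(n+3) := pow_le_pow_right₀ (by norm_num) (by omega)
    gcongr
  · refine le_trans (Finset.card_le_card fun m hm => ?_) h3
    obtain ⟨h1, h2, h3⟩ := Finset.mem_filter.1 hm
    exact Finset.mem_filter.2 ⟨h1, h2⟩
lemma PP_card (X : Cx) {n Λ i : ℕ} {p : Tile} (hp : p ∈ X.PP n Λ i) : 2^i ≤ (X.BB n p).card ∧ (X.BB n p).card < 2^(i+1) := by
  obtain ⟨hp, h⟩ := Finset.mem_filter.1 hp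
  rw [← h]
  exact ⟨Nat.pow_log_le_self 2 (X.PN_card hp).1, Nat.lt_pow_succ_log_self (by norm_num) _⟩
lemma PP_conv (X : Cx) {n Λ i : ℕ} {p q r : Tile} (hp : p ∈ X.PP n Λ i) (hr : r ∈ X.PP n Λ i) (hq : q ∈ X.tiles) (h1 : p.Le q) (h2 : q.Le r) :
    q ∈ X.PP n Λ i := by
  obtain ⟨hp1, hp2⟩ := Finset.mem_filter.1 hp
  obtain ⟨hr1, hr2⟩ := Finset.mem_filter.1 hr
  obtain ⟨-, hp3, hp4, hp5⟩ := Finset.mem_filter.1 hp1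
  obtain ⟨-, hr3, hr4, hr5⟩ := Finset.mem_filter.1 hr1
  refine Finset.mem_filter.2 ⟨Finset.mem_filter.2 ⟨hq, X.Heavy_anti h2 hr3, fun h => hp4 (X.Heavy_anti h1 h), (X.cnt_anti h1.1).trans hp5⟩, ?_⟩
  refine le_antisymm ?_ ?_
  · rw [← hp2]; exact Nat.log_mono_right (Finset.card_le_card (X.BB_le h1))
  · rw [← hr2]; exact Nat.log_mono_right (Finset.card_le_card (X.BB_le h2))
lemma greedy (R : Tile → Tile → Prop) (hr : ∀ p, R p p) (hsym : ∀ u u', R u u' → u'.s ≤ u.s → R u' u) (k : ℕ) : ∀ (P : Finset Tile), P.card = k →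
    ∃ U ⊆ P, (∀ p ∈ P, ∃ u ∈ U, R p u) ∧ ∀ u ∈ U, ∀ u' ∈ U, u ≠ u' → ¬ R u u' := by
  induction k using Nat.strong_induction_on with
  | _ k ih =>
    intro P hP
    rcases P.eq_empty_or_nonempty with rfl | hne
    · exact ⟨∅, by simp, by simp, by simp⟩
    obtain ⟨u, hu, hmax⟩ := P.exists_max_image (fun p => p.s) hne
    set P' := P.filter (fun p => ¬ R p u) with hP'
    have hlt : P'.card < k := by
      rw [← hP]; exact Finset.card_lt_card (Finset.filter_ssubset.2 ⟨u, hu, not_not.2 (hr u)⟩)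
    obtain ⟨U, hU, hc, hd⟩ := ih _ hlt P' rfl
    refine ⟨insert u U, ?_, ?_, ?_⟩
    · exact Finset.insert_subset hu (hU.trans (Finset.filter_subset _ _))
    · intro p hp
      by_cases h : R p u
      · exact ⟨u, Finset.mem_insert_self _ _, h⟩
      · obtain ⟨u', hu', h'⟩ := hc p (Finset.mem_filter.2 ⟨hp, h⟩)
        exact ⟨u', Finset.mem_insert_of_mem hu', h'⟩
    · intro v hv v' hv' hne hR
      rcases Finset.mem_insert.1 hv with h | hv1
      · rcases Finset.mem_insert.1 hv' with h' | hv1'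
        · exact hne (h.trans h'.symm)
        · have := Finset.mem_filter.1 (hU hv1')
          rw [h] at hR
          exact this.2 (hsym _ _ hR (hmax v' this.1))
      · rcases Finset.mem_insert.1 hv' with h' | hv1'
        · rw [h'] at hR
          exact (Finset.mem_filter.1 (hU hv1)).2 hR
        · exact hd v hv1 v' hv1' hne hR
/-- the top relation -/
def Tt (n : ℕ) (p u : Tile) : Prop := p.I ⊆ u.I ∧ |p.c - u.c| ≤ 2^(n+4) * p.L⁻¹
lemma Tt_sym (n : ℕ) (u u' : Tile) (h : Tt n u u') (hs : u'.s ≤ u.s) : Tt n u' u := by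
  have h1 := Tile.I_scale h.1
  have h2 : u.s = u'.s := le_antisymm h1 hs
  refine ⟨?_, ?_⟩
  · obtain ⟨x, hx⟩ := u.I_nonempty
    exact Tile.I_nest hs (h.1 hx) hx
  · have : u'.L⁻¹ = u.L⁻¹ := by unfold Tile.L; rw [h2]
    rw [abs_sub_comm, this]; exact h.2
/-- family of tops -/
structure Tops (X : Cx) (n Λ i : ℕ) (U : Finset Tile) : Prop where
  sub : U ⊆ X.PP n Λ i
  cov : ∀ p ∈ X.PP n Λ i, ∃ u ∈ U, Tt n p u
  ne : ∀ u ∈ U, ∀ u' ∈ U, u ≠ u' → ¬ Tt n u u'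
lemma exists_tops (X : Cx) (n Λ i : ℕ) : ∃ U, X.Tops n Λ i U := by
  obtain ⟨U, h1, h2, h3⟩ := greedy (Tt n) (fun p => ⟨subset_rfl, by rw [sub_self, abs_zero]; have := inv_pos.2 p.L_pos; positivity⟩) (Tt_sym n) _ (X.PP n Λ i) rfl
  exact ⟨U, h1, h2, h3⟩
lemma BB_disj (X : Cx) {n Λ i : ℕ} {U : Finset Tile} (hU : X.Tops n Λ i U) {u u' : Tile} (hu : u ∈ U) (hu' : u' ∈ U) (hne : u ≠ u')
    {x : ℝ} (hx : x ∈ u.I) (hx' : x ∈ u'.I) : Disjoint (X.BB n u) (X.BB n u') := by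
  wlog hs : u.s ≤ u'.s generalizing u u'
  · exact (this hu' hu hne.symm hx' hx (by omega)).symm
  refine Finset.disjoint_left.2 fun m hm hm' => hU.ne u hu u' hu' hne ⟨Tile.I_nest hs hx hx', ?_⟩
  have h1 := (Finset.mem_filter.1 hm).2.2
  have h2 := (Finset.mem_filter.1 hm').2.2
  have h3 := abs_sub_le u.c m.c u'.c
  rw [abs_sub_comm] at h1
  have h4 : 2^(n+3) * u'.L⁻¹ ≤ 2^(n+3) * u.L⁻¹ := mul_le_mul_of_nonneg_left (Tile.iL_le hs) (by positivity)
  have h5 : (2:ℝ)^(n+4) * u.L⁻¹ = 2 * (2^(n+3) * u.L⁻¹) := by ring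
  linarith
lemma tops_uniq (X : Cx) {n Λ i : ℕ} {U : Finset Tile} (hU : X.Tops n Λ i U) {q u u' : Tile} (hq : q ∈ X.PP n Λ i) (hu : u ∈ U) (hu' : u' ∈ U)
    (h1 : q.I ⊆ u.I) (h1' : q.I ⊆ u'.I) (h2 : |u.c - q.c| + 2^(n+3) * u.L⁻¹ ≤ 2^(n+3) * q.L⁻¹)
    (h2' : |u'.c - q.c| + 2^(n+3) * u'.L⁻¹ ≤ 2^(n+3) * q.L⁻¹) : u = u' := by
  by_contra hne
  obtain ⟨x, hx⟩ := q.I_nonempty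
  have hd := X.BB_disj hU hu hu' hne (h1 hx) (h1' hx)
  have hs : X.BB n u ∪ X.BB n u' ⊆ X.BB n q := Finset.union_subset (X.BB_mono h1 h2) (X.BB_mono h1' h2')
  have := Finset.card_le_card hs
  rw [Finset.card_union_of_disjoint hd] at this
  have a1 := (X.PP_card (hU.sub hu)).1
  have a2 := (X.PP_card (hU.sub hu')).1
  have a3 := (X.PP_card hq).2
  rw [pow_succ] at a3
  omega
lemma tops_ov (X : Cx) {n Λ i : ℕ} {U : Finset Tile} (hU : X.Tops n Λ i U) (x : ℝ) :
    ∑ u ∈ U, u.I.indicator (fun _ => (1:ℝ≥0∞)) x ≤ ENNReal.ofReal (Λ:ℝ) := by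
  have e : ∑ u ∈ U, u.I.indicator (fun _ => (1:ℝ≥0∞)) x = ((U.filter (fun u => x ∈ u.I)).card : ℝ≥0∞) := by
    rw [Finset.card_eq_sum_ones, Finset.sum_filter]
    push_cast
    exact Finset.sum_congr rfl fun u _ => by simp [Set.indicator_apply]
  rw [e, ENNReal.ofReal_natCast]
  have : (U.filter (fun u => x ∈ u.I)).card ≤ Λ := by
    rcases (U.filter (fun u => x ∈ u.I)).eq_empty_or_nonempty with h | h
    · rw [h]; simp
    obtain ⟨u0, hu0, hmin⟩ := (U.filter (fun u => x ∈ u.I)).exists_min_image (fun u => u.s) h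
    obtain ⟨hu0, hx0⟩ := Finset.mem_filter.1 hu0
    have h1 : ((U.filter (fun u => x ∈ u.I)).biUnion (X.BB n)).card = ∑ u ∈ U.filter (fun u => x ∈ u.I), (X.BB n u).card :=
      Finset.card_biUnion fun u hu u' hu' hne => by
        obtain ⟨a1, a2⟩ := Finset.mem_filter.1 hu
        obtain ⟨b1, b2⟩ := Finset.mem_filter.1 hu'
        exact X.BB_disj hU a1 b1 hne a2 b2
    have h2 : ((U.filter (fun u => x ∈ u.I)).biUnion (X.BB n)).card ≤ X.cnt n u0 := by
      refine Finset.card_le_card fun m hm => ?_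
      obtain ⟨u, hu, hm⟩ := Finset.mem_biUnion.1 hm
      obtain ⟨c1, c2, c3⟩ := Finset.mem_filter.1 hm
      exact Finset.mem_filter.2 ⟨c1, (Tile.I_nest (hmin u hu) hx0 (Finset.mem_filter.1 hu).2).trans c2⟩
    have h3 : (U.filter (fun u => x ∈ u.I)).card ≤ ∑ u ∈ U.filter (fun u => x ∈ u.I), (X.BB n u).card := by
      rw [Finset.card_eq_sum_ones]
      refine Finset.sum_le_sum fun u hu => ?_
      have := (X.PP_card (hU.sub (Finset.mem_filter.1 hu).1)).1
      exact (Nat.one_le_two_pow).trans this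
    have h4 := (Finset.mem_filter.1 (Finset.mem_filter.1 (hU.sub hu0)).1).2.2.2
    omega
  exact_mod_cast this
/-- the core of the layer -/
noncomputable def FF (X : Cx) (n Λ i D : ℕ) : Finset Tile := (X.PP n Λ i).filter (fun p =>
  (∃ q ∈ X.PP n Λ i, q.Le p ∧ q.s + D ≤ p.s) ∧ ∃ r ∈ X.PP n Λ i, p.Le r ∧ p.s + D ≤ r.s)
lemma FF_aux {n D : ℕ} (hD : n + 5 ≤ D) {q p : Tile} (h : q.s + D ≤ p.s) : 2^(n+5) * p.L⁻¹ ≤ q.L⁻¹ :=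
  le_trans (mul_le_mul_of_nonneg_right (pow_le_pow_right₀ (by norm_num) hD) (inv_pos.2 p.L_pos).le) (Tile.iL_le_pow D h)
lemma FF_uniq (X : Cx) {n Λ i D : ℕ} (hD : n + 5 ≤ D) {U : Finset Tile} (hU : X.Tops n Λ i U) {p u u' : Tile} (hp : p ∈ X.FF n Λ i D)
    (hu : u ∈ U) (hu' : u' ∈ U) (h : p.I ⊆ u.I) (h' : p.I ⊆ u'.I) (hc : |p.c - u.c| ≤ 2^D/2 * p.L⁻¹) (hc' : |p.c - u'.c| ≤ 2^D/2 * p.L⁻¹) : u = u' := by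
  obtain ⟨hpp, ⟨q, hq, hqp, hqs⟩, -⟩ := Finset.mem_filter.1 hp
  have key : ∀ u : Tile, p.I ⊆ u.I → |p.c - u.c| ≤ 2^D/2 * p.L⁻¹ → |u.c - q.c| + 2^(n+3) * u.L⁻¹ ≤ 2^(n+3) * q.L⁻¹ := by
    intro u h hc
    have h1 := Tile.c_close hqp
    have h2 := abs_sub_le u.c p.c q.c
    rw [abs_sub_comm u.c p.c] at h2
    have h3 : 2^D * p.L⁻¹ ≤ q.L⁻¹ := Tile.iL_le_pow D hqs
    have h4 := FF_aux hD hqs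
    have h5 := Tile.iL_le (Tile.I_scale h)
    have h6 : (2:ℝ)^(n+3) * u.L⁻¹ ≤ 2^(n+3) * p.L⁻¹ := mul_le_mul_of_nonneg_left h5 (by positivity)
    have h7 : (2:ℝ)^(n+5) * p.L⁻¹ = 4 * (2^(n+3) * p.L⁻¹) := by ring
    have h8 := inv_pos.2 p.L_pos
    have h9 := inv_pos.2 q.L_pos
    have h10 : (2:ℝ)^3 ≤ 2^(n+3) := pow_le_pow_right₀ (by norm_num) (by omega)
    nlinarith
  exact X.tops_uniq hU hq hu hu' (hqp.1.trans h) (hqp.1.trans h') (key u h hc) (key u' h' hc')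
lemma Tt_D {n D : ℕ} (hD : n + 5 ≤ D) {p u : Tile} (h : Tt n p u) : |p.c - u.c| ≤ 2^D/2 * p.L⁻¹ := by
  refine h.2.trans (mul_le_mul_of_nonneg_right ?_ (inv_pos.2 p.L_pos).le)
  have : (2:ℝ)^(n+5) ≤ 2^D := pow_le_pow_right₀ (by norm_num) hD
  have : (2:ℝ)^(n+5) = 2 * 2^(n+4) := by ring
  linarith
lemma FF_close (X : Cx) {n Λ i D : ℕ} (hD : n + 5 ≤ D) {U : Finset Tile} (hU : X.Tops n Λ i U) {p u : Tile} (hp : p ∈ X.FF n Λ i D)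
    (hu : u ∈ U) (h : Tt n p u) : |u.c - p.c| ≤ p.L⁻¹ ∧ p.s + D ≤ u.s := by
  obtain ⟨hpp, -, r, hr, hpr, hrs⟩ := Finset.mem_filter.1 hp
  obtain ⟨v, hv, hrv⟩ := hU.cov r hr
  have h0 : |v.c - p.c| ≤ p.L⁻¹ := by
    have h1 := Tile.c_close hpr
    have h2 := abs_sub_le v.c r.c p.c
    rw [abs_sub_comm v.c r.c] at h2
    have h3 := hrv.2
    have h4 := FF_aux hD hrs
    have h7 : (2:ℝ)^(n+5) * r.L⁻¹ = 2 * (2^(n+4) * r.L⁻¹) := by ring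
    have h8 := inv_pos.2 r.L_pos
    linarith
  have hT : Tt n p v := by
    refine ⟨hpr.1.trans hrv.1, ?_⟩
    rw [abs_sub_comm]
    refine h0.trans ?_
    have : (1:ℝ) ≤ 2^(n+4) := one_le_pow₀ (by norm_num)
    have := inv_pos.2 p.L_pos
    nlinarith
  have : u = v := X.FF_uniq hD hU hp hu hv h.1 hT.1 (Tt_D hD h) (Tt_D hD hT)
  subst this
  exact ⟨h0, hrs.trans (Tile.I_scale hrv.1)⟩
/-- deep inside -/
def In5 (p u : Tile) : Prop := ∀ x ∈ p.I, ∀ y, |x - y| < 2 * p.L → y ∈ u.I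
noncomputable def VV (X : Cx) (n Λ i D : ℕ) (u : Tile) : Finset Tile := (X.FF n Λ i D).filter (fun p => Tt n p u ∧ In5 p u)
lemma close_Tt {n : ℕ} {p r u : Tile} (h : p.Le r) (h1 : r.I ⊆ u.I) (h2 : |u.c - r.c| ≤ r.L⁻¹) : Tt n p u := by
  refine ⟨h.1.trans h1, ?_⟩
  have a1 := Tile.c_close h
  have a2 := abs_sub_le u.c r.c p.c
  have a3 := Tile.iL_le h.s
  rw [abs_sub_comm]
  have : (2:ℝ)^4 ≤ 2^(n+4) := pow_le_pow_right₀ (by norm_num) (by omega)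
  have := inv_pos.2 p.L_pos
  have := inv_pos.2 r.L_pos
  nlinarith
lemma FF_conv (X : Cx) {n Λ i D : ℕ} {p q r : Tile} (hp : p ∈ X.FF n Λ i D) (hr : r ∈ X.FF n Λ i D) (hq : q ∈ X.tiles) (h1 : p.Le q) (h2 : q.Le r) :
    q ∈ X.FF n Λ i D := by
  obtain ⟨hpp, ⟨a, ha, hap, has⟩, -⟩ := Finset.mem_filter.1 hp
  obtain ⟨hrr, -, b, hb, hrb, hbs⟩ := Finset.mem_filter.1 hr
  refine Finset.mem_filter.2 ⟨X.PP_conv hpp hrr hq h1 h2, ⟨a, ha, hap.trans h1, ?_⟩, b, hb, h2.trans hrb, ?_⟩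
  · have := h1.s; omega
  · have := h2.s; omega
lemma PP_tiles (X : Cx) {n Λ i : ℕ} {p : Tile} (hp : p ∈ X.PP n Λ i) : p ∈ X.tiles := (Finset.mem_filter.1 (Finset.mem_filter.1 hp).1).1
lemma PP_nh (X : Cx) {n Λ i : ℕ} {p : Tile} (hp : p ∈ X.PP n Λ i) : ¬ X.Heavy n p := (Finset.mem_filter.1 (Finset.mem_filter.1 hp).1).2.2.1
lemma FF_PP (X : Cx) {n Λ i D : ℕ} {p : Tile} (hp : p ∈ X.FF n Λ i D) : p ∈ X.PP n Λ i := (Finset.mem_filter.1 hp).1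
lemma forest (X : Cx) {n Λ i D : ℕ} (hD : n + 5 ≤ D) {U : Finset Tile} (hU : X.Tops n Λ i U) :
    X.IsForest n (2^D/4) Λ U (X.VV n Λ i D) where
  tree := by
    intro u hu
    refine ⟨?_, ?_, ?_, ?_, ?_⟩
    · intro p hp; exact X.PP_tiles (X.FF_PP (Finset.mem_filter.1 hp).1)
    · intro p hp; exact X.PP_nh (X.FF_PP (Finset.mem_filter.1 hp).1)
    · intro p hp
      obtain ⟨h1, h2, h3⟩ := Finset.mem_filter.1 hp
      exact (X.FF_close hD hU h1 hu h2).1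
    · intro p hp; exact (Finset.mem_filter.1 hp).2.2
    · intro p hp r hr x hxp hxr s hs1 hs2
      obtain ⟨h1, h2, h3⟩ := Finset.mem_filter.1 hp
      obtain ⟨g1, g2, g3⟩ := Finset.mem_filter.1 hr
      have hpt := X.PP_tiles (X.FF_PP h1)
      have hrt := X.PP_tiles (X.FF_PP g1)
      have ht := X.tl_A s x
      have htt : X.tl s x ∈ X.tiles := X.tl_mem ((X.mem_tiles.1 hpt).1.trans hs1) (hs2.trans (X.mem_tiles.1 hrt).2.1) (X.tiles_I hpt (X.E_sub_I _ hxp))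
      have l1 : p.Le (X.tl s x) := X.A_comparable hs1 (X.E_sub_A _ hxp) ht
      have l2 : (X.tl s x).Le r := X.A_comparable hs2 ht (X.E_sub_A _ hxr)
      refine Finset.mem_filter.2 ⟨X.FF_conv h1 g1 htt l1 l2, close_Tt l2 g2.1 (X.FF_close hD hU g1 hu g2).1, ?_⟩
      intro z hz y hy
      have := Tile.L_le l2.s
      exact g3 z (l2.1 hz) y (by linarith)
  sep := by
    intro u hu u' hu' hne p hp hI
    obtain ⟨h1, h2, h3⟩ := Finset.mem_filter.1 hp
    have hc := (X.FF_close hD hU h1 hu h2).1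
    have : 2^D/2 * p.L⁻¹ < |p.c - u'.c| := by
      by_contra hcon
      push Not at hcon
      exact hne (X.FF_uniq hD hU h1 hu hu' h2.1 hI (Tt_D hD h2) hcon)
    have h4 := abs_sub_le p.c u.c u'.c
    rw [abs_sub_comm p.c u.c] at h4
    have h5 : (2^D/2 - 1) * p.L⁻¹ ≤ |u.c - u'.c| := by linarith
    have h6 := mul_le_mul_of_nonneg_right h5 p.L_pos.le
    rw [mul_assoc, inv_mul_cancel₀ p.L_pos.ne', mul_one] at h6
    have h7 : (2:ℝ)^2 ≤ 2^D := pow_le_pow_right₀ (by norm_num) (by omega)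
    linarith
  disj := by
    intro u hu u' hu' x hx hx'
    obtain ⟨p, hp, hxp⟩ := X.mem_EU.1 hx
    obtain ⟨p', hp', hxp'⟩ := X.mem_EU.1 hx'
    wlog hs : p.s ≤ p'.s generalizing u u' p p'
    · exact (this u' hu' u hu hx' hx p' hp' hxp' p hp hxp (by omega)).symm
    obtain ⟨h1, h2, h3⟩ := Finset.mem_filter.1 hp
    obtain ⟨g1, g2, g3⟩ := Finset.mem_filter.1 hp'
    have l := X.A_comparable hs (X.E_sub_A _ hxp) (X.E_sub_A _ hxp')
    have hT : Tt n p u' := close_Tt l g2.1 (X.FF_close hD hU g1 hu' g2).1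
    exact X.FF_uniq hD hU h1 hu hu' h2.1 hT.1 (Tt_D hD h2) (Tt_D hD hT)
  ov := X.tops_ov hU
/-- boundary strip -/
def strip (D : ℕ) (u : Tile) : Set ℝ :=
  Icc (u.m * u.L) (u.m * u.L + 3 / 2^D * u.L) ∪ Icc ((u.m+1) * u.L - 3 / 2^D * u.L) ((u.m+1) * u.L)
lemma strip_vol (D : ℕ) (u : Tile) : volume (strip D u) ≤ ENNReal.ofReal (6/2^D) * volume u.I := by
  have := u.L_pos
  refine (measure_union_le _ _).trans ?_
  rw [Real.volume_Icc, Real.volume_Icc, u.I_vol, ← ENNReal.ofReal_mul (by positivity), ← ENNReal.ofReal_add (by ring_nf; positivity) (by ring_nf; positivity)]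
  exact ENNReal.ofReal_le_ofReal (by ring_nf; rfl)
lemma strip_sub {D : ℕ} {p u : Tile} (hs : p.s + D ≤ u.s) (hI : p.I ⊆ u.I) (h : ¬ In5 p u) : p.I ⊆ strip D u := by
  unfold In5 at h
  push Not at h
  obtain ⟨x, hx, y, hxy, hy⟩ := h
  intro z hz
  have hzu := hI hz
  have hL : p.L ≤ 1/2^D * u.L := by
    have := Tile.iL_le_pow D hs
    have a := p.L_pos
    have b := u.L_pos
    rw [← div_eq_mul_inv, ← one_div, div_le_div_iff₀ b a] at this
    rw [div_mul_eq_mul_div, le_div_iff₀ (by positivity)]; linarith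
  have e : (2:ℝ)^u.s = u.L := rfl
  have e' : (2:ℝ)^p.s = p.L := rfl
  simp only [Tile.I, Dy, mem_Ico, e, e'] at hx hz hzu hy
  rw [abs_lt] at hxy
  have h3 : 3/2^D * u.L = 3 * (1/2^D * u.L) := by ring
  rcases lt_or_ge y (u.m * u.L) with h1 | h1
  · left; rw [mem_Icc, h3]; constructor <;> nlinarith
  · right
    have : (u.m+1) * u.L ≤ y := by
      by_contra hcon; exact hy ⟨h1, not_le.1 hcon⟩
    rw [mem_Icc, h3]; constructor <;> nlinarith
lemma strips_vol (X : Cx) {n Λ i : ℕ} (D : ℕ) {U : Finset Tile} (hU : X.Tops n Λ i U) :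
    volume (⋃ u ∈ U, strip D u) ≤ ENNReal.ofReal (6/2^D) * (ENNReal.ofReal Λ * volume X.Q) := by
  refine (measure_biUnion_finset_le _ _).trans ((Finset.sum_le_sum fun u _ => strip_vol D u).trans ?_)
  rw [← Finset.mul_sum]
  refine mul_le_mul' le_rfl ?_
  have hQ : MeasurableSet X.Q := Dy_meas _ _
  have h := forest_ov (X.tops_ov hU) (h := X.Q.indicator (fun _ => (1:ℝ≥0∞))) (measurable_const.indicator hQ)
  rw [lintegral_indicator hQ, setLIntegral_one] at h
  refine le_trans (Finset.sum_le_sum fun u hu => ?_) h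
  rw [← setLIntegral_one]
  refine le_of_eq (setLIntegral_congr_fun u.I_meas fun x hx => ?_)
  exact (Set.indicator_of_mem (X.tiles_I (X.PP_tiles (hU.sub hu)) hx) (fun _ => (1:ℝ≥0∞))).symm
lemma BK_forest (X : Cx) (U : Finset Tile) (V : Tile → Finset Tile) : BK (fun x y => ∑ u ∈ U, X.K (V u) x y) := by
  refine ⟨?_, ?_, ?_⟩
  · have : Function.uncurry (fun x y => ∑ u ∈ U, X.K (V u) x y) = fun z => ∑ u ∈ U, Function.uncurry (X.K (V u)) z := by
      funext z; rfl
    rw [this]; exact Finset.measurable_sum _ fun u _ => (X.BK_K (V u)).meas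
  · choose b hb using fun u => (X.BK_K (V u)).bdd
    exact ⟨∑ u ∈ U, b u, fun x y => (norm_sum_le _ _).trans (Finset.sum_le_sum fun u _ => hb u x y)⟩
  · choose b hb using fun u => (X.BK_K (V u)).supp
    refine ⟨∑ u ∈ U, |b u|, fun x y h => Finset.sum_eq_zero fun u hu => hb u x y ?_⟩
    exact lt_of_le_of_lt ((le_abs_self _).trans (Finset.single_le_sum (f := fun u => |b u|) (fun _ _ => abs_nonneg _) hu)) h
/-- building blocks -/
def Piece (X : Cx) (n D Λ : ℕ) (G : ℝ → ℝ → ℂ) : Prop :=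
  (∃ V ⊆ X.tiles, (∀ p ∈ V, ¬ X.Heavy n p) ∧ (∀ p ∈ V, ∀ q ∈ V, ∀ x, x ∈ X.E p → x ∈ X.E q → p = q) ∧ G = X.K V) ∨
  ∃ U V, X.IsForest n (2^D/4) Λ U V ∧ G = fun x y => ∑ u ∈ U, X.K (V u) x y
lemma Piece.BK {X : Cx} {n D Λ : ℕ} {G : ℝ → ℝ → ℂ} (h : X.Piece n D Λ G) : BK G := by
  rcases h with ⟨V, -, -, -, rfl⟩ | ⟨U, V, -, rfl⟩
  · exact X.BK_K V
  · exact X.BK_forest U V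
lemma piece_bound (q : ℝ) (hq : 1 < q) : ∃ C : ℝ≥0, ∀ (X : Cx) (n D Λ : ℕ), n + 5 ≤ D → ∀ G, X.Piece n D Λ G → ∀ f, Bd f →
    ∫⁻ x, ‖op G f x‖ₑ ^ (2:ℝ) ≤ ENNReal.ofReal (2^(-(n:ℝ)/6) + Λ/2^D) * (C * ∫⁻ x, ‖f x‖ₑ ^ (2:ℝ)) ∧
    ∫⁻ x, ‖op G f x‖ₑ ^ q ≤ ENNReal.ofReal (1 + Λ/2^n) * (C * ∫⁻ x, ‖f x‖ₑ ^ q) := by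
  obtain ⟨C1, h1⟩ := anti_L2
  obtain ⟨C2, h2⟩ := forest_L2
  obtain ⟨C3, h3⟩ := forest_Lq q hq
  obtain ⟨C4, h4⟩ := MM_strong q hq
  refine ⟨C1 + 4 * C2 + 2 * C3 + (8:ℝ≥0)^q * C4, fun X n D Λ hD G hG f hf => ?_⟩
  have le1 : C1 ≤ C1 + 4 * C2 + 2 * C3 + (8:ℝ≥0)^q * C4 := by
    rw [add_assoc, add_assoc]; exact le_self_add
  have le2 : 4 * C2 ≤ C1 + 4 * C2 + 2 * C3 + (8:ℝ≥0)^q * C4 := by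
    rw [add_assoc, add_assoc]; exact le_add_left le_self_add
  have le3 : 2 * C3 ≤ C1 + 4 * C2 + 2 * C3 + (8:ℝ≥0)^q * C4 := by
    rw [add_assoc]; exact le_add_left le_self_add
  have le4 : (8:ℝ≥0)^q * C4 ≤ C1 + 4 * C2 + 2 * C3 + (8:ℝ≥0)^q * C4 := le_add_self
  generalize C1 + 4 * C2 + 2 * C3 + (8:ℝ≥0)^q * C4 = C at le1 le2 le3 le4
  simp only [ENNReal.rpow_two]
  have hn0 : (0:ℝ) < 2^(-(n:ℝ)/6) := Real.rpow_pos_of_pos (by norm_num) _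
  have hn1 : 1 / (2:ℝ)^n ≤ 2^(-(n:ℝ)/6) := by
    rw [one_div, ← Real.rpow_natCast, ← Real.rpow_neg (by norm_num)]
    refine Real.rpow_le_rpow_of_exponent_le (by norm_num) ?_
    have : (0:ℝ) ≤ n := Nat.cast_nonneg n
    linarith
  rcases hG with ⟨V, a1, a2, a3, rfl⟩ | ⟨U, V, hF, rfl⟩
  · constructor
    · refine (h1 X n V a1 a2 a3 f hf).trans (mul_le_mul' (ENNReal.ofReal_le_ofReal ?_) (mul_le_mul' (by exact_mod_cast le1) le_rfl))
      have : (0:ℝ) ≤ Λ/2^D := by positivity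
      linarith
    · calc ∫⁻ x, ‖op (X.K V) f x‖ₑ ^ q ≤ ∫⁻ x, (8 * MN f x)^q :=
            lintegral_mono fun x => ENNReal.rpow_le_rpow (X.anti_pt V a3 hf x) (by linarith)
        _ = (8:ℝ≥0∞)^q * ∫⁻ x, (MM (fun y => ‖f y‖ₑ) x)^q := by
            rw [← lintegral_const_mul' _ _ (ENNReal.rpow_ne_top_of_nonneg (by linarith) (by norm_num))]
            exact lintegral_congr fun x => ENNReal.mul_rpow_of_nonneg _ _ (by linarith)
        _ ≤ (8:ℝ≥0∞)^q * (C4 * ∫⁻ x, ‖f x‖ₑ ^ q) := mul_le_mul' le_rfl (h4 _ hf.meas.enorm)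
        _ ≤ 1 * (C * ∫⁻ x, ‖f x‖ₑ ^ q) := by
            rw [one_mul, ← mul_assoc]
            refine mul_le_mul' ?_ le_rfl
            have : ((8:ℝ≥0)^q * C4 : ℝ≥0) = ((8:ℝ≥0∞)^q * C4) := by
              push_cast [ENNReal.coe_rpow_of_nonneg _ (show 0 ≤ q by linarith)]; rfl
            rw [← this]; exact_mod_cast le4
        _ ≤ _ := by
            refine mul_le_mul' ?_ le_rfl
            rw [← ENNReal.ofReal_one]
            refine ENNReal.ofReal_le_ofReal ?_
            have : (0:ℝ) ≤ Λ/2^n := by positivity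
            linarith
  · have hB : (8:ℝ) ≤ 2^D/4 := by
      have : (2:ℝ)^5 ≤ 2^D := pow_le_pow_right₀ (by norm_num) (by omega)
      linarith
    constructor
    · refine (h2 X n _ _ U V hB hF f hf).trans ?_
      calc _ ≤ (ENNReal.ofReal (2^(-(n:ℝ)/6) + Λ/2^D) * 4) * (C2 * ∫⁻ x, ‖f x‖ₑ ^ 2) := by
            refine mul_le_mul' ?_ le_rfl
            rw [show (4:ℝ≥0∞) = ENNReal.ofReal 4 by norm_num, ← ENNReal.ofReal_mul (by positivity), ← ENNReal.ofReal_mul (by positivity), ← ENNReal.ofReal_add (by positivity) (by positivity)]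
            refine ENNReal.ofReal_le_ofReal ?_
            have e1 : 1/((2:ℝ)^D/4) * Λ = 4 * (Λ/2^D) := by field_simp
            have e2 : 2/(2:ℝ)^n = 2 * (1/2^n) := by ring
            rw [e1, e2]; linarith
        _ = ENNReal.ofReal (2^(-(n:ℝ)/6) + Λ/2^D) * ((4 * C2) * ∫⁻ x, ‖f x‖ₑ ^ 2) := by ring
        _ ≤ _ := mul_le_mul' le_rfl (mul_le_mul' (by exact_mod_cast le2) le_rfl)
    · refine (h3 X n _ _ U V hF f hf).trans ?_
      calc _ ≤ (ENNReal.ofReal (1 + Λ/2^n) * 2) * (C3 * ∫⁻ x, ‖f x‖ₑ ^ q) := by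
            refine mul_le_mul' ?_ le_rfl
            rw [show (2:ℝ≥0∞) = ENNReal.ofReal 2 by norm_num, ← ENNReal.ofReal_mul (by positivity), ← ENNReal.ofReal_mul (by positivity)]
            refine ENNReal.ofReal_le_ofReal ?_
            have e2 : 2/(2:ℝ)^n * Λ = 2 * (Λ/2^n) := by ring
            rw [e2]; linarith
        _ = ENNReal.ofReal (1 + Λ/2^n) * ((2 * C3) * ∫⁻ x, ‖f x‖ₑ ^ q) := by ring
        _ ≤ _ := mul_le_mul' le_rfl (mul_le_mul' (by exact_mod_cast le3) le_rfl)
/-- residue class of a family -/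
noncomputable def rc (D : ℕ) (R : Finset Tile) (k : ℕ) : Finset Tile := R.filter (fun p => p.s % D = k)
lemma rc_anti (X : Cx) {D : ℕ} {R : Finset Tile} (h : ∀ p ∈ R, ∀ p' ∈ R, p.Le p' → ¬ (p.s + D ≤ p'.s)) (k : ℕ) :
    ∀ p ∈ rc D R k, ∀ q ∈ rc D R k, ∀ x, x ∈ X.E p → x ∈ X.E q → p = q := by
  intro p hp q hq x hxp hxq
  wlog hs : p.s ≤ q.s generalizing p q
  · exact (this q hq p hp hxq hxp (by omega)).symm
  obtain ⟨h1, h2⟩ := Finset.mem_filter.1 hp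
  obtain ⟨h3, h4⟩ := Finset.mem_filter.1 hq
  have hle := X.A_comparable hs (X.E_sub_A _ hxp) (X.E_sub_A _ hxq)
  refine Tile.eq_of_s hle ?_
  have h5 := h p h1 q h3 hle
  have h6 : (q.s - p.s) % D = 0 := Int.emod_emod_of_dvd _ (dvd_refl _) ▸ by rw [Int.sub_emod, h2, h4]; simp
  obtain ⟨c, hc⟩ := Int.dvd_of_emod_eq_zero h6
  rcases lt_trichotomy c 0 with hc0 | hc0 | hc0
  · have : (D:ℤ) * c ≤ 0 := mul_nonpos_of_nonneg_of_nonpos (by omega) hc0.le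
    omega
  · subst hc0; omega
  · exfalso; apply h5
    have : (D:ℤ) * 1 ≤ D * c := mul_le_mul_of_nonneg_left (by omega) (by omega)
    omega
lemma rc_sum (D : ℕ) (hD : 0 < D) (R : Finset Tile) (g : Tile → ℂ) : ∑ p ∈ R, g p = ∑ k ∈ Finset.range D, ∑ p ∈ rc D R k, g p := by
  have h0 : (0:ℤ) < D := by exact_mod_cast hD
  have := Finset.sum_fiberwise_of_maps_to (s := R) (t := Finset.range D) (g := fun p => (p.s % D).toNat) (f := g) (fun p _ => by
    have h1 := Int.emod_nonneg p.s h0.ne'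
    have h2 := Int.emod_lt_of_pos p.s h0
    rw [Finset.mem_range]; omega)
  rw [← this]
  refine Finset.sum_congr rfl fun k hk => Finset.sum_congr ?_ fun _ _ => rfl
  unfold rc
  refine Finset.filter_congr fun p _ => ?_
  have h1 := Int.emod_nonneg p.s h0.ne'
  omega
noncomputable def R1 (X : Cx) (n Λ i D : ℕ) : Finset Tile := (X.PP n Λ i).filter (fun p => ¬ ∃ q ∈ X.PP n Λ i, q.Le p ∧ q.s + D ≤ p.s)
noncomputable def R2 (X : Cx) (n Λ i D : ℕ) : Finset Tile := (X.PP n Λ i).filter (fun p =>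
  (∃ q ∈ X.PP n Λ i, q.Le p ∧ q.s + D ≤ p.s) ∧ ¬ ∃ r ∈ X.PP n Λ i, p.Le r ∧ p.s + D ≤ r.s)
lemma PP_split (X : Cx) (n Λ i D : ℕ) (g : Tile → ℂ) : ∑ p ∈ X.PP n Λ i, g p =
    ∑ p ∈ X.R1 n Λ i D, g p + (∑ p ∈ X.R2 n Λ i D, g p + ∑ p ∈ X.FF n Λ i D, g p) := by
  unfold R1 R2 FF
  simp only [Finset.sum_filter]
  rw [← Finset.sum_add_distrib, ← Finset.sum_add_distrib]
  refine Finset.sum_congr rfl fun p _ => ?_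
  by_cases h1 : ∃ q ∈ X.PP n Λ i, q.Le p ∧ q.s + D ≤ p.s <;> by_cases h2 : ∃ r ∈ X.PP n Λ i, p.Le r ∧ p.s + D ≤ r.s <;> simp [h1, h2]
lemma FF_sum (X : Cx) {n Λ i D : ℕ} (hD : n + 5 ≤ D) {U : Finset Tile} (hU : X.Tops n Λ i U) {x : ℝ} (hx : x ∉ ⋃ u ∈ U, strip D u)
    (g : Tile → ℂ) (hg : ∀ p, x ∉ X.E p → g p = 0) : ∑ p ∈ X.FF n Λ i D, g p = ∑ u ∈ U, ∑ p ∈ X.VV n Λ i D u, g p := by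
  rw [← Finset.sum_biUnion]
  · refine (Finset.sum_subset ?_ ?_).symm
    · intro p hp
      obtain ⟨u, _, hp⟩ := Finset.mem_biUnion.1 hp
      exact (Finset.mem_filter.1 hp).1
    · intro p hp hn
      refine hg p fun hxp => ?_
      obtain ⟨u, hu, hT⟩ := hU.cov p (X.FF_PP hp)
      refine hx (mem_iUnion₂.2 ⟨u, hu, strip_sub (X.FF_close hD hU hp hu hT).2 hT.1 (fun h5 => hn ?_) (X.E_sub_I _ hxp)⟩)
      exact Finset.mem_biUnion.2 ⟨u, hu, Finset.mem_filter.2 ⟨hp, hT, h5⟩⟩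
  · intro u hu u' hu' hne
    refine Finset.disjoint_left.2 fun p hp hp' => hne ?_
    obtain ⟨h1, h2, h3⟩ := Finset.mem_filter.1 hp
    obtain ⟨g1, g2, g3⟩ := Finset.mem_filter.1 hp'
    exact X.FF_uniq hD hU h1 hu hu' h2.1 g2.1 (Tt_D hD h2) (Tt_D hD g2)
lemma layer_i (X : Cx) (n Λ i D : ℕ) (hD : n + 5 ≤ D) : ∃ H, MeasurableSet H ∧ volume H ≤ ENNReal.ofReal (6/2^D) * (ENNReal.ofReal Λ * volume X.Q) ∧
    ∃ G : ℕ → ℝ → ℝ → ℂ, (∀ k, X.Piece n D Λ (G k)) ∧ ∀ f, Bd f → ∀ x ∉ H,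
      ∑ p ∈ X.PP n Λ i, (X.E p).indicator (fun x => op (kp p.s) (md (X.N x) f) x) x = ∑ k ∈ Finset.range (2*D+1), op (G k) f x := by
  obtain ⟨U, hU⟩ := X.exists_tops n Λ i
  refine ⟨⋃ u ∈ U, strip D u, Finset.measurableSet_biUnion _ fun u _ => measurableSet_Icc.union measurableSet_Icc, X.strips_vol D hU,
    fun k => if k < D then X.K (rc D (X.R1 n Λ i D) k) else if k < 2*D then X.K (rc D (X.R2 n Λ i D) (k-D)) else fun x y => ∑ u ∈ U, X.K (X.VV n Λ i D u) x y, ?_, ?_⟩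
  · intro k
    have hR : ∀ R : Finset Tile, R ⊆ X.PP n Λ i → (∀ p ∈ R, ∀ p' ∈ R, p.Le p' → ¬ (p.s + D ≤ p'.s)) → ∀ k, X.Piece n D Λ (X.K (rc D R k)) := by
      intro R hR h k
      refine Or.inl ⟨_, fun p hp => X.PP_tiles (hR (Finset.mem_filter.1 hp).1), fun p hp => X.PP_nh (hR (Finset.mem_filter.1 hp).1), X.rc_anti h k, rfl⟩
    simp only
    split_ifs
    · exact hR (X.R1 n Λ i D) (Finset.filter_subset _ _) (fun p hp p' hp' hle hs => (Finset.mem_filter.1 hp').2 ⟨p, (Finset.mem_filter.1 hp).1, hle, hs⟩) k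
    · exact hR (X.R2 n Λ i D) (Finset.filter_subset _ _) (fun p hp p' hp' hle hs => (Finset.mem_filter.1 hp).2.2 ⟨p', (Finset.mem_filter.1 hp').1, hle, hs⟩) _
    · exact Or.inr ⟨U, _, X.forest hD hU, rfl⟩
  · intro f hf x hx
    rw [X.PP_split n Λ i D, X.FF_sum hD hU hx _ (fun p hp => Set.indicator_of_notMem hp _), rc_sum D (by omega), rc_sum D (by omega) (X.R2 n Λ i D)]
    rw [Finset.sum_range_succ, two_mul, Finset.sum_range_add, add_assoc]
    congr 1
    · refine Finset.sum_congr rfl fun k hk => ?_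
      beta_reduce
      rw [if_pos (Finset.mem_range.1 hk), X.op_K _ hf]
    congr 1
    · refine Finset.sum_congr rfl fun k hk => ?_
      have := Finset.mem_range.1 hk
      beta_reduce
      rw [if_neg (by omega), if_pos (by omega), X.op_K _ hf, Nat.add_sub_cancel_left]
    · beta_reduce
      rw [if_neg (by omega), if_neg (by omega), op_sum U (fun u => X.K (X.VV n Λ i D u)) (fun u _ => X.BK_K _) (fun _ _ => rfl) hf x]
      exact Finset.sum_congr rfl fun u _ => (X.op_K _ hf x).symm
lemma layer (X : Cx) (n Λ D : ℕ) (hD : n + 5 ≤ D) : ∃ H, MeasurableSet H ∧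
    volume H ≤ ENNReal.ofReal ((Nat.log 2 Λ + 1 : ℕ) * (6 * Λ / 2^D)) * volume X.Q ∧
    ∃ G : ℕ → ℕ → ℝ → ℝ → ℂ, (∀ i k, X.Piece n D Λ (G i k)) ∧ ∀ f, Bd f → ∀ x ∉ H,
      op (X.K (X.PN n Λ)) f x = ∑ i ∈ Finset.range (Nat.log 2 Λ + 1), ∑ k ∈ Finset.range (2*D+1), op (G i k) f x := by
  choose H hH1 hH2 G hG hGf using fun i => X.layer_i n Λ i D hD
  refine ⟨⋃ i ∈ Finset.range (Nat.log 2 Λ + 1), H i, Finset.measurableSet_biUnion _ fun i _ => hH1 i, ?_, G, hG, ?_⟩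
  · refine (measure_biUnion_finset_le _ _).trans ((Finset.sum_le_sum fun i _ => hH2 i).trans ?_)
    rw [Finset.sum_const, Finset.card_range, nsmul_eq_mul, ← mul_assoc, ← mul_assoc, ← ENNReal.ofReal_natCast, ← ENNReal.ofReal_mul (by positivity),
      ← ENNReal.ofReal_mul (by positivity)]
    refine mul_le_mul' (ENNReal.ofReal_le_ofReal (le_of_eq (by ring))) le_rfl
  · intro f hf x hx
    rw [X.op_K _ hf, ← Finset.sum_fiberwise_of_maps_to (t := Finset.range (Nat.log 2 Λ + 1)) (g := fun p => Nat.log 2 (X.BB n p).card)]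
    · refine Finset.sum_congr rfl fun i hi => ?_
      exact hGf i f hf x (fun h => hx (mem_iUnion₂.2 ⟨i, hi, h⟩))
    · intro p hp
      rw [Finset.mem_range, Nat.lt_succ_iff]
      exact Nat.log_mono_right (X.PN_card hp).2
/-- number of pieces -/
def mm (Λ D : ℕ) : ℕ := (Nat.log 2 Λ + 1) * (2*D+1)
lemma sum_bound {m : ℕ} (G : ℕ → ℝ → ℝ≥0∞) (hG : ∀ k, Measurable (G k)) (q : ℝ) (h1 : 1 ≤ q) (h2 : q ≤ 2) (B : ℝ≥0∞)
    (hB : ∀ k, ∫⁻ x, G k x ^ q ≤ B) : ∫⁻ x, (∑ k ∈ Finset.range m, G k x)^q ≤ (m:ℝ≥0∞)^2 * B := by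
  rcases Nat.eq_zero_or_pos m with rfl | hm
  · simp [ENNReal.zero_rpow_of_pos (show 0 < q by linarith)]
  have hm1 : (1:ℝ≥0∞) ≤ m := by exact_mod_cast hm
  calc ∫⁻ x, (∑ k ∈ Finset.range m, G k x)^q ≤ ∫⁻ x, m * ∑ k ∈ Finset.range m, (G k x)^q := by
        refine lintegral_mono fun x => (ENNReal.rpow_sum_le_const_mul_sum_rpow _ _ h1).trans (mul_le_mul' ?_ le_rfl)
        rw [Finset.card_range]
        refine (ENNReal.rpow_le_rpow_of_exponent_le hm1 (show q - 1 ≤ 1 by linarith)).trans (le_of_eq (ENNReal.rpow_one _))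
    _ = m * ∑ k ∈ Finset.range m, ∫⁻ x, (G k x)^q := by
        rw [lintegral_const_mul _ (Finset.measurable_sum _ fun k _ => (hG k).pow_const q), lintegral_finsetSum _ (fun k _ => (hG k).pow_const q)]
    _ ≤ m * ∑ k ∈ Finset.range m, B := mul_le_mul' le_rfl (Finset.sum_le_sum fun k _ => hB k)
    _ = _ := by rw [Finset.sum_const, Finset.card_range, nsmul_eq_mul]; ring
lemma layer_bound (q : ℝ) (hq : 1 < q) (hq2 : q ≤ 2) : ∃ C : ℝ≥0, ∀ (X : Cx) (n Λ D : ℕ), n + 5 ≤ D → ∃ H, MeasurableSet H ∧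
    volume H ≤ ENNReal.ofReal ((Nat.log 2 Λ + 1 : ℕ) * (6 * Λ / 2^D)) * volume X.Q ∧ ∀ f, Bd f →
    ∫⁻ x in Hᶜ, ‖op (X.K (X.PN n Λ)) f x‖ₑ ^ (2:ℝ) ≤ ENNReal.ofReal ((mm Λ D:ℝ)^2 * (2^(-(n:ℝ)/6) + Λ/2^D)) * (C * ∫⁻ x, ‖f x‖ₑ ^ (2:ℝ)) ∧
    ∫⁻ x in Hᶜ, ‖op (X.K (X.PN n Λ)) f x‖ₑ ^ q ≤ ENNReal.ofReal ((mm Λ D:ℝ)^2 * (1 + Λ/2^n)) * (C * ∫⁻ x, ‖f x‖ₑ ^ q) := by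
  obtain ⟨C, hC⟩ := piece_bound q hq
  refine ⟨C, fun X n Λ D hD => ?_⟩
  obtain ⟨H, hH1, hH2, G, hG, hGf⟩ := X.layer n Λ D hD
  refine ⟨H, hH1, hH2, fun f hf => ?_⟩
  have key : ∀ q : ℝ, 1 ≤ q → q ≤ 2 → ∀ (A : ℝ) (B : ℝ≥0∞), 0 ≤ A → (∀ i k, ∫⁻ x, ‖op (G i k) f x‖ₑ ^ q ≤ ENNReal.ofReal A * B) →
      ∫⁻ x in Hᶜ, ‖op (X.K (X.PN n Λ)) f x‖ₑ ^ q ≤ ENNReal.ofReal ((mm Λ D:ℝ)^2 * A) * B := by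
    intro q h1 h2 A B hA hAB
    have hm : ∀ i k, Measurable fun x => ‖op (G i k) f x‖ₑ := fun i k => (hf.op (hG i k).BK).meas.enorm
    calc ∫⁻ x in Hᶜ, ‖op (X.K (X.PN n Λ)) f x‖ₑ ^ q
        ≤ ∫⁻ x in Hᶜ, (∑ i ∈ Finset.range (Nat.log 2 Λ + 1), ∑ k ∈ Finset.range (2*D+1), ‖op (G i k) f x‖ₑ) ^ q := by
          refine setLIntegral_mono' hH1.compl fun x hx => ENNReal.rpow_le_rpow ?_ (by linarith)
          rw [hGf f hf x hx]
          exact (enorm_sum_le _ _).trans (Finset.sum_le_sum fun i _ => enorm_sum_le _ _)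
      _ ≤ ∫⁻ x, (∑ i ∈ Finset.range (Nat.log 2 Λ + 1), ∑ k ∈ Finset.range (2*D+1), ‖op (G i k) f x‖ₑ) ^ q := setLIntegral_le_lintegral _ _
      _ ≤ ((Nat.log 2 Λ + 1 : ℕ):ℝ≥0∞)^2 * (((2*D+1:ℕ):ℝ≥0∞)^2 * (ENNReal.ofReal A * B)) := by
          refine sum_bound (fun i x => ∑ k ∈ Finset.range (2*D+1), ‖op (G i k) f x‖ₑ) (fun i => Finset.measurable_sum _ fun k _ => hm i k) q h1 h2 _ fun i => ?_
          exact sum_bound (fun k x => ‖op (G i k) f x‖ₑ) (hm i) q h1 h2 _ (hAB i)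
      _ = ((mm Λ D : ℕ):ℝ≥0∞)^2 * (ENNReal.ofReal A * B) := by unfold mm; push_cast; ring
      _ = _ := by
          rw [ENNReal.ofReal_mul (by positivity), ENNReal.ofReal_pow (by positivity), ENNReal.ofReal_natCast, mul_assoc]
  have hn0 : (0:ℝ) < 2^(-(n:ℝ)/6) := Real.rpow_pos_of_pos (by norm_num) _
  exact ⟨key 2 (by norm_num) le_rfl _ _ (by positivity) fun i k => (hC X n D Λ hD _ (hG i k) f hf).1,
    key q hq.le hq2 _ _ (by positivity) fun i k => (hC X n D Λ hD _ (hG i k) f hf).2⟩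
end Cx
/-- measurable selection of an index that maximizes a finite family -/
lemma sel {ι : Type*} [MeasurableSpace ι] (T : Finset ι) (hT : T.Nonempty) (g : ι → ℝ → ℝ≥0∞) (hg : ∀ i ∈ T, Measurable (g i)) :
    ∃ σ : ℝ → ι, Measurable σ ∧ (∀ x, σ x ∈ T) ∧ (Measurable fun x => g (σ x) x) ∧ ∀ x, ∀ i ∈ T, g i x ≤ g (σ x) x := by
  induction hT using Finset.Nonempty.cons_induction with
  | singleton a =>
    refine ⟨fun _ => a, measurable_const, fun _ => Finset.mem_singleton_self a, hg a (Finset.mem_singleton_self a), fun x i hi => ?_⟩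
    rw [Finset.mem_singleton.1 hi]
  | cons a s h hs ih =>
    obtain ⟨σ, h1, h2, h3, h4⟩ := ih fun i hi => hg i (Finset.mem_cons_of_mem hi)
    have ha := hg a (Finset.mem_cons_self a s)
    have hm : MeasurableSet {x | g (σ x) x ≤ g a x} := measurableSet_le h3 ha
    have e : (fun x => g (if g (σ x) x ≤ g a x then a else σ x) x) = fun x => if g (σ x) x ≤ g a x then g a x else g (σ x) x := by
      funext x; split_ifs <;> rfl
    refine ⟨fun x => if g (σ x) x ≤ g a x then a else σ x, Measurable.ite hm measurable_const h1, fun x => ?_, ?_, ?_⟩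
    · simp only; split_ifs
      · exact Finset.mem_cons_self a s
      · exact Finset.mem_cons_of_mem (h2 x)
    · rw [e]; exact Measurable.ite hm ha h3
    · intro x i hi
      simp only
      rcases Finset.mem_cons.1 hi with rfl | hi
      · split_ifs with hc
        · exact le_rfl
        · exact (not_le.1 hc).le
      · split_ifs with hc
        · exact (h4 x i hi).trans hc
        · exact h4 x i hi
lemma exists_Cx (S : Finset ℝ) (hS : S.Nonempty) (k0 k1 j M : ℤ) (hk : k0 ≤ k1) (hj : k1 ≤ j) {f : ℝ → ℂ} (hf : Bd f) :
    ∃ X : Cx, X.j = j ∧ X.M = M ∧ X.k0 = k0 ∧ (∀ x, k0 ≤ X.a x) ∧ (∀ x, X.b x ≤ j) ∧ ∀ x, CC S k0 k1 f x ≤ ‖tr (X.a x) (X.b x) (md (X.N x) f) x‖ₑ := by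
  have hne : (S ×ˢ (Finset.Icc k0 k1 ×ˢ Finset.Icc k0 k1)).Nonempty := by
    refine Finset.Nonempty.product hS (Finset.Nonempty.product ?_ ?_) <;> exact ⟨k0, Finset.mem_Icc.2 ⟨le_rfl, hk⟩⟩
  obtain ⟨σ, h1, h2, -, h4⟩ := sel _ hne (fun i x => ‖tr i.2.1 i.2.2 (md i.1 f) x‖ₑ) (fun i _ => ((hf.md i.1).tr _ _).meas.enorm)
  have h5 : ∀ x, (σ x).1 ∈ S ∧ (k0 ≤ (σ x).2.1 ∧ (σ x).2.1 ≤ k1) ∧ (k0 ≤ (σ x).2.2 ∧ (σ x).2.2 ≤ k1) := by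
    intro x
    have := h2 x
    simpa only [Finset.mem_product, Finset.mem_Icc] using this
  refine ⟨⟨fun x => (σ x).1, fun x => (σ x).2.1, fun x => (σ x).2.2, S, j, M, k0, h1.fst, h1.snd.fst, h1.snd.snd, fun x => (h5 x).1⟩, rfl, rfl, rfl,
    fun x => (h5 x).2.1.1, fun x => (h5 x).2.2.2.trans hj, fun x => CC_le fun N hN a b ha hab hb => ?_⟩
  refine h4 x (N, a, b) ?_
  simp only [Finset.mem_product, Finset.mem_Icc]
  exact ⟨hN, ⟨ha, hab.trans hb⟩, ha.trans hab, hb⟩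
namespace Cx
lemma tr_tiles (X : Cx) (ha : ∀ x, X.k0 ≤ X.a x) (hb : ∀ x, X.b x ≤ X.j) {f : ℝ → ℂ} {x : ℝ} (hx : x ∈ X.Q) :
    tr (X.a x) (X.b x) (md (X.N x) f) x = ∑ p ∈ X.tiles, (X.E p).indicator (fun x => op (kp p.s) (md (X.N x) f) x) x := by
  unfold tr
  simp only [Set.indicator_apply]
  rw [← Finset.sum_filter]
  refine Finset.sum_bij (fun s _ => X.tl s x) ?_ ?_ ?_ ?_
  · intro s hs
    obtain ⟨h1, h2⟩ := Finset.mem_Icc.1 hs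
    exact Finset.mem_filter.2 ⟨X.tl_mem ((ha x).trans h1) (h2.trans (hb x)) hx, (X.tl_A s x).1, (X.tl_A s x).2, h1, h2⟩
  · intro s _ s' _ h
    exact congrArg Tile.s h
  · intro p hp
    obtain ⟨h1, h2⟩ := Finset.mem_filter.1 hp
    refine ⟨p.s, Finset.mem_Icc.2 ⟨h2.2.2.1, h2.2.2.2⟩, ?_⟩
    exact X.E_eq rfl (X.tl_A _ _) (X.E_sub_A _ h2)
  · intro s _; rfl
lemma Heavy_succ (X : Cx) {n : ℕ} {p : Tile} (h : X.Heavy n p) : X.Heavy (n+1) p := by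
  obtain ⟨l, t, k, ξ, h1, h2, h3, h4⟩ := h
  refine ⟨l, t, k, ξ, h1, h2, h3, lt_of_le_of_lt (ENNReal.ofReal_le_ofReal ?_) h4⟩
  have : (0:ℝ) < (2:ℝ)^t := by positivity
  refine mul_le_mul_of_nonneg_right ?_ this.le
  refine div_le_div_of_nonneg_left (by positivity) (by positivity) ?_
  exact pow_le_pow_right₀ (by norm_num) (by omega)
lemma Heavy_mono (X : Cx) {n m : ℕ} (hnm : n ≤ m) {p : Tile} (h : X.Heavy n p) : X.Heavy m p := by
  induction hnm with
  | refl => exact h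
  | step _ ih => exact X.Heavy_succ ih
/-- null tiles -/
noncomputable def ZZ (X : Cx) : Set ℝ := ⋃ p ∈ X.tiles.filter (fun p => ∀ n, ¬ X.Heavy n p), X.A p
lemma ZZ_null (X : Cx) : volume X.ZZ = 0 := by
  unfold ZZ
  refine (measure_biUnion_null_iff (Finset.countable_toSet _)).2 fun p hp => ?_
  obtain ⟨h1, h2⟩ := Finset.mem_filter.1 hp
  have key : ∀ n : ℕ, volume (X.A p) ≤ ENNReal.ofReal (1/2^n * p.L) := by
    intro n
    by_contra hc
    push Not at hc
    refine h2 n ⟨0, p.s, p.m, p.c, subset_rfl, X.tiles_I h1, by rw [sub_self, abs_zero]; have := inv_pos.2 p.L_pos; positivity, ?_⟩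
    refine lt_of_lt_of_le (lt_of_le_of_lt (ENNReal.ofReal_le_ofReal (le_of_eq ?_)) hc) (measure_mono fun x hx => ⟨hx.1, ?_⟩)
    · simp; rfl
    · have := Tile.Om_close hx.2
      have h0 := inv_pos.2 p.L_pos
      rw [← p.inv_L]
      linarith
  have : Tendsto (fun n : ℕ => ENNReal.ofReal (1/2^n * p.L)) atTop (𝓝 0) := by
    rw [← ENNReal.ofReal_zero]
    refine ENNReal.tendsto_ofReal ?_
    have := (tendsto_pow_atTop_nhds_zero_of_lt_one (show (0:ℝ) ≤ 1/2 by norm_num) (by norm_num)).mul_const p.L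
    rw [zero_mul] at this
    refine this.congr fun n => ?_
    rw [div_pow, one_pow]
  exact le_antisymm (ge_of_tendsto' this key) bot_le
/-- points with too many maximal tiles -/
noncomputable def GG (X : Cx) (n Λ : ℕ) : Set ℝ := {x | (Λ:ℝ≥0∞) < ∑ m ∈ X.MT n, m.I.indicator (fun _ => (1:ℝ≥0∞)) x}
lemma GG_vol (X : Cx) (n Λ : ℕ) (hΛ : 0 < Λ) : volume (X.GG n Λ) ≤ ENNReal.ofReal (2^(n+4) / Λ) * volume X.Q := by
  have hm : Measurable fun x => ∑ m ∈ X.MT n, m.I.indicator (fun _ => (1:ℝ≥0∞)) x :=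
    Finset.measurable_sum _ fun m _ => measurable_const.indicator m.I_meas
  have h1 : ∫⁻ x, ∑ m ∈ X.MT n, m.I.indicator (fun _ => (1:ℝ≥0∞)) x = ∑ m ∈ X.MT n, volume m.I := by
    rw [lintegral_finsetSum _ fun m _ => measurable_const.indicator m.I_meas]
    exact Finset.sum_congr rfl fun m _ => by rw [lintegral_indicator m.I_meas, setLIntegral_one]
  have hL0 : (Λ:ℝ≥0∞) ≠ 0 := by exact_mod_cast hΛ.ne'
  have h2 := meas_ge_le_lintegral_div (μ := volume) hm.aemeasurable hL0 (ENNReal.natCast_ne_top Λ)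
  rw [h1] at h2
  have hsub : X.GG n Λ ⊆ {x | (Λ:ℝ≥0∞) ≤ ∑ m ∈ X.MT n, m.I.indicator (fun _ => (1:ℝ≥0∞)) x} := by
    intro x hx
    have hx' : (Λ:ℝ≥0∞) < ∑ m ∈ X.MT n, m.I.indicator (fun _ => (1:ℝ≥0∞)) x := hx
    exact hx'.le
  refine (measure_mono hsub).trans (h2.trans ?_)
  rw [ENNReal.ofReal_div_of_pos (by exact_mod_cast hΛ), ENNReal.ofReal_natCast, ← ENNReal.mul_div_right_comm]
  exact ENNReal.div_le_div_right (X.MT_sum n) _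
lemma cnt_le (X : Cx) {n Λ : ℕ} {x : ℝ} (hx : x ∉ X.GG n Λ) {p : Tile} (hp : x ∈ p.I) : X.cnt n p ≤ Λ := by
  have h0 : ¬ ((Λ:ℝ≥0∞) < ∑ m ∈ X.MT n, m.I.indicator (fun _ => (1:ℝ≥0∞)) x) := hx
  have h := not_lt.1 h0
  have e : ∑ m ∈ X.MT n, m.I.indicator (fun _ => (1:ℝ≥0∞)) x = (((X.MT n).filter (fun m => x ∈ m.I)).card : ℝ≥0∞) := by
    rw [Finset.card_eq_sum_ones, Finset.sum_filter]
    push_cast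
    exact Finset.sum_congr rfl fun u _ => by simp [Set.indicator_apply]
  rw [e] at h
  refine le_trans (Finset.card_le_card fun m hm => ?_) (by exact_mod_cast h)
  obtain ⟨h1, h2⟩ := Finset.mem_filter.1 hm
  exact Finset.mem_filter.2 ⟨h1, h2 hp⟩
lemma layers (X : Cx) (Λ : ℕ → ℕ) : ∃ n0, ∀ x, x ∉ X.ZZ → (∀ n < n0, x ∉ X.GG n (Λ n)) → ∀ g : Tile → ℂ, (∀ p, x ∉ X.E p → g p = 0) →
    ∑ p ∈ X.tiles, g p = ∑ n ∈ Finset.range n0, ∑ p ∈ X.PN n (Λ n), g p := by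
  have h1 : ∀ p : Tile, ∃ n, (∃ n, X.Heavy n p) → X.Heavy (n+1) p ∧ ¬ X.Heavy n p := by
    intro p
    by_cases h : ∃ n, X.Heavy n p
    · have h0 : Nat.find h ≠ 0 := by
        intro h0
        have := Nat.find_spec h
        rw [h0] at this
        exact X.Heavy_zero p this
      refine ⟨Nat.find h - 1, fun _ => ⟨?_, Nat.find_min h (by omega)⟩⟩
      rw [Nat.sub_add_cancel (by omega)]; exact Nat.find_spec h
    · exact ⟨0, fun h' => absurd h' h⟩
  choose ν hν using h1
  refine ⟨X.tiles.sup ν + 1, fun x hZ hG g hg => ?_⟩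
  rw [← Finset.sum_fiberwise_of_maps_to (t := Finset.range (X.tiles.sup ν + 1)) (g := ν) (fun p hp => by
    rw [Finset.mem_range, Nat.lt_succ_iff]; exact Finset.le_sup hp)]
  refine Finset.sum_congr rfl fun n hn => ?_
  have hG := hG n (Finset.mem_range.1 hn)
  have hz : ∀ p ∈ X.tiles, x ∈ X.E p → ∃ n, X.Heavy n p := by
    intro p hp hxp
    by_contra hc
    push Not at hc
    exact hZ (mem_iUnion₂.2 ⟨p, Finset.mem_filter.2 ⟨hp, hc⟩, X.E_sub_A _ hxp⟩)
  unfold PN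
  rw [Finset.sum_filter, Finset.sum_filter]
  refine Finset.sum_congr rfl fun p hp => ?_
  by_cases hxp : x ∈ X.E p
  · have hH := hν p (hz p hp hxp)
    have hc := X.cnt_le hG (X.E_sub_I _ hxp)
    congr 1
    refine propext ⟨?_, ?_⟩
    · rintro rfl; exact ⟨hH.1, hH.2, hc⟩
    · rintro ⟨a1, a2, -⟩
      by_contra hne
      rcases lt_or_gt_of_ne hne with h | h
      · exact a2 (X.Heavy_mono h hH.1)
      · exact hH.2 (X.Heavy_mono h a1)
  · rw [hg p hxp, ite_self, ite_self]
end Cx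
/-- `2^{c n}` -/
noncomputable def ee (c : ℝ) (n : ℕ) : ℝ := (2:ℝ)^(c*n)
lemma ee_pos (c : ℝ) (n : ℕ) : 0 < ee c n := Real.rpow_pos_of_pos two_pos _
lemma ee_add (a b : ℝ) (n : ℕ) : ee a n * ee b n = ee (a+b) n := by
  unfold ee; rw [← Real.rpow_add two_pos, add_mul]
lemma ee_mono {a b : ℝ} (h : a ≤ b) (n : ℕ) : ee a n ≤ ee b n :=
  Real.rpow_le_rpow_of_exponent_le one_le_two (mul_le_mul_of_nonneg_right h n.cast_nonneg)
lemma ee_rpow (a s : ℝ) (n : ℕ) : ee a n ^ s = ee (a*s) n := by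
  unfold ee; rw [← Real.rpow_mul two_pos.le]; congr 1; ring
lemma ee_pow (a : ℝ) (n : ℕ) : ee a n = ((2:ℝ)^a)^n := by
  unfold ee; rw [Real.rpow_mul two_pos.le, Real.rpow_natCast]
lemma ee_nat (k n : ℕ) : ee k n = (2:ℝ)^(k*n) := by
  unfold ee; rw [← Nat.cast_mul, Real.rpow_natCast]
lemma ee_one (n : ℕ) : ee 1 n = (2:ℝ)^n := by
  unfold ee; rw [one_mul, Real.rpow_natCast]
lemma ee_one_le {a : ℝ} (h : 0 ≤ a) (n : ℕ) : 1 ≤ ee a n :=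
  Real.one_le_rpow one_le_two (mul_nonneg h n.cast_nonneg)
lemma ee_base {a : ℝ} (h : 0 < a) : (0:ℝ) ≤ (2:ℝ)^(-a) ∧ (2:ℝ)^(-a) < 1 :=
  ⟨(Real.rpow_pos_of_pos two_pos _).le, Real.rpow_lt_one_of_one_lt_of_neg one_lt_two (by linarith)⟩
lemma ee_sum {a : ℝ} (h : 0 < a) (n0 : ℕ) : ∑ n ∈ Finset.range n0, ee (-a) n ≤ (1-(2:ℝ)^(-a))⁻¹ := by
  simp_rw [ee_pow]
  obtain ⟨h0, h1⟩ := ee_base h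
  rw [← tsum_geometric_of_lt_one h0 h1]
  exact (summable_geometric_of_lt_one h0 h1).sum_le_tsum _ fun i _ => pow_nonneg h0 i
lemma ee_sum4 {a : ℝ} (h : 0 < a) : ∃ W : ℝ, 0 ≤ W ∧ ∀ n0, ∑ n ∈ Finset.range n0, ((n:ℝ)+1)^4 * ee (-a) n ≤ W := by
  obtain ⟨h0, h1⟩ := ee_base h
  have hs : Summable fun n : ℕ => ((n:ℝ)+1)^4 * ee (-a) n := by
    simp_rw [ee_pow]
    have s : ∀ k : ℕ, Summable fun n : ℕ => ((n:ℝ))^k * ((2:ℝ)^(-a))^n := fun k =>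
      summable_pow_mul_geometric_of_norm_lt_one k (by rw [Real.norm_of_nonneg h0]; exact h1)
    have := (((((s 4).add ((s 3).mul_left 4))).add ((s 2).mul_left 6)).add ((s 1).mul_left 4)).add (s 0)
    refine this.congr fun n => ?_
    ring
  refine ⟨_, tsum_nonneg fun n => by have := ee_pos (-a) n; positivity, fun n0 => hs.sum_le_tsum _ fun n _ => by have := ee_pos (-a) n; positivity⟩
set_option maxHeartbeats 1600000 in
lemma params {q r ε : ℝ} (hq : 1 < q) (hqr : q < r) (hr : r < 2) (hε : 0 < ε) :
    ∃ (Λ D : ℕ → ℕ) (hh w : ℕ → ℝ) (W : ℝ), 0 < W ∧ (∀ n, n + 5 ≤ D n) ∧ (∀ n, 0 < Λ n) ∧ (∀ n, 0 < hh n) ∧ (∀ n, 0 < w n) ∧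
      ∀ n0, ∑ n ∈ Finset.range n0, 2 * w n ≤ 1 ∧ ∑ n ∈ Finset.range n0, (2^(n+4) / (Λ n : ℝ)) ≤ ε ∧
        ∑ n ∈ Finset.range n0, ((Nat.log 2 (Λ n) + 1 : ℕ) * (6 * (Λ n : ℝ) / 2^(D n))) ≤ ε ∧
        ∑ n ∈ Finset.range n0, ((Cx.mm (Λ n) (D n) : ℝ)^2 * (2^(-(n:ℝ)/6) + (Λ n : ℝ)/2^(D n)) * (hh n ^ (2-r) * w n ^ (-(2:ℝ)))) ≤ W ∧
        ∑ n ∈ Finset.range n0, ((Cx.mm (Λ n) (D n) : ℝ)^2 * (1 + (Λ n : ℝ)/2^n) * (hh n ^ (q-r) * w n ^ (-q))) ≤ W := by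
  have h2r : 0 < 2 - r := by linarith
  set t : ℝ := 1/(24*(2-r)) with ht
  have ht0 : 0 < t := by positivity
  have htr : t * (2-r) = 1/24 := by rw [ht]; field_simp
  set σ : ℝ := t * (r-q) with hσ
  have hσ0 : 0 < σ := mul_pos ht0 (by linarith)
  set b : ℝ := min (σ/8) (1/48) with hb
  have hb0 : 0 < b := lt_min (by linarith) (by norm_num)
  have hb1 : b ≤ σ/8 := min_le_left _ _
  have hb2 : b ≤ 1/48 := min_le_right _ _
  set g : ℝ := min (σ/4) 1 with hg
  have hg0 : 0 < g := lt_min (by linarith) one_pos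
  have hg1 : g ≤ σ/4 := min_le_left _ _
  have hg2 : g ≤ 1 := min_le_right _ _
  set w0 : ℝ := (1-(2:ℝ)^(-b))/2 with hw0
  have hw00 : 0 < w0 := by have := (ee_base hb0).2; rw [hw0]; linarith
  obtain ⟨K, hK⟩ := exists_nat_gt (16*(1-(2:ℝ)^(-g))⁻¹/ε)
  have hgi : 0 < (1-(2:ℝ)^(-g))⁻¹ := inv_pos.2 (by have := (ee_base hg0).2; linarith)
  have hK0 : (0:ℝ) < K := lt_of_le_of_lt (by positivity) hK
  obtain ⟨D1, hD1⟩ := exists_nat_gt (3*(K:ℝ)^2/ε)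
  set D0 := D1 + K with hD0
  set Λ : ℕ → ℕ := fun n => K*⌈ee (1+g) n⌉₊ with hΛ
  set D : ℕ → ℕ := fun n => 5*n+D0+5 with hD
  have L1 : ∀ n, (K:ℝ)*ee (1+g) n ≤ Λ n := by
    intro n
    simp only [hΛ]; push_cast
    exact mul_le_mul_of_nonneg_left (Nat.le_ceil _) hK0.le
  have L2 : ∀ n, (Λ n:ℝ) ≤ 2*K*ee (1+g) n := by
    intro n
    simp only [hΛ]; push_cast
    have := (Nat.ceil_lt_add_one (ee_pos (1+g) n).le).le
    have h1 := ee_one_le (show 0 ≤ 1+g by linarith) n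
    nlinarith
  have L3 : ∀ n, (Λ n:ℝ) ≤ 2*K*2^(2*n) := by
    intro n
    refine (L2 n).trans (mul_le_mul_of_nonneg_left ?_ (by positivity))
    rw [← ee_nat]
    exact ee_mono (by push_cast; linarith) n
  have Lpos : ∀ n, 0 < Λ n := by
    intro n
    have h1 := ee_pos (1+g) n
    exact_mod_cast lt_of_lt_of_le (show (0:ℝ) < K*ee (1+g) n by positivity) (L1 n)
  have hK2 : (K:ℝ) ≤ 2^K := by exact_mod_cast (Nat.lt_two_pow_self (n := K)).le
  have e2 : ∀ n, (2:ℝ)^(D n) = 2^(2*n)*2^(2*n)*2^n*2^D1*2^K*32 := by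
    intro n
    simp only [hD, hD0]
    rw [← pow_add, ← pow_add, ← pow_add, ← pow_add, show (32:ℝ) = 2^5 by norm_num, ← pow_add]
    congr 1; ring
  have one2 : ∀ k : ℕ, (1:ℝ) ≤ 2^k := fun k => one_le_pow₀ one_le_two
  have L4 : ∀ n, (Λ n:ℝ)/2^(D n) ≤ ee (-1) n := by
    intro n
    rw [div_le_iff₀ (by positivity), e2]
    have : ee (-1) n * 2^n = 1 := by
      rw [← ee_one n, ee_add]; simp [ee]
    calc (Λ n:ℝ) ≤ 2*K*2^(2*n) := L3 n
      _ ≤ 2*2^K*2^(2*n) := by gcongr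
      _ = 1*(2^(2*n)*1*1*2^K*2) := by ring
      _ ≤ 1*(2^(2*n)*2^(2*n)*2^D1*2^K*32) := by
        gcongr
        · exact one2 _
        · exact one2 _
        · norm_num
      _ = ee (-1) n * 2^n * (2^(2*n)*2^(2*n)*2^D1*2^K*32) := by rw [this]
      _ = _ := by ring
  have mL : ∀ n, (Cx.mm (Λ n) (D n):ℝ)^2 ≤ 4*((D0:ℝ)+6)^4*((n:ℝ)+1)^4 := by
    intro n
    have h1 : Nat.log 2 (Λ n) ≤ D n := by
      rw [← Nat.log_pow one_lt_two (D n)]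
      refine Nat.log_mono_right ?_
      have := L4 n
      rw [div_le_iff₀ (by positivity)] at this
      have h1 : ee (-1) n ≤ 1 := by
        have := ee_mono (show (-1:ℝ) ≤ 0 by norm_num) n
        simpa [ee] using this
      have : (Λ n:ℝ) ≤ 2^(D n) := this.trans (by nlinarith [one2 (D n)])
      exact_mod_cast this
    have h2 : Cx.mm (Λ n) (D n) ≤ 2*((D0+6)*(n+1))^2 := by
      unfold Cx.mm
      have h3 : D n + 1 ≤ (D0+6)*(n+1) := by simp only [hD]; nlinarith
      calc (Nat.log 2 (Λ n)+1)*(2*D n+1) ≤ (D n+1)*(2*(D n+1)) := by gcongr; omega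
        _ = 2*(D n+1)^2 := by ring
        _ ≤ _ := by gcongr
    have h3 : (Cx.mm (Λ n) (D n):ℝ) ≤ 2*(((D0:ℝ)+6)*((n:ℝ)+1))^2 := by exact_mod_cast h2
    calc (Cx.mm (Λ n) (D n):ℝ)^2 ≤ (2*(((D0:ℝ)+6)*((n:ℝ)+1))^2)^2 := by gcongr
      _ = _ := by ring
  obtain ⟨W1, hW10, hW1⟩ := ee_sum4 (show (0:ℝ) < 1/12 by norm_num)
  obtain ⟨W2, hW20, hW2⟩ := ee_sum4 (show (0:ℝ) < σ/2 by linarith)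
  set c1 : ℝ := 4*((D0:ℝ)+6)^4 with hc1
  have hc10 : 0 < c1 := by positivity
  set w : ℕ → ℝ := fun n => w0*ee (-b) n with hw
  have wp : ∀ n, 0 < w n := fun n => mul_pos hw00 (ee_pos _ _)
  refine ⟨Λ, D, fun n => ee t n, w, c1*2*w0^(-(2:ℝ))*W1 + c1*(1+2*K)*w0^(-q)*W2 + 1, ?_, fun n => by simp only [hD]; omega, Lpos, fun n => ee_pos _ _, wp, fun n0 => ⟨?_, ?_, ?_, ?_, ?_⟩⟩
  · have := Real.rpow_nonneg hw00.le (-(2:ℝ)); have := Real.rpow_nonneg hw00.le (-q); positivity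
  · simp only [hw]
    rw [← Finset.mul_sum, ← Finset.mul_sum]
    have := ee_sum hb0 n0
    have h1 : 0 < 1-(2:ℝ)^(-b) := by have := (ee_base hb0).2; linarith
    calc 2*(w0*∑ n ∈ Finset.range n0, ee (-b) n) ≤ 2*(w0*(1-(2:ℝ)^(-b))⁻¹) := by gcongr
      _ = 1 := by rw [hw0]; field_simp
  · calc ∑ n ∈ Finset.range n0, (2^(n+4) / (Λ n : ℝ)) ≤ ∑ n ∈ Finset.range n0, 16/K*ee (-g) n := by
          refine Finset.sum_le_sum fun n _ => ?_
          have h1 := ee_pos (1+g) n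
          have h3 : (2:ℝ)^n = ee (-g) n * ee (1+g) n := by
            rw [ee_add, show -g+(1+g) = ((1:ℕ):ℝ) by push_cast; ring, ee_nat, one_mul]
          refine (div_le_div_of_nonneg_left (by positivity) (by positivity) (L1 n)).trans (le_of_eq ?_)
          rw [pow_add, h3]; field_simp; norm_num
      _ ≤ 16/K*(1-(2:ℝ)^(-g))⁻¹ := by rw [← Finset.mul_sum]; exact mul_le_mul_of_nonneg_left (ee_sum hg0 n0) (by positivity)
      _ ≤ ε := by
        rw [div_lt_iff₀ hε] at hK
        rw [div_mul_eq_mul_div, div_le_iff₀ hK0]; linarith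
  · calc _ ≤ ∑ n ∈ Finset.range n0, (3*(K:ℝ)^2/2^D1)*(1/2)*ee (-1) n := by
          refine Finset.sum_le_sum fun n _ => ?_
          have h1 : ((Nat.log 2 (Λ n)+1:ℕ):ℝ) ≤ 2*Λ n := by
            have := Nat.log_le_self 2 (Λ n)
            have := Lpos n
            exact_mod_cast (by omega : Nat.log 2 (Λ n)+1 ≤ 2*Λ n)
          have h2 : ee (-1) n * 2^n = 1 := by
            rw [← ee_one n, ee_add]; simp [ee]
          have h3 := L3 n
          calc ((Nat.log 2 (Λ n)+1:ℕ):ℝ) * (6*(Λ n:ℝ)/2^(D n)) ≤ (2*Λ n)*(6*(Λ n:ℝ)/2^(D n)) := by gcongr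
            _ = 12*(Λ n:ℝ)^2/2^(D n) := by ring
            _ ≤ 12*(2*K*2^(2*n))^2/2^(D n) := by gcongr
            _ ≤ _ := by
              rw [div_le_iff₀ (by positivity), e2]
              have : 3*(K:ℝ)^2/2^D1*(1/2)*ee (-1) n*(2^(2*n)*2^(2*n)*2^n*2^D1*2^K*32) = 48*(K:ℝ)^2*(2^(2*n))^2*2^K*(ee (-1) n * 2^n) := by
                field_simp; ring
              rw [this, h2]
              have : 0 ≤ 48*(K:ℝ)^2*(2^(2*n))^2 := by positivity
              nlinarith [one2 K]
      _ ≤ (3*(K:ℝ)^2/2^D1)*(1/2)*(1-(2:ℝ)^(-(1:ℝ)))⁻¹ := by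
        rw [← Finset.mul_sum]; exact mul_le_mul_of_nonneg_left (ee_sum one_pos n0) (by positivity)
      _ = 3*(K:ℝ)^2/2^D1 := by rw [Real.rpow_neg_one]; norm_num; ring
      _ ≤ ε := by
        rw [div_lt_iff₀ hε] at hD1
        have : (D1:ℝ) ≤ 2^D1 := by exact_mod_cast (Nat.lt_two_pow_self (n := D1)).le
        rw [div_le_iff₀ (by positivity)]; nlinarith
  · have h0 := Real.rpow_nonneg hw00.le (-(2:ℝ))
    have h0' := Real.rpow_nonneg hw00.le (-q)
    calc _ ≤ ∑ n ∈ Finset.range n0, (c1*2*w0^(-(2:ℝ)))*(((n:ℝ)+1)^4*ee (-(1/12)) n) := by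
          refine Finset.sum_le_sum fun n _ => ?_
          have h1 : (2:ℝ)^(-(n:ℝ)/6) + (Λ n:ℝ)/2^(D n) ≤ 2*ee (-(1/6)) n := by
            have h2 : (2:ℝ)^(-(n:ℝ)/6) = ee (-(1/6)) n := by unfold ee; congr 1; ring
            have := (L4 n).trans (ee_mono (show (-1:ℝ) ≤ -(1/6) by norm_num) n)
            rw [h2]; linarith
          have h3 : ee t n ^ (2-r) * w n ^ (-(2:ℝ)) ≤ w0^(-(2:ℝ))*ee (1/12) n := by
            simp only [hw]
            rw [Real.mul_rpow hw00.le (ee_pos _ _).le, ee_rpow, ee_rpow, mul_left_comm, ee_add]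
            exact mul_le_mul_of_nonneg_left (ee_mono (by rw [htr]; linarith) n) h0
          have p1 := ee_pos (-(1/6)) n
          have p2 := ee_pos (1/12) n
          have p3 := Real.rpow_pos_of_pos (wp n) (-(2:ℝ))
          have p4 := Real.rpow_pos_of_pos (ee_pos t n) (2-r)
          calc _ ≤ (c1*((n:ℝ)+1)^4)*(2*ee (-(1/6)) n)*(w0^(-(2:ℝ))*ee (1/12) n) := by gcongr; exact mL n
            _ = c1*2*w0^(-(2:ℝ))*(((n:ℝ)+1)^4*(ee (-(1/6)) n*ee (1/12) n)) := by ring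
            _ = _ := by rw [ee_add]; norm_num
      _ ≤ c1*2*w0^(-(2:ℝ))*W1 := by rw [← Finset.mul_sum]; exact mul_le_mul_of_nonneg_left (hW1 n0) (by positivity)
      _ ≤ _ := by have : 0 ≤ c1*(1+2*K)*w0^(-q)*W2 := by positivity
                  linarith
  · have h0 := Real.rpow_nonneg hw00.le (-(2:ℝ))
    have h0' := Real.rpow_nonneg hw00.le (-q)
    calc _ ≤ ∑ n ∈ Finset.range n0, (c1*(1+2*K)*w0^(-q))*(((n:ℝ)+1)^4*ee (-(σ/2)) n) := by
          refine Finset.sum_le_sum fun n _ => ?_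
          have h1 : 1 + (Λ n:ℝ)/2^n ≤ (1+2*K)*ee (σ/4) n := by
            have h2 : (Λ n:ℝ)/2^n ≤ 2*K*ee (σ/4) n := by
              rw [div_le_iff₀ (by positivity), ← ee_one n, mul_assoc, ee_add]
              exact (L2 n).trans (mul_le_mul_of_nonneg_left (ee_mono (by linarith) n) (by positivity))
            have := ee_one_le (show 0 ≤ σ/4 by linarith) n
            linarith
          have h3 : ee t n ^ (q-r) * w n ^ (-q) ≤ w0^(-q)*ee (-σ+σ/4) n := by
            simp only [hw]
            rw [Real.mul_rpow hw00.le (ee_pos _ _).le, ee_rpow, ee_rpow, mul_left_comm, ee_add]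
            refine mul_le_mul_of_nonneg_left (ee_mono ?_ n) h0'
            have : t*(q-r) = -σ := by rw [hσ]; ring
            rw [this]; nlinarith
          have p1 := ee_pos (σ/4) n
          have p2 := ee_pos (-σ+σ/4) n
          have p3 := Real.rpow_pos_of_pos (wp n) (-q)
          have p4 := Real.rpow_pos_of_pos (ee_pos t n) (q-r)
          calc _ ≤ (c1*((n:ℝ)+1)^4)*((1+2*K)*ee (σ/4) n)*(w0^(-q)*ee (-σ+σ/4) n) := by gcongr; exact mL n
            _ = c1*(1+2*K)*w0^(-q)*(((n:ℝ)+1)^4*(ee (σ/4) n*ee (-σ+σ/4) n)) := by ring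
            _ = _ := by rw [ee_add]; congr 3; ring
      _ ≤ c1*(1+2*K)*w0^(-q)*W2 := by rw [← Finset.mul_sum]; exact mul_le_mul_of_nonneg_left (hW2 n0) (by positivity)
      _ ≤ _ := by have : 0 ≤ c1*2*w0^(-(2:ℝ))*W1 := by positivity
                  linarith
lemma trunc_low {f : ℝ → ℂ} {H r s : ℝ} (hr : 0 < r) (hs : r ≤ s) :
    ∫⁻ y, ‖{y | ‖f y‖ ≤ H}.indicator f y‖ₑ ^ s ≤ ENNReal.ofReal (H^(s-r)) * ∫⁻ y, ‖f y‖ₑ ^ r := by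
  rw [← lintegral_const_mul' _ _ ENNReal.ofReal_ne_top]
  refine lintegral_mono fun y => ?_
  by_cases hy : ‖f y‖ ≤ H
  · rw [indicator_of_mem (show y ∈ {y | ‖f y‖ ≤ H} from hy), ← ofReal_norm,
      ENNReal.ofReal_rpow_of_nonneg (norm_nonneg _) (by linarith), ENNReal.ofReal_rpow_of_nonneg (norm_nonneg _) hr.le,
      ← ENNReal.ofReal_mul (Real.rpow_nonneg ((norm_nonneg _).trans hy) _)]
    refine ENNReal.ofReal_le_ofReal ?_
    calc ‖f y‖^s = ‖f y‖^(s-r) * ‖f y‖^r := by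
          rw [← Real.rpow_add_of_nonneg (norm_nonneg _) (by linarith) hr.le]; congr 1; ring
      _ ≤ _ := mul_le_mul_of_nonneg_right (Real.rpow_le_rpow (norm_nonneg _) hy (by linarith)) (by positivity)
  · rw [indicator_of_notMem (show y ∉ {y | ‖f y‖ ≤ H} from hy)]
    simp only [enorm_zero]
    rw [ENNReal.zero_rpow_of_pos (by linarith)]; exact bot_le
lemma trunc_high {f : ℝ → ℂ} {H r s : ℝ} (hH : 0 < H) (hs0 : 0 < s) (hs : s ≤ r) :
    ∫⁻ y, ‖{y | ‖f y‖ ≤ H}ᶜ.indicator f y‖ₑ ^ s ≤ ENNReal.ofReal (H^(s-r)) * ∫⁻ y, ‖f y‖ₑ ^ r := by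
  rw [← lintegral_const_mul' _ _ ENNReal.ofReal_ne_top]
  refine lintegral_mono fun y => ?_
  by_cases hy : ‖f y‖ ≤ H
  · rw [indicator_of_notMem (show y ∉ {y | ‖f y‖ ≤ H}ᶜ from fun h => h hy)]
    simp only [enorm_zero]
    rw [ENNReal.zero_rpow_of_pos hs0]; exact bot_le
  · rw [indicator_of_mem (show y ∈ {y | ‖f y‖ ≤ H}ᶜ from hy), ← ofReal_norm,
      ENNReal.ofReal_rpow_of_nonneg (norm_nonneg _) hs0.le, ENNReal.ofReal_rpow_of_nonneg (norm_nonneg _) (by linarith),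
      ← ENNReal.ofReal_mul (by positivity)]
    refine ENNReal.ofReal_le_ofReal ?_
    have hy' := not_le.1 hy
    calc ‖f y‖^s = ‖f y‖^(s-r) * ‖f y‖^r := by
          rw [← Real.rpow_add (hH.trans hy')]; congr 1; ring
      _ ≤ _ := mul_le_mul_of_nonneg_right (Real.rpow_le_rpow_of_nonpos hH hy'.le (by linarith)) (by positivity)
lemma cheb_piece {F : ℝ → ℝ≥0∞} (hF : Measurable F) {H : Set ℝ} (hH : MeasurableSet H) {s r a hh h A w : ℝ} {j : ℤ} {C : ℝ≥0}
    (hs : 0 < s) (ha : 0 ≤ a) (hhp : 0 < hh) (hp : 0 < h) (hA : 0 < A) (hw : 0 < w)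
    (hI : ∫⁻ x in Hᶜ, F x ^ s ≤ ENNReal.ofReal a * (C * (ENNReal.ofReal ((hh*h)^(s-r)) * ENNReal.ofReal ((2:ℝ)^j * h^r)))) :
    volume (Hᶜ ∩ {x | ENNReal.ofReal (A*h*w) < F x}) ≤ ENNReal.ofReal (C*A^(-s)*(2:ℝ)^j*(a*(hh^(s-r)*w^(-s)))) := by
  have h1 := cheb (Hᶜ.indicator F) (hF.indicator hH.compl) s (A*h*w) hs (by positivity) (ENNReal.ofReal a * (C * (ENNReal.ofReal ((hh*h)^(s-r)) * ENNReal.ofReal ((2:ℝ)^j * h^r)))) (by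
    have : ∀ x, Hᶜ.indicator F x ^ s = Hᶜ.indicator (fun x => F x ^ s) x := by
      intro x
      by_cases hx : x ∈ Hᶜ
      · rw [indicator_of_mem hx, indicator_of_mem hx]
      · rw [indicator_of_notMem hx, indicator_of_notMem hx, ENNReal.zero_rpow_of_pos hs]
    simp_rw [this]
    rw [lintegral_indicator hH.compl]; exact hI)
  refine (measure_mono ?_).trans (h1.trans (le_of_eq ?_))
  · rintro x ⟨hx, h2⟩
    rw [mem_ofPred_eq, indicator_of_mem hx]; exact h2
  · rw [← ENNReal.ofReal_coe_nnreal, ← ENNReal.ofReal_mul (by positivity), ← ENNReal.ofReal_mul (by positivity), ← ENNReal.ofReal_mul ha, ← ENNReal.ofReal_mul (by positivity)]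
    congr 1
    rw [Real.mul_rpow hhp.le hp.le, Real.mul_rpow (by positivity) hw.le, Real.mul_rpow hA.le hp.le]
    have : h^(s-r) * h^r * h^(-s) = 1 := by
      rw [← Real.rpow_add hp, ← Real.rpow_add hp, show s-r+r+-s = 0 by ring, Real.rpow_zero]
    linear_combination (C*A^(-s)*(2:ℝ)^j*(a*(hh^(s-r)*w^(-s)))) * this
lemma sum_ofReal_le {n0 : ℕ} {g : ℕ → ℝ} (hg : ∀ n, 0 ≤ g n) {B c : ℝ} (hc : 0 ≤ c) (h : ∑ n ∈ Finset.range n0, g n ≤ B) :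
    ∑ n ∈ Finset.range n0, ENNReal.ofReal (c * g n) ≤ ENNReal.ofReal (c * B) := by
  rw [← ENNReal.ofReal_sum_of_nonneg fun n _ => mul_nonneg hc (hg n), ← Finset.mul_sum]
  exact ENNReal.ofReal_le_ofReal (mul_le_mul_of_nonneg_left h hc)
set_option maxHeartbeats 800000 in
theorem loc_all {r : ℝ} (hr : 1 < r) (hr2 : r < 2) : Loc univ r := by
  intro ε₀ hε₀
  set q : ℝ := (1+r)/2 with hq
  have hq1 : 1 < q := by rw [hq]; linarith
  have hqr : q < r := by rw [hq]; linarith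
  obtain ⟨C, hC⟩ := Cx.layer_bound q hq1 (by linarith)
  set ε : ℝ := ε₀/4 with hε
  have hε0 : 0 < ε := by positivity
  obtain ⟨Λ, D, hh, w, W, hW, hD, hΛ, hhp, hwp, hsum⟩ := params hq1 hqr hr2 hε0
  set A : ℝ := max 1 (C*W/ε) with hA
  have hA1 : 1 ≤ A := le_max_left _ _
  have hA2 : C*W ≤ ε*A := by
    have := le_max_right 1 (C*W/ε)
    rw [← hA, div_le_iff₀ hε0] at this; linarith
  have hA0 : 0 < A := by linarith
  have hAs : ∀ s : ℝ, 1 ≤ s → C*A^(-s)*W ≤ ε := by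
    intro s hs
    have h1 : A^(-s) ≤ A⁻¹ := by rw [← Real.rpow_neg_one]; exact Real.rpow_le_rpow_of_exponent_le hA1 (by linarith)
    calc C*A^(-s)*W = (C*W)*A^(-s) := by ring
      _ ≤ (ε*A)*A⁻¹ := mul_le_mul hA2 h1 (by positivity) (by positivity)
      _ = ε := by field_simp
  refine ⟨A, hA0, fun S _ k0 k1 j M f h hkj hf hh0 hsupp hit => ?_⟩
  by_cases hSk : S.Nonempty ∧ k0 ≤ k1
  swap
  · have : ∀ x, CC S k0 k1 f x ≤ 0 := fun x => CC_le fun N hN a b ha hab hb => absurd ⟨⟨N, hN⟩, by omega⟩ hSk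
    have h2 : {x ∈ Dy j M | ENNReal.ofReal (A*h) < CC S k0 k1 f x} = ∅ := by
      ext x
      simp only [mem_ofPred_eq, mem_empty_iff_false, iff_false, not_and, not_lt]
      intro _; exact (this x).trans bot_le
    rw [h2]; simp
  obtain ⟨X, hXj, hXM, hXk, hXa, hXb, hXC⟩ := exists_Cx S hSk.1 k0 k1 j M hSk.2 hkj hf
  have hQ : X.Q = Dy j M := by unfold Cx.Q; rw [hXj, hXM]
  have hQv : volume X.Q = ENNReal.ofReal ((2:ℝ)^j) := by rw [hQ, Dy_vol]
  obtain ⟨n0, hn0⟩ := X.layers Λ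
  choose H hHm hHv hH using fun n => hC X n (Λ n) (D n) (hD n)
  set fm : ℕ → ℝ → ℂ := fun n => {y | ‖f y‖ ≤ hh n * h}.indicator f with hfm
  set fp : ℕ → ℝ → ℂ := fun n => {y | ‖f y‖ ≤ hh n * h}ᶜ.indicator f with hfp
  have hms : ∀ n, MeasurableSet {y | ‖f y‖ ≤ hh n * h} := fun n => measurableSet_le hf.meas.norm measurable_const
  have bm : ∀ n, Bd (fm n) := fun n => hf.indicator (hms n)
  have bp : ∀ n, Bd (fp n) := fun n => hf.indicator (hms n).compl
  have hadd : ∀ n x, op (X.K (X.PN n (Λ n))) f x = op (X.K (X.PN n (Λ n))) (fm n) x + op (X.K (X.PN n (Λ n))) (fp n) x := by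
    intro n x
    unfold op
    rw [← integral_add (((X.BK_K _).slice x).mul (bm n)).integrable (((X.BK_K _).slice x).mul (bp n)).integrable]
    refine integral_congr_ae (ae_of_all _ fun y => ?_)
    simp only
    rw [← mul_add]; congr 1
    exact (congrFun (indicator_self_add_compl {y | ‖f y‖ ≤ hh n * h} f) y).symm
  set G1 : ℕ → Set ℝ := fun n => (H n)ᶜ ∩ {x | ENNReal.ofReal (A*h*w n) < ‖op (X.K (X.PN n (Λ n))) (fm n) x‖ₑ} with hG1
  set G2 : ℕ → Set ℝ := fun n => (H n)ᶜ ∩ {x | ENNReal.ofReal (A*h*w n) < ‖op (X.K (X.PN n (Λ n))) (fp n) x‖ₑ} with hG2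
  have v1 : ∀ n, volume (G1 n) ≤ ENNReal.ofReal (C*A^(-(2:ℝ))*(2:ℝ)^j*(((Cx.mm (Λ n) (D n):ℝ)^2*(2^(-(n:ℝ)/6) + (Λ n:ℝ)/2^(D n)))*(hh n^(2-r)*w n^(-(2:ℝ))))) := by
    intro n
    refine cheb_piece ((bm n).op (X.BK_K _)).meas.enorm (hHm n) two_pos (by positivity) (hhp n) hh0 hA0 (hwp n) ?_
    refine (hH n _ (bm n)).1.trans (mul_le_mul' le_rfl (mul_le_mul' le_rfl ?_))
    exact (trunc_low (by linarith) hr2.le).trans (mul_le_mul' le_rfl hit)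
  have v2 : ∀ n, volume (G2 n) ≤ ENNReal.ofReal (C*A^(-q)*(2:ℝ)^j*(((Cx.mm (Λ n) (D n):ℝ)^2*(1 + (Λ n:ℝ)/2^n))*(hh n^(q-r)*w n^(-q)))) := by
    intro n
    refine cheb_piece ((bp n).op (X.BK_K _)).meas.enorm (hHm n) (by linarith) (by positivity) (hhp n) hh0 hA0 (hwp n) ?_
    refine (hH n _ (bp n)).2.trans (mul_le_mul' le_rfl (mul_le_mul' le_rfl ?_))
    exact (trunc_high (mul_pos (hhp n) hh0) (by linarith) hqr.le).trans (mul_le_mul' le_rfl hit)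
  obtain ⟨s1, s2, s3, s4, s5⟩ := hsum n0
  have hsub : {x ∈ Dy j M | ENNReal.ofReal (A*h) < CC S k0 k1 f x} ⊆
      X.ZZ ∪ ((⋃ n ∈ Finset.range n0, X.GG n (Λ n)) ∪ ((⋃ n ∈ Finset.range n0, H n) ∪ ((⋃ n ∈ Finset.range n0, G1 n) ∪ (⋃ n ∈ Finset.range n0, G2 n)))) := by
    rintro x ⟨hxQ, hx⟩
    by_contra hc
    simp only [mem_union, mem_iUnion, not_or, not_exists, Finset.mem_range] at hc
    obtain ⟨c0, c1, c2, c3, c4⟩ := hc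
    have key : CC S k0 k1 f x ≤ ENNReal.ofReal (A*h) := by
      refine (hXC x).trans ?_
      rw [X.tr_tiles (by rw [hXk]; exact hXa) (by rw [hXj]; exact hXb) (by rw [hQ]; exact hxQ),
        hn0 x c0 (fun n hn => c1 n hn) (fun p => (X.E p).indicator (fun x => op (kp p.s) (md (X.N x) f) x) x) (fun p hp => indicator_of_notMem hp _)]
      simp_rw [← X.op_K _ hf]
      calc _ ≤ ∑ n ∈ Finset.range n0, ‖op (X.K (X.PN n (Λ n))) f x‖ₑ := enorm_sum_le _ _
        _ ≤ ∑ n ∈ Finset.range n0, ENNReal.ofReal (A*h*(2*w n)) := by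
          refine Finset.sum_le_sum fun n hn => ?_
          have hn := Finset.mem_range.1 hn
          rw [hadd n x]
          refine (enorm_add_le _ _).trans ?_
          have w0 := hwp n
          rw [show A*h*(2*w n) = A*h*w n + A*h*w n by ring, ENNReal.ofReal_add (by positivity) (by positivity)]
          refine add_le_add ?_ ?_
          · by_contra hcc
            exact c3 n hn ⟨c2 n hn, not_le.1 hcc⟩
          · by_contra hcc
            exact c4 n hn ⟨c2 n hn, not_le.1 hcc⟩
        _ ≤ ENNReal.ofReal (A*h*1) := sum_ofReal_le (fun n => by have := hwp n; positivity) (by positivity) s1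
        _ = _ := by rw [mul_one]
    exact absurd hx (not_lt.2 key)
  have hj : (0:ℝ) < 2^j := by positivity
  have bu : ∀ G : ℕ → Set ℝ, volume (⋃ n ∈ Finset.range n0, G n) ≤ ∑ n ∈ Finset.range n0, volume (G n) := fun G => measure_biUnion_finset_le _ _
  have t1 : volume (⋃ n ∈ Finset.range n0, X.GG n (Λ n)) ≤ ENNReal.ofReal (2^j*ε) := by
    refine (bu _).trans (le_trans (Finset.sum_le_sum fun n _ => ?_) (sum_ofReal_le (fun n => by positivity) hj.le s2))
    refine (X.GG_vol n (Λ n) (hΛ n)).trans (le_of_eq ?_)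
    rw [hQv, ← ENNReal.ofReal_mul (by positivity), mul_comm]
  have t2 : volume (⋃ n ∈ Finset.range n0, H n) ≤ ENNReal.ofReal (2^j*ε) := by
    refine (bu _).trans (le_trans (Finset.sum_le_sum fun n _ => ?_) (sum_ofReal_le (fun n => by positivity) hj.le s3))
    refine (hHv n).trans (le_of_eq ?_)
    rw [hQv, ← ENNReal.ofReal_mul (by positivity), mul_comm]
  have t3 : volume (⋃ n ∈ Finset.range n0, G1 n) ≤ ENNReal.ofReal (2^j*ε) := by
    refine (bu _).trans ((Finset.sum_le_sum fun n _ => v1 n).trans ((sum_ofReal_le (fun n => ?_) (by positivity) s4).trans (ENNReal.ofReal_le_ofReal ?_)))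
    · have := hhp n; have := hwp n; positivity
    · have := hAs 2 one_le_two
      calc C*A^(-(2:ℝ))*(2:ℝ)^j*W = (2:ℝ)^j*(C*A^(-(2:ℝ))*W) := by ring
        _ ≤ _ := by gcongr
  have t4 : volume (⋃ n ∈ Finset.range n0, G2 n) ≤ ENNReal.ofReal (2^j*ε) := by
    refine (bu _).trans ((Finset.sum_le_sum fun n _ => v2 n).trans ((sum_ofReal_le (fun n => ?_) (by positivity) s5).trans (ENNReal.ofReal_le_ofReal ?_)))
    · have := hhp n; have := hwp n; positivity
    · have := hAs q hq1.le
      calc C*A^(-q)*(2:ℝ)^j*W = (2:ℝ)^j*(C*A^(-q)*W) := by ring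
        _ ≤ _ := by gcongr
  refine (measure_mono hsub).trans ?_
  refine (measure_union_le _ _).trans ?_
  rw [X.ZZ_null, zero_add]
  calc _ ≤ ENNReal.ofReal (2^j*ε) + (ENNReal.ofReal (2^j*ε) + (ENNReal.ofReal (2^j*ε) + ENNReal.ofReal (2^j*ε))) :=
        (measure_union_le _ _).trans (add_le_add t1 ((measure_union_le _ _).trans (add_le_add t2 ((measure_union_le _ _).trans (add_le_add t3 t4)))))
    _ = _ := by
      rw [← ENNReal.ofReal_add (by positivity) (by positivity), ← ENNReal.ofReal_add (by positivity) (by positivity), ← ENNReal.ofReal_add (by positivity) (by positivity)]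
      congr 1; rw [hε]; ring
/-- the Carleson–Hunt theorem for finite families and smooth truncations -/
theorem carleson (q : ℝ) (hq : 1 < q) : ∃ C : ℝ≥0, ∀ (S : Finset ℝ) (k0 k1 : ℤ) (f : ℝ → ℂ), Bd f →
    ∫⁻ x, CC S k0 k1 f x ^ q ≤ C * ∫⁻ x, ‖f x‖ₑ ^ q := by
  have h1 : 1 < min ((1+q)/2) (3/2) := lt_min (by linarith) (by norm_num)
  obtain ⟨C, hC⟩ := Loc_strong h1 (loc_all h1 (lt_of_le_of_lt (min_le_right _ _) (by norm_num))) q (lt_of_le_of_lt (min_le_left _ _) (by linarith))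
  exact ⟨C, fun S => hC S (mem_univ S)⟩
/-! ### Oscillatory integrals -/
def Tow (F : ℕ → ℝ → ℝ) : Prop := ∀ i v, HasDerivAt (F i) (F (i+1) v) v
structure Amp (L : ℝ) (χ : ℝ → ℝ) : Prop where
  bdd : ∀ v, |χ v| ≤ 1
  lip : ∀ v w, |χ v - χ w| ≤ L * |v - w|
  supp : ∀ v, 1 ≤ |v| → χ v = 0
lemma Amp.cont {L : ℝ} {χ : ℝ → ℝ} (h : Amp L χ) : Continuous χ := by
  have : LipschitzWith (Real.toNNReal L) χ := by
    refine LipschitzWith.of_dist_le_mul (fun v w => ?_)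
    rw [Real.dist_eq, Real.dist_eq]
    exact (h.lip v w).trans (mul_le_mul_of_nonneg_right (Real.le_coe_toNNReal L) (abs_nonneg _))
  exact this.continuous
lemma Tow.cont {F : ℕ → ℝ → ℝ} (h : Tow F) (i : ℕ) : Continuous (F i) :=
  continuous_iff_continuousAt.2 fun v => (h i v).continuousAt
lemma Tow.mvt {F : ℕ → ℝ → ℝ} (h : Tow F) (i : ℕ) (v w : ℝ) :
    ∃ ξ ∈ uIcc v w, F i w - F i v = F (i+1) ξ * (w - v) := by
  rcases lt_trichotomy v w with hvw | hvw | hvw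
  · obtain ⟨ξ, hξ, e⟩ := exists_hasDerivAt_eq_slope (F i) (F (i+1)) hvw (h.cont i).continuousOn (fun x _ => h i x)
    refine ⟨ξ, Icc_subset_uIcc (Ioo_subset_Icc_self hξ), ?_⟩
    rw [e]; field_simp [sub_ne_zero.2 hvw.ne']
  · exact ⟨v, left_mem_uIcc, by simp [hvw]⟩
  · obtain ⟨ξ, hξ, e⟩ := exists_hasDerivAt_eq_slope (F i) (F (i+1)) hvw (h.cont i).continuousOn (fun x _ => h i x)
    refine ⟨ξ, Icc_subset_uIcc' (Ioo_subset_Icc_self hξ), ?_⟩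
    have : v - w ≠ 0 := sub_ne_zero.2 hvw.ne'
    rw [e]; field_simp; ring
lemma osc_re {F : ℕ → ℝ → ℝ} (hF : Tow F) {L μ : ℝ} {χ : ℝ → ℝ} (hL : 0 ≤ L) (hχ : Amp L χ) (hμ : 0 < μ)
    (h : ∀ v, |v| ≤ 1 → μ ≤ |F 1 v| ∧ |F 2 v| ≤ μ) (c : ℝ) :
    |∫ v in (-1:ℝ)..1, χ v * Real.cos (F 0 v + c)| ≤ 2 * ((L + 1) / μ) := by
  have hI : ∀ v, v ∈ uIcc (-1:ℝ) 1 ↔ |v| ≤ 1 := by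
    intro v; rw [uIcc_of_le (by norm_num), mem_Icc, abs_le]
  have hne : ∀ v, |v| ≤ 1 → F 1 v ≠ 0 := fun v hv e => by
    have := (h v hv).1; rw [e, abs_zero] at this; linarith
  have hbet : ∀ v w ξ : ℝ, |v| ≤ 1 → |w| ≤ 1 → ξ ∈ uIcc v w → |ξ| ≤ 1 := fun v w ξ hv hw hξ => by
    rw [← hI] at hv hw ⊢; exact uIcc_subset_uIcc hv hw hξ
  have hl1 : ∀ v w, |v| ≤ 1 → |w| ≤ 1 → |F 1 w - F 1 v| ≤ μ * |w - v| := fun v w hv hw => by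
    obtain ⟨ξ, hξ, e⟩ := hF.mvt 1 v w
    rw [e, abs_mul]
    exact mul_le_mul_of_nonneg_right (h ξ (hbet _ _ _ hv hw hξ)).2 (abs_nonneg _)
  set f : ℝ → ℝ := fun v => χ v / F 1 v
  set g : ℝ → ℝ := fun v => Real.sin (F 0 v + c)
  have hfl : LipschitzOnWith (Real.toNNReal ((L+1)/μ)) f (uIcc (-1) 1) := by
    refine LipschitzOnWith.of_dist_le_mul (fun v hv w hw => ?_)
    rw [hI] at hv hw
    rw [Real.dist_eq, Real.dist_eq, Real.coe_toNNReal _ (by positivity)]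
    have hv0 := hne v hv
    have hw0 := hne w hw
    have e : f v - f w = (χ v - χ w) / F 1 v + χ w * (F 1 w - F 1 v) / (F 1 v * F 1 w) := by
      simp only [f]; field_simp; ring
    rw [e]
    refine (abs_add_le _ _).trans ?_
    rw [abs_div, abs_div, abs_mul, abs_mul]
    have h1 : |χ v - χ w| / |F 1 v| ≤ L * |v - w| / μ :=
      div_le_div₀ (by positivity) (hχ.lip v w) hμ (h v hv).1
    have h2 : |χ w| * |F 1 w - F 1 v| / (|F 1 v| * |F 1 w|) ≤ (1 * (μ * |w - v|)) / (μ * μ) :=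
      div_le_div₀ (by positivity) (mul_le_mul (hχ.bdd w) (hl1 v w hv hw) (abs_nonneg _) zero_le_one) (by positivity)
        (mul_le_mul (h v hv).1 (h w hw).1 hμ.le (abs_nonneg _))
    refine (add_le_add h1 h2).trans (le_of_eq ?_)
    rw [abs_sub_comm w v]; field_simp
  have hgd : ∀ v, HasDerivAt g (Real.cos (F 0 v + c) * F 1 v) v := fun v => ((hF 0 v).add_const c).sin
  have hgl : LipschitzOnWith (Real.toNNReal (|F 1 0| + μ)) g (uIcc (-1) 1) := by
    refine Convex.lipschitzOnWith_of_nnnorm_hasDerivWithin_le (f' := fun v => Real.cos (F 0 v + c) * F 1 v) (convex_uIcc _ _)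
      (fun v hv => (hgd v).hasDerivWithinAt) (fun v hv => ?_)
    rw [hI] at hv
    rw [← NNReal.coe_le_coe, coe_nnnorm, Real.coe_toNNReal _ (by positivity), Real.norm_eq_abs, abs_mul]
    have := hl1 0 v (by simp) hv
    have h3 : |F 1 v| ≤ |F 1 0| + μ := by
      have e : F 1 v = F 1 0 + (F 1 v - F 1 0) := by ring
      rw [e]; refine (abs_add_le _ _).trans ?_
      have : μ * |v - 0| ≤ μ * 1 := mul_le_mul_of_nonneg_left (by simpa using hv) hμ.le
      linarith
    calc _ ≤ 1 * |F 1 v| := mul_le_mul_of_nonneg_right (Real.abs_cos_le_one _) (abs_nonneg _)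
      _ ≤ _ := by linarith
  have key := AbsolutelyContinuousOnInterval.integral_mul_deriv_eq_deriv_mul
    hfl.absolutelyContinuousOnInterval hgl.absolutelyContinuousOnInterval
  have e1 : ∫ v in (-1:ℝ)..1, χ v * Real.cos (F 0 v + c) = ∫ v in (-1:ℝ)..1, f v * deriv g v := by
    refine intervalIntegral.integral_congr (fun v hv => ?_)
    have := hne v ((hI v).1 hv)
    rw [(hgd v).deriv]
    simp only [f]; field_simp
  have f1 : f 1 = 0 := by simp [f, hχ.supp 1 (by simp)]
  have f2 : f (-1) = 0 := by simp [f, hχ.supp (-1) (by simp)]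
  rw [e1, key, f1, f2]
  simp only [zero_mul, sub_zero, zero_sub, abs_neg]
  have hb := intervalIntegral.norm_integral_le_of_norm_le_const_ae (a := (-1:ℝ)) (b := 1) (C := (L+1)/μ) (f := fun x => deriv f x * g x) ?_
  · rw [Real.norm_eq_abs] at hb
    refine hb.trans (le_of_eq ?_)
    norm_num; ring
  · have : ∀ᵐ x : ℝ, x ≠ 1 := by simp [ae_iff]
    filter_upwards [this] with x hx1 hx
    rw [uIoc_of_le (by norm_num)] at hx
    have hn : uIcc (-1:ℝ) 1 ∈ 𝓝 x := by
      rw [uIcc_of_le (by norm_num)]; exact Icc_mem_nhds hx.1 (lt_of_le_of_ne hx.2 hx1)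
    have h1 := norm_deriv_le_of_lipschitzOn hn hfl
    rw [Real.coe_toNNReal _ (by positivity)] at h1
    rw [norm_mul]
    calc _ ≤ ((L+1)/μ) * 1 := mul_le_mul h1 (Real.abs_sin_le_one _) (abs_nonneg _) (by positivity)
      _ = _ := mul_one _
noncomputable def og (χ : ℝ → ℝ) (φ : ℝ → ℝ) (v : ℝ) : ℂ := (χ v : ℂ) * ex (φ v)
lemma Bd_og {L : ℝ} {χ φ : ℝ → ℝ} (hχ : Amp L χ) (hφ : Continuous φ) : Bd (og χ φ) := by
  refine ⟨?_, ⟨1, fun x => ?_⟩, ⟨1, fun x hx => ?_⟩⟩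
  · unfold og ex
    have := hχ.cont
    exact Continuous.measurable (by fun_prop)
  · simp only [og, norm_mul, ex_norm, mul_one, Complex.norm_real]; exact hχ.bdd x
  · simp [og, hχ.supp x hx.le]
lemma og_triv {L : ℝ} {χ φ : ℝ → ℝ} (hχ : Amp L χ) : ‖∫ v, og χ φ v‖ₑ ≤ ENNReal.ofReal 2 := by
  refine (enorm_integral_le_lintegral_enorm _).trans ?_
  calc _ ≤ ∫⁻ v, (Icc (-1:ℝ) 1).indicator (fun _ => 1) v := by
        refine lintegral_mono (fun v => ?_)
        by_cases hv : v ∈ Icc (-1:ℝ) 1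
        · rw [indicator_of_mem hv]
          have : ‖og χ φ v‖ ≤ 1 := by
            simp only [og, norm_mul, ex_norm, mul_one, Complex.norm_real]; exact hχ.bdd v
          simpa using enorm_le_of_norm this
        · rw [indicator_of_notMem hv]
          have : 1 ≤ |v| := by
            by_contra h; push Not at h; exact hv (abs_le.1 h.le)
          simp [og, hχ.supp v this]
    _ = _ := by
        rw [lintegral_indicator measurableSet_Icc]; simp; norm_num
lemma osc_base {F : ℕ → ℝ → ℝ} (hF : Tow F) {L μ : ℝ} {χ : ℝ → ℝ} (hL : 0 ≤ L) (hχ : Amp L χ) (hμ : 0 < μ)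
    (h : ∀ v, |v| ≤ 1 → μ ≤ |F 1 v| ∧ |F 2 v| ≤ μ) :
    ‖∫ v, og χ (F 0) v‖ₑ ≤ ENNReal.ofReal (4 * (L + 1) / μ) := by
  refine enorm_le_of_norm ?_
  have e : ∫ v, og χ (F 0) v = ∫ v in (-1:ℝ)..1, og χ (F 0) v := by
    rw [intervalIntegral.integral_of_le (by norm_num), ← integral_indicator measurableSet_Ioc]
    congr 1; ext v
    by_cases hv : v ∈ Ioc (-1:ℝ) 1
    · rw [indicator_of_mem hv]
    · rw [indicator_of_notMem hv]
      have : 1 ≤ |v| := by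
        by_contra h; push Not at h; exact hv ⟨(abs_lt.1 h).1, (abs_lt.1 h).2.le⟩
      simp [og, hχ.supp v this]
  have hc := hχ.cont
  have hc0 := hF.cont 0
  have e2 : ∫ v in (-1:ℝ)..1, og χ (F 0) v = ((∫ v in (-1:ℝ)..1, χ v * Real.cos (F 0 v + 0) : ℝ) : ℂ)
      + ((∫ v in (-1:ℝ)..1, χ v * Real.cos (F 0 v + -(Real.pi/2)) : ℝ) : ℂ) * Complex.I := by
    rw [← intervalIntegral.integral_ofReal, ← intervalIntegral.integral_ofReal, ← intervalIntegral.integral_mul_const,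
      ← intervalIntegral.integral_add]
    · refine intervalIntegral.integral_congr (fun v _ => ?_)
      simp only [og, ex]
      rw [Complex.exp_mul_I, ← sub_eq_add_neg, Real.cos_sub_pi_div_two, add_zero]
      push_cast; ring
    · exact Continuous.intervalIntegrable (by fun_prop) _ _
    · exact Continuous.intervalIntegrable (by fun_prop) _ _
  rw [e, e2]
  refine (norm_add_le _ _).trans ?_
  rw [norm_mul, Complex.norm_I, mul_one, Complex.norm_real, Complex.norm_real, Real.norm_eq_abs, Real.norm_eq_abs]
  have h1 := osc_re hF hL hχ hμ h 0
  have h2 := osc_re hF hL hχ hμ h (-(Real.pi/2))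
  calc _ ≤ _ := add_le_add h1 h2
    _ = _ := by ring
lemma sq_diff {G : ℝ → ℂ} (hG : Bd G) : ‖∫ v, G v‖ₑ ^ 2 ≤ ∫⁻ η, ‖∫ w, G (w + η) * conj (G w)‖ₑ := by
  have e : (∫ v, G v) * conj (∫ v, G v) = ∫ η, ∫ w, G (w + η) * conj (G w) := by
    rw [integral_integral_swap]
    · rw [← integral_conj, ← integral_const_mul]
      congr 1; ext w
      rw [integral_mul_const, integral_add_left_eq_self G w]
    · have h1 : Integrable (fun z : ℝ × ℝ => conj (G z.1) * G z.2) (volume.prod volume) :=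
        hG.conj.integrable.mul_prod hG.integrable
      have h2 := (measurePreserving_prod_add (volume : Measure ℝ) (volume : Measure ℝ)).integrable_comp_of_integrable h1
      have h3 := h2.swap
      refine h3.congr (Eventually.of_forall fun z => ?_)
      simp [Function.uncurry, Function.comp, mul_comm]
  have e2 : ‖∫ v, G v‖ₑ ^ 2 = ‖(∫ v, G v) * conj (∫ v, G v)‖ₑ := by
    rw [enorm_mul, conj_enorm, sq]
  rw [e2, e]
  exact enorm_integral_le_lintegral_enorm _
lemma split_int (F h : ℝ → ℝ≥0∞) (hh : Measurable h) (x A B μ δ : ℝ) (hA : 0 ≤ A) (hB : 0 ≤ B) (hμ : 1 ≤ μ) (hδ : 0 ≤ δ) (hδ1 : δ ≤ 1)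
    (h0 : ∀ z, 2 < |z - x| → F z = 0) (h1 : ∀ z, F z ≤ ENNReal.ofReal A)
    (h2 : ∀ z, z ≠ x → |z - x| ≤ 2 → F z ≤ ENNReal.ofReal (B * (μ * |z - x|) ^ (-δ))) :
    ∫⁻ z, F z * h z ≤ ENNReal.ofReal ((2 * A + 4 * B) * μ ^ (-(δ/2))) * MM h x := by
  have hμ0 : 0 < μ := by linarith
  set a : ℝ := μ ^ (-(1/2:ℝ)) with ha
  have ha0 : 0 < a := by positivity
  have hp : ∀ z, F z * h z ≤ (Icc (x-a) (x+a)).indicator (fun z => ENNReal.ofReal A * h z) z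
      + (Icc (x-2) (x+2)).indicator (fun z => ENNReal.ofReal (B * μ ^ (-(δ/2))) * h z) z := by
    intro z
    by_cases hz : |z - x| ≤ a
    · rw [indicator_of_mem (s := Icc (x-a) (x+a)) (by rw [abs_le] at hz; constructor <;> linarith)]
      exact le_add_right (mul_le_mul' (h1 z) le_rfl)
    · push Not at hz
      by_cases hz2 : |z - x| ≤ 2
      · rw [indicator_of_mem (s := Icc (x-2) (x+2)) (by rw [abs_le] at hz2; constructor <;> linarith)]
        refine le_add_left (mul_le_mul' ((h2 z (fun e => ?_) hz2).trans (ENNReal.ofReal_le_ofReal ?_)) le_rfl)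
        · rw [e, sub_self, abs_zero] at hz; linarith
        · refine mul_le_mul_of_nonneg_left ?_ hB
          have e : μ ^ (-(δ/2)) = (μ * a) ^ (-δ) := by
            rw [ha, ← Real.rpow_one_add' hμ0.le (by norm_num), ← Real.rpow_mul hμ0.le]; congr 1; ring
          rw [e]
          exact Real.rpow_le_rpow_of_nonpos (by positivity) (mul_le_mul_of_nonneg_left hz.le hμ0.le) (by linarith)
      · push Not at hz2
        rw [h0 z hz2, zero_mul]; exact bot_le
  refine (lintegral_mono hp).trans ?_
  rw [lintegral_add_left ((hh.const_mul _).indicator measurableSet_Icc), lintegral_indicator measurableSet_Icc,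
    lintegral_indicator measurableSet_Icc, lintegral_const_mul _ hh, lintegral_const_mul _ hh]
  refine (add_le_add (mul_le_mul' le_rfl (lintegral_le_MM h x a ha0 _ subset_rfl))
    (mul_le_mul' le_rfl (lintegral_le_MM h x 2 two_pos _ subset_rfl))).trans ?_
  rw [← mul_assoc, ← mul_assoc, ← add_mul, ← ENNReal.ofReal_mul hA, ← ENNReal.ofReal_mul (by positivity),
    ← ENNReal.ofReal_add (by positivity) (by positivity)]
  refine mul_le_mul' (ENNReal.ofReal_le_ofReal ?_) le_rfl
  have : a ≤ μ ^ (-(δ/2)) := Real.rpow_le_rpow_of_exponent_le hμ (by linarith)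
  nlinarith [mul_le_mul_of_nonneg_left this hA]
noncomputable def dl (k : ℕ) : ℝ := (1/4:ℝ)^k
lemma dl_pos (k : ℕ) : 0 < dl k := by unfold dl; positivity
lemma dl_le (k : ℕ) : dl k ≤ 1 := pow_le_one₀ (by norm_num) (by norm_num)
lemma Amp.diff {L : ℝ} {χ χ' : ℝ → ℝ} (hL : 0 ≤ L) (hχ : Amp L χ) (hχ' : Amp L χ') (η : ℝ) :
    Amp (2 * L) (fun v => χ (v + η) * χ' v) := by
  refine ⟨fun v => ?_, fun v w => ?_, fun v hv => by simp [hχ'.supp v hv]⟩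
  · rw [abs_mul]; exact mul_le_one₀ (hχ.bdd _) (abs_nonneg _) (hχ'.bdd _)
  · have e : χ (v + η) * χ' v - χ (w + η) * χ' w = (χ (v+η) - χ (w+η)) * χ' v + χ (w+η) * (χ' v - χ' w) := by ring
    rw [e]
    refine (abs_add_le _ _).trans ?_
    rw [abs_mul, abs_mul]
    have h1 := hχ.lip (v+η) (w+η)
    rw [add_sub_add_right_eq_sub] at h1
    have h2 : |χ (v+η) - χ (w+η)| * |χ' v| ≤ (L * |v - w|) * 1 := mul_le_mul h1 (hχ'.bdd _) (abs_nonneg _) (by positivity)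
    have h3 : |χ (w+η)| * |χ' v - χ' w| ≤ 1 * (L * |v - w|) := mul_le_mul (hχ.bdd _) (hχ'.lip v w) (abs_nonneg _) (by norm_num)
    linarith
lemma Tow.diff {F : ℕ → ℝ → ℝ} (h : Tow F) (η : ℝ) : Tow (fun i v => F i (v + η) - F i v) := fun i v =>
  ((h i (v + η)).comp_add_const v η).sub (h i v)
lemma Tow.diff_bd {F : ℕ → ℝ → ℝ} (hF : Tow F) {k : ℕ} {r μ η : ℝ} (hη2 : |η| ≤ 2)
    (h : ∀ v, |v| ≤ r + 2 → μ ≤ |F (k+1) v| ∧ |F (k+2) v| ≤ μ) (v : ℝ) (hv : |v| ≤ r) :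
    μ * |η| ≤ |F k (v + η) - F k v| ∧ |F (k+1) (v + η) - F (k+1) v| ≤ μ * |η| := by
  have hin : ∀ ξ ∈ uIcc v (v+η), |ξ| ≤ r + 2 := fun ξ hξ => by
    have h1 : |ξ - v| ≤ |v + η - v| := abs_sub_left_of_mem_uIcc hξ
    rw [add_sub_cancel_left] at h1
    have := abs_add_le (ξ - v) v
    rw [sub_add_cancel] at this; linarith
  constructor
  · obtain ⟨ξ, hξ, e⟩ := hF.mvt k v (v+η)
    rw [e, add_sub_cancel_left, abs_mul]
    exact mul_le_mul_of_nonneg_right (h ξ (hin ξ hξ)).1 (abs_nonneg _)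
  · obtain ⟨ξ, hξ, e⟩ := hF.mvt (k+1) v (v+η)
    rw [e, add_sub_cancel_left, abs_mul]
    exact mul_le_mul_of_nonneg_right (h ξ (hin ξ hξ)).2 (abs_nonneg _)
lemma og_far {L : ℝ} {χ : ℝ → ℝ} (hχ : Amp L χ) {η : ℝ} (hη : 2 < |η|) (φ : ℝ → ℝ) :
    ∫ w, og (fun v => χ (v + η) * χ v) φ w = 0 := by
  have : ∀ w, og (fun v => χ (v + η) * χ v) φ w = 0 := fun w => by
    by_cases hw : 1 ≤ |w|
    · simp [og, hχ.supp w hw]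
    · have : 1 ≤ |w + η| := by
        have := abs_sub_abs_le_abs_sub η (-w)
        rw [abs_neg, sub_neg_eq_add, add_comm η w] at this; linarith
      simp [og, hχ.supp _ this]
  simp [this]
theorem oscP (k : ℕ) : ∀ L : ℝ, 0 ≤ L → ∃ C : ℝ, 0 ≤ C ∧ ∀ F, Tow F → ∀ χ, Amp L χ → ∀ μ : ℝ, 0 < μ →
    (∀ v : ℝ, |v| ≤ 2 * (k:ℝ) + 1 → μ ≤ |F (k+1) v| ∧ |F (k+2) v| ≤ μ) →
    ‖∫ v, og χ (F 0) v‖ₑ ≤ ENNReal.ofReal (C * μ ^ (-dl k)) := by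
  induction k with
  | zero =>
    intro L hL
    refine ⟨4 * (L+1), by positivity, fun F hF χ hχ μ hμ h => ?_⟩
    have := osc_base hF hL hχ hμ (by simpa using h)
    rwa [dl, pow_zero, Real.rpow_neg_one, ← div_eq_mul_inv]
  | succ k ih =>
    intro L hL
    obtain ⟨C, hC, H⟩ := ih (2*L) (by positivity)
    refine ⟨8 + 8 * C, by positivity, fun F hF χ hχ μ hμ h => ?_⟩
    have hd0 := dl_pos k
    have hd1 := dl_le k
    have hde : dl (k+1) = dl k / 4 := by unfold dl; rw [pow_succ]; ring
    by_cases hμ1 : μ < 1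
    · refine (og_triv hχ).trans (ENNReal.ofReal_le_ofReal ?_)
      have : 1 ≤ μ ^ (-dl (k+1)) := Real.one_le_rpow_of_pos_of_le_one_of_nonpos hμ hμ1.le (by linarith [dl_pos (k+1)])
      nlinarith
    · push Not at hμ1
      have hG := Bd_og hχ (hF.cont 0)
      have hprod : ∀ η w, og χ (F 0) (w + η) * conj (og χ (F 0) w)
          = og (fun v => χ (v + η) * χ v) (fun v => F 0 (v + η) - F 0 v) w := fun η w => by
        simp only [og, map_mul, ex_conj, Complex.conj_ofReal, sub_eq_add_neg, ex_add]; push_cast; ring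
      have hs := sq_diff hG
      simp_rw [hprod] at hs
      have hsp := split_int (fun η => ‖∫ w, og (fun v => χ (v + η) * χ v) (fun v => F 0 (v + η) - F 0 v) w‖ₑ)
        (fun _ => 1) measurable_const 0 2 C μ (dl k) (by norm_num) hC hμ1 hd0.le hd1
        (fun η hη => ?_) (fun η => og_triv (hχ.diff hL hχ η)) (fun η hη hη2 => ?_)
      · simp only [mul_one] at hsp
        have h1 := (hs.trans hsp).trans (mul_le_mul' le_rfl (MM_le_of_le 1 (fun _ => le_rfl) 0))
        have e : ENNReal.ofReal ((2 * 2 + 4 * C) * μ ^ (-(dl k / 2))) * (2 * 1) =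
            ENNReal.ofReal ((8 + 8 * C) * μ ^ (-(dl k / 2))) := by
          rw [mul_one, show (2:ℝ≥0∞) = ENNReal.ofReal 2 by simp, ← ENNReal.ofReal_mul (by positivity)]
          congr 1; ring
        rw [e] at h1
        have h2 : ‖∫ v, og χ (F 0) v‖ₑ ^ 2 ≤ (ENNReal.ofReal ((8 + 8 * C) * μ ^ (-dl (k+1)))) ^ 2 := by
          refine h1.trans ?_
          rw [← ENNReal.ofReal_pow (by positivity)]
          refine ENNReal.ofReal_le_ofReal ?_
          rw [mul_pow, ← Real.rpow_natCast (μ ^ _) 2, ← Real.rpow_mul hμ.le, hde]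
          have : -(dl k / 4) * ((2:ℕ):ℝ) = -(dl k / 2) := by push_cast; ring
          rw [this]
          refine mul_le_mul_of_nonneg_right ?_ (by positivity)
          nlinarith
        exact (ENNReal.pow_le_pow_left_iff two_ne_zero).1 h2
      · rw [sub_zero] at hη
        simp [og_far hχ hη]
      · rw [sub_zero] at hη2 ⊢
        refine H _ (hF.diff η) _ (hχ.diff hL hχ η) (μ * |η|) (by positivity) (fun v hv => ?_)
        exact hF.diff_bd hη2 (fun v hv => h v (hv.trans (le_of_eq (by push_cast; ring)))) v hv
/-! ### Single scale L² decay -/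
noncomputable def KQ (s : ℤ) (φ N : ℝ → ℝ) (x y : ℝ) : ℂ := kp s x y * (ex (φ (x - y)) * ex (-(N x * y)))
lemma KQ_norm (s : ℤ) (φ N : ℝ → ℝ) (x y : ℝ) : ‖KQ s φ N x y‖ = ‖kp s x y‖ := by
  simp [KQ]
lemma BK_KQ (s : ℤ) {φ N : ℝ → ℝ} (hφ : Measurable φ) (hN : Measurable N) : BK (KQ s φ N) := by
  obtain ⟨hm, ⟨B, hB⟩, ⟨R, hR⟩⟩ := BK_kp s
  refine ⟨?_, ⟨B, fun x y => by rw [KQ_norm]; exact hB x y⟩, ⟨R, fun x y h => by rw [KQ, hR x y h, zero_mul]⟩⟩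
  have h1 : Measurable (fun z : ℝ × ℝ => ex (φ (z.1 - z.2)) * ex (-(N z.1 * z.2))) :=
    (ex_meas.comp (hφ.comp (measurable_fst.sub measurable_snd))).mul
      (ex_meas.comp ((hN.comp measurable_fst).mul measurable_snd).neg)
  exact hm.mul h1
lemma op_KQ_le (s : ℤ) (φ N : ℝ → ℝ) (f : ℝ → ℂ) (x : ℝ) : ‖op (KQ s φ N) f x‖ₑ ≤ 8 * MN f x := by
  have := ker_bound (KQ s φ N x) f x ((2:ℝ)^s) (4 * (2:ℝ)^(-s)) (by positivity)
    (fun y => by rw [KQ_norm]; exact kp_norm_le s x y) (fun y hy => by rw [KQ, kp_zero s hy.le, zero_mul])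
  refine this.trans (le_of_eq ?_)
  congr 1
  rw [zpow_neg, show 2 * (4 * ((2:ℝ)^s)⁻¹) * (2:ℝ)^s = 8 by field_simp; norm_num]
  norm_num
lemma amp_ps : Amp 10 (fun v => ps 0 v / 4) := by
  refine ⟨fun v => ?_, fun v w => ?_, fun v hv => ?_⟩
  · have := ps_bound 0 v
    rw [abs_div, abs_of_pos (by norm_num : (0:ℝ) < 4)]; simp at this; linarith
  · rw [← sub_div, abs_div, abs_of_pos (by norm_num : (0:ℝ) < 4)]
    have := ps0_lip v w; linarith
  · rw [ps_zero_hi 0 (by simpa using hv), zero_div]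
lemma KQ_pair (φ N : ℝ → ℝ) (x z : ℝ) :
    ‖op (KQ 0 φ N) (fun y => conj (KQ 0 φ N x y)) z‖ₑ = 16 * ‖∫ u, og (fun v => (ps 0 (v + (z - x)) / 4) * (ps 0 v / 4))
      (fun v => φ (v + (z - x)) - φ v + (N z - N x) * v) u‖ₑ := by
  have e : op (KQ 0 φ N) (fun y => conj (KQ 0 φ N x y)) z = (16 * ex (-((N z - N x) * x))) * ∫ u, og (fun v => (ps 0 (v + (z - x)) / 4) * (ps 0 v / 4))
      (fun v => φ (v + (z - x)) - φ v + (N z - N x) * v) u := by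
    unfold op
    rw [← integral_sub_left_eq_self _ volume x, ← integral_const_mul]
    congr 1; ext u
    have e1 : z - (x - u) = u + (z - x) := by ring
    have e2 : x - (x - u) = u := by ring
    simp only [KQ, kp, og, e1, e2, map_mul, ex_conj, Complex.conj_ofReal]
    have : ex (-(N z * (x - u))) * ex (-(-(N x * (x-u)))) = ex (-((N z - N x) * x)) * ex ((N z - N x) * u) := by
      rw [← ex_add, ← ex_add]; congr 1; ring
    rw [ex_add (φ (u + (z - x)) - φ u), sub_eq_add_neg (φ _) (φ u), ex_add]
    push_cast
    linear_combination (ps 0 (u + (z - x)) * ps 0 u * ex (φ (u + (z - x))) * ex (-φ u)) * this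
  rw [e, enorm_mul, enorm_mul, ex_enorm, mul_one]
  congr 1
  rw [← ofReal_norm]; norm_num
def Tow.lin {F : ℕ → ℝ → ℝ} (h : Tow F) (θ : ℝ) :
    Tow (fun i v => F i v + (if i = 0 then θ * v else if i = 1 then θ else 0)) := fun i v => by
  refine (h i v).add ?_
  rcases i with _ | _ | i
  · simpa using (hasDerivAt_id v).const_mul θ
  · simpa using hasDerivAt_const v θ
  · simpa using hasDerivAt_const v (0:ℝ)
theorem ss0 (k : ℕ) (hk : 1 ≤ k) : ∃ C : ℝ, 0 ≤ C ∧ ∀ F, Tow F → ∀ N, Measurable N → ∀ μ : ℝ, 0 < μ →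
    (∀ v : ℝ, |v| ≤ 2 * (k:ℝ) + 3 → μ ≤ |F (k+2) v| ∧ |F (k+3) v| ≤ μ) →
    ∀ f, Bd f → ∫⁻ x, ‖op (KQ 0 (F 0) N) f x‖ₑ ^ 2 ≤ ENNReal.ofReal (C * μ ^ (-(dl k / 2))) * ∫⁻ x, ‖f x‖ₑ ^ 2 := by
  obtain ⟨C, hC, H⟩ := oscP k (2 * 10) (by norm_num)
  obtain ⟨C2, h2⟩ := MM_strong 2 (by norm_num)
  have hMN : ∀ g, Bd g → ∫⁻ x, MN g x ^ 2 ≤ C2 * ∫⁻ x, ‖g x‖ₑ ^ 2 := fun g hg => by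
    simpa only [MN, ENNReal.rpow_two] using h2 _ hg.meas.enorm
  refine ⟨64 * C2 + (64 + 64 * C) * (1 + C2), by positivity, fun F hF N hN μ hμ h => ?_⟩
  have hd0 := dl_pos k
  have hK := BK_KQ 0 (hF.cont 0).measurable hN
  intro f hf
  by_cases hμ1 : μ < 1
  · calc _ ≤ ∫⁻ x, 64 * MN f x ^ 2 := by
          refine lintegral_mono (fun x => ?_)
          calc _ ≤ (8 * MN f x) ^ 2 := by gcongr; exact op_KQ_le _ _ _ _ _
            _ = _ := by rw [mul_pow]; norm_num
      _ ≤ 64 * (C2 * ∫⁻ x, ‖f x‖ₑ ^ 2) := by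
          rw [lintegral_const_mul' _ _ (by norm_num)]; exact mul_le_mul' le_rfl (hMN f hf)
      _ ≤ _ := by
          rw [← mul_assoc]
          refine mul_le_mul' ?_ le_rfl
          have e : (64:ℝ≥0∞) * C2 = ENNReal.ofReal (64 * C2) := by
            rw [ENNReal.ofReal_mul (by norm_num)]; simp
          rw [e]
          refine ENNReal.ofReal_le_ofReal ?_
          have : 1 ≤ μ ^ (-(dl k/2)) := Real.one_le_rpow_of_pos_of_le_one_of_nonpos hμ hμ1.le (by linarith)
          have h3 : (0:ℝ) ≤ (64 + 64 * C) * (1 + C2) := by positivity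
          have h4 : (0:ℝ) ≤ 64 * C2 := by positivity
          nlinarith
  push Not at hμ1
  revert f
  suffices hs : ∀ g, Bd g → ∫⁻ x, ‖op (adj (KQ 0 (F 0) N)) g x‖ₑ ^ 2 ≤
      ENNReal.ofReal ((64 * C2 + (64 + 64 * C) * (1 + C2)) * μ ^ (-(dl k / 2))) * ∫⁻ x, ‖g x‖ₑ ^ 2 from
    fun f hf => l2_dual hK _ hs f hf
  intro g hg
  set K := KQ 0 (F 0) N with hKd
  have hh := hg.op hK.adj
  rw [hh.sq_eq, ← op_dual hh hg hK]
  have hpt : ∀ x, ‖op K (op (adj K) g) x‖ₑ ≤ ENNReal.ofReal ((2 * 32 + 4 * (16 * C)) * μ ^ (-(dl k / 2))) * MN g x := fun x => by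
    have hk' : Bd (fun y => conj (K x y)) := (hK.slice x).conj
    have e : op K (op (adj K) g) x = ∫ z, g z * conj (op K (fun y => conj (K x y)) z) := by
      have h3 := op_dual hg hk' hK.adj
      have e4 : adj (adj K) = K := by ext x y; simp [adj]
      rw [e4] at h3
      rw [← h3]; unfold op; congr 1; ext y; simp [mul_comm]
    rw [e]
    refine (enorm_integral_le_lintegral_enorm _).trans ?_
    have e5 : ∀ z, ‖g z * conj (op K (fun y => conj (K x y)) z)‖ₑ = ‖op K (fun y => conj (K x y)) z‖ₑ * ‖g z‖ₑ := fun z => by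
      rw [enorm_mul, conj_enorm, mul_comm]
    simp_rw [e5]
    have e16 : (16:ℝ≥0∞) = ENNReal.ofReal 16 := by simp
    refine split_int _ _ hg.meas.enorm x 32 (16 * C) μ (dl k) (by norm_num) (by positivity) hμ1 hd0.le (dl_le k)
      (fun z hz => ?_) (fun z => ?_) (fun z hz hz2 => ?_)
    · rw [hKd, KQ_pair, og_far amp_ps hz]; simp
    · rw [hKd, KQ_pair]
      calc _ ≤ 16 * ENNReal.ofReal 2 := mul_le_mul' le_rfl (og_triv (amp_ps.diff (by norm_num) amp_ps (z - x)))
        _ = _ := by rw [e16, ← ENNReal.ofReal_mul (by norm_num)]; norm_num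
    · rw [hKd, KQ_pair, mul_assoc, ENNReal.ofReal_mul (by norm_num), ← e16]
      refine mul_le_mul' le_rfl ?_
      have hz0 : z - x ≠ 0 := sub_ne_zero.2 hz
      refine H _ ((hF.diff (z - x)).lin (N z - N x)) _ (amp_ps.diff (by norm_num) amp_ps (z - x)) (μ * |z - x|)
        (by positivity) (fun v hv => ?_)
      have hb := hF.diff_bd (k := k + 1) (r := 2 * (k:ℝ) + 1) hz2
        (fun v hv => h v (hv.trans (le_of_eq (by ring)))) v hv
      have e1 : ¬ (k + 1 = 1) := by omega
      have e2 : ¬ (k + 2 = 1) := by omega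
      simpa [e1, e2, show k ≠ 0 by omega] using hb
  refine (enorm_integral_le_lintegral_enorm _).trans ?_
  calc _ ≤ ∫⁻ x, ENNReal.ofReal ((2 * 32 + 4 * (16 * C)) * μ ^ (-(dl k / 2))) * (‖g x‖ₑ ^ 2 + MN g x ^ 2) := by
        refine lintegral_mono (fun x => ?_)
        rw [enorm_mul, conj_enorm]
        refine (mul_le_mul' (hpt x) le_rfl).trans ?_
        rw [mul_assoc]
        refine mul_le_mul' le_rfl ?_
        rw [mul_comm]; exact mul_le_sq_add _ _
    _ ≤ ENNReal.ofReal ((2 * 32 + 4 * (16 * C)) * μ ^ (-(dl k / 2))) * (ENNReal.ofReal (1 + C2) * ∫⁻ x, ‖g x‖ₑ ^ 2) := by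
        rw [lintegral_const_mul' _ _ ENNReal.ofReal_ne_top, lintegral_add_left (hg.meas.enorm.pow_const 2)]
        refine mul_le_mul' le_rfl ?_
        rw [ENNReal.ofReal_add (by norm_num) (by positivity), add_mul]
        simpa using add_le_add le_rfl (hMN g hg)
    _ ≤ _ := by
        rw [← mul_assoc, ← ENNReal.ofReal_mul (by positivity)]
        refine mul_le_mul' (ENNReal.ofReal_le_ofReal ?_) le_rfl
        have h3 : (0:ℝ) ≤ 64 * C2 * μ ^ (-(dl k / 2)) := by positivity
        nlinarith
/-! ### Polynomial phases -/
noncomputable def PH (d : ℕ) (a : ℕ → ℝ) (i : ℕ) (v : ℝ) : ℝ := ∑ j ∈ Finset.Icc 3 d, a j * (j.descFactorial i : ℝ) * v ^ (j - i)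
noncomputable def lam (d : ℕ) (a : ℕ → ℝ) (s : ℤ) : ℝ := ∑ j ∈ Finset.Icc 3 d, |a j| * ((2:ℝ)^s)^j
lemma PH_tow (d : ℕ) (a : ℕ → ℝ) : Tow (PH d a) := fun i v => by
  unfold PH
  refine HasDerivAt.fun_sum (fun j _ => ?_)
  have h := ((hasDerivAt_pow (j - i) v).const_mul (a j * (j.descFactorial i : ℝ)))
  refine h.congr_deriv ?_
  rw [Nat.descFactorial_succ, Nat.sub_sub]; push_cast; ring
lemma PH_meas (d : ℕ) (a : ℕ → ℝ) : Measurable (PH d a 0) := ((PH_tow d a).cont 0).measurable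
lemma dom (d : ℕ) : ∃ κ : ℝ, 0 < κ ∧ κ ≤ 1 ∧ ∀ c : ℕ → ℝ, 0 < lam d c 0 → ∃ k, 1 ≤ k ∧ k ≤ d ∧ ∃ μ, κ * lam d c 0 ≤ μ ∧
    ∀ v : ℝ, |v| ≤ 2 * (k:ℝ) + 3 → μ ≤ |PH d c (k+2) v| ∧ |PH d c (k+3) v| ≤ μ := by
  set D : ℝ := ((d:ℝ) + 1)^(d+1) with hD
  set r : ℝ := 2 * d + 3 with hr
  set M : ℝ := 2 * ((d:ℝ)+1) * D * r with hM
  have hD1 : 1 ≤ D := one_le_pow₀ (by linarith [(Nat.cast_nonneg d : (0:ℝ) ≤ d)])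
  have hd0 : (0:ℝ) ≤ d := Nat.cast_nonneg d
  have hr1 : 1 ≤ r := by linarith
  have hrM : r ≤ M := by
    have : 1 ≤ 2 * ((d:ℝ)+1) * D := by nlinarith
    nlinarith
  have hM0 : 0 < M := by linarith
  refine ⟨(2 * ((d:ℝ)+1) * M^d)⁻¹, by positivity, inv_le_one_of_one_le₀ ?_, fun c hc => ?_⟩
  · have : 1 ≤ M^d := one_le_pow₀ (by linarith)
    nlinarith
  have hne : (Finset.Icc 3 d).Nonempty := by
    by_contra h
    rw [Finset.not_nonempty_iff_eq_empty] at h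
    simp [lam, h] at hc
  obtain ⟨j, hj, hmax⟩ := Finset.exists_max_image (Finset.Icc 3 d) (fun j => |c j| * M^j) hne
  have hj3 := (Finset.mem_Icc.1 hj).1
  have hjd := (Finset.mem_Icc.1 hj).2
  have hlam : lam d c 0 ≤ ((d:ℝ)+1) * (|c j| * M^d) := by
    unfold lam
    calc _ ≤ ∑ i ∈ Finset.Icc 3 d, |c j| * M^d := by
          refine Finset.sum_le_sum (fun i hi => ?_)
          rw [zpow_zero, one_pow, mul_one]
          calc |c i| ≤ |c i| * M^i := le_mul_of_one_le_right (abs_nonneg _) (one_le_pow₀ (by linarith))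
            _ ≤ |c j| * M^j := hmax i hi
            _ ≤ _ := mul_le_mul_of_nonneg_left (pow_le_pow_right₀ (by linarith) hjd) (abs_nonneg _)
      _ ≤ _ := by
          rw [Finset.sum_const, nsmul_eq_mul]
          refine mul_le_mul_of_nonneg_right ?_ (by positivity)
          rw [Nat.card_Icc]
          have : d + 1 - 3 ≤ d + 1 := by omega
          exact_mod_cast this
  have hterm : ∀ i ∈ Finset.Icc 3 d, j < i → ∀ m, (m = j ∨ m = j + 1) → ∀ v : ℝ, |v| ≤ r →
      |c i * (i.descFactorial m : ℝ) * v ^ (i - m)| ≤ |c j| / (2 * ((d:ℝ)+1)) := by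
    intro i hi hji m hm v hv
    have hid := (Finset.mem_Icc.1 hi).2
    have h1 : (i.descFactorial m : ℝ) ≤ D := by
      calc (i.descFactorial m : ℝ) ≤ (i:ℝ)^m := by exact_mod_cast Nat.descFactorial_le_pow i m
        _ ≤ ((d:ℝ)+1)^m := pow_le_pow_left₀ (by positivity) (by have : (i:ℝ) ≤ d := by exact_mod_cast hid
                                                                linarith) m
        _ ≤ D := pow_le_pow_right₀ (by linarith) (by omega)
    obtain ⟨n, rfl⟩ : ∃ n, i = j + 1 + n := ⟨i - (j+1), by omega⟩
    have h2 : |v| ^ (j + 1 + n - m) ≤ r * M^n := by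
      calc _ ≤ r ^ (j + 1 + n - m) := pow_le_pow_left₀ (abs_nonneg _) hv _
        _ ≤ r ^ (n+1) := pow_le_pow_right₀ hr1 (by omega)
        _ = r * r^n := pow_succ' _ _
        _ ≤ _ := mul_le_mul_of_nonneg_left (pow_le_pow_left₀ (by linarith) hrM n) (by linarith)
    have h3 : |c (j+1+n)| * M^n * M ≤ |c j| := by
      have := hmax _ hi
      simp only [pow_add, pow_one] at this
      have hp : 0 < M^j := by positivity
      have e : |c (j+1+n)| * (M^j * M * M^n) = (|c (j+1+n)| * M^n * M) * M^j := by ring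
      rw [e] at this
      exact le_of_mul_le_mul_right this hp
    rw [abs_mul, abs_mul, abs_pow, Nat.abs_cast]
    calc _ ≤ |c (j+1+n)| * D * (r * M^n) :=
          mul_le_mul (mul_le_mul_of_nonneg_left h1 (abs_nonneg _)) h2 (by positivity) (by positivity)
      _ = (|c (j+1+n)| * M^n * M) / (2 * ((d:ℝ)+1)) := by rw [hM]; field_simp
      _ ≤ _ := div_le_div_of_nonneg_right h3 (by positivity)
  have hsum : ∀ T ⊆ Finset.Icc 3 d, ∀ g : ℕ → ℝ, (∀ i ∈ T, |g i| ≤ |c j| / (2 * ((d:ℝ)+1))) →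
      |∑ i ∈ T, g i| ≤ |c j| / 2 := by
    intro T hT g hg
    refine (Finset.abs_sum_le_sum_abs _ _).trans ((Finset.sum_le_sum hg).trans ?_)
    rw [Finset.sum_const, nsmul_eq_mul]
    have : (T.card : ℝ) ≤ d + 1 := by
      have h1 := Finset.card_le_card hT
      rw [Nat.card_Icc] at h1
      exact_mod_cast (by omega : T.card ≤ d + 1)
    calc _ ≤ ((d:ℝ)+1) * (|c j| / (2 * ((d:ℝ)+1))) := mul_le_mul_of_nonneg_right this (by positivity)
      _ = _ := by field_simp
  have hz : ∀ i m (v : ℝ), i < m → c i * (i.descFactorial m : ℝ) * v ^ (i - m) = 0 := fun i m v h => by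
    rw [Nat.descFactorial_eq_zero_iff_lt.2 h]; simp
  have hg0 : 0 ≤ |c j| / (2 * ((d:ℝ)+1)) := by positivity
  refine ⟨j - 2, by omega, by omega, |c j| / 2, ?_, fun v hv => ?_⟩
  · rw [inv_mul_le_iff₀ (by positivity)]
    refine hlam.trans (le_of_eq (by ring))
  · have hv' : |v| ≤ r := hv.trans (by
      have : ((j - 2 : ℕ) : ℝ) ≤ d := by exact_mod_cast (by omega : j - 2 ≤ d)
      linarith)
    rw [show j - 2 + 2 = j by omega, show j - 2 + 3 = j + 1 by omega]
    constructor
    · unfold PH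
      rw [← Finset.add_sum_erase _ _ hj]
      have h1 := hsum ((Finset.Icc 3 d).erase j) (Finset.erase_subset _ _) (fun i => c i * (i.descFactorial j : ℝ) * v ^ (i - j))
        (fun i hi => by
          rw [Finset.mem_erase] at hi
          rcases lt_or_gt_of_ne hi.1 with h | h
          · rw [hz i j v h]; simpa using hg0
          · exact hterm i hi.2 h j (Or.inl rfl) v hv')
      have h2 : |c j| ≤ |c j * (j.descFactorial j : ℝ) * v ^ (j - j)| := by
        rw [Nat.sub_self, pow_zero, mul_one, abs_mul, Nat.descFactorial_self, Nat.abs_cast]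
        exact le_mul_of_one_le_right (abs_nonneg _) (by exact_mod_cast Nat.factorial_pos j)
      have h3 := abs_sub_abs_le_abs_sub (c j * (j.descFactorial j : ℝ) * v ^ (j - j))
        (-∑ i ∈ (Finset.Icc 3 d).erase j, c i * (i.descFactorial j : ℝ) * v ^ (i - j))
      rw [abs_neg, sub_neg_eq_add] at h3
      linarith
    · refine hsum _ subset_rfl _ (fun i hi => ?_)
      by_cases h : j < i
      · exact hterm i hi h (j+1) (Or.inr rfl) v hv'
      · rw [hz i (j+1) v (by omega)]; simpa using hg0
/-! ### Rescaling -/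
lemma lint_scale {b : ℝ} (hb : 0 < b) (g : ℝ → ℝ≥0∞) (hg : Measurable g) :
    ∫⁻ x, g x = ENNReal.ofReal b * ∫⁻ u, g (b * u) := by
  conv_lhs => rw [← Real.smul_map_volume_mul_left hb.ne']
  rw [lintegral_smul_measure, lintegral_map hg (measurable_const_mul b), abs_of_pos hb, smul_eq_mul]
lemma lam_scale (d : ℕ) (a : ℕ → ℝ) (s : ℤ) : lam d (fun j => a j * ((2:ℝ)^s)^j) 0 = lam d a s := by
  unfold lam
  refine Finset.sum_congr rfl (fun j _ => ?_)
  rw [zpow_zero, one_pow, mul_one, abs_mul, abs_of_nonneg (by positivity : (0:ℝ) ≤ ((2:ℝ)^s)^j)]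
lemma op_scale (d : ℕ) (a : ℕ → ℝ) (s : ℤ) (N : ℝ → ℝ) (f : ℝ → ℂ) (u : ℝ) :
    op (KQ s (PH d a 0) N) f ((2:ℝ)^s * u)
      = op (KQ 0 (PH d (fun j => a j * ((2:ℝ)^s)^j) 0) (fun u => (2:ℝ)^s * N ((2:ℝ)^s * u))) (fun w => f ((2:ℝ)^s * w)) u := by
  have hp : (0:ℝ) < (2:ℝ)^s := by positivity
  unfold op
  have h := Measure.integral_comp_mul_left (fun y => KQ s (PH d a 0) N ((2:ℝ)^s * u) y * f y) ((2:ℝ)^s)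
  rw [abs_of_pos (inv_pos.2 hp)] at h
  have h' : ∫ y, KQ s (PH d a 0) N ((2:ℝ)^s * u) y * f y
      = ((2:ℝ)^s) • ∫ w, KQ s (PH d a 0) N ((2:ℝ)^s * u) ((2:ℝ)^s * w) * f ((2:ℝ)^s * w) := by
    rw [h, smul_smul, mul_inv_cancel₀ hp.ne', one_smul]
  rw [h', ← integral_smul]
  congr 1; ext w
  have e1 : PH d (fun j => a j * ((2:ℝ)^s)^j) 0 (u - w) = PH d a 0 ((2:ℝ)^s * u - (2:ℝ)^s * w) := by
    unfold PH
    refine Finset.sum_congr rfl (fun j _ => ?_)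
    rw [← mul_sub, Nat.sub_zero, mul_pow]; ring
  have e2 : ps s ((2:ℝ)^s * u - (2:ℝ)^s * w) = (2:ℝ)^(-s) * ps 0 (u - w) := by
    rw [ps_scale, ← mul_sub, ← mul_assoc, ← zpow_add₀ two_ne_zero, neg_add_cancel, zpow_zero, one_mul]
  have e3 : ((2:ℝ)^s : ℝ) * N ((2:ℝ)^s * u) * w = N ((2:ℝ)^s * u) * ((2:ℝ)^s * w) := by ring
  have e4 : ((2:ℂ)^s) * (2:ℂ)^(-s) = 1 := by rw [← zpow_add₀ two_ne_zero, add_neg_cancel, zpow_zero]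
  simp only [KQ, kp, e1, e2, e3, Complex.real_smul]
  push_cast
  linear_combination (ps 0 (u - w) * (ex (PH d a 0 (2 ^ s * u - 2 ^ s * w)) * ex (-(N (2 ^ s * u) * (2 ^ s * w)))) * f (2 ^ s * w)) * e4
theorem ss_L2 (d : ℕ) : ∃ C δ : ℝ, 0 ≤ C ∧ 0 < δ ∧ ∀ a : ℕ → ℝ, ∀ s : ℤ, 1 ≤ lam d a s → ∀ N, Measurable N → ∀ f, Bd f →
    ∫⁻ x, ‖op (KQ s (PH d a 0) N) f x‖ₑ ^ 2 ≤ ENNReal.ofReal (C * lam d a s ^ (-δ)) * ∫⁻ x, ‖f x‖ₑ ^ 2 := by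
  obtain ⟨κ, hκ, hκ1, hdom⟩ := dom d
  have hss : ∀ k : ℕ, ∃ C : ℝ, 0 ≤ C ∧ (1 ≤ k → ∀ F, Tow F → ∀ N, Measurable N → ∀ μ : ℝ, 0 < μ →
    (∀ v : ℝ, |v| ≤ 2 * (k:ℝ) + 3 → μ ≤ |F (k+2) v| ∧ |F (k+3) v| ≤ μ) →
    ∀ f, Bd f → ∫⁻ x, ‖op (KQ 0 (F 0) N) f x‖ₑ ^ 2 ≤ ENNReal.ofReal (C * μ ^ (-(dl k / 2))) * ∫⁻ x, ‖f x‖ₑ ^ 2) := fun k => by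
    by_cases hk : 1 ≤ k
    · obtain ⟨C, h0, h⟩ := ss0 k hk; exact ⟨C, h0, fun _ => h⟩
    · exact ⟨0, le_rfl, fun h => absurd h hk⟩
  choose C hC0 hC using hss
  refine ⟨(∑ k ∈ Finset.range (d+1), C k) * κ⁻¹, dl d / 2, mul_nonneg (Finset.sum_nonneg fun k _ => hC0 k) (by positivity),
    by linarith [dl_pos d], fun a s hl N hN f hf => ?_⟩
  set c : ℕ → ℝ := fun j => a j * ((2:ℝ)^s)^j with hc
  have hl0 : lam d c 0 = lam d a s := lam_scale d a s
  obtain ⟨k, hk1, hkd, μ, hμ, hv⟩ := hdom c (by rw [hl0]; linarith)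
  rw [hl0] at hμ
  have hκl : 0 < κ * lam d a s := by nlinarith
  have hp : (0:ℝ) < (2:ℝ)^s := by positivity
  have hf' : Bd (fun w => f ((2:ℝ)^s * w)) := by
    obtain ⟨hm, ⟨B, hB⟩, ⟨R, hR⟩⟩ := hf
    refine ⟨hm.comp (measurable_const_mul _), ⟨B, fun x => hB _⟩, ⟨((2:ℝ)^s)⁻¹ * R, fun x hx => hR _ ?_⟩⟩
    rwa [abs_mul, abs_of_pos hp, ← inv_mul_lt_iff₀ hp]
  have hN' : Measurable (fun u => (2:ℝ)^s * N ((2:ℝ)^s * u)) := (hN.comp (measurable_const_mul _)).const_mul _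
  have hmain := hC k hk1 (PH d c) (PH_tow d c) _ hN' μ (by linarith) hv _ hf'
  rw [lint_scale hp _ ((hf.op (BK_KQ s (PH_meas d a) hN)).meas.enorm.pow_const 2),
    lint_scale hp _ (hf.meas.enorm.pow_const 2)]
  simp_rw [op_scale]
  rw [mul_left_comm]
  refine mul_le_mul' le_rfl (hmain.trans (mul_le_mul' (ENNReal.ofReal_le_ofReal ?_) le_rfl))
  have hdk := dl_pos k
  have hμ0 : 0 < μ := by linarith
  have h1 : μ ^ (-(dl k / 2)) ≤ κ⁻¹ * lam d a s ^ (-(dl d / 2)) := by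
    calc _ ≤ (κ * lam d a s) ^ (-(dl k / 2)) := Real.rpow_le_rpow_of_nonpos hκl hμ (by linarith)
      _ = κ ^ (-(dl k / 2)) * lam d a s ^ (-(dl k / 2)) := Real.mul_rpow hκ.le (by linarith)
      _ ≤ _ := by
        refine mul_le_mul ?_ (Real.rpow_le_rpow_of_exponent_le hl ?_) (by positivity) (by positivity)
        · rw [← Real.rpow_neg_one]
          exact Real.rpow_le_rpow_of_exponent_ge hκ hκ1 (by linarith [dl_le k])
        · have : dl d ≤ dl k := pow_le_pow_of_le_one (by norm_num) (by norm_num) hkd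
          linarith
  calc _ ≤ (∑ k ∈ Finset.range (d+1), C k) * (κ⁻¹ * lam d a s ^ (-(dl d / 2))) :=
        mul_le_mul (Finset.single_le_sum (f := C) (fun k _ => hC0 k) (Finset.mem_range.2 (by omega))) h1 (by positivity)
          (Finset.sum_nonneg fun k _ => hC0 k)
    _ = _ := by ring
/-! ### Interpolation and summation over scales -/
lemma ind_pow (f : ℝ → ℂ) {E : Set ℝ} (hE : MeasurableSet E) {q : ℝ} (hq : 0 < q) :
    ∫⁻ x, ‖E.indicator f x‖ₑ ^ q = ∫⁻ x in E, ‖f x‖ₑ ^ q := by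
  rw [← lintegral_indicator hE]
  congr 1; ext x
  by_cases hx : x ∈ E
  · rw [indicator_of_mem hx, indicator_of_mem hx]
  · rw [indicator_of_notMem hx, indicator_of_notMem hx, enorm_zero, ENNReal.zero_rpow_of_pos hq]
lemma interp {T : (ℝ → ℂ) → ℝ → ℝ≥0∞} (hm : ∀ f, Bd f → Measurable (T f))
    (hadd : ∀ f g, Bd f → Bd g → ∀ x, T (fun x => f x + g x) x ≤ T f x + T g x) {p0 q p1 : ℝ} (hp0 : 0 < p0) (h0q : p0 < q)
    (hq1 : q < p1) {l α β C0 C1 : ℝ} (hl : 0 < l) (hC0 : 0 ≤ C0) (hC1 : 0 ≤ C1)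
    (h0 : ∀ f, Bd f → ∫⁻ x, T f x ^ p0 ≤ ENNReal.ofReal (C0 * l ^ (-α)) * ∫⁻ x, ‖f x‖ₑ ^ p0)
    (h1 : ∀ f, Bd f → ∫⁻ x, T f x ^ p1 ≤ ENNReal.ofReal (C1 * l ^ (-β)) * ∫⁻ x, ‖f x‖ₑ ^ p1) (f : ℝ → ℂ) (hf : Bd f) :
    ∫⁻ x, T f x ^ q ≤ ENNReal.ofReal (q * (C0 * 2^p0 * (q-p0)⁻¹ + C1 * 2^p1 * (p1-q)⁻¹) * l ^ (-((α*(p1-q)+β*(q-p0))/(p1-p0))))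
      * ∫⁻ x, ‖f x‖ₑ ^ q := by
  set γ := (β - α) / (p1 - p0) with hγ
  have hp1 : 0 < p1 := by linarith
  have hpp : p1 - p0 ≠ 0 := by linarith
  have hh : ∀ (g : ℝ → ℂ), Bd g → ∀ (r C t : ℝ), 0 < r → 0 ≤ C → 0 < t →
      ∫⁻ x, T g x ^ r ≤ ENNReal.ofReal C * ∫⁻ x, ‖g x‖ₑ ^ r →
      volume {x | ENNReal.ofReal (t/2) < T g x} ≤ ENNReal.ofReal (C * 2^r) * ENNReal.ofReal (t^(-r)) * ∫⁻ x, ‖g x‖ₑ ^ r := by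
    intro g hg r C t hr hC ht hI
    refine (cheb _ (hm g hg) r (t/2) hr (by positivity) _ hI).trans (le_of_eq ?_)
    have e : ENNReal.ofReal ((t/2)^(-r)) = ENNReal.ofReal (2^r) * ENNReal.ofReal (t^(-r)) := by
      rw [← ENNReal.ofReal_mul (by positivity), Real.div_rpow ht.le (by norm_num), Real.rpow_neg (by norm_num : (0:ℝ) ≤ 2),
        div_inv_eq_mul, mul_comm]
    rw [e, ENNReal.ofReal_mul hC]; ring
  have := marc (T f) (fun x => ‖f x‖ₑ) (hm f hf) hf.meas.enorm p0 q p1 hp0 h0q hq1 (l^γ) (by positivity)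
    (ENNReal.ofReal (C0 * l^(-α) * 2^p0)) (ENNReal.ofReal (C1 * l^(-β) * 2^p1)) (fun t ht => ?_)
  · refine this.trans (mul_le_mul' (le_of_eq ?_) le_rfl)
    have i0 : 0 < q - p0 := by linarith
    have i1 : 0 < p1 - q := by linarith
    have hq : 0 < q := by linarith
    rw [← ENNReal.ofReal_mul (by positivity), ← ENNReal.ofReal_mul (by positivity), ← ENNReal.ofReal_add (by positivity) (by positivity),
      ← ENNReal.ofReal_mul hq.le, ← Real.rpow_mul hl.le, ← Real.rpow_mul hl.le]
    congr 1
    have e1 : l ^ (-α) * l ^ (γ * (p0 - q)) = l ^ (-((α*(p1-q)+β*(q-p0))/(p1-p0))) := by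
      rw [← Real.rpow_add hl]; congr 1; rw [hγ]; field_simp; ring
    have e2 : l ^ (-β) * l ^ (γ * (p1 - q)) = l ^ (-((α*(p1-q)+β*(q-p0))/(p1-p0))) := by
      rw [← Real.rpow_add hl]; congr 1; rw [hγ]; field_simp; ring
    linear_combination q * C0 * 2^p0 * (q-p0)⁻¹ * e1 + q * C1 * 2^p1 * (p1-q)⁻¹ * e2
  · set E := {x | ENNReal.ofReal (l^γ * t) < ‖f x‖ₑ}
    have hE : MeasurableSet E := measurableSet_lt measurable_const hf.meas.enorm
    have hE' : {x | ‖f x‖ₑ ≤ ENNReal.ofReal (l^γ * t)} = Eᶜ := by ext x; simp [E]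
    rw [hE', ← ind_pow f hE hp0, ← ind_pow f hE.compl hp1]
    have b0 := hf.indicator hE
    have b1 := hf.indicator hE.compl
    refine (measure_mono (t := {x | ENNReal.ofReal (t/2) < T (E.indicator f) x} ∪ {x | ENNReal.ofReal (t/2) < T (Eᶜ.indicator f) x})
      (fun x hx => ?_)).trans ((measure_union_le _ _).trans (add_le_add
        (hh _ b0 p0 _ t hp0 (by positivity) ht (h0 _ b0)) (hh _ b1 p1 _ t hp1 (by positivity) ht (h1 _ b1))))
    have hx' : ENNReal.ofReal t < T f x := hx
    by_contra hcon
    rw [mem_union, not_or] at hcon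
    have c1 : T (E.indicator f) x ≤ ENNReal.ofReal (t/2) := not_lt.1 hcon.1
    have c2 : T (Eᶜ.indicator f) x ≤ ENNReal.ofReal (t/2) := not_lt.1 hcon.2
    have c3 := hadd _ _ b0 b1 x
    have e : (fun x => E.indicator f x + Eᶜ.indicator f x) = f := by
      ext x; exact congrFun (indicator_self_add_compl E f) x
    rw [e] at c3
    have c4 := c3.trans (add_le_add c1 c2)
    rw [← ENNReal.ofReal_add (by positivity) (by positivity), add_halves] at c4
    exact absurd hx' (not_lt.2 c4)
noncomputable def VS (S : Finset ℝ) (s : ℤ) (φ : ℝ → ℝ) (f : ℝ → ℂ) (x : ℝ) : ℝ≥0∞ :=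
  ⨆ N ∈ (S : Set ℝ), ‖op (KQ s φ (fun _ => N)) f x‖ₑ
lemma VS_meas (S : Finset ℝ) (s : ℤ) {φ : ℝ → ℝ} (hφ : Measurable φ) {f : ℝ → ℂ} (hf : Bd f) : Measurable (VS S s φ f) :=
  Measurable.biSup _ S.countable_toSet (fun _ _ => (hf.op (BK_KQ s hφ measurable_const)).meas.enorm)
lemma VS_add (S : Finset ℝ) (s : ℤ) {φ : ℝ → ℝ} (hφ : Measurable φ) {f g : ℝ → ℂ} (hf : Bd f) (hg : Bd g) (x : ℝ) :
    VS S s φ (fun x => f x + g x) x ≤ VS S s φ f x + VS S s φ g x := by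
  refine iSup₂_le (fun N hN => ?_)
  have hK := (BK_KQ s hφ (measurable_const (a := N))).slice x
  have e : op (KQ s φ (fun _ => N)) (fun x => f x + g x) x = op (KQ s φ (fun _ => N)) f x + op (KQ s φ (fun _ => N)) g x := by
    unfold op
    rw [← integral_add (hK.mul hf).integrable (hK.mul hg).integrable]
    congr 1; ext y; ring
  rw [e]
  exact (enorm_add_le _ _).trans (add_le_add (le_iSup₂ (f := fun N _ => ‖op (KQ s φ (fun _ => N)) f x‖ₑ) N hN)
    (le_iSup₂ (f := fun N _ => ‖op (KQ s φ (fun _ => N)) g x‖ₑ) N hN))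
lemma VS_MN (q : ℝ) (hq : 1 < q) : ∃ C : ℝ, 0 ≤ C ∧ ∀ S s φ f, Bd f →
    ∫⁻ x, VS S s φ f x ^ q ≤ ENNReal.ofReal C * ∫⁻ x, ‖f x‖ₑ ^ q := by
  obtain ⟨C, hC⟩ := MM_strong q hq
  refine ⟨8^q * C, by positivity, fun S s φ f hf => ?_⟩
  calc _ ≤ ∫⁻ x, (8 * MN f x) ^ q := lintegral_mono fun x =>
        ENNReal.rpow_le_rpow (iSup₂_le fun N _ => op_KQ_le _ _ _ _ _) (by linarith)
    _ = ENNReal.ofReal (8^q) * ∫⁻ x, MN f x ^ q := by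
        simp_rw [ENNReal.mul_rpow_of_nonneg _ _ (by linarith : 0 ≤ q)]
        rw [lintegral_const_mul' _ _ (by finiteness), ← ENNReal.ofReal_rpow_of_pos (by norm_num)]; norm_num
    _ ≤ _ := by
        rw [ENNReal.ofReal_mul (by positivity), mul_assoc]
        exact mul_le_mul' le_rfl (by simpa [MN] using hC _ hf.meas.enorm)
theorem VS_L2 (d : ℕ) : ∃ C δ : ℝ, 0 ≤ C ∧ 0 < δ ∧ ∀ a s, 1 ≤ lam d a s → ∀ S f, Bd f →
    ∫⁻ x, VS S s (PH d a 0) f x ^ (2:ℝ) ≤ ENNReal.ofReal (C * lam d a s ^ (-δ)) * ∫⁻ x, ‖f x‖ₑ ^ (2:ℝ) := by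
  obtain ⟨C, δ, hC, hδ, h⟩ := ss_L2 d
  refine ⟨C, δ, hC, hδ, fun a s hl S f hf => ?_⟩
  simp only [ENNReal.rpow_two]
  rcases S.eq_empty_or_nonempty with rfl | hS
  · simp [VS]
  · obtain ⟨σ, hσ, -, -, hmax⟩ := sel S hS (fun N x => ‖op (KQ s (PH d a 0) (fun _ => N)) f x‖ₑ)
      (fun N _ => (hf.op (BK_KQ s (PH_meas d a) measurable_const)).meas.enorm)
    refine le_trans (lintegral_mono fun x => ?_) (h a s hl σ hσ f hf)
    exact pow_le_pow_left' (iSup₂_le fun N hN => hmax x N hN) 2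
theorem VS_Lq (d : ℕ) (q : ℝ) (hq : 1 < q) : ∃ C δ : ℝ, 0 ≤ C ∧ 0 < δ ∧ ∀ a s, 1 ≤ lam d a s → ∀ S f, Bd f →
    ∫⁻ x, VS S s (PH d a 0) f x ^ q ≤ ENNReal.ofReal (C * lam d a s ^ (-δ)) * ∫⁻ x, ‖f x‖ₑ ^ q := by
  obtain ⟨C, δ, hC, hδ, h⟩ := VS_L2 d
  rcases lt_trichotomy q 2 with h2 | rfl | h2
  · obtain ⟨C', hC', h'⟩ := VS_MN ((1+q)/2) (by linarith)
    refine ⟨_, _, ?_, ?_, fun a s hl S f hf => interp (T := VS S s (PH d a 0)) (fun f hf => VS_meas S s (PH_meas d a) hf)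
      (fun f g hf hg x => VS_add S s (PH_meas d a) hf hg x) (p0 := (1+q)/2) (p1 := 2) (α := 0) (β := δ) (C0 := C') (C1 := C)
      (by linarith) (by linarith) h2 (by linarith) hC' hC
      (fun f hf => by simpa using h' S s (PH d a 0) f hf) (h a s hl S) f hf⟩
    · have i0 : 0 ≤ q - (1+q)/2 := by linarith
      have i1 : 0 ≤ 2 - q := by linarith
      positivity
    · rw [zero_mul, zero_add]
      exact div_pos (mul_pos hδ (by linarith)) (by linarith)
  · exact ⟨C, δ, hC, hδ, h⟩
  · obtain ⟨C', hC', h'⟩ := VS_MN (q+1) (by linarith)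
    refine ⟨_, _, ?_, ?_, fun a s hl S f hf => interp (T := VS S s (PH d a 0)) (fun f hf => VS_meas S s (PH_meas d a) hf)
      (fun f g hf hg x => VS_add S s (PH_meas d a) hf hg x) (p0 := 2) (p1 := q+1) (α := δ) (β := 0) (C0 := C) (C1 := C')
      (by linarith) h2 (by linarith) (by linarith) hC hC' (h a s hl S)
      (fun f hf => by simpa using h' S s (PH d a 0) f hf) f hf⟩
    · have i0 : 0 ≤ q - 2 := by linarith
      have i1 : 0 ≤ q + 1 - q := by linarith
      positivity
    · rw [zero_mul, add_zero]
      exact div_pos (mul_pos hδ (by linarith)) (by linarith)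
/-! ### Sum over scales -/
lemma lam_mono (d : ℕ) (a : ℕ → ℝ) {s s' : ℤ} (h : s ≤ s') : (2:ℝ)^(s'-s) * lam d a s ≤ lam d a s' := by
  unfold lam
  rw [Finset.mul_sum]
  refine Finset.sum_le_sum (fun j hj => ?_)
  have h3 := (Finset.mem_Icc.1 hj).1
  have e : (2:ℝ)^s' = (2:ℝ)^(s'-s) * (2:ℝ)^s := by rw [← zpow_add₀ two_ne_zero]; congr 1; ring
  have h1 : (1:ℝ) ≤ (2:ℝ)^(s'-s) := one_le_zpow₀ (by norm_num) (by omega)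
  have h2 : (2:ℝ)^(s'-s) ≤ ((2:ℝ)^(s'-s))^j := le_self_pow₀ h1 (by omega)
  rw [e, mul_pow]
  calc _ = (2:ℝ)^(s'-s) * (|a j| * ((2:ℝ)^s)^j) := by ring
    _ ≤ ((2:ℝ)^(s'-s))^j * (|a j| * ((2:ℝ)^s)^j) := mul_le_mul_of_nonneg_right h2 (by positivity)
    _ = _ := by ring
lemma cut (d : ℕ) (a : ℕ → ℝ) (k0 k1 : ℤ) : ∃ c : ℤ, (∀ s, k0 ≤ s → s ≤ c → lam d a s ≤ (2:ℝ)^(s-c)) ∧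
    ∀ s, c < s → s ≤ k1 → (2:ℝ)^(s-c-1) ≤ lam d a s := by
  set T := insert (k0-1) ((Finset.Icc k0 k1).filter (fun s => lam d a s ≤ 1))
  have hT : T.Nonempty := ⟨k0-1, Finset.mem_insert_self _ _⟩
  have hm := T.max'_mem hT
  set c := T.max' hT
  have hc0 : k0 - 1 ≤ c := T.le_max' _ (Finset.mem_insert_self _ _)
  refine ⟨c, fun s h0 hs => ?_, fun s hs h1 => ?_⟩
  · have hl : lam d a c ≤ 1 := by
      rcases Finset.mem_insert.1 hm with h | h
      · omega
      · exact (Finset.mem_filter.1 h).2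
    have h2 := (lam_mono d a hs).trans hl
    rw [← neg_sub, zpow_neg]
    rwa [← le_inv_mul_iff₀ (by positivity), mul_one] at h2
  · have hl : 1 < lam d a (c+1) := by
      by_contra h; push Not at h
      have : c + 1 ∈ T := Finset.mem_insert_of_mem (Finset.mem_filter.2 ⟨Finset.mem_Icc.2 ⟨by omega, by omega⟩, h⟩)
      have := T.le_max' _ this
      omega
    have h2 := lam_mono d a (show c + 1 ≤ s by omega)
    rw [← sub_sub] at h2
    have : (0:ℝ) < (2:ℝ)^(s-c-1) := by positivity
    nlinarith
lemma low_diff (d : ℕ) (a : ℕ → ℝ) (s : ℤ) (N : ℝ) {f : ℝ → ℂ} (hf : Bd f) (x : ℝ) :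
    ‖op (KQ s (PH d a 0) (fun _ => N)) f x - op (kp s) (md N f) x‖ₑ ≤ ENNReal.ofReal (8 * lam d a s) * MN f x := by
  have hK := (BK_KQ s (PH_meas d a) (measurable_const (a := N))).slice x
  have e : op (KQ s (PH d a 0) (fun _ => N)) f x - op (kp s) (md N f) x
      = ∫ y, (kp s x y * ((ex (PH d a 0 (x - y)) - 1) * ex (-(N * y)))) * f y := by
    unfold op
    rw [← integral_sub (hK.mul hf).integrable (((BK_kp s).slice x).mul (hf.md N)).integrable]
    congr 1; ext y; simp only [KQ, md]; ring
  rw [e]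
  have hl : 0 ≤ lam d a s := Finset.sum_nonneg fun j _ => by positivity
  have hp : (0:ℝ) < (2:ℝ)^s := by positivity
  refine (ker_bound _ f x ((2:ℝ)^s) (4 * (2:ℝ)^(-s) * lam d a s) hp (fun y => ?_)
    (fun y hy => by rw [kp_zero s hy.le, zero_mul])).trans (le_of_eq ?_)
  · by_cases hy : |x - y| ≤ (2:ℝ)^s
    · rw [norm_mul, norm_mul, ex_norm, mul_one]
      refine mul_le_mul (kp_norm_le s x y) ((ex_sub_one _).trans ?_) (norm_nonneg _) (by positivity)
      unfold PH lam
      refine (Finset.abs_sum_le_sum_abs _ _).trans (Finset.sum_le_sum fun j _ => ?_)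
      rw [Nat.descFactorial_zero, Nat.cast_one, mul_one, Nat.sub_zero, abs_mul, abs_pow]
      exact mul_le_mul_of_nonneg_left (pow_le_pow_left₀ (abs_nonneg _) hy j) (abs_nonneg _)
    · push Not at hy
      rw [kp_zero s hy.le, zero_mul, norm_zero]; positivity
  · congr 2; rw [zpow_neg]; field_simp; ring
noncomputable def nq (q : ℝ) (F : ℝ → ℝ≥0∞) : ℝ≥0∞ := (∫⁻ x, F x ^ q) ^ (1/q)
lemma nq_sum {ι : Type*} {q : ℝ} (hq : 1 < q) (T : Finset ι) (F : ι → ℝ → ℝ≥0∞) (hF : ∀ i, Measurable (F i)) :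
    nq q (fun x => ∑ i ∈ T, F i x) ≤ ∑ i ∈ T, nq q (F i) := by
  induction T using Finset.induction_on with
  | empty => simp [nq, ENNReal.zero_rpow_of_pos (by linarith : 0 < q), show 0 < q by linarith]
  | insert i T hi ih =>
    simp_rw [Finset.sum_insert hi]
    exact (ENNReal.lintegral_Lp_add_le (hF i).aemeasurable (Finset.measurable_fun_sum T fun i _ => hF i).aemeasurable hq.le).trans
      (add_le_add le_rfl ih)
lemma nq_le {q C : ℝ} (hq : 1 < q) (hC : 0 ≤ C) {F g : ℝ → ℝ≥0∞} (h : ∫⁻ x, F x ^ q ≤ ENNReal.ofReal C * ∫⁻ x, g x ^ q) :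
    nq q F ≤ ENNReal.ofReal (C ^ (1/q)) * nq q g := by
  have hq0 : 0 ≤ 1/q := by positivity
  unfold nq
  rw [← ENNReal.ofReal_rpow_of_nonneg hC hq0, ← ENNReal.mul_rpow_of_nonneg _ _ hq0]
  exact ENNReal.rpow_le_rpow h hq0
theorem thmA (d : ℕ) (q : ℝ) (hq : 1 < q) : ∃ C : ℝ, 0 ≤ C ∧ ∀ (a : ℕ → ℝ) (S : Finset ℝ) (k0 k1 : ℤ) (f : ℝ → ℂ), Bd f →
    ∃ W : ℝ → ℝ≥0∞, Measurable W ∧ (∀ N ∈ S, ∀ i j x, k0 ≤ i → j ≤ k1 →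
      ‖∑ s ∈ Finset.Icc i j, op (KQ s (PH d a 0) (fun _ => N)) f x‖ₑ + 16 * MN f x ≤ W x) ∧
      ∫⁻ x, W x ^ q ≤ ENNReal.ofReal C * ∫⁻ x, ‖f x‖ₑ ^ q := by
  obtain ⟨C1, h1⟩ := carleson q hq
  obtain ⟨C2, h2⟩ := MM_strong q hq
  obtain ⟨C3, δ, hC3, hδ, h3⟩ := VS_Lq d q hq
  have hq0 : 0 < q := by linarith
  set ρ : ℝ := 2 ^ (-(δ/q)) with hρ
  have hρ0 : 0 ≤ ρ := by positivity
  have hρ1 : ρ < 1 := Real.rpow_lt_one_of_one_lt_of_neg (by norm_num) (by rw [neg_lt_zero]; positivity)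
  set B : ℝ := (C1:ℝ)^(1/q) + (32^q * (C2:ℝ))^(1/q) + C3^(1/q) * (1-ρ)⁻¹ with hB
  have hB0 : 0 ≤ B := by
    have : 0 ≤ (1-ρ)⁻¹ := inv_nonneg.2 (by linarith)
    positivity
  refine ⟨B^q, by positivity, fun a S k0 k1 f hf => ?_⟩
  obtain ⟨c, hc1, hc2⟩ := cut d a k0 k1
  have hVm := fun s => VS_meas S s (PH_meas d a) hf
  have hCm := CC_meas S k0 k1 hf
  have hMm : Measurable (fun x => 32 * MN f x) := (measurable_MM hf.meas.enorm).const_mul _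
  refine ⟨fun x => (CC S k0 k1 f x + 32 * MN f x) + ∑ s ∈ Finset.Icc (c+1) k1, VS S s (PH d a 0) f x,
    (hCm.add hMm).add (Finset.measurable_fun_sum _ fun s _ => hVm s), fun N hN i j x hi hj => ?_, ?_⟩
  · set U : ℤ → ℂ := fun s => op (KQ s (PH d a 0) (fun _ => N)) f x
    have hfil : (Finset.Icc i j).filter (fun s => s ≤ c) = Finset.Icc i (min j c) := by
      ext s; simp only [Finset.mem_filter, Finset.mem_Icc, le_min_iff]; tauto
    have hlow : ‖∑ s ∈ Finset.Icc i (min j c), U s‖ₑ ≤ CC S k0 k1 f x + 16 * MN f x := by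
      have e : ∑ s ∈ Finset.Icc i (min j c), U s = tr i (min j c) (md N f) x + ∑ s ∈ Finset.Icc i (min j c), (U s - op (kp s) (md N f) x) := by
        rw [Finset.sum_sub_distrib]; unfold tr; ring
      rw [e]
      refine (enorm_add_le _ _).trans (add_le_add (le_CC hN hi ((min_le_left _ _).trans hj)) ?_)
      refine (enorm_sum_le _ _).trans ?_
      calc _ ≤ ∑ s ∈ Finset.Icc i (min j c), ENNReal.ofReal (8 * (2:ℝ)^(s-c)) * MN f x := by
            refine Finset.sum_le_sum fun s hs => ?_
            rw [Finset.mem_Icc] at hs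
            refine (low_diff d a s N hf x).trans (mul_le_mul' (ENNReal.ofReal_le_ofReal ?_) le_rfl)
            have := hc1 s (by omega) (by omega)
            linarith
        _ = ENNReal.ofReal (∑ s ∈ Finset.Icc i (min j c), 8 * (2:ℝ)^(s-c)) * MN f x := by
            rw [← Finset.sum_mul, ENNReal.ofReal_sum_of_nonneg (fun s _ => by positivity)]
        _ ≤ _ := by
            refine mul_le_mul' ?_ le_rfl
            rw [show (16:ℝ≥0∞) = ENNReal.ofReal 16 by simp]
            refine ENNReal.ofReal_le_ofReal ?_
            have h5 := geo_up i (min j c)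
            have h6 : (2:ℝ)^(min j c) ≤ (2:ℝ)^c := zpow_le_zpow_right₀ (by norm_num) (min_le_right _ _)
            have hp : (0:ℝ) < (2:ℝ)^c := by positivity
            simp_rw [zpow_sub₀ (two_ne_zero : (2:ℝ) ≠ 0), ← mul_div_assoc]
            rw [← Finset.sum_div, ← Finset.mul_sum, div_le_iff₀ hp]
            linarith
    have hhigh : ‖∑ s ∈ (Finset.Icc i j).filter (fun s => ¬ s ≤ c), U s‖ₑ ≤ ∑ s ∈ Finset.Icc (c+1) k1, VS S s (PH d a 0) f x := by
      refine (enorm_sum_le _ _).trans ((Finset.sum_le_sum fun s _ => ?_).trans (Finset.sum_le_sum_of_subset (fun s hs => ?_)))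
      · exact le_iSup₂ (f := fun N _ => ‖op (KQ s (PH d a 0) (fun _ => N)) f x‖ₑ) N hN
      · simp only [Finset.mem_filter, Finset.mem_Icc] at hs ⊢; omega
    have e : ∑ s ∈ Finset.Icc i j, U s = ∑ s ∈ Finset.Icc i (min j c), U s + ∑ s ∈ (Finset.Icc i j).filter (fun s => ¬ s ≤ c), U s := by
      rw [← hfil, Finset.sum_filter_add_sum_filter_not]
    change ‖∑ s ∈ Finset.Icc i j, U s‖ₑ + _ ≤ _
    rw [e]
    calc _ ≤ ((CC S k0 k1 f x + 16 * MN f x) + ∑ s ∈ Finset.Icc (c+1) k1, VS S s (PH d a 0) f x) + 16 * MN f x :=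
          add_le_add ((enorm_add_le _ _).trans (add_le_add hlow hhigh)) le_rfl
      _ = _ := by ring
  · have hn : nq q (fun x => (CC S k0 k1 f x + 32 * MN f x) + ∑ s ∈ Finset.Icc (c+1) k1, VS S s (PH d a 0) f x)
        ≤ ENNReal.ofReal B * nq q (fun x => ‖f x‖ₑ) := by
      have t1 : nq q (CC S k0 k1 f) ≤ ENNReal.ofReal ((C1:ℝ)^(1/q)) * nq q (fun x => ‖f x‖ₑ) :=
        nq_le hq (by positivity) (by simpa using h1 S k0 k1 f hf)
      have t2 : nq q (fun x => 32 * MN f x) ≤ ENNReal.ofReal ((32^q * (C2:ℝ))^(1/q)) * nq q (fun x => ‖f x‖ₑ) := by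
        refine nq_le hq (by positivity) ?_
        simp_rw [ENNReal.mul_rpow_of_nonneg _ _ hq0.le]
        rw [lintegral_const_mul' _ _ (by finiteness), ENNReal.ofReal_mul (by positivity), mul_assoc,
          ← ENNReal.ofReal_rpow_of_pos (by norm_num)]
        exact mul_le_mul' (by norm_num) (by simpa [MN] using h2 _ hf.meas.enorm)
      have t3 : nq q (fun x => ∑ s ∈ Finset.Icc (c+1) k1, VS S s (PH d a 0) f x)
          ≤ ENNReal.ofReal (C3^(1/q) * (1-ρ)⁻¹) * nq q (fun x => ‖f x‖ₑ) := by
        refine (nq_sum hq _ _ hVm).trans ?_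
        set n := (k1 - c).toNat with hnn
        calc _ ≤ ∑ s ∈ Finset.Icc (c+1) k1, ENNReal.ofReal (C3^(1/q) * ρ^((s-c-1).toNat)) * nq q (fun x => ‖f x‖ₑ) := by
              refine Finset.sum_le_sum fun s hs => ?_
              rw [Finset.mem_Icc] at hs
              have hls := hc2 s (by omega) hs.2
              have h7 : (1:ℝ) ≤ (2:ℝ)^(s-c-1) := one_le_zpow₀ (by norm_num) (by omega)
              have hl0 : 0 < lam d a s := by linarith
              refine (nq_le hq (by positivity) (h3 a s (h7.trans hls) S f hf)).trans
                (mul_le_mul' (ENNReal.ofReal_le_ofReal ?_) le_rfl)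
              rw [Real.mul_rpow hC3 (by positivity), ← Real.rpow_mul hl0.le]
              refine mul_le_mul_of_nonneg_left ?_ (by positivity)
              have e8 : (2:ℝ)^(s-c-1) = (2:ℝ)^((s-c-1).toNat : ℝ) := by
                rw [Real.rpow_natCast, ← zpow_natCast, Int.toNat_of_nonneg (by omega)]
              rw [e8] at hls
              calc _ ≤ ((2:ℝ)^((s-c-1).toNat : ℝ)) ^ (-δ * (1/q)) := Real.rpow_le_rpow_of_nonpos (by positivity) hls (by
                      have : 0 < δ * (1/q) := by positivity
                      linarith)
                _ = _ := by
                    rw [← Real.rpow_mul (by norm_num), hρ, ← Real.rpow_natCast (2 ^ _), ← Real.rpow_mul (by norm_num)]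
                    congr 1; ring
          _ ≤ ∑ s ∈ Finset.Icc (c+1) (c+1-1+n), ENNReal.ofReal (C3^(1/q) * ρ^((s-c-1).toNat)) * nq q (fun x => ‖f x‖ₑ) :=
              Finset.sum_le_sum_of_subset (Finset.Icc_subset_Icc le_rfl (by omega))
          _ ≤ _ := by
              rw [sum_Icc_ind, ← Finset.sum_mul]
              refine mul_le_mul' ?_ le_rfl
              have e9 : ∀ m : ℕ, (c + 1 + (m:ℤ) - c - 1).toNat = m := fun m => by omega
              simp_rw [e9]
              refine sum_ofReal_le (fun m => by positivity) (by positivity) ?_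
              rw [← tsum_geometric_of_lt_one hρ0 hρ1]
              exact (summable_geometric_of_lt_one hρ0 hρ1).sum_le_tsum _ (fun m _ => by positivity)
      have m1 := ENNReal.lintegral_Lp_add_le (hCm.add hMm).aemeasurable
        (Finset.measurable_fun_sum (Finset.Icc (c+1) k1) fun s _ => hVm s).aemeasurable hq.le (μ := volume)
      have m2 := ENNReal.lintegral_Lp_add_le hCm.aemeasurable hMm.aemeasurable hq.le (μ := volume)
      refine (m1.trans (add_le_add (m2.trans (add_le_add t1 t2)) t3)).trans (le_of_eq ?_)
      have : 0 ≤ (1-ρ)⁻¹ := inv_nonneg.2 (by linarith)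
      rw [← add_mul, ← add_mul, hB, ENNReal.ofReal_add (by positivity) (by positivity), ENNReal.ofReal_add (by positivity) (by positivity)]
    have h9 := ENNReal.rpow_le_rpow hn hq0.le
    unfold nq at h9
    rw [ENNReal.mul_rpow_of_nonneg _ _ hq0.le, ← ENNReal.rpow_mul, ← ENNReal.rpow_mul, one_div_mul_cancel hq0.ne', ENNReal.rpow_one,
      ENNReal.rpow_one, ENNReal.ofReal_rpow_of_nonneg hB0 hq0.le] at h9
    exact h9
/-! ### Sharp truncations and the limiting argument -/
noncomputable def sct (ε R t : ℝ) : ℝ := if ε < |t| ∧ |t| < R then t⁻¹ else 0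
noncomputable def SK (ε R : ℝ) (φ : ℝ → ℝ) (M x y : ℝ) : ℂ := (sct ε R (x - y) : ℂ) * (ex (φ (x - y)) * ex (-(M * y)))
lemma sct_set (ε R : ℝ) : MeasurableSet {t : ℝ | ε < |t| ∧ |t| < R} :=
  measurableSet_Ioo (a := ε) (b := R) |>.preimage (f := fun t : ℝ => |t|) (by fun_prop)
lemma sct_meas (ε R : ℝ) : Measurable (sct ε R) := Measurable.ite (sct_set ε R) measurable_inv measurable_const
lemma SK_norm (ε R : ℝ) (φ : ℝ → ℝ) (M x y : ℝ) : ‖SK ε R φ M x y‖ = |sct ε R (x - y)| := by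
  simp [SK]
lemma sct_bd {ε R : ℝ} (hε : 0 < ε) (t : ℝ) : |sct ε R t| ≤ ε⁻¹ := by
  unfold sct; split_ifs with h
  · rw [abs_inv]; exact inv_anti₀ hε h.1.le
  · simp [hε.le]
lemma SK_bd {ε R : ℝ} (hε : 0 < ε) {φ : ℝ → ℝ} (hφ : Measurable φ) (M x : ℝ) : Bd (SK ε R φ M x) := by
  refine ⟨?_, ⟨ε⁻¹, fun y => by rw [SK_norm]; exact sct_bd hε _⟩, ⟨|x| + |R|, fun y hy => ?_⟩⟩
  · have := sct_meas ε R
    have h2 : Measurable (fun y : ℝ => ex (φ (x - y))) := ex_meas.comp (hφ.comp (by fun_prop))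
    have h3 : Measurable (fun y : ℝ => (sct ε R (x - y) : ℂ)) := Complex.measurable_ofReal.comp (this.comp (by fun_prop))
    exact h3.mul (h2.mul (by fun_prop))
  · rw [SK, sct, if_neg]
    · simp
    · rintro ⟨-, h⟩
      have h1 := abs_sub_abs_le_abs_sub y x
      rw [abs_sub_comm] at h1
      linarith [le_abs_self R]
lemma sct_diff {ε R : ℝ} (n m : ℤ) (hn : (2:ℝ)^n ≤ ε) (hm : (2:ℝ)^m ≤ R) (hm' : R < (2:ℝ)^(m+1)) (hnm : n ≤ m) (t : ℝ) :
    (|t| ≤ ε → |sct ε R t - ∑ s ∈ Finset.Icc (n+1) (m+1), ps s t| ≤ 2 * (2:ℝ)^(-n)) ∧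
    (¬ |t| ≤ ε → |sct ε R t - ∑ s ∈ Finset.Icc (n+1) (m+1), ps s t| ≤ 2 * (2:ℝ)^(-m)) ∧
    ((2:ℝ)^(m+1) < |t| → ¬ |t| ≤ ε → sct ε R t - ∑ s ∈ Finset.Icc (n+1) (m+1), ps s t = 0) := by
  have pn : (0:ℝ) < (2:ℝ)^n := by positivity
  have pm : (0:ℝ) < (2:ℝ)^m := by positivity
  have hsm : (2:ℝ)^(m+1) = 2 * (2:ℝ)^m := by rw [zpow_add₀ (by norm_num)]; ring
  rw [ps_tele _ _ (by omega), show (1:ℤ) - (n+1) = -n by ring]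
  have e1 : (2:ℝ)^(-n) * |t| = |t| / (2:ℝ)^n := by rw [zpow_neg]; ring
  have e2 : (2:ℝ)^(-(m+1)) * |t| = |t| / (2 * (2:ℝ)^m) := by rw [zpow_neg, hsm]; ring
  rw [e1, e2, zpow_neg, zpow_neg]
  have hAB : th (|t| / (2:ℝ)^n) ≤ th (|t| / (2 * (2:ℝ)^m)) := by
    apply th_anti
    have : (2:ℝ)^n ≤ (2:ℝ)^m := zpow_le_zpow_right₀ (by norm_num) hnm
    exact div_le_div_of_nonneg_left (abs_nonneg _) pn (by linarith)
  have A0 := th_nonneg (|t| / (2 * (2:ℝ)^m))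
  have A1 := th_le_one (|t| / (2 * (2:ℝ)^m))
  have B0 := th_nonneg (|t| / (2:ℝ)^n)
  have B1 := th_le_one (|t| / (2:ℝ)^n)
  refine ⟨fun h => ?_, fun h => ?_, fun h h' => ?_⟩
  · rw [sct, if_neg (by rintro ⟨h1, -⟩; linarith), zero_sub, abs_neg, abs_div]
    by_cases ht : |t| ≤ (2:ℝ)^n / 2
    · have hB : th (|t| / (2:ℝ)^n) = 1 := th_one (by rw [div_le_iff₀ pn]; linarith)
      rw [show th (|t| / (2 * (2:ℝ)^m)) - th (|t| / (2:ℝ)^n) = 0 by linarith]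
      simp [pn.le]
    · push Not at ht
      have h0 : 0 < |t| := by linarith
      rw [div_le_iff₀ h0]
      calc _ ≤ (1:ℝ) := by rw [abs_le]; constructor <;> linarith
        _ = 2 * ((2:ℝ)^n)⁻¹ * ((2:ℝ)^n / 2) := by field_simp
        _ ≤ _ := by gcongr
  · push Not at h
    have hB : th (|t| / (2:ℝ)^n) = 0 := th_zero (by rw [le_div_iff₀ pn]; linarith)
    rw [hB, sub_zero]
    have h0 : 0 < |t| := by linarith
    by_cases ht : |t| < (2:ℝ)^m
    · have hA : th (|t| / (2 * (2:ℝ)^m)) = 1 := th_one (by rw [div_le_iff₀ (by positivity)]; linarith)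
      rw [sct, if_pos ⟨h, by linarith⟩, hA]; simp [pm.le]
    · push Not at ht
      have : |sct ε R t - th (|t| / (2 * (2:ℝ)^m)) / t| ≤ 1 / |t| := by
        unfold sct; split_ifs
        · rw [show t⁻¹ - th (|t| / (2 * (2:ℝ)^m)) / t = (1 - th (|t| / (2 * (2:ℝ)^m))) / t by ring, abs_div]
          gcongr; rw [abs_le]; constructor <;> linarith
        · rw [zero_sub, abs_neg, abs_div]
          gcongr; rw [abs_le]; constructor <;> linarith
      refine this.trans ?_
      rw [one_div]
      have := inv_anti₀ pm ht
      have h5 : 0 < ((2:ℝ)^m)⁻¹ := by positivity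
      linarith
  · push Not at h'
    rw [sct, if_neg (by rintro ⟨-, h1⟩; linarith), th_zero (u := |t| / (2:ℝ)^n) (by rw [le_div_iff₀ pn]; linarith),
      th_zero (by rw [le_div_iff₀ (by positivity)]; linarith)]
    simp
lemma SK_trunc {ε R : ℝ} (hε : 0 < ε) (hR : ε < R) : ∃ i j : ℤ, ∀ (φ : ℝ → ℝ), Measurable φ → ∀ (M : ℝ) (g : ℝ → ℂ), Bd g → ∀ x,
    ‖op (SK ε R φ M) g x‖ₑ ≤ ‖∑ s ∈ Finset.Icc i j, op (KQ s φ (fun _ => M)) g x‖ₑ + 16 * MN g x := by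
  obtain ⟨n, hn, hn'⟩ := exists_mem_Ico_zpow hε (one_lt_two (α := ℝ))
  obtain ⟨m, hm, hm'⟩ := exists_mem_Ico_zpow (hε.trans hR) (one_lt_two (α := ℝ))
  have hnm : n ≤ m := by
    have : (2:ℝ)^n < (2:ℝ)^(m+1) := by linarith
    have := (zpow_lt_zpow_iff_right₀ (one_lt_two (α := ℝ))).1 this
    omega
  refine ⟨n+1, m+1, fun φ hφ M g hg x => ?_⟩
  set T := Finset.Icc (n+1) (m+1)
  have hK : ∀ s, Bd (KQ s φ (fun _ => M) x) := fun s => (BK_KQ s hφ measurable_const).slice x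
  set k : ℝ → ℂ := fun y => SK ε R φ M x y - ∑ s ∈ T, KQ s φ (fun _ => M) x y with hk
  have hkB : Bd k := (SK_bd hε hφ M x).sub (Bd.sum T (fun s => KQ s φ (fun _ => M) x) fun s _ => hK s)
  have hkn : ∀ y, ‖k y‖ = |sct ε R (x - y) - ∑ s ∈ T, ps s (x - y)| := fun y => by
    have : k y = ((sct ε R (x - y) - ∑ s ∈ T, ps s (x - y) : ℝ) : ℂ) * (ex (φ (x - y)) * ex (-(M * y))) := by
      simp only [hk, SK, KQ, kp]
      rw [← Finset.sum_mul]; push_cast; ring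
    rw [this, norm_mul, Complex.norm_real, norm_mul, ex_norm, ex_norm, Real.norm_eq_abs]; ring
  set A : Set ℝ := {y | |x - y| ≤ ε}
  have hA : MeasurableSet A := measurableSet_le (by fun_prop) measurable_const
  have h1 := ker_bound (A.indicator k) g x ((2:ℝ)^(n+1)) (2 * (2:ℝ)^(-n)) (by positivity) (fun y => by
      by_cases hy : y ∈ A
      · rw [indicator_of_mem hy, hkn]; exact (sct_diff n m hn hm hm' hnm _).1 hy
      · rw [indicator_of_notMem hy, norm_zero]; positivity) (fun y hy => by
      have : y ∉ A := fun (h : |x - y| ≤ ε) => by linarith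
      rw [indicator_of_notMem this])
  have h2 := ker_bound (Aᶜ.indicator k) g x ((2:ℝ)^(m+1)) (2 * (2:ℝ)^(-m)) (by positivity) (fun y => by
      by_cases hy : y ∈ Aᶜ
      · rw [indicator_of_mem hy, hkn]; exact (sct_diff n m hn hm hm' hnm _).2.1 hy
      · rw [indicator_of_notMem hy, norm_zero]; positivity) (fun y hy => by
      by_cases hy' : y ∈ Aᶜ
      · rw [indicator_of_mem hy', ← norm_eq_zero, hkn, (sct_diff n m hn hm hm' hnm _).2.2 hy hy', abs_zero]
      · rw [indicator_of_notMem hy'])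
  have e8 : ∀ l : ℤ, 2 * (2 * (2:ℝ)^(-l)) * (2:ℝ)^(l+1) = 8 := fun l => by
    rw [zpow_neg, zpow_add₀ (by norm_num)]; field_simp; norm_num
  rw [e8] at h1 h2
  have hsplit : op (SK ε R φ M) g x = ∑ s ∈ T, op (KQ s φ (fun _ => M)) g x
      + ((∫ y, A.indicator k y * g y) + ∫ y, Aᶜ.indicator k y * g y) := by
    unfold op
    rw [← integral_finsetSum _ fun s _ => hg.kint (hK s), ← integral_add (hg.kint (hkB.indicator hA)) (hg.kint (hkB.indicator hA.compl)),
      ← integral_add (f := fun y => ∑ s ∈ T, KQ s φ (fun _ => M) x y * g y)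
        (g := fun y => A.indicator k y * g y + Aᶜ.indicator k y * g y) (integrable_finsetSum _ fun s _ => hg.kint (hK s))
        ((hg.kint (hkB.indicator hA)).add (hg.kint (hkB.indicator hA.compl)))]
    refine integral_congr_ae (.of_forall fun y => ?_)
    have := congrFun (indicator_self_add_compl A k) y
    simp only [Pi.add_apply] at this
    simp only [← add_mul, this, ← Finset.sum_mul]
    simp only [hk]; ring
  rw [hsplit]
  refine (enorm_add_le _ _).trans (add_le_add le_rfl ((enorm_add_le _ _).trans ((add_le_add h1 h2).trans (le_of_eq ?_))))
  rw [← add_mul]; congr 1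
  rw [← ENNReal.ofReal_add (by norm_num) (by norm_num)]; norm_num
theorem thmB (d : ℕ) (q : ℝ) (hq : 1 < q) : ∃ C : ℝ, 0 ≤ C ∧ ∀ (a : ℕ → ℝ) (g : ℝ → ℂ), Measurable g → (∃ B : ℝ, ∀ x, ‖g x‖ ≤ B) →
    ∃ L : ℝ → ℝ≥0∞, (∀ M ε R x, 0 < ε → ε < R → ‖op (SK ε R (PH d a 0) M) g x‖ₑ ≤ L x) ∧
      ∫⁻ x, L x ^ q ≤ ENNReal.ofReal C * ∫⁻ x, ‖g x‖ₑ ^ q := by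
  obtain ⟨C, hC, H⟩ := thmA d q hq
  have hq0 : 0 < q := by linarith
  refine ⟨C, hC, fun a g hg hgb => ?_⟩
  obtain ⟨e, he⟩ := exists_surjective_nat ℚ
  obtain ⟨B, hB⟩ := hgb
  set S : ℕ → Finset ℝ := fun n => (Finset.range n).image (fun k => ((e k : ℚ) : ℝ))
  set gn : ℕ → ℝ → ℂ := fun n => (Icc (-(n:ℝ)) n).indicator g
  have hle : ∀ n y, ‖gn n y‖ ≤ ‖g y‖ := fun n y => norm_indicator_le_norm_self _ _
  have hgn : ∀ n, Bd (gn n) := fun n => ⟨hg.indicator measurableSet_Icc, ⟨B, fun y => (hle n y).trans (hB y)⟩,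
    ⟨n, fun y hy => indicator_of_notMem (fun h => by have := abs_le.2 h; linarith) _⟩⟩
  choose W hWm hW1 hW2 using fun n : ℕ => H a (S n) (-(n:ℤ)) n (gn n) (hgn n)
  have hφ : Measurable (PH d a 0) := PH_meas d a
  refine ⟨fun x => (liminf (fun n => W n x ^ q) atTop) ^ q⁻¹, fun M ε R x hε hR => ?_, ?_⟩
  · rw [ENNReal.le_rpow_inv_iff hq0]
    have hop : ∀ M, ∀ n : ℕ, |x| + R ≤ n → op (SK ε R (PH d a 0) M) g x = op (SK ε R (PH d a 0) M) (gn n) x := fun M n hn => by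
      unfold op
      refine integral_congr_ae (.of_forall fun y => ?_)
      by_cases hy : y ∈ Icc (-(n:ℝ)) n
      · simp only [gn, indicator_of_mem hy]
      · have : SK ε R (PH d a 0) M x y = 0 := by
          rw [SK, sct, if_neg]
          · simp
          · rintro ⟨-, h⟩
            refine hy (abs_le.1 ?_)
            have h1 := abs_sub_abs_le_abs_sub y x
            rw [abs_sub_comm] at h1; linarith
        simp [this]
    obtain ⟨n0, hn0⟩ := exists_nat_ge (|x| + R)
    refine Rat.denseRange_cast.induction_on (p := fun M : ℝ => ‖op (SK ε R (PH d a 0) M) g x‖ₑ ^ q ≤ _) M ?_ ?_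
    · refine isClosed_le ?_ continuous_const
      simp_rw [hop _ n0 hn0]
      refine (ENNReal.continuous_rpow_const).comp (continuous_enorm.comp ?_)
      unfold op
      refine continuous_of_dominated (bound := fun y => ε⁻¹ * ‖gn n0 y‖)
        (fun M => (hgn n0).kint (SK_bd hε hφ M x) |>.aestronglyMeasurable) (fun M => .of_forall fun y => ?_)
        ((hgn n0).integrable.norm.const_mul _) (.of_forall fun y => ?_)
      · rw [norm_mul, SK_norm]; gcongr; exact sct_bd hε _
      · unfold SK; fun_prop
    · intro r
      obtain ⟨k, rfl⟩ := he r
      obtain ⟨i, j, hij⟩ := SK_trunc hε hR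
      refine le_liminf_of_le (by isBoundedDefault) ?_
      filter_upwards [eventually_ge_atTop n0, eventually_gt_atTop k, eventually_ge_atTop i.natAbs, eventually_ge_atTop j.natAbs] with n h1 h2 h3 h4
      refine ENNReal.rpow_le_rpow ?_ hq0.le
      rw [hop _ n (hn0.trans (by exact_mod_cast h1))]
      exact (hij _ hφ _ _ (hgn n) x).trans (hW1 n _ (Finset.mem_image.2 ⟨k, Finset.mem_range.2 h2, rfl⟩) i j x (by omega) (by omega))
  · simp_rw [ENNReal.rpow_inv_rpow hq0.ne']
    refine (lintegral_liminf_le fun n => (hWm n).pow_const q).trans ?_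
    refine liminf_le_of_frequently_le' (Frequently.of_forall fun n => (hW2 n).trans (mul_le_mul' le_rfl (lintegral_mono fun y => ?_)))
    refine ENNReal.rpow_le_rpow ?_ hq0.le
    rw [← ofReal_norm, ← ofReal_norm]; exact ENNReal.ofReal_le_ofReal (hle n y)
lemma poly_split (d : ℕ) (P : Polynomial ℝ) (hP : P.natDegree ≤ d) (t : ℝ) :
    P.eval t = P.coeff 0 + P.coeff 1 * t + P.coeff 2 * t^2 + PH (d+3) P.coeff 0 t := by
  rw [Polynomial.eval_eq_sum_range' (n := d+3+1) (by omega), PH, Finset.range_eq_Ico,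
    Finset.sum_eq_sum_Ico_succ_bot (by omega), Finset.sum_eq_sum_Ico_succ_bot (by omega), Finset.sum_eq_sum_Ico_succ_bot (by omega)]
  have : Finset.Ico (0+1+1+1) (d+3+1) = Finset.Icc 3 (d+3) := by ext; simp
  rw [this]; simp; ring
lemma stmt_eq (d : ℕ) (P : Polynomial ℝ) (hP : P.natDegree ≤ d) (f : ℝ → ℂ) (N ε R x : ℝ) :
    ‖∫ t in {t : ℝ | ε < |t| ∧ |t| < R}, f (x - t) * Complex.exp (Complex.I * ((N * t + P.eval t : ℝ) : ℂ)) / (t : ℂ)‖ₑ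
    = ‖op (SK ε R (PH (d+3) P.coeff 0) (N + P.coeff 1 + 2 * P.coeff 2 * x)) (fun y => ex (P.coeff 2 * y^2) * f y) x‖ₑ := by
  rw [← integral_indicator (sct_set ε R), ← integral_sub_left_eq_self _ _ x]
  set c : ℂ := ex (P.coeff 0 + (N + P.coeff 1) * x + P.coeff 2 * x^2) with hc
  have : ∀ z : ℂ, ‖z‖ₑ = ‖c * z‖ₑ := fun z => by
    rw [← ofReal_norm, ← ofReal_norm, norm_mul, hc, ex_norm, one_mul]
  rw [this (op _ _ _), op, ← integral_const_mul]
  congr 2; ext y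
  by_cases h : ε < |x - y| ∧ |x - y| < R
  · rw [indicator_of_mem (show x - y ∈ {t : ℝ | ε < |t| ∧ |t| < R} from h), SK, sct, if_pos h, sub_sub_cancel, poly_split d P hP,
      mul_comm Complex.I]
    have : Complex.exp (((N * (x - y) + (P.coeff 0 + P.coeff 1 * (x - y) + P.coeff 2 * (x - y)^2 + PH (d+3) P.coeff 0 (x - y)) : ℝ) : ℂ) * Complex.I)
        = c * (ex (PH (d+3) P.coeff 0 (x - y)) * ex (-((N + P.coeff 1 + 2 * P.coeff 2 * x) * y))) * ex (P.coeff 2 * y^2) := by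
      rw [hc, ← ex_add, ← ex_add, ← ex_add, ex]
      congr 3; ring
    rw [this]; push_cast; ring
  · rw [indicator_of_notMem (show x - y ∉ {t : ℝ | ε < |t| ∧ |t| < R} from h), SK, sct, if_neg h]; simp
end PC

open MeasureTheory Complex
open scoped ENNReal NNReal

theorem statement0 (d : ℕ) (hd : 1 ≤ d) (p : ℝ) (hp : 1 < p) :
    ∃ C : ℝ, 0 < C ∧
      ∀ P : Polynomial ℝ, P.natDegree ≤ d →
        ∀ f : SchwartzMap ℝ ℂ,
          (∫⁻ x : ℝ,
              (⨆ (N : ℝ) (ε : ℝ) (R : ℝ) (_ : 0 < ε) (_ : ε < R),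
                (‖∫ t in {t : ℝ | ε < |t| ∧ |t| < R},
                    f (x - t) * Complex.exp (Complex.I * ((N * t + P.eval t : ℝ) : ℂ))
                      / (t : ℂ)‖₊ : ℝ≥0∞)) ^ p) ^ p⁻¹
            ≤ ENNReal.ofReal C * eLpNorm (f : ℝ → ℂ) (ENNReal.ofReal p) volume := by
  obtain ⟨C, hC, H⟩ := PC.thmB (d+3) p hp
  have hp0 : 0 < p := by linarith
  refine ⟨C ^ p⁻¹ + 1, by positivity, fun P hP f => ?_⟩
  obtain ⟨L, hL, hL2⟩ := H P.coeff (fun y => PC.ex (P.coeff 2 * y^2) * f y)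
    ((PC.ex_meas.comp (by fun_prop)).mul f.continuous.measurable)
    ⟨SchwartzMap.seminorm ℝ 0 0 f, fun y => by rw [norm_mul, PC.ex_norm, one_mul]; exact SchwartzMap.norm_le_seminorm ℝ f y⟩
  have hf : ∀ y, ‖PC.ex (P.coeff 2 * y^2) * f y‖ₑ = ‖f y‖ₑ := fun y => by
    rw [← ofReal_norm, ← ofReal_norm, norm_mul, PC.ex_norm, one_mul]
  simp_rw [hf] at hL2
  rw [eLpNorm_eq_lintegral_rpow_enorm_toReal (by simpa using hp0) ENNReal.ofReal_ne_top, ENNReal.toReal_ofReal hp0.le, one_div]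
  calc _ ≤ (∫⁻ x, L x ^ p) ^ p⁻¹ := by
        refine ENNReal.rpow_le_rpow (lintegral_mono fun x => ENNReal.rpow_le_rpow ?_ hp0.le) (by positivity)
        refine iSup_le fun N => iSup_le fun ε => iSup_le fun R => iSup_le fun h1 => iSup_le fun h2 => ?_
        exact (PC.stmt_eq d P hP f N ε R x).le.trans (hL _ ε R x h1 h2)
    _ ≤ (ENNReal.ofReal C * ∫⁻ x, ‖f x‖ₑ ^ p) ^ p⁻¹ := ENNReal.rpow_le_rpow hL2 (by positivity)
    _ = ENNReal.ofReal (C ^ p⁻¹) * (∫⁻ x, ‖f x‖ₑ ^ p) ^ p⁻¹ := by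
        rw [ENNReal.mul_rpow_of_nonneg _ _ (by positivity), ENNReal.ofReal_rpow_of_nonneg hC (by positivity)]
    _ ≤ _ := mul_le_mul' (ENNReal.ofReal_le_ofReal (by linarith)) le_rfl
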